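/- Let 0 → τM → E → M → 0 be an almost split sequence of representations of a Dynkin quiver Q. Then the F-polynomials satisfy F_M(y) · F_{τM}(y) = F_E(y) + y^{dim M}. -/

import Mathlib

/-!
STATEMENT 16: Let `0 → τM → E → M → 0` be an almost split sequence of representations
of a Dynkin quiver Q over ℂ.  Then the F-polynomials satisfy
`F_M(y) · F_{τM}(y) = F_E(y) + y^{dim M}`.

The F-polynomial of a representation X is `F_X(y) = Σ_e χ(Gr_e(X)) y^e`, where the
sum runs over the dimension vectors `e ≤ dim X` (for all other e the quiver
Grassmannian is empty) and χ is the Euler characteristic (rational coefficients,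
classical topology).  A quiver is Dynkin iff its Tits form is positive definite.
-/

noncomputable section
open Matrix

variable {V A : Type}

/-- A complex representation of the quiver `(V, A, s, t)` of dimension vector `d`. -/
abbrev QRep (s t : A → V) (d : V → ℕ) : Type :=
  ∀ a : A, Matrix (Fin (d (t a))) (Fin (d (s a))) ℂ

/-- The quiver Grassmannian `Gr_e(M)`: families of subspaces `N i ⊆ ℂ^{d i}` of
dimension `e i` with `M_a (N (s a)) ⊆ N (t a)` for every arrow. -/
def SubRep (s t : A → V) {d : V → ℕ} (M : QRep s t d) (e : V → ℕ) : Type :=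
  {N : ∀ i : V, Submodule ℂ (Fin (d i) → ℂ) //
    (∀ i, Module.finrank ℂ (N i) = e i) ∧
    ∀ a : A, (N (s a)).map (M a).mulVecLin ≤ N (t a)}

/-- The map `Φ^M_N`, whose cokernel is `Ext¹_Q(N,M)`. -/
def PhiFun (s t : A → V) {e d : V → ℕ} (N : QRep s t e) (M : QRep s t d) :
    (∀ i : V, Matrix (Fin (d i)) (Fin (e i)) ℂ) →
      (∀ a : A, Matrix (Fin (d (t a))) (Fin (e (s a))) ℂ) :=
  fun f a => M a * f (s a) - f (t a) * N a

/-- `Ext¹_Q(N, M) = 0`, expressed as surjectivity of `Φ^M_N` (whose cokernel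
computes `Ext¹` via the standard resolution over the path algebra). -/
def ExtVanish (s t : A → V) {e d : V → ℕ} (N : QRep s t e) (M : QRep s t d) : Prop :=
  Function.Surjective (PhiFun s t N M)

/-- A representation is rigid if `Ext¹_Q(M, M) = 0`. -/
def Rigid (s t : A → V) {d : V → ℕ} (M : QRep s t d) : Prop :=
  ExtVanish s t M M

/-- The Euler form `⟨x,y⟩ = Σ_i x i * y i − Σ_a x (s a) * y (t a)` of the quiver. -/
def eulerForm [Fintype V] [Fintype A] (s t : A → V) (x y : V → ℤ) : ℤ :=
  (∑ i : V, x i * y i) - ∑ a : A, x (s a) * y (t a)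

/-- The quiver is Dynkin (disjoint union of simply-laced Dynkin diagrams), i.e. its
Tits form is positive definite. -/
def IsDynkin [Fintype V] [Fintype A] (s t : A → V) : Prop :=
  ∀ x : V → ℤ, x ≠ 0 → 0 < eulerForm s t x x

/-- Morphisms of representations `X → Y`, given by matrices `φ i` with
`Y_a φ_{s a} = φ_{t a} X_a`. -/
def RHom (s t : A → V) {dX dY : V → ℕ} (X : QRep s t dX) (Y : QRep s t dY) : Type :=
  {φ : ∀ i : V, Matrix (Fin (dY i)) (Fin (dX i)) ℂ //
    ∀ a : A, Y a * φ (s a) = φ (t a) * X a}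

/-- A representation is indecomposable: nonzero, and its only idempotent
endomorphisms are 0 and 1. -/
def Indec (s t : A → V) {d : V → ℕ} (M : QRep s t d) : Prop :=
  (∃ i, 0 < d i) ∧
  ∀ φ : RHom s t M M, (∀ i, φ.1 i * φ.1 i = φ.1 i) →
    (∀ i, φ.1 i = 0) ∨ (∀ i, φ.1 i = 1)

/-- The direct sum of two representations. -/
def dsum (s t : A → V) {d e : V → ℕ} (M : QRep s t d) (N : QRep s t e) :
    QRep s t (fun i => d i + e i) :=
  fun a => Matrix.reindex finSumFinEquiv finSumFinEquiv
    (Matrix.fromBlocks (M a) 0 0 (N a))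

/-- `0 → X → Y → Z → 0` is a short exact sequence of representations. -/
def IsSES (s t : A → V) {dX dY dZ : V → ℕ}
    {X : QRep s t dX} {Y : QRep s t dY} {Z : QRep s t dZ}
    (f : RHom s t X Y) (g : RHom s t Y Z) : Prop :=
  (∀ i, Function.Injective (f.1 i).mulVecLin) ∧
  (∀ i, Function.Surjective (g.1 i).mulVecLin) ∧
  ∀ i, LinearMap.range (f.1 i).mulVecLin = LinearMap.ker (g.1 i).mulVecLin

/-- A morphism of representations is a split epimorphism. -/
def IsSplitEpi (s t : A → V) {dX dY : V → ℕ}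
    {X : QRep s t dX} {Y : QRep s t dY} (h : RHom s t X Y) : Prop :=
  ∃ r : RHom s t Y X, ∀ i, h.1 i * r.1 i = 1

/-- `0 → T → E → M → 0` is an almost split (Auslander–Reiten) sequence: it is a
non-split short exact sequence, T and M are indecomposable, and every morphism
`X → M` which is not a split epimorphism factors through `E`. -/
def IsAlmostSplit (s t : A → V) {dT dE dM : V → ℕ}
    {T : QRep s t dT} {E : QRep s t dE} {M : QRep s t dM}
    (f : RHom s t T E) (g : RHom s t E M) : Prop :=
  IsSES s t f g ∧ ¬ IsSplitEpi s t g ∧ Indec s t T ∧ Indec s t M ∧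
  ∀ (x : V → ℕ) (X : QRep s t x) (h : RHom s t X M), ¬ IsSplitEpi s t h →
    ∃ u : RHom s t X E, ∀ i, g.1 i * u.1 i = h.1 i

/-- Coordinates for a tuple of `(d i) × (e i)` matrices. -/
abbrev Coord (d e : V → ℕ) : Type := (Σ i : V, Fin (d i) × Fin (e i)) → ℂ

/-- The `i`-th matrix encoded by a coordinate vector. -/
def matOf {d e : V → ℕ} (F : Coord (V := V) d e) (i : V) :
    Matrix (Fin (d i)) (Fin (e i)) ℂ :=
  fun p q => F ⟨i, (p, q)⟩

/-- The "Stiefel-type" variety of tuples of injective linear maps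
`ℂ^{e i} → ℂ^{d i}` whose images form a subrepresentation of `M`. -/
def StQ (s t : A → V) {d : V → ℕ} (M : QRep s t d) (e : V → ℕ) : Type :=
  {F : Coord (V := V) d e //
    (∀ i, Function.Injective (matOf F i).mulVecLin) ∧
    ∀ a : A, (LinearMap.range (matOf F (s a)).mulVecLin).map (M a).mulVecLin ≤
      LinearMap.range (matOf F (t a)).mulVecLin}

/-- The canonical surjection from the Stiefel-type variety onto the quiver
Grassmannian, sending a tuple of injective maps to the tuple of their images. -/
def toSub (s t : A → V) {d : V → ℕ} (M : QRep s t d) (e : V → ℕ) :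
    StQ s t M e → SubRep s t M e := fun F =>
  ⟨fun i => LinearMap.range (matOf F.1 i).mulVecLin,
   fun i => by
     rw [LinearMap.finrank_range_of_inj (F.2.1 i)]
     exact Module.finrank_fin_fun ℂ,
   F.2.2⟩

/-- The classical (Euclidean) topology on the quiver Grassmannian, as the quotient
topology from the space of injective tuples with its Euclidean topology. -/
instance (s t : A → V) {d : V → ℕ} (M : QRep s t d) (e : V → ℕ) :
    TopologicalSpace (SubRep s t M e) :=
  TopologicalSpace.coinduced (toSub s t M e)
    (TopologicalSpace.induced Subtype.val inferInstance)

open CategoryTheory in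
/-- The singular chain complex of a topological space with rational coefficients. -/
def singComplex (X : Type) [TopologicalSpace X] : ChainComplex (ModuleCat ℚ) ℕ :=
  (AlgebraicTopology.alternatingFaceMapComplex (ModuleCat ℚ)).obj
    (((CategoryTheory.SimplicialObject.whiskering _ _).obj (ModuleCat.free ℚ)).obj
      (TopCat.toSSet.obj (TopCat.of X)))

/-- Singular homology with rational coefficients. -/
def Hsing (n : ℕ) (X : Type) [TopologicalSpace X] : ModuleCat ℚ :=
  (singComplex X).homology n

/-- Singular cohomology with rational coefficients (over a field, the dual of
singular homology by universal coefficients). -/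
abbrev Hcoh (n : ℕ) (X : Type) [TopologicalSpace X] : Type :=
  Module.Dual ℚ (Hsing n X)

/-- The topological Euler characteristic `χ(X) = Σ (−1)ⁱ dim Hⁱ(X, ℚ)`. -/
def eulerChar (X : Type) [TopologicalSpace X] : ℤ :=
  finsum fun n : ℕ => (-1 : ℤ) ^ n * (Module.finrank ℚ (Hcoh n X) : ℤ)

/-- The F-polynomial `F_X(y) = Σ_e χ(Gr_e(X)) y^e` of a representation. -/
def Fpoly [Fintype V] [Fintype A] [DecidableEq V] (s t : A → V) {d : V → ℕ}
    (M : QRep s t d) : MvPolynomial V ℤ :=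
  ∑ f : ∀ i : V, Fin (d i + 1),
    MvPolynomial.monomial (Finsupp.equivFunOnFinite.symm (fun i => (f i : ℕ)))
      (eulerChar (SubRep s t M (fun i => (f i : ℕ))))

namespace FPoly

/-- A `ℕ`-graded `ℚ`-vector space is finite if each piece is finite dimensional and almost all
pieces vanish. -/
def FinGr (A : ℕ → Type) [∀ n, AddCommGroup (A n)] [∀ n, Module ℚ (A n)] : Prop :=
  (∀ n, Module.Finite ℚ (A n)) ∧ ∃ N, ∀ n, N ≤ n → Subsingleton (A n)

/-- The alternating sum of the dimensions of a graded vector space. -/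
def chiGr (A : ℕ → Type) [∀ n, AddCommGroup (A n)] [∀ n, Module ℚ (A n)] : ℤ :=
  finsum fun n : ℕ => (-1 : ℤ) ^ n * (Module.finrank ℚ (A n) : ℤ)

section
variable {A B C : ℕ → Type} [∀ n, AddCommGroup (A n)] [∀ n, Module ℚ (A n)]
  [∀ n, AddCommGroup (B n)] [∀ n, Module ℚ (B n)] [∀ n, AddCommGroup (C n)] [∀ n, Module ℚ (C n)]

theorem chiGr_eq_sum {N : ℕ} (h : ∀ n, N ≤ n → Subsingleton (A n)) :
    chiGr A = ∑ n ∈ Finset.range N, (-1 : ℤ) ^ n * (Module.finrank ℚ (A n) : ℤ) := by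
  unfold chiGr
  apply finsum_eq_sum_of_support_subset
  intro n hn
  simp only [Finset.coe_range, Set.mem_Iio]
  by_contra hlt
  have := h n (not_lt.mp hlt)
  apply hn
  simp [Module.finrank_zero_of_subsingleton]

theorem FinGr.congr (e : ∀ n, A n ≃ₗ[ℚ] B n) (h : FinGr A) : FinGr B := by
  refine ⟨fun n => ?_, ?_⟩
  · have := h.1 n
    exact Module.Finite.equiv (e n)
  · obtain ⟨N, hN⟩ := h.2
    exact ⟨N, fun n hn => by have := hN n hn; exact (e n).symm.toEquiv.subsingleton⟩

theorem chiGr_congr (e : ∀ n, A n ≃ₗ[ℚ] B n) : chiGr A = chiGr B := by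
  unfold chiGr
  congr 1
  funext n
  rw [(e n).finrank_eq]

theorem finite_of_exact {X Y Z : Type} [AddCommGroup X] [Module ℚ X] [AddCommGroup Y] [Module ℚ Y]
    [AddCommGroup Z] [Module ℚ Z] (f : X →ₗ[ℚ] Y) (g : Y →ₗ[ℚ] Z) (h : Function.Exact f g)
    [Module.Finite ℚ X] [Module.Finite ℚ Z] : Module.Finite ℚ Y := by
  have h1 : (LinearMap.ker g).FG := by
    rw [LinearMap.exact_iff.mp h]
    exact (Module.Finite.iff_fg).mp inferInstance
  have h2 : (LinearMap.range g).FG := IsNoetherian.noetherian _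
  refine ⟨Submodule.fg_of_fg_map_of_fg_inf_ker g ?_ ?_⟩
  · rwa [Submodule.map_top]
  · rwa [top_inf_eq]

theorem subsingleton_of_exact {X Y Z : Type} [AddCommGroup X] [Module ℚ X] [AddCommGroup Y]
    [Module ℚ Y] [AddCommGroup Z] [Module ℚ Z] (f : X →ₗ[ℚ] Y) (g : Y →ₗ[ℚ] Z)
    (h : Function.Exact f g) [Subsingleton X] [Subsingleton Z] : Subsingleton Y := by
  refine subsingleton_of_forall_eq 0 fun y => ?_
  obtain ⟨x, rfl⟩ := (h y).mp (Subsingleton.elim _ _)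
  rw [Subsingleton.elim x 0, map_zero]

/-- A long exact sequence of graded vector spaces. -/
structure LES (f : ∀ n, A n →ₗ[ℚ] B n) (g : ∀ n, B n →ₗ[ℚ] C n)
    (δ : ∀ n, C (n + 1) →ₗ[ℚ] A n) : Prop where
  exA : ∀ n, Function.Exact (δ n) (f n)
  exB : ∀ n, Function.Exact (f n) (g n)
  exC : ∀ n, Function.Exact (g (n + 1)) (δ n)
  surj : Function.Surjective (g 0)

variable {f : ∀ n, A n →ₗ[ℚ] B n} {g : ∀ n, B n →ₗ[ℚ] C n} {δ : ∀ n, C (n + 1) →ₗ[ℚ] A n}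

theorem LES.finB (h : LES f g δ) (hA : FinGr A) (hC : FinGr C) : FinGr B := by
  obtain ⟨hA, N, hN⟩ := hA
  obtain ⟨hC, M, hM⟩ := hC
  refine ⟨fun n => finite_of_exact _ _ (h.exB n), max N M, fun n hn => ?_⟩
  have := hN n (le_trans (le_max_left _ _) hn)
  have := hM n (le_trans (le_max_right _ _) hn)
  exact subsingleton_of_exact _ _ (h.exB n)

theorem LES.finA (h : LES f g δ) (hB : FinGr B) (hC : FinGr C) : FinGr A := by
  obtain ⟨hA, N, hN⟩ := hB
  obtain ⟨hC, M, hM⟩ := hC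
  refine ⟨fun n => finite_of_exact _ _ (h.exA n), max N M, fun n hn => ?_⟩
  have := hN n (le_trans (le_max_left _ _) hn)
  have := hM (n + 1) (le_trans (le_trans (le_max_right _ _) hn) (Nat.le_succ n))
  exact subsingleton_of_exact _ _ (h.exA n)

theorem LES.finC (h : LES f g δ) (hA : FinGr A) (hB : FinGr B) : FinGr C := by
  obtain ⟨hA, N, hN⟩ := hA
  obtain ⟨hB, M, hM⟩ := hB
  refine ⟨fun n => ?_, max N M + 1, fun n hn => ?_⟩
  · cases n with
    | zero => exact Module.Finite.of_surjective _ h.surj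
    | succ n => exact finite_of_exact _ _ (h.exC n)
  · cases n with
    | zero => omega
    | succ n =>
      have := hN n (by omega)
      have := hM (n + 1) (by omega)
      exact subsingleton_of_exact _ _ (h.exC n)

theorem finrank_of_exact {X Y Z : Type} [AddCommGroup X] [Module ℚ X] [AddCommGroup Y]
    [Module ℚ Y] [AddCommGroup Z] [Module ℚ Z] (f : X →ₗ[ℚ] Y) (g : Y →ₗ[ℚ] Z)
    (h : Function.Exact f g) [Module.Finite ℚ Y] :
    Module.finrank ℚ Y =
      Module.finrank ℚ (LinearMap.range f) + Module.finrank ℚ (LinearMap.range g) := by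
  rw [← LinearMap.exact_iff.mp h, add_comm]
  exact (LinearMap.finrank_range_add_finrank_ker g).symm

theorem LES.chi (h : LES f g δ) (hA : FinGr A) (hB : FinGr B) (hC : FinGr C) :
    chiGr B = chiGr A + chiGr C := by
  obtain ⟨hA, N, hN⟩ := hA
  obtain ⟨hB, M, hM⟩ := hB
  obtain ⟨hC, K, hK⟩ := hC
  set L := max N (max M K) with hL
  rw [chiGr_eq_sum (A := A) (N := L + 1) (fun n hn => hN n (by omega)),
    chiGr_eq_sum (A := B) (N := L + 1) (fun n hn => hM n (by omega)),
    chiGr_eq_sum (A := C) (N := L + 1) (fun n hn => hK n (by omega))]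
  set r : ℕ → ℕ := fun n => Module.finrank ℚ (LinearMap.range (δ n))
  set a : ℕ → ℕ := fun n => Module.finrank ℚ (LinearMap.range (f n))
  set b : ℕ → ℕ := fun n => Module.finrank ℚ (LinearMap.range (g n))
  have eA : ∀ n, Module.finrank ℚ (A n) = r n + a n := fun n => finrank_of_exact _ _ (h.exA n)
  have eB : ∀ n, Module.finrank ℚ (B n) = a n + b n := fun n => finrank_of_exact _ _ (h.exB n)
  have eC : ∀ n, Module.finrank ℚ (C (n + 1)) = b (n + 1) + r n :=
    fun n => finrank_of_exact _ _ (h.exC n)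
  have eC0 : Module.finrank ℚ (C 0) = b 0 := by
    simp only [b]
    rw [LinearMap.range_eq_top.mpr h.surj, finrank_top]
  have key : ∀ m, ∑ n ∈ Finset.range (m + 1), (-1 : ℤ) ^ n * (Module.finrank ℚ (A n) : ℤ) +
      ∑ n ∈ Finset.range (m + 1), (-1 : ℤ) ^ n * (Module.finrank ℚ (C n) : ℤ) =
      ∑ n ∈ Finset.range (m + 1), (-1 : ℤ) ^ n * (Module.finrank ℚ (B n) : ℤ) + (-1) ^ m * r m := by
    intro m
    induction m with
    | zero => simp [eA, eB, eC0]; ring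
    | succ m ih =>
      rw [Finset.sum_range_succ _ (m + 1), Finset.sum_range_succ _ (m + 1),
        Finset.sum_range_succ _ (m + 1), eA (m + 1), eB (m + 1), eC m]
      push_cast
      have : ((-1 : ℤ)) ^ (m + 1) = - (-1) ^ m := by ring
      rw [this]
      linarith
  rw [key L]
  have : r L = 0 := by
    have := hN L (by omega)
    simp only [r]
    exact Module.finrank_zero_of_subsingleton
  rw [this]; simp
end

end FPoly

namespace FPoly
open CategoryTheory

/-- The homology of a chain complex as a graded vector space. -/
abbrev HGr (K : ChainComplex (ModuleCat.{0} ℚ) ℕ) (n : ℕ) : Type := K.homology n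

theorem les_of_shortExact {S : ShortComplex (ChainComplex (ModuleCat.{0} ℚ) ℕ)}
    (hS : S.ShortExact) :
    LES (A := HGr S.X₁) (B := HGr S.X₂) (C := HGr S.X₃)
      (fun n => (HomologicalComplex.homologyMap S.f n).hom)
      (fun n => (HomologicalComplex.homologyMap S.g n).hom)
      (fun n => (hS.δ (n + 1) n rfl).hom) where
  exA n := (ShortComplex.ShortExact.moduleCat_exact_iff_function_exact _).mp
    (hS.homology_exact₁ (n + 1) n rfl)
  exB n := (ShortComplex.ShortExact.moduleCat_exact_iff_function_exact _).mp
    (hS.homology_exact₂ n)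
  exC n := (ShortComplex.ShortExact.moduleCat_exact_iff_function_exact _).mp
    (hS.homology_exact₃ (n + 1) n rfl)
  surj := by
    have := hS.epi_g
    have := HomologicalComplex.epi_homologyMap_of_epi_of_not_rel S.g 0 (by simp)
    exact (ModuleCat.epi_iff_surjective _).mp this

/-- A chain complex of rational vector spaces, unbundled. -/
structure LC where
  C : ℕ → Type
  [acg : ∀ n, AddCommGroup (C n)]
  [mod : ∀ n, Module ℚ (C n)]
  d : ∀ n, C (n + 1) →ₗ[ℚ] C n
  dd : ∀ n x, d n (d (n + 1) x) = 0

attribute [instance] LC.acg LC.mod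

/-- The associated object of the category of chain complexes. -/
def LC.cx (K : LC) : ChainComplex (ModuleCat.{0} ℚ) ℕ :=
  ChainComplex.of (fun n => ModuleCat.of ℚ (K.C n)) (fun n => ModuleCat.ofHom (K.d n))
    (fun n => by ext x; exact K.dd n x)

theorem LC.cx_d (K : LC) (n : ℕ) : K.cx.d (n + 1) n = ModuleCat.ofHom (K.d n) :=
  (ChainComplex.of_d (fun n => ModuleCat.of ℚ (K.C n)) (fun n => ModuleCat.ofHom (K.d n)) n :)

/-- The homology groups. -/
abbrev LC.H (K : LC) (n : ℕ) : Type := HGr K.cx n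

/-- Finiteness of homology. -/
def LC.Fin (K : LC) : Prop := FinGr K.H

/-- The Euler characteristic. -/
def LC.chi (K : LC) : ℤ := chiGr K.H

/-- The chain map associated with a compatible family of linear maps. -/
def LC.hom {K L : LC} (f : ∀ n, K.C n →ₗ[ℚ] L.C n)
    (hf : ∀ n x, L.d n (f (n + 1) x) = f n (K.d n x)) : K.cx ⟶ L.cx :=
  ChainComplex.ofHom (X := K.cx) (Y := L.cx) (fun n => ModuleCat.ofHom (f n))
    (fun n => by rw [LC.cx_d, LC.cx_d]; ext x; exact hf n x)

theorem LC.les {K L P : LC} (f : ∀ n, K.C n →ₗ[ℚ] L.C n)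
    (hf : ∀ n x, L.d n (f (n + 1) x) = f n (K.d n x))
    (g : ∀ n, L.C n →ₗ[ℚ] P.C n) (hg : ∀ n x, P.d n (g (n + 1) x) = g n (L.d n x))
    (inj : ∀ n, Function.Injective (f n)) (ex : ∀ n, Function.Exact (f n) (g n))
    (surj : ∀ n, Function.Surjective (g n)) :
    ∃ (f' : ∀ n, K.H n →ₗ[ℚ] L.H n) (g' : ∀ n, L.H n →ₗ[ℚ] P.H n)
      (δ : ∀ n, P.H (n + 1) →ₗ[ℚ] K.H n), LES f' g' δ := by
  let S : ShortComplex (ChainComplex (ModuleCat.{0} ℚ) ℕ) :=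
    ShortComplex.mk (LC.hom f hf) (LC.hom g hg) (by
      ext n x
      exact (ex n).apply_apply_eq_zero x)
  have hS : S.ShortExact := by
    apply HomologicalComplex.shortExact_of_degreewise_shortExact
    intro n
    have h1 : Mono ((S.map (HomologicalComplex.eval _ _ n)).f) :=
      (ModuleCat.mono_iff_injective _).mpr (inj n)
    have h2 : Epi ((S.map (HomologicalComplex.eval _ _ n)).g) :=
      (ModuleCat.epi_iff_surjective _).mpr (surj n)
    exact ⟨(ShortComplex.ShortExact.moduleCat_exact_iff_function_exact _).mpr (ex n)⟩
  exact ⟨_, _, _, les_of_shortExact hS⟩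

/-- Isomorphic complexes have isomorphic homology. -/
theorem LC.congr {K L : LC} (f : ∀ n, K.C n ≃ₗ[ℚ] L.C n)
    (hf : ∀ n x, L.d n (f (n + 1) x) = f n (K.d n x)) : Nonempty (∀ n, K.H n ≃ₗ[ℚ] L.H n) := by
  let e : K.cx ≅ L.cx := HomologicalComplex.Hom.isoOfComponents
    (fun n => (f n).toModuleIso) (by
      intro i j hij
      obtain rfl : j + 1 = i := hij
      rw [LC.cx_d, LC.cx_d]
      ext x
      exact hf j x)
  exact ⟨fun n => ((HomologicalComplex.homologyFunctor _ _ n).mapIso e).toLinearEquiv⟩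

/-- An exact complex has no homology. -/
theorem LC.acyclic (K : LC) (h0 : Function.Surjective (K.d 0))
    (h : ∀ n x, K.d n x = 0 → ∃ y, K.d (n + 1) y = x) (n : ℕ) : Subsingleton (K.H n) := by
  have : K.cx.ExactAt n := by
    cases n with
    | zero =>
      rw [HomologicalComplex.exactAt_iff' _ 1 0 0 (by simp) (by simp)]
      rw [ShortComplex.moduleCat_exact_iff]
      intro x _
      obtain ⟨y, hy⟩ := h0 x
      refine ⟨y, ?_⟩
      rw [← hy]
      change (K.cx.d 1 0).hom y = _
      rw [LC.cx_d]; rfl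
    | succ n =>
      rw [HomologicalComplex.exactAt_iff' _ (n + 1 + 1) (n + 1) n (by simp) (by simp)]
      rw [ShortComplex.moduleCat_exact_iff]
      intro x hx
      change (K.cx.d (n + 1) n).hom x = 0 at hx
      rw [LC.cx_d] at hx
      obtain ⟨y, hy⟩ := h n x hx
      refine ⟨y, ?_⟩
      rw [← hy]
      change (K.cx.d (n + 1 + 1) (n + 1)).hom y = _
      rw [LC.cx_d]; rfl
  rw [HomologicalComplex.exactAt_iff_isZero_homology] at this
  exact ModuleCat.subsingleton_of_isZero this

theorem FinGr.of_subsingleton {A : ℕ → Type} [∀ n, AddCommGroup (A n)] [∀ n, Module ℚ (A n)]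
    (h : ∀ n, Subsingleton (A n)) : FinGr A :=
  ⟨fun n => by have := h n; infer_instance, 0, fun n _ => h n⟩

theorem chiGr_of_subsingleton {A : ℕ → Type} [∀ n, AddCommGroup (A n)] [∀ n, Module ℚ (A n)]
    (h : ∀ n, Subsingleton (A n)) : chiGr A = 0 := by
  rw [chiGr_eq_sum (N := 0) (fun n _ => h n)]; simp

/-- The product of two complexes. -/
def LC.prod (K L : LC) : LC where
  C n := K.C n × L.C n
  d n := (K.d n).prodMap (L.d n)
  dd n x := by simp [K.dd, L.dd]

theorem LC.prod_les (K L : LC) :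
    ∃ (f' : ∀ n, K.H n →ₗ[ℚ] (K.prod L).H n) (g' : ∀ n, (K.prod L).H n →ₗ[ℚ] L.H n)
      (δ : ∀ n, L.H (n + 1) →ₗ[ℚ] K.H n), LES f' g' δ :=
  LC.les (L := K.prod L) (fun n => LinearMap.inl ℚ (K.C n) (L.C n))
    (fun n x => Prod.ext rfl (map_zero (L.d n)))
    (fun n => LinearMap.snd ℚ (K.C n) (L.C n)) (fun n x => rfl)
    (fun n => LinearMap.inl_injective) (fun n => Function.Exact.inl_snd)
    (fun n => LinearMap.snd_surjective)

theorem LC.prod_fin {K L : LC} (hK : K.Fin) (hL : L.Fin) : (K.prod L).Fin := by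
  obtain ⟨f, g, δ, h⟩ := K.prod_les L
  exact h.finB hK hL

theorem LC.prod_chi {K L : LC} (hK : K.Fin) (hL : L.Fin) : (K.prod L).chi = K.chi + L.chi := by
  obtain ⟨f, g, δ, h⟩ := K.prod_les L
  exact h.chi hK (h.finB hK hL) hL

/-- The product is a retract: if the product is finite, so are the factors. -/
theorem LC.fin_of_prod {K L : LC} (h : (K.prod L).Fin) : K.Fin ∧ L.Fin := by
  have key : ∀ {K P : LC} (f : ∀ n, K.C n →ₗ[ℚ] P.C n)
      (hf : ∀ n x, P.d n (f (n + 1) x) = f n (K.d n x))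
      (g : ∀ n, P.C n →ₗ[ℚ] K.C n) (hg : ∀ n x, K.d n (g (n + 1) x) = g n (P.d n x))
      (_ : ∀ n x, g n (f n x) = x), P.Fin → K.Fin := by
    intro K P f hf g hg hfg hP
    have hinj : ∀ n, Function.Injective
        (HomologicalComplex.homologyMap (LC.hom f hf) n).hom := by
      intro n
      have e : HomologicalComplex.homologyMap (LC.hom f hf) n ≫
          HomologicalComplex.homologyMap (LC.hom g hg) n = 𝟙 _ := by
        rw [← HomologicalComplex.homologyMap_comp]
        have : LC.hom f hf ≫ LC.hom g hg = 𝟙 _ := by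
          ext n x; exact hfg n x
        rw [this, HomologicalComplex.homologyMap_id]
      intro x y hxy
      have e2 := congrArg (fun k => k.hom) e
      have e3 : ∀ x, (HomologicalComplex.homologyMap (LC.hom g hg) n).hom
          ((HomologicalComplex.homologyMap (LC.hom f hf) n).hom x) = x := fun x =>
        LinearMap.congr_fun e2 x
      rw [← e3 x, hxy, e3 y]
    obtain ⟨h1, N, h2⟩ := hP
    refine ⟨fun n => ?_, N, fun n hn => ?_⟩
    · have := h1 n
      exact Module.Finite.of_injective _ (hinj n)
    · have := h2 n hn
      exact (hinj n).subsingleton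
  exact ⟨key (P := K.prod L) (fun n => LinearMap.inl ℚ _ _)
      (fun n x => Prod.ext rfl (map_zero (L.d n)))
      (fun n => LinearMap.fst ℚ _ _) (fun n x => rfl) (fun n x => rfl) h,
    key (P := K.prod L) (fun n => LinearMap.inr ℚ _ _)
      (fun n x => Prod.ext (map_zero (K.d n)) rfl)
      (fun n => LinearMap.snd ℚ _ _) (fun n x => rfl) (fun n x => rfl) h⟩

end FPoly

namespace FPoly

/-- A semi-simplicial set. -/
structure SSD where
  S : ℕ → Type
  δ : ∀ n, Fin (n + 2) → S (n + 1) → S n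
  rel : ∀ n (i j : Fin (n + 2)), i ≤ j → ∀ x, δ n i (δ (n + 1) j.succ x) =
    δ n j (δ (n + 1) i.castSucc x)

/-- The boundary operator of a semi-simplicial set. -/
def SSD.bd (K : SSD) (n : ℕ) : (K.S (n + 1) →₀ ℚ) →ₗ[ℚ] (K.S n →₀ ℚ) :=
  ∑ i : Fin (n + 2), (-1 : ℚ) ^ (i : ℕ) • Finsupp.lmapDomain ℚ ℚ (K.δ n i)

theorem SSD.bd_single (K : SSD) (n : ℕ) (x : K.S (n + 1)) (r : ℚ) :
    K.bd n (Finsupp.single x r) =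
      ∑ i : Fin (n + 2), (-1 : ℚ) ^ (i : ℕ) • Finsupp.single (K.δ n i x) r := by
  simp [SSD.bd, Finsupp.mapDomain_single]

theorem SSD.bd_bd (K : SSD) (n : ℕ) (c : K.S (n + 2) →₀ ℚ) : K.bd n (K.bd (n + 1) c) = 0 := by
  induction c using Finsupp.induction_linear with
  | zero => simp
  | add f g hf hg => rw [map_add, map_add, hf, hg, add_zero]
  | single x r =>
    rw [SSD.bd_single, map_sum]
    simp only [map_smul, SSD.bd_single, Finset.smul_sum, smul_smul]
    rw [← Finset.sum_product']
    let P := Fin (n + 3) × Fin (n + 2)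
    let s : Finset P := Finset.univ.filter fun ij => (ij.2 : ℕ) < (ij.1 : ℕ)
    rw [Finset.univ_product_univ, ← Finset.sum_add_sum_compl s, ← eq_neg_iff_add_eq_zero,
      ← Finset.sum_neg_distrib]
    let φ : ∀ ij : P, ij ∈ s → P := fun ij hij =>
      (Fin.castLT (ij.2.castSucc) (by
        have := (Finset.mem_filter.mp hij).2
        have h2 := ij.2.2
        simp only [Fin.val_castSucc]; omega), ij.1.pred (by
        have := (Finset.mem_filter.mp hij).2
        intro h0; rw [h0] at this; simp at this))
    let ψ : ∀ ij : P, ij ∈ s → P := fun ij hij => (ij.2.castSucc, (φ ij hij).2)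
    apply Finset.sum_bij ψ
    · intro ij hij
      have := (Finset.mem_filter.mp hij).2
      simp only [s, ψ, φ, Finset.mem_compl, Finset.mem_filter, Finset.mem_univ, true_and,
        Fin.val_castSucc, Fin.val_pred]
      omega
    · rintro ⟨i, j⟩ hij ⟨i', j'⟩ hij' h
      have h1 := (Finset.mem_filter.mp hij).2
      have h2 := (Finset.mem_filter.mp hij').2
      have e1 := congrArg Prod.fst h
      have e2 := congrArg Prod.snd h
      simp only [ψ, φ, Fin.castSucc_inj, Fin.pred_inj] at e1 e2
      exact Prod.ext e2 e1
    · rintro ⟨i', j'⟩ hij'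
      have h1 : ¬ ((j' : ℕ) < (i' : ℕ)) := by
        simpa [s] using hij'
      refine ⟨(j'.succ, Fin.castLT i' (by omega)), ?_, ?_⟩
      · simp only [s, Finset.mem_filter, Finset.mem_univ, true_and, Fin.val_succ, Fin.val_castLT]
        omega
      · ext <;> simp [ψ, φ]
    · rintro ⟨i, j⟩ hij
      have h1 := (Finset.mem_filter.mp hij).2
      simp only at h1
      obtain ⟨k, rfl⟩ : ∃ k : Fin (n + 2), i = k.succ :=
        ⟨i.pred (by rintro rfl; simp at h1), by simp⟩
      have hle : j ≤ k := by
        rw [Fin.le_def]; simp at h1; omega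
      simp only [ψ, φ, Fin.pred_succ, Fin.val_succ, Fin.val_castSucc]
      rw [K.rel n j k hle, ← neg_smul]
      congr 1
      ring

/-- The chain complex of a semi-simplicial set. -/
def SSD.lc (K : SSD) : LC where
  C n := K.S n →₀ ℚ
  d := K.bd
  dd := K.bd_bd

theorem SSD.bd_map {K L : SSD} (f : ∀ n, K.S n → L.S n)
    (hf : ∀ n i x, L.δ n i (f (n + 1) x) = f n (K.δ n i x)) (n : ℕ) (c : K.S (n + 1) →₀ ℚ) :
    L.bd n (Finsupp.lmapDomain ℚ ℚ (f (n + 1)) c) = Finsupp.lmapDomain ℚ ℚ (f n) (K.bd n c) := by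
  induction c using Finsupp.induction_linear with
  | zero => simp
  | add a b ha hb => rw [map_add, map_add, ha, hb, map_add, map_add]
  | single x r =>
    rw [Finsupp.lmapDomain_apply, Finsupp.mapDomain_single, SSD.bd_single, SSD.bd_single, map_sum]
    refine Finset.sum_congr rfl fun i _ => ?_
    rw [map_smul, Finsupp.lmapDomain_apply, Finsupp.mapDomain_single, hf]

theorem SSD.congr {K L : SSD} (f : ∀ n, K.S n ≃ L.S n)
    (hf : ∀ n i x, L.δ n i (f (n + 1) x) = f n (K.δ n i x)) :
    Nonempty (∀ n, K.lc.H n ≃ₗ[ℚ] L.lc.H n) :=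
  LC.congr (K := K.lc) (L := L.lc) (fun n => Finsupp.domLCongr (f n)) (fun n x => by
    have key : ∀ n (c : K.S n →₀ ℚ),
        Finsupp.domLCongr (R := ℚ) (f n) c = Finsupp.lmapDomain ℚ ℚ (f n) c := fun n c =>
      Finsupp.equivMapDomain_eq_mapDomain _ _
    exact (congrArg (L.bd n) (key (n + 1) x)).trans
      ((SSD.bd_map (fun n => f n) hf n x).trans (key n _).symm))

/-- A family of simplices closed under faces. -/
def SSD.Closed (K : SSD) (P : ∀ n, Set (K.S n)) : Prop :=
  ∀ n i x, x ∈ P (n + 1) → K.δ n i x ∈ P n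

/-- The semi-simplicial subset. -/
def SSD.sub (K : SSD) (P : ∀ n, Set (K.S n)) (h : K.Closed P) : SSD where
  S n := P n
  δ n i x := ⟨K.δ n i x.1, h n i x.1 x.2⟩
  rel n i j hij x := Subtype.ext (K.rel n i j hij x.1)

section
variable (K : SSD) {P Q R : ∀ n, Set (K.S n)} (hP : K.Closed P) (hQ : K.Closed Q) (hR : K.Closed R)

/-- The inclusion of the chains of a semi-simplicial subset into another one. -/
def SSD.incl (h : ∀ n, P n ⊆ Q n) (n : ℕ) : (P n →₀ ℚ) →ₗ[ℚ] (Q n →₀ ℚ) :=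
  Finsupp.lmapDomain ℚ ℚ (Set.inclusion (h n))

theorem SSD.incl_bd (h : ∀ n, P n ⊆ Q n) (n : ℕ) (x : P (n + 1) →₀ ℚ) :
    (K.sub Q hQ).bd n (K.incl h (n + 1) x) = K.incl h n ((K.sub P hP).bd n x) :=
  SSD.bd_map (K := K.sub P hP) (L := K.sub Q hQ) (fun n => Set.inclusion (h n))
    (fun _ _ _ => rfl) n x

theorem SSD.incl_injective (h : ∀ n, P n ⊆ Q n) (n : ℕ) : Function.Injective (K.incl h n) :=
  Finsupp.mapDomain_injective (Set.inclusion_injective (h n))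

theorem SSD.incl_comm (hPR : ∀ n, P n ⊆ R n) (hQR : ∀ n, Q n ⊆ R n) (n : ℕ)
    (c : (P n ∩ Q n : Set (K.S n)) →₀ ℚ) :
    K.incl hPR n (K.incl (P := fun n => P n ∩ Q n) (fun _ => Set.inter_subset_left) n c) =
      K.incl hQR n (K.incl (P := fun n => P n ∩ Q n) (fun _ => Set.inter_subset_right) n c) := by
  simp only [SSD.incl, Finsupp.lmapDomain_apply, ← Finsupp.mapDomain_comp]
  rfl

open Classical in
theorem SSD.incl_exact (hPR : ∀ n, P n ⊆ R n) (hQR : ∀ n, Q n ⊆ R n) (n : ℕ)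
    (a : P n →₀ ℚ) (b : Q n →₀ ℚ) (h : K.incl hPR n a + -K.incl hQR n b = 0) :
    ∃ c : (P n ∩ Q n : Set (K.S n)) →₀ ℚ,
      K.incl (P := fun n => P n ∩ Q n) (fun _ => Set.inter_subset_left) n c = a ∧
      K.incl (P := fun n => P n ∩ Q n) (fun _ => Set.inter_subset_right) n c = b := by
  have iP : ∀ n, P n ∩ Q n ⊆ P n := fun n => Set.inter_subset_left
  have h' : K.incl hPR n a = K.incl hQR n b := by
    rwa [← sub_eq_add_neg, sub_eq_zero] at h
  let c : (P n ∩ Q n : Set (K.S n)) →₀ ℚ :=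
    Finsupp.comapDomain (Set.inclusion (iP n)) a (Set.inclusion_injective (iP n)).injOn
  have hc : K.incl (P := fun n => P n ∩ Q n) (fun _ => Set.inter_subset_left) n c = a := by
    apply Finsupp.mapDomain_comapDomain _ (Set.inclusion_injective (iP n))
    intro x hx
    have h1 : K.incl hPR n a (Set.inclusion (hPR n) x) = a x :=
      Finsupp.mapDomain_apply (Set.inclusion_injective (hPR n)) a x
    have h2 : Set.inclusion (hPR n) x ∈ (K.incl hQR n b).support := by
      rw [← h', Finsupp.mem_support_iff, h1]
      exact Finsupp.mem_support_iff.mp hx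
    have h3 := Finsupp.mapDomain_support (f := Set.inclusion (hQR n)) h2
    obtain ⟨y, _, hy⟩ := Finset.mem_image.mp h3
    have hxy : y.1 = x.1 := congrArg Subtype.val hy
    exact ⟨⟨x.1, x.2, hxy ▸ y.2⟩, rfl⟩
  refine ⟨c, hc, K.incl_injective hQR n ?_⟩
  rw [← K.incl_comm hPR hQR, hc, h']

theorem SSD.incl_surj (hPR : ∀ n, P n ⊆ R n) (hQR : ∀ n, Q n ⊆ R n)
    (hR' : ∀ n, R n ⊆ P n ∪ Q n) (n : ℕ) (c : R n →₀ ℚ) :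
    ∃ p : (P n →₀ ℚ) × (Q n →₀ ℚ), K.incl hPR n p.1 + -K.incl hQR n p.2 = c := by
  induction c using Finsupp.induction_linear with
  | zero => exact ⟨0, by simp⟩
  | add x y hx hy =>
    obtain ⟨p, hp⟩ := hx
    obtain ⟨q, hq⟩ := hy
    exact ⟨p + q, by rw [← hp, ← hq]; simp only [Prod.fst_add, Prod.snd_add, map_add]; abel⟩
  | single x r =>
    rcases hR' n x.2 with h | h
    · exact ⟨(Finsupp.single ⟨x.1, h⟩ r, 0), by simp [SSD.incl, Finsupp.mapDomain_single]⟩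
    · exact ⟨(0, Finsupp.single ⟨x.1, h⟩ (-r)), by
        simp [SSD.incl, Finsupp.mapDomain_single, ← Finsupp.single_neg]⟩

theorem SSD.incl_sub_bd (hPR : ∀ n, P n ⊆ R n) (hQR : ∀ n, Q n ⊆ R n) (n : ℕ)
    (x : P (n + 1) →₀ ℚ) (y : Q (n + 1) →₀ ℚ) :
    (K.sub R hR).bd n (K.incl hPR (n + 1) x + -K.incl hQR (n + 1) y) =
      K.incl hPR n ((K.sub P hP).bd n x) + -K.incl hQR n ((K.sub Q hQ).bd n y) := by
  rw [← K.incl_bd hP hR hPR, ← K.incl_bd hQ hR hQR]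
  exact (map_add ((K.sub R hR).bd n) _ _).trans (congrArg (_ + ·) (map_neg _ _))

theorem SSD.mv_les (hPR : ∀ n, P n ⊆ R n) (hQR : ∀ n, Q n ⊆ R n)
    (hR' : ∀ n, R n ⊆ P n ∪ Q n) (hI : K.Closed fun n => P n ∩ Q n) :
    ∃ (f' : ∀ n, (K.sub _ hI).lc.H n →ₗ[ℚ] ((K.sub P hP).lc.prod (K.sub Q hQ).lc).H n)
      (g' : ∀ n, ((K.sub P hP).lc.prod (K.sub Q hQ).lc).H n →ₗ[ℚ] (K.sub R hR).lc.H n)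
      (δ : ∀ n, (K.sub R hR).lc.H (n + 1) →ₗ[ℚ] (K.sub _ hI).lc.H n), LES f' g' δ := by
  have iP : ∀ n, P n ∩ Q n ⊆ P n := fun n => Set.inter_subset_left
  have iQ : ∀ n, P n ∩ Q n ⊆ Q n := fun n => Set.inter_subset_right
  refine LC.les (K := (K.sub _ hI).lc) (L := (K.sub P hP).lc.prod (K.sub Q hQ).lc)
    (P := (K.sub R hR).lc)
    (fun n => (K.incl iP n).prod (K.incl iQ n))
    (fun n x => Prod.ext (K.incl_bd hI hP iP n x) (K.incl_bd hI hQ iQ n x))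
    (fun n => (K.incl hPR n).coprod (-(K.incl hQR n)))
    (fun n x => K.incl_sub_bd hP hQ hR hPR hQR n x.1 x.2)
    (fun n x y h => K.incl_injective iP n (congrArg Prod.fst h)) ?_
    (fun n c => K.incl_surj hPR hQR hR' n c)
  rintro n ⟨a, b⟩
  constructor
  · intro h
    obtain ⟨c, h1, h2⟩ := K.incl_exact hPR hQR n a b h
    exact ⟨c, Prod.ext h1 h2⟩
  · rintro ⟨c, hc⟩
    have h1 : K.incl iP n c = a := congrArg Prod.fst hc
    have h2 : K.incl iQ n c = b := congrArg Prod.snd hc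
    subst h1 h2
    change K.incl hPR n (K.incl iP n c) + -(K.incl hQR n (K.incl iQ n c)) = 0
    exact (congrArg (· + _) (K.incl_comm hPR hQR n c)).trans (add_neg_cancel _)

/-- The inclusion of the chains of a semi-simplicial subset. -/
def SSD.val (n : ℕ) : (P n →₀ ℚ) →ₗ[ℚ] (K.S n →₀ ℚ) :=
  Finsupp.lmapDomain ℚ ℚ Subtype.val

theorem SSD.val_bd (n : ℕ) (x : P (n + 1) →₀ ℚ) :
    K.bd n (K.val (n + 1) x) = K.val n ((K.sub P hP).bd n x) :=
  SSD.bd_map (K := K.sub P hP) (L := K) (fun n => Subtype.val) (fun _ _ _ => rfl) n x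

/-- The quotient complex by a semi-simplicial subset. -/
def SSD.quot : LC where
  C n := (K.S n →₀ ℚ) ⧸ LinearMap.range (K.val (P := P) n)
  d n := Submodule.mapQ _ _ (K.bd n) (by
    rintro _ ⟨x, rfl⟩
    exact ⟨_, (K.val_bd hP n x).symm⟩)
  dd n x := by
    obtain ⟨x, rfl⟩ := Submodule.mkQ_surjective _ x
    simp only [Submodule.mkQ_apply, Submodule.mapQ_apply, SSD.bd_bd]
    rfl

/-- If every relative cycle is homologous to a chain of the subset, the inclusion of the subset
induces an isomorphism in homology. -/
theorem SSD.sub_les (h : ∀ n (c : K.S (n + 1) →₀ ℚ),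
      K.bd n c ∈ LinearMap.range (K.val (P := P) n) →
      ∃ y, c - K.bd (n + 1) y ∈ LinearMap.range (K.val (P := P) (n + 1)))
    (h0 : ∀ c : K.S 0 →₀ ℚ, ∃ y, c - K.bd 0 y ∈ LinearMap.range (K.val (P := P) 0)) :
    ((K.sub P hP).lc.Fin ↔ K.lc.Fin) ∧ ((K.sub P hP).lc.Fin → (K.sub P hP).lc.chi = K.lc.chi) := by
  have acy : ∀ n, Subsingleton ((K.quot hP).H n) := by
    apply LC.acyclic
    · intro c
      obtain ⟨c, rfl⟩ := Submodule.mkQ_surjective _ c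
      obtain ⟨y, hy⟩ := h0 c
      refine ⟨Submodule.Quotient.mk y, ?_⟩
      change Submodule.Quotient.mk (K.bd 0 y) = Submodule.Quotient.mk c
      rw [eq_comm, Submodule.Quotient.eq]
      exact hy
    · intro n c hc
      obtain ⟨c, rfl⟩ := Submodule.mkQ_surjective _ c
      change Submodule.Quotient.mk (K.bd n c) = 0 at hc
      rw [Submodule.Quotient.mk_eq_zero] at hc
      obtain ⟨y, hy⟩ := h n c hc
      refine ⟨Submodule.Quotient.mk y, ?_⟩
      change Submodule.Quotient.mk (K.bd (n + 1) y) = Submodule.Quotient.mk c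
      rw [eq_comm, Submodule.Quotient.eq]
      exact hy
  obtain ⟨f, g, δ, H⟩ := LC.les (K := (K.sub P hP).lc) (L := K.lc) (P := K.quot hP)
    (fun n => K.val n) (fun n x => K.val_bd hP n x) (fun n => Submodule.mkQ _) (fun n x => rfl)
    (fun n => Finsupp.mapDomain_injective Subtype.val_injective)
    (fun n => LinearMap.exact_map_mkQ_range _) (fun n => Submodule.mkQ_surjective _)
  have hq := FinGr.of_subsingleton acy
  have hc := chiGr_of_subsingleton acy
  refine ⟨⟨fun h => H.finB h hq, fun h => H.finA h hq⟩, fun h => ?_⟩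
  have := H.chi h (H.finB h hq) hq
  rw [hc, add_zero] at this
  exact this.symm

end

end FPoly

namespace FPoly

/-- The standard topological simplex. -/
abbrev Simp (n : ℕ) : Type := stdSimplex ℝ (Fin (n + 1))

/-- The affine map of simplices with prescribed values on the vertices. -/
def real {k n : ℕ} (w : Fin (k + 1) → Simp n) (x : Simp k) : Simp n :=
  ⟨fun m => ∑ j, x.1 j * (w j).1 m, fun m => Finset.sum_nonneg fun j _ =>
    mul_nonneg (x.2.1 j) ((w j).2.1 m), by
    rw [Finset.sum_comm]
    simp only [← Finset.mul_sum, (w _).2.2, mul_one]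
    exact x.2.2⟩

/-- The vertices of the standard simplex. -/
def vert {n : ℕ} (j : Fin (n + 1)) : Simp n := ⟨Pi.single j 1, single_mem_stdSimplex ℝ j⟩

theorem real_real {k n m : ℕ} (w : Fin (k + 1) → Simp n) (u : Fin (m + 1) → Simp k) (x : Simp m) :
    real w (real u x) = real (fun j => real w (u j)) x := by
  apply Subtype.ext
  funext l
  simp only [real, Finset.sum_mul, Finset.mul_sum]
  rw [Finset.sum_comm]
  simp only [mul_assoc]

theorem real_vert {k n : ℕ} (w : Fin (k + 1) → Simp n) (j : Fin (k + 1)) :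
    real w (vert j) = w j := by
  apply Subtype.ext
  funext l
  simp [real, vert, Pi.single_apply]

theorem real_vert_eq {n : ℕ} (x : Simp n) : real vert x = x := by
  apply Subtype.ext
  funext l
  simp [real, vert, Pi.single_apply]

/-- The affine map of simplices, as a continuous map. -/
def realC {k n : ℕ} (w : Fin (k + 1) → Simp n) : C(Simp k, Simp n) :=
  ⟨real w, by
    apply Continuous.subtype_mk
    refine continuous_pi fun m => continuous_finsetSum _ fun j _ => ?_
    exact ((continuous_apply j).comp continuous_subtype_val).mul continuous_const⟩

theorem realC_comp {k n m : ℕ} (w : Fin (k + 1) → Simp n) (u : Fin (m + 1) → Simp k) :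
    (realC w).comp (realC u) = realC fun j => real w (u j) := by
  ext1 x
  exact real_real w u x

theorem realC_vert {n : ℕ} : realC (vert (n := n)) = ContinuousMap.id _ := by
  ext1 x
  exact real_vert_eq x

theorem succAbove_rel {n : ℕ} (i j : Fin (n + 2)) (h : i ≤ j) (k : Fin (n + 1)) :
    j.succ.succAbove (i.succAbove k) = i.castSucc.succAbove (j.succAbove k) := by
  have := congrArg (fun f => f.toOrderHom k) (SimplexCategory.δ_comp_δ h)
  exact this

/-- The semi-simplicial set of tuples of points of a simplex. -/
def tup (N : ℕ) : SSD where
  S k := Fin (k + 1) → Simp N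
  δ _ i w := w ∘ i.succAbove
  rel n i j h w := by
    funext k
    simp only [Function.comp_apply, succAbove_rel i j h]

/-- The singular semi-simplicial set of a space. -/
def singS (X : Type) [TopologicalSpace X] : SSD where
  S k := C(Simp k, X)
  δ _ i σ := σ.comp (realC (vert ∘ i.succAbove))
  rel n i j h σ := by
    simp only [ContinuousMap.comp_assoc, realC_comp, Function.comp_apply, real_vert,
      succAbove_rel i j h]

abbrev TC (N k : ℕ) : Type := (Fin (k + 1) → Simp N) →₀ ℚ

/-- The cone operator on chains of tuples. -/
def cone {N : ℕ} (b : Simp N) (k : ℕ) : TC N k →ₗ[ℚ] TC N (k + 1) :=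
  Finsupp.lmapDomain ℚ ℚ (fun w => (Fin.cons b w : Fin (k + 2) → Simp N))

/-- The boundary operator on chains of tuples. -/
abbrev tbd (N k : ℕ) : TC N (k + 1) →ₗ[ℚ] TC N k := (tup N).bd k

theorem tbd_single {N k : ℕ} (w : Fin (k + 2) → Simp N) (r : ℚ) :
    tbd N k (Finsupp.single w r) =
      ∑ i : Fin (k + 2), (-1 : ℚ) ^ (i : ℕ) • Finsupp.single (w ∘ i.succAbove) r :=
  SSD.bd_single (tup N) k w r

theorem tbd_cone {N k : ℕ} (b : Simp N) (c : TC N (k + 1)) :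
    tbd N (k + 1) (cone b (k + 1) c) = c - cone b k (tbd N k c) := by
  induction c using Finsupp.induction_linear with
  | zero => simp
  | add x y hx hy => simp only [map_add, hx, hy]; abel
  | single w r =>
    have e : cone b (k + 1) (Finsupp.single w r) =
        Finsupp.single (Fin.cons b w : Fin (k + 3) → Simp N) r := by
      simp [cone, Finsupp.mapDomain_single]
    rw [e, tbd_single, tbd_single, Fin.sum_univ_succ, map_sum, sub_eq_add_neg,
      ← Finset.sum_neg_distrib]
    congr 1
    · simp only [Fin.val_zero, pow_zero, one_smul]
      congr 1
    · refine Finset.sum_congr rfl fun i _ => ?_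
      rw [map_smul, ← neg_smul]
      congr 1
      · rw [Fin.val_succ]; ring
      · simp only [cone, Finsupp.lmapDomain_apply, Finsupp.mapDomain_single]
        congr 1
        funext j
        refine Fin.cases ?_ (fun j => ?_) j
        · simp
        · simp

/-- The barycentre of a tuple. -/
def bary {N k : ℕ} (w : Fin (k + 1) → Simp N) : Simp N :=
  real w ⟨fun _ => ((k : ℝ) + 1)⁻¹, fun _ => by positivity, by
    simp; field_simp⟩

theorem real_bary {N N' k : ℕ} (u : Fin (N + 1) → Simp N') (w : Fin (k + 1) → Simp N) :
    real u (bary w) = bary (real u ∘ w) :=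
  real_real u w _

/-- Barycentric subdivision of tuples. -/
def Sd (N : ℕ) : ∀ k, TC N k →ₗ[ℚ] TC N k
  | 0 => LinearMap.id
  | k + 1 => Finsupp.linearCombination ℚ fun w =>
      cone (bary w) k (Sd N k (tbd N k (Finsupp.single w 1)))

/-- The homotopy between the identity and the barycentric subdivision. -/
def Th (N : ℕ) : ∀ k, TC N k →ₗ[ℚ] TC N (k + 1)
  | 0 => 0
  | k + 1 => Finsupp.linearCombination ℚ fun w =>
      cone (bary w) (k + 1) (Finsupp.single w 1 - Th N k (tbd N k (Finsupp.single w 1)))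

theorem tbd_Th (N : ℕ) : ∀ k (c : TC N (k + 1)),
    tbd N (k + 1) (Th N (k + 1) c) = c - Sd N (k + 1) c - Th N k (tbd N k c) := by
  intro k
  induction k with
  | zero =>
    intro c
    induction c using Finsupp.induction_linear with
    | zero => simp
    | add x y hx hy => simp only [map_add, hx, hy]; abel
    | single w r =>
      simp only [Th, Sd, Finsupp.linearCombination_single, map_smul, tbd_cone, LinearMap.zero_apply,
        sub_zero, LinearMap.id_apply, smul_sub, Finsupp.smul_single, smul_eq_mul, mul_one]
  | succ k ih =>
    intro c
    induction c using Finsupp.induction_linear with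
    | zero => simp
    | add x y hx hy => simp only [map_add, hx, hy]; abel
    | single w r =>
      have hr : (Finsupp.single w r : TC N (k + 2)) = r • Finsupp.single w 1 := by simp
      have bb : tbd N k (tbd N (k + 1) (Finsupp.single w 1)) = 0 := (tup N).bd_bd k _
      rw [hr, map_smul, map_smul, map_smul, map_smul, map_smul, ← smul_sub, ← smul_sub]
      congr 1
      conv_lhs => rw [Th, Finsupp.linearCombination_single, one_smul, tbd_cone,
        map_sub (tbd N (k+1)), ih, bb,
        map_zero, sub_zero, sub_sub_cancel]
      conv_rhs => enter [1, 2]; rw [Sd, Finsupp.linearCombination_single, one_smul]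
      abel

/-- Pushing forward tuples along an affine map. -/
def tmap {N N' : ℕ} (u : Fin (N + 1) → Simp N') (k : ℕ) : TC N k →ₗ[ℚ] TC N' k :=
  Finsupp.lmapDomain ℚ ℚ (fun w => real u ∘ w)

theorem tmap_tbd {N N' : ℕ} (u : Fin (N + 1) → Simp N') (k : ℕ) (c : TC N (k + 1)) :
    tbd N' k (tmap u (k + 1) c) = tmap u k (tbd N k c) :=
  SSD.bd_map (K := tup N) (L := tup N') (fun k w => real u ∘ w) (fun _ _ _ => rfl) k c

theorem tmap_cone {N N' : ℕ} (u : Fin (N + 1) → Simp N') (k : ℕ) (b : Simp N) (c : TC N k) :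
    tmap u (k + 1) (cone b k c) = cone (real u b) k (tmap u k c) := by
  simp only [tmap, cone, Finsupp.lmapDomain_apply, ← Finsupp.mapDomain_comp]
  congr 1
  funext w j
  refine Fin.cases ?_ (fun j => ?_) j <;> simp

theorem tmap_single {N N' : ℕ} (u : Fin (N + 1) → Simp N') (k : ℕ) (w : Fin (k + 1) → Simp N)
    (r : ℚ) : tmap u k (Finsupp.single w r) = Finsupp.single (real u ∘ w) r := by
  simp [tmap, Finsupp.mapDomain_single]

theorem tmap_Sd {N N' : ℕ} (u : Fin (N + 1) → Simp N') : ∀ k (c : TC N k),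
    tmap u k (Sd N k c) = Sd N' k (tmap u k c) := by
  intro k
  induction k with
  | zero => intro c; rfl
  | succ k ih =>
    intro c
    induction c using Finsupp.induction_linear with
    | zero => simp
    | add x y hx hy => simp only [map_add, hx, hy]
    | single w r =>
      simp only [Sd, Finsupp.linearCombination_single, map_smul, tmap_cone, tmap_single, ih,
        ← tmap_tbd, real_bary]

theorem tmap_Th {N N' : ℕ} (u : Fin (N + 1) → Simp N') : ∀ k (c : TC N k),
    tmap u (k + 1) (Th N k c) = Th N' k (tmap u k c) := by
  intro k
  induction k with
  | zero => intro c; simp [Th]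
  | succ k ih =>
    intro c
    induction c using Finsupp.induction_linear with
    | zero => simp
    | add x y hx hy => simp only [map_add, hx, hy]
    | single w r =>
      simp only [Th, Finsupp.linearCombination_single, map_smul, tmap_cone, map_sub, tmap_single,
        ih, ← tmap_tbd, real_bary]

section
variable {X : Type} [TopologicalSpace X]

/-- The boundary operator on singular chains. -/
abbrev sbd (X : Type) [TopologicalSpace X] (k : ℕ) :
    (C(Simp (k + 1), X) →₀ ℚ) →ₗ[ℚ] (C(Simp k, X) →₀ ℚ) := (singS X).bd k

/-- The singular chain obtained from a chain of tuples. -/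
def push {N : ℕ} (σ : C(Simp N, X)) (k : ℕ) : TC N k →ₗ[ℚ] (C(Simp k, X) →₀ ℚ) :=
  Finsupp.lmapDomain ℚ ℚ (fun w => σ.comp (realC w))

theorem push_single {N : ℕ} (σ : C(Simp N, X)) (k : ℕ) (w : Fin (k + 1) → Simp N) (r : ℚ) :
    push σ k (Finsupp.single w r) = Finsupp.single (σ.comp (realC w)) r := by
  simp [push, Finsupp.mapDomain_single]

theorem push_face {N n : ℕ} (σ : C(Simp N, X)) (i : Fin (n + 2)) (w : Fin (n + 2) → Simp N) :
    (σ.comp (realC w)).comp (realC (vert ∘ i.succAbove)) = σ.comp (realC (w ∘ i.succAbove)) := by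
  rw [ContinuousMap.comp_assoc, realC_comp]
  simp only [Function.comp_apply, real_vert]
  rfl

theorem push_bd {N : ℕ} (σ : C(Simp N, X)) (k : ℕ) (c : TC N (k + 1)) :
    sbd X k (push σ (k + 1) c) = push σ k (tbd N k c) :=
  SSD.bd_map (K := tup N) (L := singS X) (fun k w => σ.comp (realC w)) (fun n i w => by
    change (σ.comp (realC w)).comp (realC (vert ∘ i.succAbove)) = σ.comp (realC (w ∘ i.succAbove))
    exact push_face σ i w) k c

theorem push_comp {N N' : ℕ} (σ : C(Simp N', X)) (u : Fin (N + 1) → Simp N') (k : ℕ) (c : TC N k) :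
    push (σ.comp (realC u)) k c = push σ k (tmap u k c) := by
  simp only [push, tmap, Finsupp.lmapDomain_apply, ← Finsupp.mapDomain_comp]
  congr 1
  funext w
  simp only [Function.comp_apply, ContinuousMap.comp_assoc, realC_comp]
  rfl

/-- The tautological tuple. -/
abbrev tvert (k : ℕ) : TC k k := Finsupp.single vert 1

variable (X)

/-- Barycentric subdivision of singular chains. -/
def sd (k : ℕ) : (C(Simp k, X) →₀ ℚ) →ₗ[ℚ] (C(Simp k, X) →₀ ℚ) :=
  Finsupp.linearCombination ℚ fun σ => push σ k (Sd k k (tvert k))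

/-- The subdivision homotopy on singular chains. -/
def th (k : ℕ) : (C(Simp k, X) →₀ ℚ) →ₗ[ℚ] (C(Simp (k + 1), X) →₀ ℚ) :=
  Finsupp.linearCombination ℚ fun σ => push σ (k + 1) (Th k k (tvert k))

theorem tmap_tvert {N k : ℕ} (w : Fin (k + 1) → Simp N) :
    tmap w k (tvert k) = Finsupp.single w 1 := by
  rw [tmap_single]
  congr 1
  funext j
  exact real_vert w j

theorem sd_push {N : ℕ} (σ : C(Simp N, X)) (k : ℕ) (c : TC N k) :
    sd X k (push σ k c) = push σ k (Sd N k c) := by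
  induction c using Finsupp.induction_linear with
  | zero => simp
  | add x y hx hy => simp only [map_add, hx, hy]
  | single w r =>
    rw [push_single, sd, Finsupp.linearCombination_single, push_comp, tmap_Sd, tmap_tvert,
      ← map_smul, ← map_smul]
    simp

theorem th_push {N : ℕ} (σ : C(Simp N, X)) (k : ℕ) (c : TC N k) :
    th X k (push σ k c) = push σ (k + 1) (Th N k c) := by
  induction c using Finsupp.induction_linear with
  | zero => simp
  | add x y hx hy => simp only [map_add, hx, hy]
  | single w r =>
    rw [push_single, th, Finsupp.linearCombination_single, push_comp, tmap_Th, tmap_tvert,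
      ← map_smul, ← map_smul]
    simp

theorem push_tvert {k : ℕ} (σ : C(Simp k, X)) : push σ k (tvert k) = Finsupp.single σ 1 := by
  rw [push_single, realC_vert]
  rfl

theorem bd_th (k : ℕ) (c : C(Simp (k + 1), X) →₀ ℚ) :
    sbd X (k + 1) (th X (k + 1) c) = c - sd X (k + 1) c - th X k (sbd X k c) := by
  induction c using Finsupp.induction_linear with
  | zero => simp
  | add x y hx hy =>
    simp only [map_add, hx, hy]
    abel
  | single σ r =>
    have hr : Finsupp.single σ r = push σ (k + 1) (r • tvert (k + 1)) := by
      rw [map_smul, push_tvert]; simp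
    rw [hr, th_push, sd_push, push_bd, push_bd, th_push, tbd_Th, map_sub, map_sub]

theorem bd_th_zero (c : C(Simp 0, X) →₀ ℚ) : sd X 0 c = c := by
  induction c using Finsupp.induction_linear with
  | zero => simp
  | add x y hx hy => simp only [map_add, hx, hy]
  | single σ r =>
    have hr : Finsupp.single σ r = push σ 0 (r • tvert 0) := by
      rw [map_smul, push_tvert]; simp
    rw [hr, sd_push]; rfl

end

end FPoly

namespace FPoly

theorem map_mem_of_supported {α β : Type} {P : Set α} {Q : Submodule ℚ (β →₀ ℚ)}
    (L : (α →₀ ℚ) →ₗ[ℚ] (β →₀ ℚ)) (h : ∀ a ∈ P, L (Finsupp.single a 1) ∈ Q) {c : α →₀ ℚ}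
    (hc : c ∈ Finsupp.supported ℚ ℚ P) : L c ∈ Q := by
  rw [Finsupp.supported_eq_span_single] at hc
  have : Submodule.span ℚ ((fun i => Finsupp.single i (1 : ℚ)) '' P) ≤ Q.comap L := by
    rw [Submodule.span_le]
    rintro _ ⟨a, ha, rfl⟩
    exact h a ha
  exact this hc

theorem range_val_eq {α : Type} (P : Set α) :
    LinearMap.range (Finsupp.lmapDomain ℚ ℚ (Subtype.val : P → α)) = Finsupp.supported ℚ ℚ P := by
  apply le_antisymm
  · rintro _ ⟨c, rfl⟩
    have hc : c ∈ Finsupp.supported ℚ ℚ (Set.univ : Set P) := by simp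
    exact map_mem_of_supported _ (fun a _ => by
      simp only [Finsupp.lmapDomain_apply, Finsupp.mapDomain_single]
      exact Finsupp.single_mem_supported ℚ 1 a.2) hc
  · rw [Finsupp.supported_eq_span_single, Submodule.span_le]
    rintro _ ⟨a, ha, rfl⟩
    exact ⟨Finsupp.single ⟨a, ha⟩ 1, by simp [Finsupp.mapDomain_single]⟩

theorem dist_real_le {k N : ℕ} {w : Fin (k + 1) → Simp N} {p : Simp N} {r : ℝ}
    (h : ∀ j, dist (w j) p ≤ r) (x : Simp k) : dist (real w x) p ≤ r := by
  have : (real w x).1 = ∑ j, x.1 j • (w j).1 := by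
    funext m
    simp [real]
  have h2 : (real w x).1 ∈ Metric.closedBall p.1 r := by
    rw [this]
    exact (convex_closedBall p.1 r).sum_mem (fun j _ => x.2.1 j) x.2.2 (fun j _ => h j)
  exact h2

theorem dist_bary_le {k N : ℕ} {w : Fin (k + 2) → Simp N} {r : ℝ}
    (h : ∀ i j, dist (w i) (w j) ≤ r) (j : Fin (k + 2)) :
    dist (bary w) (w j) ≤ ((k + 1 : ℕ) : ℝ) / ((k + 1 : ℕ) + 1) * r := by
  have e : (bary w).1 - (w j).1 = ∑ i, (((k + 1 : ℕ) : ℝ) + 1)⁻¹ • ((w i).1 - (w j).1) := by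
    have h1 : (bary w).1 = ∑ i, (((k + 1 : ℕ) : ℝ) + 1)⁻¹ • (w i).1 := by
      funext m
      simp [bary, real]
    simp only [smul_sub, Finset.sum_sub_distrib, ← h1]
    congr 1
    rw [Finset.sum_const, Finset.card_univ, Fintype.card_fin, ← Nat.cast_smul_eq_nsmul ℝ, smul_smul]
    push_cast
    rw [show ((k : ℝ) + 2) * ((k : ℝ) + 1 + 1)⁻¹ = 1 by field_simp; ring, one_smul]
  have e2 : dist (bary w) (w j) = ‖(bary w).1 - (w j).1‖ := dist_eq_norm (bary w).1 (w j).1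
  rw [e2, e]
  refine (norm_sum_le _ _).trans ?_
  have hb : ∀ i, ‖(((k + 1 : ℕ) : ℝ) + 1)⁻¹ • ((w i).1 - (w j).1)‖ ≤
      (((k + 1 : ℕ) : ℝ) + 1)⁻¹ * (if i = j then 0 else r) := by
    intro i
    rw [norm_smul, Real.norm_of_nonneg (by positivity)]
    apply mul_le_mul_of_nonneg_left _ (by positivity)
    split_ifs with hij
    · subst hij; simp
    · have := h i j
      rwa [Subtype.dist_eq, dist_eq_norm] at this
  refine (Finset.sum_le_sum fun i _ => hb i).trans ?_
  rw [← Finset.mul_sum]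
  have : ∑ i : Fin (k + 2), (if i = j then 0 else r) = ((k + 1 : ℕ) : ℝ) * r := by
    rw [← Finset.add_sum_erase _ _ (Finset.mem_univ j)]
    simp only [if_true, zero_add]
    rw [Finset.sum_congr rfl (g := fun _ => r) (fun i hi => if_neg (Finset.ne_of_mem_erase hi))]
    simp [Finset.card_erase_of_mem]
  rw [this]
  apply le_of_eq; ring

theorem Sd_mesh {N : ℕ} : ∀ (k : ℕ) (w : Fin (k + 1) → Simp N) (r : ℝ), 0 ≤ r →
    (∀ i j, dist (w i) (w j) ≤ r) →
    Sd N k (Finsupp.single w 1) ∈ Finsupp.supported ℚ ℚ {u : Fin (k + 1) → Simp N |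
      (∀ i, u i ∈ Set.range (real w)) ∧ ∀ i j, dist (u i) (u j) ≤ (k : ℝ) / (k + 1) * r} := by
  intro k
  induction k with
  | zero =>
    intro w r hr h
    apply Finsupp.single_mem_supported
    refine ⟨fun i => ⟨vert i, real_vert w i⟩, fun i j => ?_⟩
    rw [show i = j by omega]; simp
  | succ k ih =>
    intro w r hr h
    rw [Sd, Finsupp.linearCombination_single, one_smul, tbd_single, map_sum, map_sum]
    refine Submodule.sum_mem _ fun i _ => ?_
    rw [map_smul, map_smul]
    refine Submodule.smul_mem _ _ ?_
    refine map_mem_of_supported (cone (bary w) k) ?_ (ih (w ∘ i.succAbove) r hr fun a b => h _ _)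
    rintro u ⟨hu1, hu2⟩
    have hu1' : ∀ j, u j ∈ Set.range (real w) := by
      intro j
      obtain ⟨x, hx⟩ := hu1 j
      refine ⟨real (vert ∘ i.succAbove) x, ?_⟩
      rw [real_real, ← hx]
      simp only [Function.comp_apply, real_vert]
      rfl
    have hb : ∀ j, dist (bary w) (u j) ≤ ((k + 1 : ℕ) : ℝ) / ((k + 1 : ℕ) + 1) * r := by
      intro j
      obtain ⟨x, hx⟩ := hu1' j
      rw [← hx, dist_comm]
      apply dist_real_le
      intro l
      rw [dist_comm]
      exact dist_bary_le h l
    have hmono : (k : ℝ) / (k + 1) * r ≤ ((k + 1 : ℕ) : ℝ) / ((k + 1 : ℕ) + 1) * r := by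
      apply mul_le_mul_of_nonneg_right _ hr
      rw [div_le_div_iff₀ (by positivity) (by positivity)]
      push_cast
      nlinarith
    rw [cone, Finsupp.lmapDomain_apply, Finsupp.mapDomain_single]
    apply Finsupp.single_mem_supported
    refine ⟨fun j => ?_, fun a b => ?_⟩
    · refine Fin.cases ?_ (fun j => ?_) j
      · exact ⟨_, rfl⟩
      · simpa using hu1' j
    · refine Fin.cases ?_ (fun a => ?_) a <;> refine Fin.cases ?_ (fun b => ?_) b
      · simp only [Fin.cons_zero, dist_self]; positivity
      · simpa only [Fin.cons_zero, Fin.cons_succ] using hb b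
      · simpa only [Fin.cons_zero, Fin.cons_succ, dist_comm] using hb a
      · simpa only [Fin.cons_succ] using (hu2 a b).trans hmono

/-- Tuples of small diameter. -/
def meshSet (N k : ℕ) (r : ℝ) : Set (Fin (k + 1) → Simp N) :=
  {u | ∀ i j, dist (u i) (u j) ≤ r}

theorem Sd_iter_mesh {N : ℕ} (k m : ℕ) (w : Fin (k + 1) → Simp N) :
    (Sd N k)^[m] (Finsupp.single w 1) ∈
      Finsupp.supported ℚ ℚ (meshSet N k (((k : ℝ) / (k + 1)) ^ m)) := by
  induction m with
  | zero =>
    apply Finsupp.single_mem_supported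
    intro i j
    rw [pow_zero, Subtype.dist_eq, dist_pi_le_iff zero_le_one]
    intro b
    have h1 := fun (x : Simp N) => mem_Icc_of_mem_stdSimplex x.2 b
    rw [Real.dist_eq, abs_le]
    have := h1 (w i); have := h1 (w j)
    simp only [Set.mem_Icc] at *
    constructor <;> linarith
  | succ m ih =>
    rw [Function.iterate_succ_apply']
    refine map_mem_of_supported _ (fun u hu => ?_) ih
    refine Finsupp.supported_mono ?_ (Sd_mesh k u _ (by positivity) hu)
    rintro v ⟨_, hv⟩ i j
    rw [pow_succ, mul_comm]
    exact hv i j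

section
variable (X : Type) [TopologicalSpace X]

/-- Singular simplices with image in a given set. -/
def inS (U : Set X) (n : ℕ) : Set (C(Simp n, X)) := {σ | Set.range σ ⊆ U}

variable {X}

theorem inS_closed (U : Set X) : (singS X).Closed (inS X U) := by
  intro n i σ hσ
  rintro _ ⟨x, rfl⟩
  exact hσ ⟨_, rfl⟩

theorem inS_comp {U : Set X} {n k : ℕ} {σ : C(Simp n, X)} (h : σ ∈ inS X U n)
    (f : C(Simp k, Simp n)) : σ.comp f ∈ inS X U k := by
  rintro _ ⟨x, rfl⟩
  exact h ⟨_, rfl⟩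

/-- Simplices contained in one of two sets. -/
def smallS (U V : Set X) (n : ℕ) : Set (C(Simp n, X)) := inS X U n ∪ inS X V n

theorem smallS_closed (U V : Set X) : (singS X).Closed (smallS U V) := by
  rintro n i σ (h | h)
  · exact Or.inl (inS_closed U n i σ h)
  · exact Or.inr (inS_closed V n i σ h)

theorem smallS_comp {U V : Set X} {n k : ℕ} {σ : C(Simp n, X)} (h : σ ∈ smallS U V n)
    (f : C(Simp k, Simp n)) : σ.comp f ∈ smallS U V k := by
  rcases h with h | h
  · exact Or.inl (inS_comp h f)
  · exact Or.inr (inS_comp h f)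

/-- Chains of small simplices. -/
abbrev smallC (U V : Set X) (n : ℕ) : Submodule ℚ (C(Simp n, X) →₀ ℚ) :=
  Finsupp.supported ℚ ℚ (smallS U V n)

theorem push_small {U V : Set X} {n k : ℕ} {σ : C(Simp n, X)} (h : σ ∈ smallS U V n) (c : TC n k) :
    push σ k c ∈ smallC U V k := by
  refine map_mem_of_supported (P := Set.univ) _ (fun a _ => ?_) (by simp)
  rw [push_single]
  exact Finsupp.single_mem_supported ℚ 1 (smallS_comp h _)

theorem sd_small {U V : Set X} {n : ℕ} {c : C(Simp n, X) →₀ ℚ} (h : c ∈ smallC U V n) :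
    sd X n c ∈ smallC U V n := by
  refine map_mem_of_supported _ (fun σ hσ => ?_) h
  rw [sd, Finsupp.linearCombination_single, one_smul]
  exact push_small hσ _

theorem th_small {U V : Set X} {n : ℕ} {c : C(Simp n, X) →₀ ℚ} (h : c ∈ smallC U V n) :
    th X n c ∈ smallC U V (n + 1) := by
  refine map_mem_of_supported _ (fun σ hσ => ?_) h
  rw [th, Finsupp.linearCombination_single, one_smul]
  exact push_small hσ _

theorem sd_iter_push {N : ℕ} (σ : C(Simp N, X)) (k m : ℕ) (c : TC N k) :
    (sd X k)^[m] (push σ k c) = push σ k ((Sd N k)^[m] c) := by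
  induction m with
  | zero => rfl
  | succ m ih => rw [Function.iterate_succ_apply', Function.iterate_succ_apply', ih, sd_push]

theorem sd_iter_small {U V : Set X} {n : ℕ} {c : C(Simp n, X) →₀ ℚ} (h : c ∈ smallC U V n) (m : ℕ) :
    (sd X n)^[m] c ∈ smallC U V n := by
  induction m with
  | zero => exact h
  | succ m ih => rw [Function.iterate_succ_apply']; exact sd_small ih

theorem exists_sd_small_single {U V : Set X} (hU : IsOpen U) (hV : IsOpen V)
    (hUV : U ∪ V = Set.univ)
    {n : ℕ} (σ : C(Simp n, X)) : ∃ m, (sd X n)^[m] (Finsupp.single σ 1) ∈ smallC U V n := by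
  obtain ⟨δ, hδ, hball⟩ := lebesgue_number_lemma_of_metric (s := (Set.univ : Set (Simp n)))
    (c := fun b : Bool => σ ⁻¹' (if b then U else V)) isCompact_univ
    (fun b => by cases b <;> simp [hU.preimage σ.continuous, hV.preimage σ.continuous])
    (fun x _ => by
      have : σ x ∈ U ∪ V := hUV ▸ Set.mem_univ _
      rcases this with h | h
      · exact Set.mem_iUnion.mpr ⟨true, by simpa using h⟩
      · exact Set.mem_iUnion.mpr ⟨false, by simpa using h⟩)
  have hlt : (n : ℝ) / (n + 1) < 1 := by
    rw [div_lt_one (by positivity)]; linarith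
  obtain ⟨m, hm⟩ := exists_pow_lt_of_lt_one hδ hlt
  refine ⟨m, ?_⟩
  rw [← push_tvert, sd_iter_push]
  refine map_mem_of_supported _ (fun u hu => ?_) (Sd_iter_mesh n m vert)
  rw [push_single]
  apply Finsupp.single_mem_supported
  obtain ⟨b, hb⟩ := hball (u 0) (Set.mem_univ _)
  have hr : Set.range (real u) ⊆ σ ⁻¹' (if b then U else V) := by
    rintro _ ⟨x, rfl⟩
    apply hb
    exact lt_of_le_of_lt (dist_real_le (fun j => hu j 0) x) hm
  cases b
  · right
    rintro _ ⟨x, rfl⟩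
    exact hr ⟨x, rfl⟩
  · left
    rintro _ ⟨x, rfl⟩
    exact hr ⟨x, rfl⟩

theorem exists_sd_small {U V : Set X} (hU : IsOpen U) (hV : IsOpen V)
    (hUV : U ∪ V = Set.univ)
    {n : ℕ} (c : C(Simp n, X) →₀ ℚ) : ∃ m, (sd X n)^[m] c ∈ smallC U V n := by
  have hadd : ∀ m (x y : C(Simp n, X) →₀ ℚ), (sd X n)^[m] (x + y) =
      (sd X n)^[m] x + (sd X n)^[m] y := fun m x y => by
    rw [← Module.End.coe_pow, map_add]
  have hsmul : ∀ m (r : ℚ) (x : C(Simp n, X) →₀ ℚ), (sd X n)^[m] (r • x) =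
      r • (sd X n)^[m] x := fun m r x => by
    rw [← Module.End.coe_pow, map_smul]
  induction c using Finsupp.induction_linear with
  | zero => exact ⟨0, by simp⟩
  | add x y hx hy =>
    obtain ⟨a, ha⟩ := hx
    obtain ⟨b, hb⟩ := hy
    refine ⟨a + b, ?_⟩
    rw [hadd]
    refine Submodule.add_mem _ ?_ ?_
    · rw [show a + b = b + a from Nat.add_comm a b, Function.iterate_add_apply]
      exact sd_iter_small ha b
    · rw [Function.iterate_add_apply]; exact sd_iter_small hb a
  | single σ r =>
    obtain ⟨m, hm⟩ := exists_sd_small_single hU hV hUV σ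
    refine ⟨m, ?_⟩
    rw [show Finsupp.single σ r = r • Finsupp.single σ 1 by simp, hsmul]
    exact Submodule.smul_mem _ _ hm

theorem sbd_sd (n : ℕ) (c : C(Simp (n + 1), X) →₀ ℚ) :
    sbd X n (sd X (n + 1) c) = sd X n (sbd X n c) := by
  have bb : ∀ m (c : C(Simp (m + 2), X) →₀ ℚ), sbd X m (sbd X (m + 1) c) = 0 :=
    fun m c => (singS X).bd_bd m c
  have h1 : sd X (n + 1) c = c - th X n (sbd X n c) - sbd X (n + 1) (th X (n + 1) c) := by
    rw [bd_th]; abel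
  rw [h1, map_sub, map_sub, bb, sub_zero]
  cases n with
  | zero =>
    rw [bd_th_zero]
    have : th X 0 (sbd X 0 c) = 0 := by
      have : th X 0 = 0 := by
        ext σ : 1
        ext
        simp [th, Th]
      rw [this]; rfl
    rw [this, map_zero, sub_zero]
  | succ n =>
    rw [bd_th, bb, map_zero, sub_zero, sub_sub_cancel]

theorem exists_homologous_small {U V : Set X} (hU : IsOpen U) (hV : IsOpen V)
    (hUV : U ∪ V = Set.univ) (n : ℕ) (c : C(Simp (n + 1), X) →₀ ℚ)
    (hc : sbd X n c ∈ smallC U V n) :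
    ∃ y, c - sbd X (n + 1) y ∈ smallC U V (n + 1) := by
  obtain ⟨m, hm⟩ := exists_sd_small hU hV hUV c
  have key : ∀ m, sbd X n ((sd X (n + 1))^[m] c) ∈ smallC U V n ∧
      ∃ y, c - (sd X (n + 1))^[m] c - sbd X (n + 1) y ∈ smallC U V (n + 1) := by
    intro m
    induction m with
    | zero => exact ⟨hc, 0, by simp⟩
    | succ m ih =>
      obtain ⟨h1, y, hy⟩ := ih
      rw [Function.iterate_succ_apply']
      set c' := (sd X (n + 1))^[m] c
      refine ⟨by rw [sbd_sd]; exact sd_small h1, y + th X (n + 1) c', ?_⟩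
      have e : c - sd X (n + 1) c' - sbd X (n + 1) (y + th X (n + 1) c') =
          (c - c' - sbd X (n + 1) y) + th X n (sbd X n c') := by
        rw [map_add, bd_th]; abel
      rw [e]
      exact Submodule.add_mem _ hy (th_small h1)
  obtain ⟨_, y, hy⟩ := key m
  refine ⟨y, ?_⟩
  have := Submodule.add_mem _ hy hm
  rwa [show c - (sd X (n + 1))^[m] c - sbd X (n + 1) y + (sd X (n + 1))^[m] c =
    c - sbd X (n + 1) y by abel] at this

theorem sd_iter_zero (m : ℕ) (c : C(Simp 0, X) →₀ ℚ) : (sd X 0)^[m] c = c := by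
  induction m with
  | zero => rfl
  | succ m ih => rw [Function.iterate_succ_apply', ih, bd_th_zero]

theorem small_les {U V : Set X} (hU : IsOpen U) (hV : IsOpen V)
    (hUV : U ∪ V = Set.univ) :
    (((singS X).sub _ (smallS_closed U V)).lc.Fin ↔ (singS X).lc.Fin) ∧
    (((singS X).sub _ (smallS_closed U V)).lc.Fin →
      ((singS X).sub _ (smallS_closed U V)).lc.chi = (singS X).lc.chi) := by
  apply SSD.sub_les
  · intro n c hc
    have e : ∀ n, LinearMap.range ((singS X).val (P := smallS U V) n) = smallC U V n := fun n =>
      range_val_eq _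
    rw [e] at hc ⊢
    exact exists_homologous_small hU hV hUV n c hc
  · intro c
    refine ⟨0, ?_⟩
    rw [map_zero, sub_zero]
    have e : LinearMap.range ((singS X).val (P := smallS U V) 0) = smallC U V 0 := range_val_eq _
    rw [e]
    obtain ⟨m, hm⟩ := exists_sd_small hU hV hUV c
    exact (sd_iter_zero m c) ▸ hm

/-- Singular homology of a space is finite. -/
def FinH (X : Type) [TopologicalSpace X] : Prop := (singS X).lc.Fin

/-- The Euler characteristic, computed by singular homology. -/
def chiH (X : Type) [TopologicalSpace X] : ℤ := (singS X).lc.chi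

/-- Simplices in a subset are simplices of the subspace. -/
def inSEquiv (U : Set X) (n : ℕ) : inS X U n ≃ C(Simp n, U) where
  toFun σ := ⟨fun x => ⟨σ.1 x, σ.2 ⟨x, rfl⟩⟩, Continuous.subtype_mk σ.1.continuous _⟩
  invFun τ := ⟨⟨fun x => (τ x).1, continuous_subtype_val.comp τ.continuous⟩, by
    rintro _ ⟨x, rfl⟩
    exact (τ x).2⟩
  left_inv _ := rfl
  right_inv _ := rfl

theorem sub_sing_equiv (U : Set X) :
    Nonempty (∀ n, ((singS X).sub _ (inS_closed U)).lc.H n ≃ₗ[ℚ] (singS U).lc.H n) :=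
  SSD.congr (K := (singS X).sub _ (inS_closed U)) (L := singS U) (inSEquiv U)
    (fun _ _ _ => rfl)

theorem fin_sub_sing (U : Set X) : ((singS X).sub _ (inS_closed U)).lc.Fin ↔ FinH U := by
  obtain ⟨e⟩ := sub_sing_equiv U
  exact ⟨fun h => FinGr.congr e h, fun h => FinGr.congr (fun n => (e n).symm) h⟩

theorem chi_sub_sing (U : Set X) : ((singS X).sub _ (inS_closed U)).lc.chi = chiH U := by
  obtain ⟨e⟩ := sub_sing_equiv U
  exact chiGr_congr e

theorem inS_inter (U V : Set X) : (fun n => inS X U n ∩ inS X V n) = inS X (U ∩ V) := by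
  funext n
  ext σ
  simp [inS, Set.subset_inter_iff]

theorem SSD.sub_eq {K : SSD} {P Q : ∀ n, Set (K.S n)} (e : P = Q) (hP : K.Closed P)
    (hQ : K.Closed Q) :
    ((K.sub P hP).lc.Fin ↔ (K.sub Q hQ).lc.Fin) ∧ (K.sub P hP).lc.chi = (K.sub Q hQ).lc.chi := by
  subst e
  exact ⟨Iff.rfl, rfl⟩

/-- The Mayer–Vietoris sequence, in Euler characteristic form. -/
theorem mayerVietoris {U V : Set X} (hU : IsOpen U) (hV : IsOpen V)
    (hUV : U ∪ V = Set.univ) :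
    (FinH U → FinH V → FinH ↥(U ∩ V) → FinH X) ∧
    (FinH U → FinH V → FinH X → FinH ↥(U ∩ V)) ∧
    (FinH X → FinH ↥(U ∩ V) → FinH U ∧ FinH V) ∧
    (FinH U → FinH V → FinH X → chiH X = chiH U + chiH V - chiH ↥(U ∩ V)) := by
  obtain ⟨hs1, hs2⟩ := small_les hU hV hUV
  have hI : (singS X).Closed fun n => inS X U n ∩ inS X V n := fun n i σ hσ =>
    ⟨inS_closed U n i σ hσ.1, inS_closed V n i σ hσ.2⟩
  have hE := SSD.sub_eq (K := singS X) (inS_inter U V) hI (inS_closed (U ∩ V))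
  have hIF := hE.1.trans (fin_sub_sing (U ∩ V))
  have hIc := hE.2.trans (chi_sub_sing (U ∩ V))
  obtain ⟨f, g, δ, H⟩ := (singS X).mv_les (P := inS X U) (Q := inS X V) (R := smallS U V)
    (inS_closed U) (inS_closed V) (smallS_closed U V) (fun n => Set.subset_union_left)
    (fun n => Set.subset_union_right) (fun n => subset_rfl) hI
  rw [← hIF, ← hIc, ← fin_sub_sing, ← fin_sub_sing, ← chi_sub_sing, ← chi_sub_sing]
  unfold FinH chiH
  rw [← hs1]
  refine ⟨fun a b c => H.finC c (LC.prod_fin a b), fun a b c => H.finA (LC.prod_fin a b) c,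
    fun a b => LC.fin_of_prod (H.finB b a), fun a b c => ?_⟩
  rw [← hs2 c]
  have h1 := H.chi (H.finA (LC.prod_fin a b) c) (LC.prod_fin a b) c
  have h2 := LC.prod_chi a b
  exact eq_sub_of_add_eq ((add_comm _ _).trans (h1.symm.trans h2))

end

end FPoly

namespace FPoly

open CategoryTheory in
/-- Singular homology, as a functor. -/
def HsF (n : ℕ) : TopCat.{0} ⥤ ModuleCat.{0} ℚ :=
  TopCat.toSSet ⋙ (SimplicialObject.whiskering _ _).obj (ModuleCat.free ℚ) ⋙
    AlgebraicTopology.alternatingFaceMapComplex (ModuleCat ℚ) ⋙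
    HomologicalComplex.homologyFunctor _ _ n

open CategoryTheory in
theorem HsF_map_eq (n : ℕ) {X Y : TopCat.{0}} {f g : X ⟶ Y} (h : TopCat.Homotopy f g) :
    (HsF n).map f = (HsF n).map g :=
  (h.toSSet.toSimplicialObjectHomotopy.whiskerRight (ModuleCat.free ℚ)).map_homology_eq n

open CategoryTheory in
theorem Hsing_equiv {X Y : Type} [TopologicalSpace X] [TopologicalSpace Y]
    (e : ContinuousMap.HomotopyEquiv X Y) (n : ℕ) : Nonempty (Hsing n X ≃ₗ[ℚ] Hsing n Y) := by
  let f : TopCat.of X ⟶ TopCat.of Y := TopCat.ofHom e.toFun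
  let g : TopCat.of Y ⟶ TopCat.of X := TopCat.ofHom e.invFun
  have h1 : (HsF n).map (f ≫ g) = (HsF n).map (𝟙 _) :=
    HsF_map_eq n (show TopCat.Homotopy (f ≫ g) (𝟙 _) from e.left_inv.some)
  have h2 : (HsF n).map (g ≫ f) = (HsF n).map (𝟙 _) :=
    HsF_map_eq n (show TopCat.Homotopy (g ≫ f) (𝟙 _) from e.right_inv.some)
  rw [CategoryTheory.Functor.map_comp, CategoryTheory.Functor.map_id] at h1 h2
  let i : (HsF n).obj (TopCat.of X) ≅ (HsF n).obj (TopCat.of Y) := ⟨_, _, h1, h2⟩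
  exact ⟨i.toLinearEquiv⟩

open CategoryTheory in
theorem Hsing_unit (n : ℕ) : Nonempty (Hsing n Unit ≃ₗ[ℚ]
    (ChainComplex.alternatingConst.obj (ModuleCat.of ℚ (Unit →₀ ℚ))).homology n) := by
  let i1 : TopCat.toSSet.obj (TopCat.of Unit) ≅ (Functor.const SimplexCategoryᵒᵖ).obj Unit :=
    TopCat.toSSetIsoConst (TopCat.of Unit)
  let i2 := ((SimplicialObject.whiskering _ _).obj (ModuleCat.free ℚ)).mapIso i1
  let i3 : ((SimplicialObject.whiskering _ _).obj (ModuleCat.free ℚ)).obj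
      ((Functor.const SimplexCategoryᵒᵖ).obj Unit) ≅
      (Functor.const SimplexCategoryᵒᵖ).obj (ModuleCat.of ℚ (Unit →₀ ℚ)) :=
    Functor.constComp _ Unit (ModuleCat.free ℚ)
  let i4 := (AlgebraicTopology.alternatingFaceMapComplex (ModuleCat.{0} ℚ)).mapIso (i2 ≪≫ i3)
  let i5 := i4 ≪≫ (AlgebraicTopology.alternatingFaceMapComplexConst (C := ModuleCat.{0} ℚ)).app
    (ModuleCat.of ℚ (Unit →₀ ℚ))
  exact ⟨((HomologicalComplex.homologyFunctor _ _ n).mapIso i5).toLinearEquiv⟩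

open CategoryTheory in
/-- Singular simplices in the categorical and in the naive sense. -/
def toSSetE (X : Type) [TopologicalSpace X] (n : ℕ) :
    C(Simp n, X) ≃ (TopCat.toSSet.obj (TopCat.of X)).obj (Opposite.op (SimplexCategory.mk n)) :=
  (TopCat.toSSetObjEquiv (TopCat.of X) (Opposite.op (SimplexCategory.mk n))).symm

open CategoryTheory in
theorem toSSetE_δ (X : Type) [TopologicalSpace X] (n : ℕ) (i : Fin (n + 2))
    (σ : C(Simp (n + 1), X)) :
    (TopCat.toSSet.obj (TopCat.of X)).δ i (toSSetE X (n + 1) σ) =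
      toSSetE X n (σ.comp (realC (vert ∘ i.succAbove))) := by
  apply (TopCat.toSSetObjEquiv (TopCat.of X) (Opposite.op (SimplexCategory.mk n))).injective
  ext x
  change σ (stdSimplex.map (SimplexCategory.δ i) x) = σ (real (vert ∘ i.succAbove) x)
  congr 1
  apply Subtype.ext
  funext l
  change FunOnFinite.linearMap ℝ ℝ (SimplexCategory.δ i) x.1 l = _
  rw [FunOnFinite.linearMap_apply_apply]
  simp only [real, vert, Function.comp_apply, Pi.single_apply, mul_ite, mul_one, mul_zero]
  rw [Finset.sum_ite, Finset.sum_const_zero, add_zero]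
  refine Finset.sum_congr ?_ fun _ _ => rfl
  ext m
  simp only [Finset.mem_filter, Finset.mem_univ, true_and]
  exact eq_comm

open CategoryTheory in
theorem altFace_d_apply (K : SimplicialObject (ModuleCat.{0} ℚ)) (n : ℕ)
    (x : (AlgebraicTopology.AlternatingFaceMapComplex.obj K).X (n + 1)) :
    ((AlgebraicTopology.AlternatingFaceMapComplex.obj K).d (n + 1) n).hom x =
      ∑ i : Fin (n + 2), (-1 : ℤ) ^ (i : ℕ) • (K.δ i).hom x := by
  rw [AlgebraicTopology.AlternatingFaceMapComplex.obj_d_eq, ModuleCat.hom_sum,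
    LinearMap.sum_apply]
  rfl

open CategoryTheory in
/-- The comparison of chain groups. -/
def chainE (X : Type) [TopologicalSpace X] (n : ℕ) :
    (C(Simp n, X) →₀ ℚ) ≃ₗ[ℚ] (singComplex X).X n :=
  Finsupp.domLCongr (toSSetE X n)

open CategoryTheory in
theorem singComplex_d (X : Type) [TopologicalSpace X] (n : ℕ)
    (c : C(Simp (n + 1), X) →₀ ℚ) :
    ((singComplex X).d (n + 1) n).hom (chainE X (n + 1) c) = chainE X n (sbd X n c) := by
  have key : ((singComplex X).d (n + 1) n).hom ∘ₗ (chainE X (n + 1)).toLinearMap =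
      (chainE X n).toLinearMap ∘ₗ sbd X n := by
    refine Finsupp.lhom_ext fun σ r => ?_
    refine (altFace_d_apply _ n _).trans ?_
    change _ = chainE X n (sbd X n (Finsupp.single σ r))
    have h : sbd X n (Finsupp.single σ r) = ∑ i : Fin (n + 2), (-1 : ℚ) ^ (i : ℕ) •
        Finsupp.single (σ.comp (realC (vert ∘ i.succAbove))) r := (singS X).bd_single n σ r
    rw [h, map_sum]
    refine Finset.sum_congr rfl fun i _ => ?_
    rw [map_smul]
    have h1 : chainE X n (Finsupp.single (σ.comp (realC (vert ∘ i.succAbove))) r) =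
        (Finsupp.single (toSSetE X n (σ.comp (realC (vert ∘ i.succAbove)))) r :) :=
      Finsupp.domLCongr_single _ _ _
    have h2 : chainE X (n + 1) (Finsupp.single σ r) = (Finsupp.single (toSSetE X (n + 1) σ) r :) :=
      Finsupp.domLCongr_single _ _ _
    rw [h1, ← toSSetE_δ]
    change (-1 : ℤ) ^ (i : ℕ) • (ModuleCat.Hom.hom _ (chainE X (n + 1) (Finsupp.single σ r))) = _
    rw [h2]
    have h3 : ∀ v : (singComplex X).X n, (-1 : ℤ) ^ (i : ℕ) • v = (-1 : ℚ) ^ (i : ℕ) • v := by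
      intro v
      rw [← Int.cast_smul_eq_zsmul ℚ]
      push_cast
      rfl
    refine (h3 _).trans ?_
    congr 1
    exact Finsupp.mapDomain_single
  exact LinearMap.congr_fun key c

/-- Compatibility of the two models of singular chains. -/
theorem Hsing_singS (X : Type) [TopologicalSpace X] :
    Nonempty (∀ n, (singS X).lc.H n ≃ₗ[ℚ] Hsing n X) := by
  let e : (singS X).lc.cx ≅ singComplex X := HomologicalComplex.Hom.isoOfComponents
    (fun n => (chainE X n).toModuleIso) (by
      intro i j hij
      obtain rfl : j + 1 = i := hij
      rw [LC.cx_d]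
      refine ModuleCat.hom_ext ?_
      exact LinearMap.ext fun c => singComplex_d X j c)
  exact ⟨fun n => ((HomologicalComplex.homologyFunctor _ _ n).mapIso e).toLinearEquiv⟩

theorem FinH_iff (X : Type) [TopologicalSpace X] : FinH X ↔ FinGr fun n => Hsing n X := by
  obtain ⟨e⟩ := Hsing_singS X
  exact ⟨fun h => FinGr.congr e h, fun h => FinGr.congr (fun n => (e n).symm) h⟩

theorem chiH_eq (X : Type) [TopologicalSpace X] : chiH X = chiGr fun n => Hsing n X := by
  obtain ⟨e⟩ := Hsing_singS X
  exact chiGr_congr e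

theorem eulerChar_eq (X : Type) [TopologicalSpace X] : eulerChar X = chiH X := by
  rw [chiH_eq]
  unfold eulerChar chiGr
  congr 1
  funext n
  rw [Subspace.dual_finrank_eq]

section
variable {X Y : Type} [TopologicalSpace X] [TopologicalSpace Y]

theorem FinH.homotopyEquiv (e : ContinuousMap.HomotopyEquiv X Y) (h : FinH X) : FinH Y := by
  rw [FinH_iff] at *
  exact FinGr.congr (fun n => (Hsing_equiv e n).some) h

theorem chiH_homotopyEquiv (e : ContinuousMap.HomotopyEquiv X Y) : chiH X = chiH Y := by
  rw [chiH_eq, chiH_eq]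
  exact chiGr_congr (fun n => (Hsing_equiv e n).some)

theorem FinH.homeo (e : X ≃ₜ Y) (h : FinH X) : FinH Y := h.homotopyEquiv e.toHomotopyEquiv

theorem chiH_homeo (e : X ≃ₜ Y) : chiH X = chiH Y := chiH_homotopyEquiv e.toHomotopyEquiv
end

theorem Hsing_unit_pos (n : ℕ) (hn : n ≠ 0) : Subsingleton (Hsing n Unit) := by
  obtain ⟨e⟩ := Hsing_unit n
  have := ChainComplex.alternatingConst_exactAt (ModuleCat.of ℚ (Unit →₀ ℚ)) n hn
  have h := ModuleCat.subsingleton_of_isZero this.isZero_homology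
  exact e.toEquiv.subsingleton

theorem Hsing_unit_zero : Nonempty (Hsing 0 Unit ≃ₗ[ℚ] (Unit →₀ ℚ)) := by
  obtain ⟨e⟩ := Hsing_unit 0
  exact ⟨e.trans (ChainComplex.alternatingConstHomologyZero
    (ModuleCat.of ℚ (Unit →₀ ℚ))).toLinearEquiv⟩

theorem FinH_unit : FinH Unit := by
  rw [FinH_iff]
  refine ⟨fun n => ?_, 1, fun n hn => Hsing_unit_pos n (by omega)⟩
  rcases Nat.eq_zero_or_pos n with rfl | h
  · exact Module.Finite.equiv Hsing_unit_zero.some.symm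
  · have := Hsing_unit_pos n (by omega)
    infer_instance

theorem chiH_unit : chiH Unit = 1 := by
  rw [chiH_eq, chiGr_eq_sum (N := 1) (fun n hn => Hsing_unit_pos n (by omega))]
  simp [Hsing_unit_zero.some.finrank_eq]

theorem FinH.contractible (X : Type) [TopologicalSpace X] [ContractibleSpace X] : FinH X :=
  FinH_unit.homotopyEquiv (ContractibleSpace.hequiv_unit X).some.symm

theorem chiH_contractible (X : Type) [TopologicalSpace X] [ContractibleSpace X] : chiH X = 1 :=
  (chiH_homotopyEquiv (ContractibleSpace.hequiv_unit X).some).trans chiH_unit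

theorem H_empty (X : Type) [TopologicalSpace X] [IsEmpty X] (n : ℕ) :
    Subsingleton ((singS X).lc.H n) := by
  have h : ∀ n, Subsingleton (C(Simp n, X) →₀ ℚ) := fun n => by
    have : IsEmpty C(Simp n, X) := ⟨fun σ => IsEmpty.false (σ (vert 0))⟩
    infer_instance
  have h' : ∀ n, Subsingleton ((singS X).lc.C n) := h
  exact LC.acyclic _ (fun x => ⟨0, (h' 0).elim _ _⟩) (fun n x _ => ⟨0, (h' (n + 1)).elim _ _⟩) n

theorem FinH.empty (X : Type) [TopologicalSpace X] [IsEmpty X] : FinH X :=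
  FinGr.of_subsingleton (H_empty X)

theorem chiH_empty (X : Type) [TopologicalSpace X] [IsEmpty X] : chiH X = 0 :=
  chiGr_of_subsingleton (H_empty X)

end FPoly

namespace FPoly

section
variable {X : Type} [TopologicalSpace X]

/-- The preimage of a subset in a larger subset. -/
def subHomeo {S T : Set X} (h : S ⊆ T) : ↥((↑) ⁻¹' S : Set T) ≃ₜ S where
  toFun x := ⟨x.1.1, x.2⟩
  invFun x := ⟨⟨x.1, h x.2⟩, x.2⟩
  left_inv _ := rfl
  right_inv _ := rfl
  continuous_toFun := by fun_prop
  continuous_invFun := by fun_prop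

theorem mayerVietoris_sets {U V : Set X} (hU : IsOpen U) (hV : IsOpen V) :
    (FinH U → FinH V → FinH ↥(U ∩ V) → FinH ↥(U ∪ V)) ∧
    (FinH U → FinH V → FinH ↥(U ∪ V) → FinH ↥(U ∩ V)) ∧
    (FinH ↥(U ∪ V) → FinH ↥(U ∩ V) → FinH U ∧ FinH V) ∧
    (FinH U → FinH V → FinH ↥(U ∪ V) →
      chiH ↥(U ∪ V) = chiH U + chiH V - chiH ↥(U ∩ V)) := by
  have hUV : (((↑) ⁻¹' U : Set ↥(U ∪ V)) ∪ ((↑) ⁻¹' V)) = Set.univ := by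
    exact Set.eq_univ_of_forall fun x => x.2
  have eU := subHomeo (S := U) (T := U ∪ V) Set.subset_union_left
  have eV := subHomeo (S := V) (T := U ∪ V) Set.subset_union_right
  have eI := subHomeo (S := U ∩ V) (T := U ∪ V) (Set.inter_subset_left.trans Set.subset_union_left)
  have h := mayerVietoris (hU.preimage continuous_subtype_val) (hV.preimage continuous_subtype_val)
    hUV
  rw [← Set.preimage_inter] at h
  obtain ⟨h1, h2, h3, h4⟩ := h
  refine ⟨fun a b c => h1 (a.homeo eU.symm) (b.homeo eV.symm) (c.homeo eI.symm),
    fun a b c => (h2 (a.homeo eU.symm) (b.homeo eV.symm) c).homeo eI,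
    fun a b => ?_, fun a b c => ?_⟩
  · obtain ⟨x, y⟩ := h3 a (b.homeo eI.symm)
    exact ⟨x.homeo eU, y.homeo eV⟩
  · rw [h4 (a.homeo eU.symm) (b.homeo eV.symm) c, chiH_homeo eU, chiH_homeo eV, chiH_homeo eI]

variable {F : Type} [NormedAddCommGroup F] [NormedSpace ℝ F]

/-- A subset with convex fibres over the base and a section is homotopy equivalent to the base. -/
theorem fibre_convex_equiv {O : Set X} {P : Set (X × F)} (hP : ∀ p ∈ P, p.1 ∈ O)
    (hconv : ∀ x ∈ O, Convex ℝ {v | (x, v) ∈ P}) {σ : X → F} (hσ : ContinuousOn σ O)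
    (hσP : ∀ x ∈ O, (x, σ x) ∈ P) : Nonempty (ContinuousMap.HomotopyEquiv P O) := by
  have hσ' : Continuous fun x : O => σ x := continuousOn_iff_continuous_domRestrict.mp hσ
  have hσ'' : Continuous fun p : P => σ p.1.1 :=
    hσ'.comp (f := fun p : P => (⟨p.1.1, hP _ p.2⟩ : O)) (by fun_prop)
  let f : C(P, O) := ⟨fun p => ⟨p.1.1, hP _ p.2⟩, by fun_prop⟩
  let g : C(O, P) := ⟨fun x => ⟨(x.1, σ x.1), hσP _ x.2⟩,
    (continuous_subtype_val.prodMk hσ').subtype_mk _⟩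
  refine ⟨⟨f, g, ?_, ?_⟩⟩
  · refine ⟨⟨⟨fun q => ⟨(q.2.1.1, (1 - (q.1 : ℝ)) • σ q.2.1.1 + (q.1 : ℝ) • q.2.1.2), ?_⟩, ?_⟩,
      ?_, ?_⟩⟩
    · have hO := hP _ q.2.2
      exact hconv _ hO (hσP _ hO) q.2.2 (by linarith [q.1.2.2]) q.1.2.1 (by ring)
    · have : Continuous fun q : unitInterval × P => σ q.2.1.1 := hσ''.comp continuous_snd
      exact ((by fun_prop : Continuous fun q : unitInterval × P => q.2.1.1).prodMk
        (((by fun_prop : Continuous fun q : unitInterval × P => (1 - (q.1 : ℝ))).smul this).add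
        (by fun_prop))).subtype_mk _
    · intro p; apply Subtype.ext; simp [f, g]
    · intro p; apply Subtype.ext; simp
  · have : f.comp g = ContinuousMap.id _ := by ext x; rfl
    rw [this]

/-- The Euler characteristic of the complement of a graph over a closed subset. -/
theorem graph_gap {O Z : Set X} (hO : IsOpen O) (hZ : IsClosed Z) {f : X → ℝ}
    (hf : ContinuousOn f O) (hfin : FinH O) :
    (FinH ↥(O \ Z) ↔ FinH ↥{p : X × ℝ | p.1 ∈ O ∧ ¬ (p.1 ∈ Z ∧ p.2 = f p.1)}) ∧
    (FinH ↥(O \ Z) → chiH ↥{p : X × ℝ | p.1 ∈ O ∧ ¬ (p.1 ∈ Z ∧ p.2 = f p.1)} =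
      2 * chiH O - chiH ↥(O \ Z)) := by
  set P : Set (X × ℝ) := {p | p.1 ∈ O ∧ (p.1 ∈ Z → f p.1 < p.2)} with hPdef
  set Q : Set (X × ℝ) := {p | p.1 ∈ O ∧ (p.1 ∈ Z → p.2 < f p.1)} with hQdef
  have hO2 : IsOpen {p : X × ℝ | p.1 ∈ O} := hO.preimage continuous_fst
  have hZ2 : IsOpen {p : X × ℝ | p.1 ∈ Zᶜ} := hZ.isOpen_compl.preimage continuous_fst
  have hf2 : ContinuousOn (fun p : X × ℝ => p.2 - f p.1) {p : X × ℝ | p.1 ∈ O} :=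
    continuous_snd.continuousOn.sub (hf.comp continuous_fst.continuousOn fun p hp => hp)
  have hPo : IsOpen P := by
    have : P = {p : X × ℝ | p.1 ∈ O} ∩ {p : X × ℝ | p.1 ∈ Zᶜ} ∪
        {p : X × ℝ | p.1 ∈ O} ∩ (fun p : X × ℝ => p.2 - f p.1) ⁻¹' Set.Ioi 0 := by
      ext p; simp [P]; tauto
    rw [this]
    exact (hO2.inter hZ2).union (hf2.isOpen_inter_preimage hO2 isOpen_Ioi)
  have hQo : IsOpen Q := by
    have : Q = {p : X × ℝ | p.1 ∈ O} ∩ {p : X × ℝ | p.1 ∈ Zᶜ} ∪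
        {p : X × ℝ | p.1 ∈ O} ∩ (fun p : X × ℝ => p.2 - f p.1) ⁻¹' Set.Iio 0 := by
      ext p; simp [Q]; tauto
    rw [this]
    exact (hO2.inter hZ2).union (hf2.isOpen_inter_preimage hO2 isOpen_Iio)
  have hU : P ∪ Q = {p : X × ℝ | p.1 ∈ O ∧ ¬ (p.1 ∈ Z ∧ p.2 = f p.1)} := by
    ext p
    simp only [P, Q, Set.mem_union, Set.mem_ofPred_eq]
    constructor
    · rintro (⟨h, h'⟩ | ⟨h, h'⟩)
      · exact ⟨h, fun hz => (h' hz.1).ne' hz.2⟩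
      · exact ⟨h, fun hz => (h' hz.1).ne hz.2⟩
    · rintro ⟨h, h'⟩
      by_cases hz : p.1 ∈ Z
      · rcases lt_trichotomy p.2 (f p.1) with h1 | h1 | h1
        · exact Or.inr ⟨h, fun _ => h1⟩
        · exact absurd ⟨hz, h1⟩ h'
        · exact Or.inl ⟨h, fun _ => h1⟩
      · exact Or.inl ⟨h, fun h => absurd h hz⟩
  have hI : P ∩ Q = {p | p.1 ∈ O \ Z} := by
    ext p
    simp only [P, Q, Set.mem_inter_iff, Set.mem_ofPred_eq, Set.mem_sdiff]
    constructor
    · rintro ⟨⟨h, h1⟩, _, h2⟩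
      exact ⟨h, fun hz => lt_asymm (h1 hz) (h2 hz)⟩
    · rintro ⟨h, h1⟩
      exact ⟨⟨h, fun h => absurd h h1⟩, h, fun h => absurd h h1⟩
  obtain ⟨eP⟩ := fibre_convex_equiv (O := O) (P := P) (fun p hp => hp.1) (fun x hx => by
    intro a ha b hb s t hs ht hst
    refine ⟨hx, fun hz => ?_⟩
    exact (convex_Ioi (f x)) (ha.2 hz) (hb.2 hz) hs ht hst)
    (σ := fun x => f x + 1) (hf.add continuousOn_const) (fun x hx => ⟨hx, fun _ => by simp⟩)
  obtain ⟨eQ⟩ := fibre_convex_equiv (O := O) (P := Q) (fun p hp => hp.1) (fun x hx => by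
    intro a ha b hb s t hs ht hst
    refine ⟨hx, fun hz => ?_⟩
    exact (convex_Iio (f x)) (ha.2 hz) (hb.2 hz) hs ht hst)
    (σ := fun x => f x - 1) (hf.sub continuousOn_const) (fun x hx => ⟨hx, fun _ => by simp⟩)
  obtain ⟨eI⟩ := fibre_convex_equiv (O := O \ Z) (P := {p : X × ℝ | p.1 ∈ O \ Z}) (fun p hp => hp)
    (fun x hx => by intro a ha b hb s t hs ht hst; exact hx)
    (σ := fun x => 0) continuousOn_const (fun x hx => hx)
  have hmv := mayerVietoris_sets hPo hQo
  rw [hU, hI] at hmv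
  obtain ⟨h1, h2, h3, h4⟩ := hmv
  have fP := hfin.homotopyEquiv eP.symm
  have fQ := hfin.homotopyEquiv eQ.symm
  have key : FinH ↥(O \ Z) → FinH ↥{p : X × ℝ | p.1 ∈ O ∧ ¬ (p.1 ∈ Z ∧ p.2 = f p.1)} :=
    fun h => h1 fP fQ (h.homotopyEquiv eI.symm)
  refine ⟨⟨key, fun h => (h2 fP fQ h).homotopyEquiv eI⟩, fun h => ?_⟩
  rw [h4 fP fQ (key h), chiH_homotopyEquiv eP, chiH_homotopyEquiv eQ, chiH_homotopyEquiv eI]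
  ring

end

end FPoly

namespace FPoly

open Topology

section
variable {X Y : Type} [TopologicalSpace X] [TopologicalSpace Y]

theorem FinH.set_homeo (e : X ≃ₜ Y) {S : Set X} {T : Set Y} (h : ∀ x, x ∈ S ↔ e x ∈ T) :
    (FinH S ↔ FinH T) ∧ chiH S = chiH T := by
  have e' : S ≃ₜ T := e.subtype h
  exact ⟨⟨fun a => a.homeo e', fun a => a.homeo e'.symm⟩, chiH_homeo e'⟩

/-- Splitting off the first coordinate. -/
def splitCoord (X : Type) [TopologicalSpace X] (m : ℕ) :
    X × (Fin (m + 1) → ℝ) ≃ₜ (X × (Fin m → ℝ)) × ℝ where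
  toFun p := ((p.1, fun i => p.2 i.succ), p.2 0)
  invFun q := (q.1.1, Fin.cons q.2 q.1.2)
  left_inv p := by
    refine Prod.ext rfl (funext fun i => ?_)
    refine Fin.cases rfl (fun i => rfl) i
  right_inv q := rfl
  continuous_toFun := by fun_prop
  continuous_invFun := by
    refine Continuous.prodMk (by fun_prop) (continuous_pi fun i => ?_)
    refine Fin.cases ?_ (fun i => ?_) i
    · simp only [Fin.cons_zero]; fun_prop
    · simp only [Fin.cons_succ]; fun_prop

theorem stabilize [ContractibleSpace X] {Z : Set X} (hZ : IsClosed Z) (m : ℕ) :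
    (FinH ↥(Zᶜ) ↔ FinH ↥({p : X × (Fin m → ℝ) | p.1 ∈ Z ∧ p.2 = 0}ᶜ)) ∧
    (FinH ↥(Zᶜ) → 1 - chiH ↥({p : X × (Fin m → ℝ) | p.1 ∈ Z ∧ p.2 = 0}ᶜ) =
      (-1) ^ m * (1 - chiH ↥(Zᶜ))) := by
  induction m with
  | zero =>
    have h := FinH.set_homeo (Homeomorph.prodUnique X (Fin 0 → ℝ))
      (S := {p : X × (Fin 0 → ℝ) | p.1 ∈ Z ∧ p.2 = 0}ᶜ) (T := Zᶜ) (fun p => by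
        simp [Subsingleton.elim p.2 0])
    refine ⟨h.1.symm, fun _ => by rw [h.2]; simp⟩
  | succ m ih =>
    set A : Set (X × (Fin m → ℝ)) := {p | p.1 ∈ Z ∧ p.2 = 0} with hA
    have hAc : IsClosed A := (hZ.preimage continuous_fst).inter
      (isClosed_singleton.preimage continuous_snd)
    have hg := graph_gap (O := Set.univ) isOpen_univ hAc (f := fun _ => 0) continuousOn_const
      ((FinH.contractible _).homeo (Homeomorph.Set.univ _).symm)
    have h := FinH.set_homeo (splitCoord X m)
      (S := {p : X × (Fin (m + 1) → ℝ) | p.1 ∈ Z ∧ p.2 = 0}ᶜ)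
      (T := {p | p.1 ∈ Set.univ ∧ ¬ (p.1 ∈ A ∧ p.2 = 0)}) (fun p => by
        simp only [hA, splitCoord, Set.mem_compl_iff, Set.mem_ofPred_eq, Set.mem_univ, true_and,
          Homeomorph.homeomorph_mk_coe, Equiv.coe_fn_mk, and_assoc]
        refine not_congr (and_congr_right fun _ => ?_)
        constructor
        · intro h; exact ⟨funext fun i => congrFun h i.succ, congrFun h 0⟩
        · rintro ⟨h1, h2⟩
          funext i
          refine Fin.cases h2 (fun i => congrFun h1 i) i)
    rw [← Set.compl_eq_univ_sdiff] at hg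
    refine ⟨ih.1.trans (hg.1.trans h.1.symm), fun hf => ?_⟩
    rw [h.2, hg.2 (ih.1.mp hf), chiH_homeo (Homeomorph.Set.univ _), chiH_contractible, pow_succ]
    have := ih.2 hf
    linarith

theorem embedding_complement {Z : Type} [TopologicalSpace Z] {n m : ℕ} {i : Z → (Fin n → ℝ)}
    {j : Z → (Fin m → ℝ)} (hi : IsClosedEmbedding i) (hj : IsClosedEmbedding j)
    (hf : FinH ↥((Set.range i)ᶜ)) : FinH ↥((Set.range j)ᶜ) ∧
      (-1 : ℤ) ^ n * (1 - chiH ↥((Set.range i)ᶜ)) =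
        (-1 : ℤ) ^ m * (1 - chiH ↥((Set.range j)ᶜ)) := by
  obtain ⟨J, hJ⟩ := ContinuousMap.exists_extension hi ⟨j, hj.continuous⟩
  obtain ⟨I, hI⟩ := ContinuousMap.exists_extension hj ⟨i, hi.continuous⟩
  have hJ' : ∀ z, J (i z) = j z := fun z => congrArg (fun f => f z) hJ
  have hI' : ∀ z, I (j z) = i z := fun z => congrArg (fun f => f z) hI
  let e : (Fin n → ℝ) × (Fin m → ℝ) ≃ₜ (Fin m → ℝ) × (Fin n → ℝ) :=
    { toFun := fun p => (p.2 + J p.1, p.1 - I (p.2 + J p.1))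
      invFun := fun q => (q.2 + I q.1, q.1 - J (q.2 + I q.1))
      left_inv := fun p => by simp
      right_inv := fun q => by simp
      continuous_toFun := by fun_prop
      continuous_invFun := by fun_prop }
  have he := FinH.set_homeo e (S := {p | p.1 ∈ Set.range i ∧ p.2 = 0}ᶜ)
    (T := {p | p.1 ∈ Set.range j ∧ p.2 = 0}ᶜ) (fun p => by
      refine not_congr ?_
      constructor
      · rintro ⟨⟨z, hz⟩, h⟩
        refine ⟨⟨z, ?_⟩, ?_⟩
        · change _ = p.2 + J p.1
          rw [h, ← hz, hJ', zero_add]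
        · change p.1 - I (p.2 + J p.1) = 0
          rw [h, ← hz, hJ', zero_add, hI', sub_self]
      · rintro ⟨⟨z, hz⟩, h⟩
        change _ = p.2 + J p.1 at hz
        change p.1 - I (p.2 + J p.1) = 0 at h
        rw [← hz, hI', sub_eq_zero] at h
        rw [h, hJ'] at hz
        exact ⟨⟨z, h.symm⟩, by simpa using hz⟩)
  obtain ⟨h1, h2⟩ := stabilize hi.isClosed_range m
  obtain ⟨h3, h4⟩ := stabilize hj.isClosed_range n
  have hf' := h3.mpr (he.1.mp (h1.mp hf))
  refine ⟨hf', ?_⟩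
  have e1 := h2 hf
  have e2 := h4 hf'
  rw [← he.2, e1] at e2
  have h5 : ((-1 : ℤ) ^ m) * (-1) ^ m = 1 := by rw [← mul_pow]; simp
  have h6 : ((-1 : ℤ) ^ n) * (-1) ^ n = 1 := by rw [← mul_pow]; simp
  calc (-1 : ℤ) ^ n * (1 - chiH ↥((Set.range i)ᶜ))
      = (-1 : ℤ) ^ m * (-1) ^ n * ((-1) ^ m * (1 - chiH ↥((Set.range i)ᶜ))) := by
        linear_combination (-(-1 : ℤ) ^ n * (1 - chiH ↥((Set.range i)ᶜ))) * h5
    _ = _ := by rw [e2]; linear_combination ((-1 : ℤ) ^ m * (1 - chiH ↥((Set.range j)ᶜ))) * h6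

end

/-- A space that embeds as a closed subset of a Euclidean space. -/
def CE (Z : Type) [TopologicalSpace Z] : Prop :=
  ∃ (n : ℕ) (j : Z → (Fin n → ℝ)), IsClosedEmbedding j

/-- `EC Z c`: the compactly supported Euler characteristic of `Z` is defined and equals `c`. -/
def EC (Z : Type) [TopologicalSpace Z] (c : ℤ) : Prop :=
  ∃ (n : ℕ) (j : Z → (Fin n → ℝ)), IsClosedEmbedding j ∧ FinH ↥((Set.range j)ᶜ) ∧
    c = (-1) ^ n * (1 - chiH ↥((Set.range j)ᶜ))

section
variable {Z Z' : Type} [TopologicalSpace Z] [TopologicalSpace Z'] {a b c : ℤ}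

theorem CE.of_closedEmbedding {W : Type} [NormedAddCommGroup W] [NormedSpace ℝ W]
    [FiniteDimensional ℝ W] {j : Z → W} (hj : IsClosedEmbedding j) : CE Z := by
  let e : W ≃L[ℝ] (Fin (Module.finrank ℝ W) → ℝ) :=
    (Module.finBasis ℝ W).equivFun.toContinuousLinearEquiv
  exact ⟨_, e ∘ j, e.toHomeomorph.isClosedEmbedding.comp hj⟩

theorem EC_iff {W : Type} [NormedAddCommGroup W] [NormedSpace ℝ W] [FiniteDimensional ℝ W]
    {j : Z → W} (hj : IsClosedEmbedding j) : EC Z c ↔ FinH ↥((Set.range j)ᶜ) ∧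
      c = (-1) ^ (Module.finrank ℝ W) * (1 - chiH ↥((Set.range j)ᶜ)) := by
  let e : W ≃L[ℝ] (Fin (Module.finrank ℝ W) → ℝ) :=
    (Module.finBasis ℝ W).equivFun.toContinuousLinearEquiv
  have hj' : IsClosedEmbedding (e ∘ j) := e.toHomeomorph.isClosedEmbedding.comp hj
  have h := FinH.set_homeo e.toHomeomorph (S := (Set.range j)ᶜ) (T := (Set.range (e ∘ j))ᶜ)
    (fun x => by
      refine not_congr ?_
      constructor
      · rintro ⟨z, rfl⟩; exact ⟨z, rfl⟩
      · rintro ⟨z, hz⟩; exact ⟨z, e.injective hz⟩)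
  rw [h.1, h.2]
  constructor
  · rintro ⟨n, i, hi, hf, rfl⟩
    exact embedding_complement hi hj' hf
  · rintro ⟨h1, h2⟩
    exact ⟨_, _, hj', h1, h2⟩

theorem EC.unique (h : EC Z a) (h' : EC Z b) : a = b := by
  obtain ⟨n, j, hj, hf, rfl⟩ := h
  have := ((EC_iff hj).mp h').2
  rw [this]
  simp

theorem CE.homeo (e : Z ≃ₜ Z') (h : CE Z) : CE Z' := by
  obtain ⟨n, j, hj⟩ := h
  exact ⟨n, j ∘ e.symm, hj.comp e.symm.isClosedEmbedding⟩

theorem EC.homeo (e : Z ≃ₜ Z') (h : EC Z c) : EC Z' c := by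
  obtain ⟨n, j, hj, hf, rfl⟩ := h
  have : Set.range j = Set.range (j ∘ e.symm) := by
    rw [Set.range_comp, e.symm.surjective.range_eq, Set.image_univ]
  exact ⟨n, j ∘ e.symm, hj.comp e.symm.isClosedEmbedding, this ▸ hf, by rw [← this]⟩

theorem CE.of_isClosedEmbedding {f : Z → Z'} (hf : IsClosedEmbedding f) (h : CE Z') : CE Z := by
  obtain ⟨n, j, hj⟩ := h
  exact ⟨n, j ∘ f, hj.comp hf⟩

theorem CE.closed {C : Set Z} (hC : IsClosed C) (h : CE Z) : CE C :=
  h.of_isClosedEmbedding hC.isClosedEmbedding_subtypeVal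

theorem exists_zero_set {W : Type} [MetricSpace W] {C : Set W} (hC : IsClosed C) :
    ∃ d : C(W, ℝ), ∀ w, d w = 0 ↔ w ∈ C := by
  rcases C.eq_empty_or_nonempty with rfl | hne
  · exact ⟨⟨fun _ => 1, continuous_const⟩, fun w => by simp⟩
  · exact ⟨⟨fun w => Metric.infDist w C, Metric.continuous_infDist_pt C⟩,
      fun w => (hC.mem_iff_infDist_zero hne).symm⟩

/-- The graph embedding of an open subset. -/
theorem open_embedding_aux {n : ℕ} {j : Z → (Fin n → ℝ)} (hj : IsClosedEmbedding j) {C : Set Z}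
    {d : C((Fin n → ℝ), ℝ)} (hd : ∀ w, d w = 0 ↔ w ∈ j '' C) :
    IsClosedEmbedding (fun z : ↥(Cᶜ) => (j z, (d (j z))⁻¹)) ∧
    Set.range (fun z : ↥(Cᶜ) => (j z, (d (j z))⁻¹)) =
      {p | p.1 ∈ Set.range j ∧ p.2 * d p.1 = 1} := by
  have hne : ∀ z : ↥(Cᶜ), d (j z) ≠ 0 := fun z h => by
    obtain ⟨y, hy, e⟩ := (hd _).mp h
    exact z.2 (hj.injective e ▸ hy)
  have hr : Set.range (fun z : ↥(Cᶜ) => (j z, (d (j z))⁻¹)) =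
      {p | p.1 ∈ Set.range j ∧ p.2 * d p.1 = 1} := by
    ext p
    constructor
    · rintro ⟨z, rfl⟩
      exact ⟨⟨z, rfl⟩, inv_mul_cancel₀ (hne z)⟩
    · rintro ⟨⟨z, hz⟩, h⟩
      have hz' : z ∈ Cᶜ := fun hC => by
        rw [(hd p.1).mpr ⟨z, hC, hz⟩] at h
        simp at h
      refine ⟨⟨z, hz'⟩, Prod.ext hz ?_⟩
      change (d (j z))⁻¹ = p.2
      rw [hz]
      exact (eq_inv_of_mul_eq_one_left h).symm
  refine ⟨⟨?_, ?_⟩, hr⟩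
  · have hjc := hj.continuous
    refine IsEmbedding.of_comp (g := Prod.fst) ?_ continuous_fst
      (hj.isEmbedding.comp IsEmbedding.subtypeVal)
    have : Continuous fun z : ↥(Cᶜ) => d (j z) := by fun_prop
    exact Continuous.prodMk (by fun_prop) (this.inv₀ hne)
  · rw [hr]
    exact (hj.isClosed_range.preimage continuous_fst).inter
      (isClosed_eq (by fun_prop) continuous_const)

theorem EC.additive {C : Set Z} (hC : IsClosed C) (hZ : CE Z) :
    (EC C a → EC ↥(Cᶜ) b → EC Z (a + b)) ∧ (EC C a → EC Z c → EC ↥(Cᶜ) (c - a)) := by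
  obtain ⟨n, j, hj⟩ := hZ
  obtain ⟨d, hd⟩ := exists_zero_set (hj.isClosedMap C hC)
  obtain ⟨hg, hr⟩ := open_embedding_aux hj hd
  have hjC : IsClosedEmbedding (fun z : C => j z) := hj.comp hC.isClosedEmbedding_subtypeVal
  have hrC : Set.range (fun z : C => j z) = j '' C := by
    ext w; simp
  rw [EC_iff hj, EC_iff hg, EC_iff hjC, EC_iff hj, EC_iff hg, hr, hrC]
  set Z1 := Set.range j with hZ1
  set O := (j '' C)ᶜ with hO
  have hOo : IsOpen O := (hj.isClosedMap C hC).isOpen_compl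
  have hOd : ∀ w ∈ O, d w ≠ 0 := fun w hw h => hw ((hd w).mp h)
  set G : Set ((Fin n → ℝ) × ℝ) := {p | p.1 ∈ Z1 ∧ p.2 * d p.1 = 1}ᶜ with hG
  have hGo : IsOpen G := by
    rw [hG, ← hr]; exact hg.isClosed_range.isOpen_compl
  have hf : ContinuousOn (fun w => (d w)⁻¹) O := d.continuous.continuousOn.inv₀ hOd
  have hOZ : O \ Z1 = Z1ᶜ := by
    ext w
    simp only [hO, hZ1, Set.mem_sdiff, Set.mem_compl_iff, Set.mem_image, Set.mem_range]
    constructor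
    · exact fun h => h.2
    · exact fun h => ⟨fun ⟨z, _, hz⟩ => h ⟨z, hz⟩, h⟩
  have hI : {p : (Fin n → ℝ) × ℝ | p.1 ∈ O} ∩ G =
      {p | p.1 ∈ O ∧ ¬ (p.1 ∈ Z1 ∧ p.2 = (d p.1)⁻¹)} := by
    ext p
    refine and_congr_right fun hp => not_congr (and_congr_right fun _ => ?_)
    exact mul_eq_one_iff_eq_inv₀ (hOd _ hp)
  have hU : {p : (Fin n → ℝ) × ℝ | p.1 ∈ O} ∪ G = Set.univ := by
    refine Set.eq_univ_of_forall fun p => ?_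
    by_cases hp : p.1 ∈ O
    · exact Or.inl hp
    · refine Or.inr fun h => ?_
      have : d p.1 = 0 := (hd _).mpr (not_not.mp hp)
      have h2 : p.2 * d p.1 = 1 := h.2
      rw [this] at h2
      simp at h2
  obtain ⟨eO⟩ := fibre_convex_equiv (O := O) (P := {p : (Fin n → ℝ) × ℝ | p.1 ∈ O})
    (fun p hp => hp) (fun x hx => by intro a ha b hb s t hs ht hst; exact hx)
    (σ := fun x => (0 : ℝ)) continuousOn_const (fun x hx => hx)
  have hmv := mayerVietoris (hOo.preimage continuous_fst) hGo hU
  obtain ⟨m1, m2, m3, m4⟩ := hmv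
  have hgap := graph_gap hOo hj.isClosed_range hf
  rw [hOZ, ← hI] at hgap
  have hW : FinH ((Fin n → ℝ) × ℝ) := FinH.contractible _
  have hWc : chiH ((Fin n → ℝ) × ℝ) = 1 := chiH_contractible _
  have formula : FinH O → FinH ↥(Z1ᶜ) → FinH G → chiH G = 1 + chiH O - chiH ↥(Z1ᶜ) := by
    intro fO fZ fG
    have e1 := m4 (fO.homotopyEquiv eO.symm) fG hW
    have e2 := (hgap fO).2 fZ
    have e3 := chiH_homotopyEquiv eO
    have e4 : chiH ↥((fun p : (Fin n → ℝ) × ℝ => p.1) ⁻¹' O ∩ G) =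
      chiH ↥({p : (Fin n → ℝ) × ℝ | p.1 ∈ O} ∩ G) := rfl
    have e5 : chiH ↥((fun p : (Fin n → ℝ) × ℝ => p.1) ⁻¹' O) =
      chiH ↥{p : (Fin n → ℝ) × ℝ | p.1 ∈ O} := rfl
    change _ = chiH ↥((fun p : (Fin n → ℝ) × ℝ => p.1) ⁻¹' O) + _ -
      chiH ↥((fun p : (Fin n → ℝ) × ℝ => p.1) ⁻¹' O ∩ G) at e1
    linarith
  simp only [Module.finrank_prod, Module.finrank_fin_fun, Module.finrank_self]
  constructor
  · rintro ⟨fO, rfl⟩ ⟨fG, rfl⟩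
    have fZ : FinH ↥(Z1ᶜ) := (hgap fO).1.mpr (m2 (fO.homotopyEquiv eO.symm) fG hW)
    refine ⟨fZ, ?_⟩
    rw [formula fO fZ fG]; ring
  · rintro ⟨fO, rfl⟩ ⟨fZ, rfl⟩
    have fG : FinH G := (m3 hW ((hgap fO).1.mp fZ)).2
    refine ⟨fG, ?_⟩
    rw [formula fO fZ fG]; ring

end

end FPoly

namespace FPoly

open Topology

theorem EC_empty (Z : Type) [TopologicalSpace Z] [IsEmpty Z] : EC Z 0 := by
  refine ⟨0, fun _ => 0, ⟨⟨⟨Subsingleton.elim _ _⟩, fun x => isEmptyElim x⟩, ?_⟩, ?_, ?_⟩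
  · rw [Set.range_eq_empty]; exact isClosed_empty
  · rw [Set.range_eq_empty, Set.compl_empty]
    exact (FinH.contractible _).homeo (Homeomorph.Set.univ _).symm
  · rw [Set.range_eq_empty, Set.compl_empty, chiH_homeo (Homeomorph.Set.univ _),
      chiH_contractible]
    simp

theorem EC_unit : EC Unit 1 := by
  have hr : (Set.range fun _ : Unit => (0 : Fin 0 → ℝ))ᶜ = ∅ := by
    ext x; simp [Subsingleton.elim x 0]
  refine ⟨0, fun _ => 0, ?_, ?_, ?_⟩
  · exact (continuous_const).isClosedEmbedding (fun _ _ _ => Subsingleton.elim _ _)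
  · rw [hr]; exact FinH.empty _
  · rw [hr, chiH_empty]; simp

theorem EC_convex {W : Type} [NormedAddCommGroup W] [NormedSpace ℝ W] [FiniteDimensional ℝ W]
    {C : Set W} (hc : IsCompact C) (hconv : Convex ℝ C) (hne : C.Nonempty) : EC C 1 := by
  obtain ⟨p, hp⟩ := hne
  have hj : IsClosedEmbedding (fun _ : Unit => p) :=
    continuous_const.isClosedEmbedding (fun _ _ _ => Subsingleton.elim _ _)
  have h1 := (EC_iff hj).mp EC_unit
  have hrp : Set.range (fun _ : Unit => p) = {p} := by ext; simp [eq_comm]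
  rw [EC_iff hc.isClosed.isClosedEmbedding_subtypeVal]
  rw [hrp] at h1
  rw [Subtype.range_coe]
  obtain ⟨R, hR0, hR⟩ := hc.isBounded.subset_closedBall_lt 0 p
  suffices h : Nonempty (ContinuousMap.HomotopyEquiv ↥({p}ᶜ : Set W) ↥(Cᶜ)) by
    obtain ⟨e⟩ := h
    exact ⟨h1.1.homotopyEquiv e, by rw [← chiH_homotopyEquiv e]; exact h1.2⟩
  -- pushing radially away from `p`
  let push : ℝ → W → W := fun t x => p + (1 + t * R / ‖x - p‖) • (x - p)
  have push_norm : ∀ t x, 0 ≤ t → x ≠ p → ‖push t x - p‖ = ‖x - p‖ + t * R := by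
    intro t x ht hx
    have h0 : 0 < ‖x - p‖ := norm_pos_iff.mpr (sub_ne_zero.mpr hx)
    simp only [push, add_sub_cancel_left, norm_smul, Real.norm_eq_abs]
    rw [abs_of_nonneg (by positivity)]
    field_simp
  have push_ne : ∀ t x, 0 ≤ t → x ≠ p → push t x ≠ p := by
    intro t x ht hx h
    have h0 : 0 < ‖x - p‖ := norm_pos_iff.mpr (sub_ne_zero.mpr hx)
    have := push_norm t x ht hx
    rw [h, sub_self, norm_zero] at this
    have : 0 ≤ t * R := by positivity
    linarith
  have push_out : ∀ t x, 0 ≤ t → x ∉ C → push t x ∉ C := by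
    intro t x ht hx h
    have hx' : x ≠ p := fun e => hx (e ▸ hp)
    have h0 : 0 < ‖x - p‖ := norm_pos_iff.mpr (sub_ne_zero.mpr hx')
    have h1 : 0 < 1 + t * R / ‖x - p‖ := by positivity
    have h2 : (1 + t * R / ‖x - p‖)⁻¹ ≤ 1 := inv_le_one_of_one_le₀ (by
      have : 0 ≤ t * R / ‖x - p‖ := by positivity
      linarith)
    have := hconv.add_smul_sub_mem hp h ⟨(inv_pos.mpr h1).le, h2⟩
    simp only [push, add_sub_cancel_left, smul_smul, inv_mul_cancel₀ h1.ne', one_smul,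
      add_sub_cancel] at this
    exact hx this
  have push_one : ∀ x, x ≠ p → push 1 x ∉ C := by
    intro x hx h
    have h0 : 0 < ‖x - p‖ := norm_pos_iff.mpr (sub_ne_zero.mpr hx)
    have := hR h
    rw [mem_closedBall_iff_norm, push_norm 1 x zero_le_one hx] at this
    linarith
  have push_zero : ∀ x, push 0 x = x := fun x => by simp [push]
  have push_cont : ∀ {Y : Type} [TopologicalSpace Y] (a : Y → ℝ) (b : Y → W), Continuous a →
      Continuous b → (∀ y, b y ≠ p) → Continuous fun y => push (a y) (b y) := by
    intro Y _ a b ha hb h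
    refine continuous_const.add (((continuous_const.add ((ha.mul continuous_const).div
      (hb.sub continuous_const).norm fun y => ?_))).smul (hb.sub continuous_const))
    exact norm_ne_zero_iff.mpr (sub_ne_zero.mpr (h y))
  let r : C(↥({p}ᶜ : Set W), ↥(Cᶜ)) := ⟨fun x => ⟨push 1 x.1, push_one _ x.2⟩,
    (push_cont _ _ continuous_const continuous_subtype_val fun y => y.2).subtype_mk _⟩
  let i : C(↥(Cᶜ), ↥({p}ᶜ : Set W)) := ⟨fun x => ⟨x.1, fun h => x.2 ((h : x.1 = p) ▸ hp)⟩,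
    by fun_prop⟩
  have hneC : ∀ x : ↥(Cᶜ), x.1 ≠ p := fun x h => x.2 (h ▸ hp)
  refine ⟨⟨r, i, ⟨ContinuousMap.Homotopy.symm
    ⟨⟨fun q => ⟨push q.1 q.2.1, push_ne _ _ q.1.2.1 q.2.2⟩,
    ?_⟩, fun x => Subtype.ext (push_zero _), fun x => rfl⟩⟩,
    ⟨ContinuousMap.Homotopy.symm ⟨⟨fun q => ⟨push q.1 q.2.1, push_out _ _ q.1.2.1 q.2.2⟩,
    ?_⟩, fun x => Subtype.ext (push_zero _), fun x => rfl⟩⟩⟩⟩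
  · exact (push_cont (fun q : unitInterval × ↥({p}ᶜ : Set W) => (q.1 : ℝ)) (fun q => q.2.1)
      (by fun_prop) (by fun_prop) fun y => y.2.2).subtype_mk _
  · exact (push_cont (fun q : unitInterval × ↥(Cᶜ) => (q.1 : ℝ)) (fun q => q.2.1)
      (by fun_prop) (by fun_prop) fun y => hneC y.2).subtype_mk _

theorem EC.prod_space {Z : Type} [TopologicalSpace Z] {c : ℤ} (h : EC Z c) (W : Type)
    [NormedAddCommGroup W] [NormedSpace ℝ W] [FiniteDimensional ℝ W] :
    EC (Z × W) ((-1) ^ Module.finrank ℝ W * c) := by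
  obtain ⟨n, j, hj, hf, rfl⟩ := h
  have hj' : IsClosedEmbedding (Prod.map j (id : W → W)) := hj.prodMap .id
  rw [EC_iff hj']
  obtain ⟨e⟩ := fibre_convex_equiv (O := (Set.range j)ᶜ)
    (P := (Set.range (Prod.map j (id : W → W)))ᶜ)
    (fun p hp ⟨z, hz⟩ => hp ⟨(z, p.2), Prod.ext hz rfl⟩)
    (fun x hx => by
      intro a ha b hb s t hs ht hst
      rintro ⟨z, hz⟩
      exact hx ⟨z.1, congrArg Prod.fst hz⟩) (σ := fun _ => (0 : W)) continuousOn_const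
    (fun x hx ⟨z, hz⟩ => hx ⟨z.1, congrArg Prod.fst hz⟩)
  refine ⟨hf.homotopyEquiv e.symm, ?_⟩
  rw [chiH_homotopyEquiv e, Module.finrank_prod, Module.finrank_fin_fun, pow_add]
  ring

theorem CE.prod {Z Z' : Type} [TopologicalSpace Z] [TopologicalSpace Z'] (h : CE Z) (h' : CE Z') :
    CE (Z × Z') := by
  obtain ⟨n, j, hj⟩ := h
  obtain ⟨m, i, hi⟩ := h'
  exact CE.of_closedEmbedding (hj.prodMap hi)

section
variable {Z : Type} [TopologicalSpace Z] {a b c : ℤ}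

/-- Additivity for a relatively closed subset `C` of a subset `S`. -/
theorem EC.additive_sets {C S : Set Z} (hCS : C ⊆ S) (hC : IsClosed ((↑) ⁻¹' C : Set S))
    (hS : CE S) : (EC C a → EC ↥(S \ C) b → EC S (a + b)) ∧
      (EC C a → EC S c → EC ↥(S \ C) (c - a)) := by
  have e1 : ↥((↑) ⁻¹' C : Set S) ≃ₜ C := subHomeo hCS
  have e2 : ↥(((↑) ⁻¹' C : Set S)ᶜ) ≃ₜ ↥(S \ C) :=
    { toFun := fun x => ⟨x.1.1, x.1.2, x.2⟩
      invFun := fun x => ⟨⟨x.1, x.2.1⟩, x.2.2⟩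
      left_inv := fun _ => rfl
      right_inv := fun _ => rfl
      continuous_toFun := by fun_prop
      continuous_invFun := by fun_prop }
  obtain ⟨h1, h2⟩ := EC.additive (a := a) (b := b) (c := c) hC hS
  exact ⟨fun x y => h1 (x.homeo e1.symm) (y.homeo e2.symm),
    fun x y => (h2 (x.homeo e1.symm) y).homeo e2⟩

theorem EC.union (hZ : CE Z) {A B : Set Z} (hA : IsClosed A) (hB : IsClosed B) (ha : EC A a)
    (hb : EC B b) (hc : EC ↥(A ∩ B) c) : EC ↥(A ∪ B) (a + b - c) := by
  have h1 := (EC.additive_sets (b := 0) Set.inter_subset_right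
    ((hA.inter hB).preimage continuous_subtype_val) (hZ.closed hB)).2 hc hb
  have h2 : (A ∪ B) \ A = B \ (A ∩ B) := by
    ext x; simp
  rw [← h2] at h1
  have := (EC.additive_sets (c := 0) (Set.subset_union_left (s := A) (t := B))
    (hA.preimage continuous_subtype_val) (hZ.closed (hA.union hB))).1 ha h1
  convert this using 1; ring

end

/-- Inclusion-exclusion as a principle of induction. -/
theorem sup_induction {L ι : Type} [DistribLattice L] [OrderBot L] {R : L → Prop} (h0 : R ⊥)
    (hR : ∀ a b, R a → R b → R (a ⊓ b) → R (a ⊔ b)) (s : Finset ι) (x : ι → L)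
    (h : ∀ (I : Finset ι) (hI : I.Nonempty), I ⊆ s → R (I.inf' hI x)) : R (s.sup x) := by
  classical
  induction s using Finset.induction_on generalizing x with
  | empty => simpa using h0
  | insert i s hi ih =>
    rw [Finset.sup_insert]
    refine hR _ _ ?_ (ih x fun I hI hs => h I hI (hs.trans (Finset.subset_insert _ _))) ?_
    · simpa using h {i} (by simp) (by simp)
    · rw [Finset.sup_inf_distrib_left]
      refine ih _ fun I hI hs => ?_
      have := h (insert i I) (by simp) (Finset.insert_subset_insert _ hs)
      rw [Finset.inf'_insert hI] at this
      convert this using 1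
      obtain ⟨k, hk⟩ := hI
      refine le_antisymm (le_inf ((Finset.inf'_le _ hk).trans inf_le_left)
        (Finset.le_inf' _ _ fun j hj => (Finset.inf'_le _ hj).trans inf_le_right))
        (Finset.le_inf' _ _ fun j hj => inf_le_inf_left _ (Finset.inf'_le _ hj))
end FPoly

namespace FPoly

open Topology TopologicalSpace

/-- Homeomorphic to a nonempty compact convex set. -/
def Cell (Z : Type) [TopologicalSpace Z] : Prop :=
  ∃ (W : Type) (_ : NormedAddCommGroup W) (_ : NormedSpace ℝ W) (_ : FiniteDimensional ℝ W)
    (C : Set W), IsCompact C ∧ Convex ℝ C ∧ C.Nonempty ∧ Nonempty (Z ≃ₜ C)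

theorem Cell.ec {Z : Type} [TopologicalSpace Z] (h : Cell Z) : EC Z 1 := by
  obtain ⟨W, _, _, _, C, h1, h2, h3, ⟨e⟩⟩ := h
  exact (EC_convex h1 h2 h3).homeo e.symm

theorem Cell.prod {Z Z' : Type} [TopologicalSpace Z] [TopologicalSpace Z'] (h : Cell Z)
    (h' : Cell Z') : Cell (Z × Z') := by
  obtain ⟨W, _, _, _, C, h1, h2, h3, ⟨e⟩⟩ := h
  obtain ⟨W', _, _, _, C', h1', h2', h3', ⟨e'⟩⟩ := h'
  exact ⟨W × W', inferInstance, inferInstance, inferInstance, C ×ˢ C', h1.prod h1', h2.prod h2',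
    h3.prod h3', ⟨(e.prodCongr e').trans (Homeomorph.Set.prod C C').symm⟩⟩

/-- Existence of arbitrarily fine good covers. -/
def Good (X : Type) [MetricSpace X] : Prop :=
  ∀ ε > 0, ∃ (n : ℕ) (U : Fin n → Opens X) (K : Fin n → Closeds X),
    (∀ i, ∃ q, (K i : Set X) ⊆ Metric.closedBall q ε) ∧
    (∀ x, ∃ i, x ∈ U i) ∧ (∀ x, ∃ i, x ∈ K i) ∧
    ∀ I : Finset (Fin n), I.Nonempty →
      (IsEmpty ↥(⋂ i ∈ I, (U i : Set X)) ∧ IsEmpty ↥(⋂ i ∈ I, (K i : Set X))) ∨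
      (ContractibleSpace ↥(⋂ i ∈ I, (U i : Set X)) ∧ Cell ↥(⋂ i ∈ I, (K i : Set X)))

section
variable {X : Type}

theorem coe_opens_inf' [TopologicalSpace X] {ι : Type} {I : Finset ι} (hI : I.Nonempty)
    (U : ι → Opens X) (K : ι → Closeds X) :
    ((I.inf' hI fun i => (U i, K i)).1 : Set X) = ⋂ i ∈ I, (U i : Set X) ∧
    ((I.inf' hI fun i => (U i, K i)).2 : Set X) = ⋂ i ∈ I, (K i : Set X) := by
  induction hI using Finset.Nonempty.cons_induction with
  | singleton a => simp
  | cons a s h hs ih =>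
    rw [Finset.inf'_cons hs]
    simp only [Prod.fst_inf, Prod.snd_inf, Opens.coe_inf, Closeds.coe_inf, ih.1, ih.2,
      Finset.mem_cons, Set.iInter_iInter_eq_or_left, and_self]

theorem coe_opens_sup [TopologicalSpace X] {ι : Type} (I : Finset ι)
    (U : ι → Opens X) (K : ι → Closeds X) :
    ((I.sup fun i => (U i, K i)).1 : Set X) = ⋃ i ∈ I, (U i : Set X) ∧
    ((I.sup fun i => (U i, K i)).2 : Set X) = ⋃ i ∈ I, (K i : Set X) := by
  classical
  induction I using Finset.induction_on with
  | empty => simp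
  | insert a s h ih =>
    rw [Finset.sup_insert]
    simp only [Prod.fst_sup, Prod.snd_sup, Opens.coe_sup, Closeds.coe_sup, ih.1, ih.2,
      Finset.mem_insert, Set.iUnion_iUnion_eq_or_left, and_self]

theorem Good.fibration [MetricSpace X] (hX : Good X) {S : Type} [TopologicalSpace S] (hS : CE S)
    {p : S → X} (hp : Continuous p) {c : ℤ} {ε : ℝ} (hε : 0 < ε)
    (h : ∀ (K : Set X) (q : X), IsClosed K → K ⊆ Metric.closedBall q ε → Cell K →
      EC ↥(p ⁻¹' K) c) : FinH X ∧ EC S (c * chiH X) := by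
  obtain ⟨n, U, K, hK, hU1, hK1, hI⟩ := hX ε hε
  let Q : Set X → Set X → Prop := fun A B => FinH A ∧ EC ↥(p ⁻¹' B) (c * chiH A)
  have key := sup_induction (L := Opens X × Closeds X) (R := fun x => Q x.1 x.2)
    ?_ ?_ Finset.univ (fun i => (U i, K i)) ?_
  · rw [(coe_opens_sup _ U K).1, (coe_opens_sup _ U K).2] at key
    have e1 : (⋃ i ∈ Finset.univ, (U i : Set X)) = Set.univ :=
      Set.eq_univ_of_forall fun x => by simpa using hU1 x
    have e2 : (⋃ i ∈ Finset.univ, (K i : Set X)) = Set.univ :=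
      Set.eq_univ_of_forall fun x => by simpa using hK1 x
    rw [e1, e2] at key
    dsimp only [Q] at key
    rw [Set.preimage_univ, chiH_homeo (Homeomorph.Set.univ _)] at key
    exact ⟨key.1.homeo (Homeomorph.Set.univ _), key.2.homeo (Homeomorph.Set.univ _)⟩
  · have h0 : IsEmpty ↥(∅ : Set X) := inferInstance
    have : IsEmpty ↥(p ⁻¹' (∅ : Set X)) := by rw [Set.preimage_empty]; infer_instance
    have : Q ∅ ∅ := by
      refine ⟨FinH.empty _, ?_⟩
      rw [chiH_empty, mul_zero]
      exact EC_empty _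
    exact this
  · rintro ⟨A, C⟩ ⟨B, D⟩ ⟨h1, h2⟩ ⟨h3, h4⟩ ⟨h5, h6⟩
    obtain ⟨m1, -, -, m4⟩ := mayerVietoris_sets A.isOpen B.isOpen
    have h7 := m1 h1 h3 h5
    have e := m4 h1 h3 h7
    have : EC ↥(p ⁻¹' ((C : Set X) ∪ D)) _ :=
      EC.union hS (C.isClosed.preimage hp) (D.isClosed.preimage hp) h2 h4 h6
    have hQ : Q (A ∪ B) (C ∪ D) := by
      refine ⟨h7, ?_⟩
      rw [e]
      convert this using 1
      change _ = _ - c * chiH ↥((A : Set X) ∩ B)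
      ring
    exact hQ
  · intro I hne _
    rw [(coe_opens_inf' hne U K).1, (coe_opens_inf' hne U K).2]
    rcases hI I hne with ⟨h1, h2⟩ | ⟨h1, h2⟩
    · have : IsEmpty ↥(p ⁻¹' (⋂ i ∈ I, (K i : Set X))) := ⟨fun x => h2.false ⟨p x.1, x.2⟩⟩
      refine ⟨FinH.empty _, ?_⟩
      rw [chiH_empty, mul_zero]
      exact EC_empty _
    · refine ⟨FinH.contractible _, ?_⟩
      rw [chiH_contractible, mul_one]
      obtain ⟨i, hi⟩ := hne
      obtain ⟨q, hq⟩ := hK i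
      exact h _ q (isClosed_biInter fun i _ => (K i).isClosed)
        ((Set.biInter_subset_of_mem hi).trans hq) h2

theorem Good.ec [MetricSpace X] (hX : Good X) (hc : CE X) : FinH X ∧ EC X (chiH X) := by
  have := hX.fibration hc continuous_id (c := 1) one_pos (fun K q _ _ h => h.ec)
  rwa [one_mul] at this

end

/-- The compactly supported Euler characteristic of a locally trivial bundle of complex vector
spaces over a product. -/
theorem Good.bundle {X Y : Type} [MetricSpace X] [MetricSpace Y] [CompactSpace X] [CompactSpace Y]
    (hX : Good X) (hY : Good Y) {S : Type} [TopologicalSpace S] (hS : CE S) {p : S → X × Y}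
    (hp : Continuous p) {H : Type} [NormedAddCommGroup H] [NormedSpace ℂ H]
    [FiniteDimensional ℂ H]
    (hloc : ∀ z, ∃ O ∈ 𝓝 z, ∃ K : Submodule ℂ H, ∃ e : ↥(p ⁻¹' O) ≃ₜ ↥O × K,
      ∀ s, ((e s).1 : X × Y) = p s) : EC S (chiH X * chiH Y) := by
  choose O hO hO' using hloc
  obtain ⟨δ, hδ, hL⟩ := lebesgue_number_lemma_of_metric (isCompact_univ (X := X × Y))
    (c := fun z => interior (O z)) (fun _ => isOpen_interior)
    (fun z _ => Set.mem_iUnion.mpr ⟨z, mem_interior_iff_mem_nhds.mpr (hO z)⟩)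
  have hδ2 : 0 < δ / 2 := half_pos hδ
  have main : ∀ (K : Set X) (x : X) (L : Set Y) (y : Y), K ⊆ Metric.closedBall x (δ / 2) →
      L ⊆ Metric.closedBall y (δ / 2) → Cell K → Cell L → EC ↥(p ⁻¹' (K ×ˢ L)) 1 := by
    intro K x L y hK hL' hcK hcL
    obtain ⟨z, hz⟩ := hL (x, y) trivial
    have hsub : K ×ˢ L ⊆ O z := by
      rintro ⟨a, b⟩ ⟨ha, hb⟩
      refine interior_subset (hz ?_)
      rw [Metric.mem_ball, Prod.dist_eq]
      have h1 := Metric.mem_closedBall.mp (hK ha)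
      have h2 := Metric.mem_closedBall.mp (hL' hb)
      exact max_lt (by dsimp only; linarith) (by dsimp only; linarith)
    obtain ⟨N, e, he⟩ := hO' z
    let _ : NormedSpace ℝ N := NormedSpace.complexToReal
    have : FiniteDimensional ℝ N := FiniteDimensional.complexToReal N
    have he' : ∀ w, p (e.symm w).1 = w.1 := fun w => by rw [← he, e.apply_symm_apply]
    let e2 : ↥(p ⁻¹' (K ×ˢ L)) ≃ₜ (K × L) × N :=
      { toFun := fun s => ((⟨(p s.1).1, s.2.1⟩, ⟨(p s.1).2, s.2.2⟩), (e ⟨s.1, hsub s.2⟩).2)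
        invFun := fun w => ⟨(e.symm (⟨(w.1.1.1, w.1.2.1), hsub ⟨w.1.1.2, w.1.2.2⟩⟩, w.2)).1, by
          rw [Set.mem_preimage, he']; exact ⟨w.1.1.2, w.1.2.2⟩⟩
        left_inv := fun s => by
          apply Subtype.ext
          have : (⟨((p s.1).1, (p s.1).2), hsub s.2⟩ : O z) = (e ⟨s.1, hsub s.2⟩).1 :=
            Subtype.ext (he ⟨s.1, hsub s.2⟩).symm
          dsimp only
          rw [this, Prod.mk.eta, e.symm_apply_apply]
        right_inv := fun w => by
          have h1 := he' (⟨(w.1.1.1, w.1.2.1), hsub ⟨w.1.1.2, w.1.2.2⟩⟩, w.2)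
          refine Prod.ext (Prod.ext (Subtype.ext ?_) (Subtype.ext ?_)) ?_
          · exact congrArg Prod.fst h1
          · exact congrArg Prod.snd h1
          · simp
        continuous_toFun := by
          refine Continuous.prodMk (Continuous.prodMk (Continuous.subtype_mk ?_ _)
            (Continuous.subtype_mk ?_ _)) ?_
          · exact (hp.comp continuous_subtype_val).fst
          · exact (hp.comp continuous_subtype_val).snd
          · exact (e.continuous.comp (Continuous.subtype_mk continuous_subtype_val _)).snd
        continuous_invFun := by
          refine Continuous.subtype_mk (continuous_subtype_val.comp (e.symm.continuous.comp
            (Continuous.prodMk (Continuous.subtype_mk ?_ _) continuous_snd))) _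
          fun_prop }
    have := ((hcK.prod hcL).ec.prod_space N).homeo e2.symm
    rw [finrank_real_of_complex, pow_mul] at this
    simpa using this
  have hmid : ∀ (K : Set X) (x : X), IsClosed K → K ⊆ Metric.closedBall x (δ / 2) → Cell K →
      EC ↥((fun s => (p s).1) ⁻¹' K) (chiH Y) := by
    intro K x hK hKx hcK
    have hK' : IsClosed ((fun s => (p s).1) ⁻¹' K) := hK.preimage hp.fst
    have := (hY.fibration (hS.closed hK') (p := fun s => (p s.1).2)
      (hp.snd.comp continuous_subtype_val) (c := 1) hδ2 fun L y hL hLy hcL => ?_).2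
    · rwa [one_mul] at this
    · refine (main K x L y hKx hLy hcK hcL).homeo ?_
      exact
        { toFun := fun s => ⟨⟨s.1, s.2.1⟩, s.2.2⟩
          invFun := fun s => ⟨s.1.1, s.1.2, s.2⟩
          left_inv := fun _ => rfl
          right_inv := fun _ => rfl
          continuous_toFun := by fun_prop
          continuous_invFun := by fun_prop }
  have := (hX.fibration hS hp.fst hδ2 hmid).2
  rwa [mul_comm] at this

/-- Additivity over a stratification by a finite poset. -/
theorem EC.stratify {X P : Type} [TopologicalSpace X] (hX : CE X) [PartialOrder P]
    (g : X → P) (hg : ∀ d, IsClosed {x | g x ≤ d}) (c : P → ℤ) (s : Finset P)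
    (hs : IsLowerSet (s : Set P))
    (h : ∀ d ∈ s, EC ↥{x | g x = d} (c d)) : EC ↥{x | g x ∈ s} (∑ d ∈ s, c d) := by
  classical
  induction hn : s.card generalizing s with
  | zero =>
    rw [Finset.card_eq_zero] at hn
    subst hn
    have : IsEmpty ↥{x | g x ∈ (∅ : Finset P)} := by simp
    exact EC_empty _
  | succ n ih =>
    have hne : s.Nonempty := Finset.card_pos.mp (by omega)
    obtain ⟨m, hm⟩ := s.exists_maximal hne
    have hclosed : ∀ t : Finset P, IsLowerSet (t : Set P) → IsClosed {x | g x ∈ t} := by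
      intro t ht
      have : {x | g x ∈ t} = ⋃ d ∈ t, {x | g x ≤ d} := by
        ext x
        simp only [Set.mem_ofPred_eq, Set.mem_iUnion, exists_prop]
        exact ⟨fun h => ⟨_, h, le_rfl⟩, fun ⟨d, hd, hx⟩ => ht hx hd⟩
      rw [this]
      exact isClosed_biUnion_finset fun d _ => hg d
    have hlow : IsLowerSet ((s.erase m : Finset P) : Set P) := by
      intro a b hba ha
      simp only [Finset.coe_erase, Set.mem_sdiff, Finset.mem_coe, Set.mem_singleton_iff] at ha ⊢
      refine ⟨hs hba ha.1, ?_⟩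
      rintro rfl
      exact ha.2 (le_antisymm (hm.2 ha.1 hba) hba)
    have h1 := ih (s.erase m) hlow (fun d hd => h d (Finset.mem_of_mem_erase hd))
      (by rw [Finset.card_erase_of_mem hm.1]; omega)
    have hd : {x | g x ∈ s} \ {x | g x ∈ s.erase m} = {x | g x = m} := by
      ext x
      simp only [Set.mem_sdiff, Set.mem_ofPred_eq, Finset.mem_erase]
      constructor
      · rintro ⟨ha, hb⟩
        by_contra hc
        exact hb ⟨hc, ha⟩
      · rintro rfl
        exact ⟨hm.1, by simp⟩
    have h2 := h m hm.1
    rw [← hd] at h2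
    have := (EC.additive_sets (c := 0) (C := {x | g x ∈ s.erase m}) (S := {x | g x ∈ s})
      (fun x hx => Finset.mem_of_mem_erase hx)
      ((hclosed _ hlow).preimage continuous_subtype_val) (hX.closed (hclosed s hs))).1 h1 h2
    rwa [Finset.sum_erase_add _ _ hm.1] at this

end FPoly

namespace FPoly

open Topology TopologicalSpace

section
variable {W : Type} [NormedAddCommGroup W] [InnerProductSpace ℝ W]

theorem norm_sq_combo (u v : W) {a b : ℝ} (hab : a + b = 1) :
    ‖a • u + b • v‖ ^ 2 = a * ‖u‖ ^ 2 + b * ‖v‖ ^ 2 - a * b * ‖u - v‖ ^ 2 := by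
  rw [norm_add_sq_real, norm_sub_sq_real, norm_smul, norm_smul, inner_smul_left, inner_smul_right,
    mul_pow, mul_pow, Real.norm_eq_abs, Real.norm_eq_abs, sq_abs, sq_abs]
  simp only [conj_trivial]
  obtain rfl : b = 1 - a := by linarith
  ring

/-- Strict convexity of small balls in a chart. -/
theorem norm_convex_bound {x y z : W} {a b s c K δ m σ : ℝ} (ha : 0 ≤ a) (hb : 0 ≤ b)
    (hab : a + b = 1) (hK : 0 ≤ K) (hs : 0 ≤ s) (hc : c * s ≤ ‖x - y‖) (hc0 : 0 ≤ c)
    (hz : ‖z - (a • x + b • y)‖ ≤ K * (a * b) * s ^ 2) (hx : ‖x‖ ≤ m) (hy : ‖y‖ ≤ m)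
    (hm : m ≤ δ) (hsσ : s ≤ σ) (hK1 : 2 * δ * K + K ^ 2 * σ ^ 2 ≤ c ^ 2) : ‖z‖ ≤ m := by
  have hm0 : 0 ≤ m := (norm_nonneg x).trans hx
  set v := a • x + b • y with hv
  set e := K * (a * b) * s ^ 2 with he
  have hab0 : 0 ≤ a * b := mul_nonneg ha hb
  have he0 : 0 ≤ e := by positivity
  have hab1 : a * b ≤ 1 := by nlinarith
  have h1 : ‖z‖ ≤ ‖v‖ + e := by
    calc ‖z‖ = ‖v + (z - v)‖ := by congr 1; abel
      _ ≤ ‖v‖ + ‖z - v‖ := norm_add_le _ _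
      _ ≤ _ := by linarith
  have h2 : ‖v‖ ^ 2 ≤ m ^ 2 - a * b * (c * s) ^ 2 := by
    rw [hv, norm_sq_combo x y hab]
    have h3 : ‖x‖ ^ 2 ≤ m ^ 2 := pow_le_pow_left₀ (norm_nonneg _) hx 2
    have h4 : ‖y‖ ^ 2 ≤ m ^ 2 := pow_le_pow_left₀ (norm_nonneg _) hy 2
    have h5 : (c * s) ^ 2 ≤ ‖x - y‖ ^ 2 := pow_le_pow_left₀ (by positivity) hc 2
    have h6 := mul_le_mul_of_nonneg_left h5 hab0
    have h7 := mul_le_mul_of_nonneg_left h3 ha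
    have h8 := mul_le_mul_of_nonneg_left h4 hb
    have : a * m ^ 2 + b * m ^ 2 = m ^ 2 := by rw [← add_mul, hab, one_mul]
    linarith
  have h3 : ‖v‖ ≤ m := by
    refine abs_le_of_sq_le_sq' ?_ hm0 |>.2
    have : 0 ≤ a * b * (c * s) ^ 2 := by positivity
    linarith
  refine abs_le_of_sq_le_sq' (a := ‖z‖) (b := m) ?_ hm0 |>.2
  have h4 : ‖z‖ ^ 2 ≤ (‖v‖ + e) ^ 2 := pow_le_pow_left₀ (norm_nonneg _) h1 2
  have h5 : ‖v‖ * e ≤ δ * e := mul_le_mul_of_nonneg_right (h3.trans hm) he0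
  have h6 : e ^ 2 ≤ a * b * s ^ 2 * (K ^ 2 * σ ^ 2) := by
    have h7 : s ^ 2 ≤ σ ^ 2 := pow_le_pow_left₀ hs hsσ 2
    have h8 : (a * b) * s ^ 2 ≤ 1 * σ ^ 2 := mul_le_mul hab1 h7 (by positivity) (by norm_num)
    have h9 : 0 ≤ a * b * s ^ 2 * K ^ 2 := by positivity
    calc e ^ 2 = a * b * s ^ 2 * K ^ 2 * (a * b * s ^ 2) := by rw [he]; ring
      _ ≤ a * b * s ^ 2 * K ^ 2 * (1 * σ ^ 2) := mul_le_mul_of_nonneg_left h8 h9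
      _ = _ := by ring
  have h10 : a * b * s ^ 2 * (2 * δ * K + K ^ 2 * σ ^ 2) ≤ a * b * s ^ 2 * c ^ 2 :=
    mul_le_mul_of_nonneg_left hK1 (by positivity)
  have h11 : δ * e = a * b * s ^ 2 * (δ * K) := by rw [he]; ring
  nlinarith

/-- A set which near every point is the image of an immersion of class `C²`. -/
def LocSmooth (X : Set W) : Prop :=
  ∀ p ∈ X, ∃ (K : Type) (_ : NormedAddCommGroup K) (_ : NormedSpace ℝ K)
    (_ : FiniteDimensional ℝ K) (ψ : K → W), ψ 0 = p ∧ ContDiffAt ℝ 2 ψ 0 ∧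
    Function.Injective (fderiv ℝ ψ 0) ∧ Filter.map ψ (𝓝 0) = 𝓝[X] p

theorem chart_bounds {K : Type} [NormedAddCommGroup K] [NormedSpace ℝ K] [FiniteDimensional ℝ K]
    {ψ : K → W} (h2 : ContDiffAt ℝ 2 ψ 0) (hinj : Function.Injective (fderiv ℝ ψ 0)) :
    ∃ ρ > 0, ∃ c > 0, ∃ L ≥ 0, ContinuousOn ψ (Metric.ball 0 ρ) ∧
      (∀ x ∈ Metric.ball (0 : K) ρ, ∀ y ∈ Metric.ball (0 : K) ρ, c * ‖x - y‖ ≤ ‖ψ x - ψ y‖) ∧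
      ∀ x ∈ Metric.ball (0 : K) ρ, ∀ y ∈ Metric.ball (0 : K) ρ, ∀ a b : ℝ, 0 ≤ a → 0 ≤ b →
        a + b = 1 → ‖ψ (a • x + b • y) - (a • ψ x + b • ψ y)‖ ≤ L * (a * b) * ‖x - y‖ ^ 2 := by
  have hs : HasStrictFDerivAt ψ (fderiv ℝ ψ 0) 0 := h2.hasStrictFDerivAt (by norm_num)
  obtain ⟨L, t, ht, hL⟩ := (h2.fderiv_right (m := 1) (by norm_num)).exists_lipschitzOnWith
  have hdiff : ∀ᶠ x in 𝓝 (0 : K), DifferentiableAt ℝ ψ x := by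
    have := h2.eventually (by norm_num)
    exact this.mono fun x hx => hx.differentiableAt (by norm_num)
  obtain ⟨N, hN0, hN⟩ := (fderiv ℝ ψ 0).toLinearMap.injective_iff_antilipschitz.mp hinj
  have hN' : ∀ v, ‖v‖ ≤ N * ‖fderiv ℝ ψ 0 v‖ := fun v => by
    simpa using hN.le_mul_dist v 0
  have hNr : (0 : ℝ) < N := hN0
  obtain ⟨u, hu, hu'⟩ := hs.approximates_deriv_on_nhds (c := ⟨1 / (2 * N), by positivity⟩)
    (Or.inr (by exact_mod_cast (by positivity : (0 : ℝ) < 1 / (2 * N))))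
  obtain ⟨ρ, hρ, hball⟩ := Metric.mem_nhds_iff.mp
    (Filter.inter_mem (Filter.inter_mem ht hu) hdiff)
  refine ⟨ρ, hρ, 1 / (2 * N), by positivity, L, L.2, ?_, ?_, ?_⟩
  · exact fun x hx => (hball hx).2.continuousAt.continuousWithinAt
  · intro x hx y hy
    have h1 : ‖ψ x - ψ y - fderiv ℝ ψ 0 (x - y)‖ ≤ 1 / (2 * N) * ‖x - y‖ :=
      hu' _ (hball hx).1.2 _ (hball hy).1.2
    have h3 := hN' (x - y)
    have h4 : ‖fderiv ℝ ψ 0 (x - y)‖ ≤ ‖ψ x - ψ y‖ + ‖ψ x - ψ y - fderiv ℝ ψ 0 (x - y)‖ := by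
      rw [← norm_neg (ψ x - ψ y - _)]
      refine le_trans (le_of_eq ?_) (norm_add_le _ _)
      congr 1; abel
    have h5 : 1 / N * ‖x - y‖ ≤ ‖fderiv ℝ ψ 0 (x - y)‖ := by
      rw [one_div, inv_mul_le_iff₀ hNr]; exact h3
    have h6 : (1 : ℝ) / N = 1 / (2 * N) + 1 / (2 * N) := by field_simp; norm_num
    rw [h6, add_mul] at h5
    linarith
  · have taylor : ∀ x ∈ Metric.ball (0 : K) ρ, ∀ z ∈ Metric.ball (0 : K) ρ,
        ‖ψ x - ψ z - fderiv ℝ ψ z (x - z)‖ ≤ L * ‖x - z‖ ^ 2 := by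
      intro x hx z hz
      have hseg : segment ℝ z x ⊆ Metric.ball 0 ρ := (convex_ball 0 ρ).segment_subset hz hx
      have := (convex_segment z x).norm_image_sub_le_of_norm_hasFDerivWithin_le'
        (f := ψ) (f' := fderiv ℝ ψ) (φ := fderiv ℝ ψ z) (C := L * ‖x - z‖)
        (fun w hw => (hball (hseg hw)).2.hasFDerivAt.hasFDerivWithinAt)
        (fun w hw => ?_) (left_mem_segment ℝ z x) (right_mem_segment ℝ z x)
      · rw [mul_assoc, ← sq] at this; exact this
      · refine (hL.norm_sub_le (hball (hseg hw)).1.1 (hball hz).1.1).trans ?_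
        refine mul_le_mul_of_nonneg_left ?_ L.2
        rw [norm_sub_rev]
        rw [norm_sub_rev x z]
        obtain ⟨α, β, hα, hβ, hαβ, rfl⟩ := hw
        have : z - (α • z + β • x) = β • (z - x) := by
          obtain rfl : α = 1 - β := by linarith
          module
        rw [this, norm_smul, Real.norm_eq_abs, abs_of_nonneg hβ]
        exact mul_le_of_le_one_left (norm_nonneg _) (by linarith)
    intro x hx y hy a b ha hb hab
    set z := a • x + b • y with hz
    have hzb : z ∈ Metric.ball (0 : K) ρ := convex_ball 0 ρ hx hy ha hb hab
    have t1 := taylor x hx z hzb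
    have t2 := taylor y hy z hzb
    have e1 : x - z = b • (x - y) := by
      rw [hz]; obtain rfl : a = 1 - b := by linarith
      module
    have e2 : y - z = (-a) • (x - y) := by
      rw [hz]; obtain rfl : a = 1 - b := by linarith
      module
    have e3 : ψ z - (a • ψ x + b • ψ y) = -(a • (ψ x - ψ z - fderiv ℝ ψ z (x - z)) +
        b • (ψ y - ψ z - fderiv ℝ ψ z (y - z))) := by
      rw [e1, e2, map_smul, map_smul]
      obtain rfl : a = 1 - b := by linarith
      module
    rw [e3, norm_neg]
    refine (norm_add_le _ _).trans ?_
    rw [norm_smul, norm_smul, Real.norm_eq_abs, Real.norm_eq_abs, abs_of_nonneg ha,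
      abs_of_nonneg hb]
    rw [e1, norm_smul, Real.norm_eq_abs, abs_of_nonneg hb] at t1
    rw [e2, norm_smul, Real.norm_eq_abs, abs_neg, abs_of_nonneg ha] at t2
    have := add_le_add (mul_le_mul_of_nonneg_left t1 ha) (mul_le_mul_of_nonneg_left t2 hb)
    rw [← e1, ← e2] at this
    refine this.trans (le_of_eq ?_)
    obtain rfl : a = 1 - b := by linarith
    ring

theorem LocSmooth.exists_cells {X : Set W} (hX : LocSmooth X) {p : W} (hp : p ∈ X) :
    ∃ δ > 0, ∀ (C : Set W) (D : Set ℝ), (∃ q ∈ C, dist q p < δ) → IsLowerSet D →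
      D ⊆ Set.Iic δ → {x ∈ X | ∀ c ∈ C, ‖x - c‖ ∈ D}.Nonempty →
      ContractibleSpace ↥{x ∈ X | ∀ c ∈ C, ‖x - c‖ ∈ D} ∧
      (IsCompact {x ∈ X | ∀ c ∈ C, ‖x - c‖ ∈ D} → Cell ↥{x ∈ X | ∀ c ∈ C, ‖x - c‖ ∈ D}) := by
  obtain ⟨K, _, _, _, ψ, h0, h2, hinj, hmap⟩ := hX p hp
  obtain ⟨ρ, hρ, c, hc, L, hL, hcont, hanti, hquad⟩ := chart_bounds h2 hinj
  have hL1 : 0 < L + 1 := by linarith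
  set ρ' := min ρ (c / (4 * (L + 1))) with hρ'
  have hρ'0 : 0 < ρ' := by positivity
  have hsub : Metric.ball (0 : K) ρ' ⊆ Metric.ball 0 ρ := Metric.ball_subset_ball (min_le_left _ _)
  -- the chart stays in `X`
  have hmem : ∀ᶠ u in 𝓝 (0 : K), ψ u ∈ X := by
    have : ∀ᶠ x in Filter.map ψ (𝓝 0), x ∈ X := by
      rw [hmap]; exact self_mem_nhdsWithin
    exact this
  obtain ⟨ρ₂, hρ₂, hρ₂X⟩ := Metric.eventually_nhds_iff_ball.mp hmem
  set B := Metric.ball (0 : K) (min ρ' ρ₂) with hB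
  have hBρ : B ⊆ Metric.ball 0 ρ := (Metric.ball_subset_ball (min_le_left _ _)).trans hsub
  have himg : ψ '' B ∈ 𝓝[X] p := by
    rw [← hmap]
    exact Filter.image_mem_map (Metric.ball_mem_nhds _ (by positivity))
  obtain ⟨η, hη, hηX⟩ := Metric.mem_nhdsWithin_iff.mp himg
  refine ⟨min (η / 2) (c ^ 2 / (4 * (L + 1))), by positivity, fun C D ⟨q, hqC, hq⟩ hD hDδ hne => ?_⟩
  set δ := min (η / 2) (c ^ 2 / (4 * (L + 1))) with hδ
  set T := {x ∈ X | ∀ c ∈ C, ‖x - c‖ ∈ D} with hT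
  have hTB : T ⊆ ψ '' B := by
    intro x hx
    refine hηX ⟨?_, hx.1⟩
    have h1 : dist x q ≤ δ := by rw [dist_eq_norm]; exact hDδ (hx.2 q hqC)
    have h2 : δ ≤ η / 2 := min_le_left _ _
    rw [Metric.mem_ball]
    linarith [dist_triangle x q p]
  set S : Set K := B ∩ ψ ⁻¹' T with hS
  have hSconv : Convex ℝ S := by
    intro x hx y hy a b ha hb hab
    have hz : a • x + b • y ∈ B := convex_ball _ _ hx.1 hy.1 ha hb hab
    refine ⟨hz, hρ₂X _ (Metric.ball_subset_ball (min_le_right _ _) hz), fun w hw => ?_⟩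
    have hmax : max ‖ψ x - w‖ ‖ψ y - w‖ ∈ D := by
      rcases max_choice ‖ψ x - w‖ ‖ψ y - w‖ with h | h <;> rw [h]
      · exact hx.2.2 w hw
      · exact hy.2.2 w hw
    refine hD ?_ hmax
    have hxρ : ∀ v ∈ B, ‖v‖ ≤ c / (4 * (L + 1)) := fun v hv => by
      rw [hB, mem_ball_zero_iff] at hv
      exact hv.le.trans ((min_le_left _ _).trans (min_le_right _ _))
    refine norm_convex_bound (x := ψ x - w) (y := ψ y - w) (a := a) (b := b) (s := ‖x - y‖)
      (c := c) (K := L) (δ := δ) (σ := c / (2 * (L + 1))) ha hb hab hL (norm_nonneg _) ?_ hc.le ?_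
      (le_max_left _ _) (le_max_right _ _) (hDδ hmax) ?_ ?_
    · rw [sub_sub_sub_cancel_right]
      exact hanti x (hBρ hx.1) y (hBρ hy.1)
    · have e : ψ (a • x + b • y) - w - (a • (ψ x - w) + b • (ψ y - w)) =
          ψ (a • x + b • y) - (a • ψ x + b • ψ y) := by
        obtain rfl : a = 1 - b := by linarith
        module
      rw [e]
      exact hquad x (hBρ hx.1) y (hBρ hy.1) a b ha hb hab
    · have h1 := hxρ x hx.1
      have h2 := hxρ y hy.1
      have h3 := norm_sub_le x y
      have : c / (2 * (L + 1)) = c / (4 * (L + 1)) + c / (4 * (L + 1)) := by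
        field_simp; norm_num
      linarith
    · have h1 : δ ≤ c ^ 2 / (4 * (L + 1)) := min_le_right _ _
      have h3 : c ^ 2 / (4 * (L + 1)) * L ≤ c ^ 2 / 4 := by
        rw [div_mul_eq_mul_div, div_le_div_iff₀ (by positivity) (by norm_num)]
        nlinarith [sq_nonneg c]
      have h4 : L ^ 2 * (c / (2 * (L + 1))) ^ 2 ≤ c ^ 2 / 4 := by
        rw [div_pow, mul_div_assoc', div_le_div_iff₀ (by positivity) (by norm_num)]
        nlinarith [sq_nonneg c, mul_nonneg hL (sq_nonneg c)]
      have h5 := mul_le_mul_of_nonneg_right h1 hL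
      have h6 := sq_nonneg c
      have h7 : 2 * δ * L = 2 * (δ * L) := by ring
      linarith
  have hinjB : Set.InjOn ψ B := fun x hx y hy h => by
    have := hanti x (hBρ hx) y (hBρ hy)
    rw [h, sub_self, norm_zero] at this
    have h3 : ‖x - y‖ ≤ 0 := by
      by_contra hcon
      push Not at hcon
      linarith [mul_pos hc hcon]
    exact sub_eq_zero.mp (norm_le_zero_iff.mp h3)
  have hTimg : ∀ x : T, ∃ u ∈ B, ψ u = x := fun x => hTB x.2
  choose φ hφB hφ using hTimg
  have hφc : Continuous φ := by
    refine (LipschitzWith.of_dist_le_mul (K := ⟨c⁻¹, by positivity⟩) fun x y => ?_).continuous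
    change _ ≤ c⁻¹ * _
    rw [le_inv_mul_iff₀ hc, dist_eq_norm, Subtype.dist_eq, dist_eq_norm, ← hφ x, ← hφ y]
    exact hanti _ (hBρ (hφB x)) _ (hBρ (hφB y))
  let e : T ≃ₜ S :=
    { toFun := fun x => ⟨φ x, hφB x, by rw [Set.mem_preimage, hφ]; exact x.2⟩
      invFun := fun u => ⟨ψ u, u.2.2⟩
      left_inv := fun x => Subtype.ext (hφ x)
      right_inv := fun u => Subtype.ext (hinjB (hφB _) u.2.1 (hφ _))
      continuous_toFun := hφc.subtype_mk _
      continuous_invFun := (continuousOn_iff_continuous_domRestrict.mp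
        (hcont.mono (Set.inter_subset_left.trans hBρ))).subtype_mk _ }
  have hSne : S.Nonempty := by
    obtain ⟨x, hx⟩ := hne
    exact ⟨_, (e ⟨x, hx⟩).2⟩
  refine ⟨?_, fun hcomp => ?_⟩
  · have := hSconv.contractibleSpace hSne
    exact e.contractibleSpace
  · have : CompactSpace T := isCompact_iff_compactSpace.mp hcomp
    exact ⟨K, inferInstance, inferInstance, inferInstance, S, isCompact_iff_compactSpace.mpr
      e.compactSpace, hSconv, hSne, ⟨e⟩⟩

theorem LocSmooth.good {X : Set W} (hX : LocSmooth X) (hc : IsCompact X) : Good X := by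
  intro ε hε
  -- a uniform radius
  have huni : ∃ δ > 0, ∀ q ∈ X, ∀ (C : Set W) (D : Set ℝ), q ∈ C → IsLowerSet D →
      D ⊆ Set.Iic δ → {x ∈ X | ∀ c ∈ C, ‖x - c‖ ∈ D}.Nonempty →
      ContractibleSpace ↥{x ∈ X | ∀ c ∈ C, ‖x - c‖ ∈ D} ∧
      (IsCompact {x ∈ X | ∀ c ∈ C, ‖x - c‖ ∈ D} → Cell ↥{x ∈ X | ∀ c ∈ C, ‖x - c‖ ∈ D}) := by
    refine hc.induction_on (p := fun s => ∃ δ > 0, ∀ q ∈ s, ∀ (C : Set W) (D : Set ℝ), q ∈ C →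
      IsLowerSet D → D ⊆ Set.Iic δ → {x ∈ X | ∀ c ∈ C, ‖x - c‖ ∈ D}.Nonempty →
      ContractibleSpace ↥{x ∈ X | ∀ c ∈ C, ‖x - c‖ ∈ D} ∧
      (IsCompact {x ∈ X | ∀ c ∈ C, ‖x - c‖ ∈ D} → Cell ↥{x ∈ X | ∀ c ∈ C, ‖x - c‖ ∈ D}))
      ⟨1, one_pos, by simp⟩ ?_ ?_ ?_
    · rintro s t hst ⟨δ, hδ, h⟩
      exact ⟨δ, hδ, fun q hq => h q (hst hq)⟩
    · rintro s t ⟨δ, hδ, h⟩ ⟨δ', hδ', h'⟩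
      refine ⟨min δ δ', lt_min hδ hδ', fun q hq C D hC hD hDs => ?_⟩
      rcases hq with hq | hq
      · exact h q hq C D hC hD (hDs.trans (Set.Iic_subset_Iic.mpr (min_le_left _ _)))
      · exact h' q hq C D hC hD (hDs.trans (Set.Iic_subset_Iic.mpr (min_le_right _ _)))
    · intro p hp
      obtain ⟨δ, hδ, h⟩ := hX.exists_cells hp
      exact ⟨Metric.ball p δ, mem_nhdsWithin_of_mem_nhds (Metric.ball_mem_nhds p hδ), δ, hδ,
        fun q hq C D hC hD hDs => h C D ⟨q, hC, hq⟩ hD hDs⟩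
  obtain ⟨δ, hδ, hcell⟩ := huni
  set r := min δ ε with hr
  have hr0 : 0 < r := lt_min hδ hε
  obtain ⟨t, htX, htf, hcov⟩ := hc.elim_finite_subcover_image (b := X)
    (c := fun x => Metric.ball x (r / 2)) (fun x _ => Metric.isOpen_ball)
    (fun x hx => Set.mem_iUnion₂.mpr ⟨x, hx, Metric.mem_ball_self (half_pos hr0)⟩)
  obtain ⟨n, q, hq⟩ : ∃ (n : ℕ) (q : Fin n → W), Set.range q = t := by
    have := htf.to_subtype
    obtain ⟨n, ⟨e⟩⟩ := Finite.exists_equiv_fin t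
    exact ⟨n, fun i => (e.symm i).1, by
      rw [Set.range_comp' (f := e.symm) (g := Subtype.val), e.symm.surjective.range_eq,
        Set.image_univ, Subtype.range_coe]⟩
  have hqX : ∀ i, q i ∈ X := fun i => htX (hq ▸ Set.mem_range_self i)
  -- a slightly smaller radius with the same nerve
  obtain ⟨r', hr'1, hr'2, hr'3⟩ : ∃ r' < r, r / 2 ≤ r' ∧ ∀ I : Finset (Fin n),
      (∃ x ∈ X, ∀ i ∈ I, ‖x - q i‖ < r) → ∃ x ∈ X, ∀ i ∈ I, ‖x - q i‖ ≤ r' := by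
    have : ∀ F : Finset (Finset (Fin n)), ∃ r' < r, r / 2 ≤ r' ∧ ∀ I ∈ F,
      (∃ x ∈ X, ∀ i ∈ I, ‖x - q i‖ < r) → ∃ x ∈ X, ∀ i ∈ I, ‖x - q i‖ ≤ r' := by
      classical
      intro F
      induction F using Finset.induction_on with
      | empty => exact ⟨r / 2, by linarith, le_rfl, by simp⟩
      | insert I F hI ih =>
        obtain ⟨r₁, h1, h2, h3⟩ := ih
        have : ∃ r₂ < r, (∃ x ∈ X, ∀ i ∈ I, ‖x - q i‖ < r) → ∃ x ∈ X, ∀ i ∈ I, ‖x - q i‖ ≤ r₂ := by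
          by_cases h : ∃ x ∈ X, ∀ i ∈ I, ‖x - q i‖ < r
          · obtain ⟨x, hx, hxi⟩ := h
            rcases I.eq_empty_or_nonempty with rfl | hne
            · exact ⟨r / 2, by linarith, fun _ => ⟨x, hx, by simp⟩⟩
            · exact ⟨I.sup' hne fun i => ‖x - q i‖, (Finset.sup'_lt_iff _).mpr hxi,
                fun _ => ⟨x, hx, fun i hi => Finset.le_sup' (fun i => ‖x - q i‖) hi⟩⟩
          · exact ⟨r / 2, by linarith, fun h' => absurd h' h⟩
        obtain ⟨r₂, h4, h5⟩ := this
        refine ⟨max r₁ r₂, max_lt h1 h4, h2.trans (le_max_left _ _), fun J hJ hx => ?_⟩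
        rcases Finset.mem_insert.mp hJ with rfl | hJ
        · obtain ⟨x, hx, hxi⟩ := h5 hx
          exact ⟨x, hx, fun i hi => (hxi i hi).trans (le_max_right _ _)⟩
        · obtain ⟨x, hx, hxi⟩ := h3 J hJ hx
          exact ⟨x, hx, fun i hi => (hxi i hi).trans (le_max_left _ _)⟩
    obtain ⟨r', h1, h2, h3⟩ := this Finset.univ
    exact ⟨r', h1, h2, fun I => h3 I (Finset.mem_univ _)⟩
  let U : Fin n → Opens X := fun i => ⟨{x | ‖(x : W) - q i‖ < r},
    isOpen_lt (by fun_prop) continuous_const⟩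
  let K : Fin n → Closeds X := fun i => ⟨{x | ‖(x : W) - q i‖ ≤ r'},
    isClosed_le (by fun_prop) continuous_const⟩
  have hcov' : ∀ x : X, ∃ i, ‖(x : W) - q i‖ < r / 2 := fun x => by
    obtain ⟨y, hy, hxy⟩ := Set.mem_iUnion₂.mp (hcov x.2)
    rw [← hq] at hy
    obtain ⟨i, rfl⟩ := hy
    exact ⟨i, by rwa [Metric.mem_ball, dist_eq_norm] at hxy⟩
  refine ⟨n, U, K, fun i => ⟨⟨q i, hqX i⟩, fun x hx => ?_⟩, fun x => ?_, fun x => ?_,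
    fun I hI => ?_⟩
  · have hx' : ‖(x : W) - q i‖ ≤ r' := hx
    rw [Metric.mem_closedBall, Subtype.dist_eq, dist_eq_norm]
    exact hx'.trans (hr'1.le.trans (min_le_right _ _))
  · obtain ⟨i, hi⟩ := hcov' x
    exact ⟨i, (by linarith : ‖(x : W) - q i‖ < r)⟩
  · obtain ⟨i, hi⟩ := hcov' x
    exact ⟨i, (by linarith : ‖(x : W) - q i‖ ≤ r')⟩
  have hU : ∀ x : X, x ∈ (⋂ i ∈ I, (U i : Set X)) ↔
      (x : W) ∈ {x ∈ X | ∀ c ∈ q '' (I : Set (Fin n)), ‖x - c‖ ∈ Set.Iio r} := fun x => by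
    simp [U]
  have hK : ∀ x : X, x ∈ (⋂ i ∈ I, (K i : Set X)) ↔
      (x : W) ∈ {x ∈ X | ∀ c ∈ q '' (I : Set (Fin n)), ‖x - c‖ ∈ Set.Iic r'} := fun x => by
    simp [K]
  have homeo : ∀ (A : Set X) (B : Set W), B ⊆ X → (∀ x : X, x ∈ A ↔ (x : W) ∈ B) →
      Nonempty (A ≃ₜ B) := fun A B hB hAB =>
    ⟨{ toFun := fun x => ⟨x.1, (hAB _).mp x.2⟩
       invFun := fun x => ⟨⟨x.1, hB x.2⟩, (hAB ⟨x.1, hB x.2⟩).mpr x.2⟩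
       left_inv := fun _ => rfl
       right_inv := fun _ => rfl
       continuous_toFun := by fun_prop
       continuous_invFun := by fun_prop }⟩
  obtain ⟨eU⟩ := homeo _ _ (fun x hx => hx.1) hU
  obtain ⟨eK⟩ := homeo _ _ (fun x hx => hx.1) hK
  obtain ⟨i, hi⟩ := hI
  by_cases hne : ∃ x ∈ X, ∀ i ∈ I, ‖x - q i‖ < r
  · right
    obtain ⟨x, hx, hxi⟩ := hne
    obtain ⟨y, hy, hyi⟩ := hr'3 I ⟨x, hx, hxi⟩
    have h1 := (hcell (q i) (hqX i) (q '' I) (Set.Iio r) ⟨i, hi, rfl⟩ (isLowerSet_Iio r)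
      (Set.Iio_subset_Iic (min_le_left _ _)) ⟨x, hx, by simpa using hxi⟩).1
    have h2 := (hcell (q i) (hqX i) (q '' I) (Set.Iic r') ⟨i, hi, rfl⟩ (isLowerSet_Iic r')
      (Set.Iic_subset_Iic.mpr (hr'1.le.trans (min_le_left _ _))) ⟨y, hy, by simpa using hyi⟩).2 ?_
    · refine ⟨eU.contractibleSpace, ?_⟩
      obtain ⟨W', i1, i2, i3, C, c1, c2, c3, ⟨e⟩⟩ := h2
      exact ⟨W', i1, i2, i3, C, c1, c2, c3, ⟨eK.trans e⟩⟩
    · have : {x ∈ X | ∀ c ∈ q '' (I : Set (Fin n)), ‖x - c‖ ∈ Set.Iic r'} =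
          X ∩ ⋂ c ∈ q '' (I : Set (Fin n)), {x | ‖x - c‖ ≤ r'} := by
        ext x; simp
      rw [this]
      exact hc.inter_right (isClosed_biInter fun c _ => isClosed_le (by fun_prop) continuous_const)
  · left
    refine ⟨⟨fun x => hne ⟨(x.1 : W), x.1.2, fun i hi => ?_⟩⟩, ⟨fun x => hne ⟨(x.1 : W), x.1.2,
      fun i hi => ?_⟩⟩⟩
    · exact ((hU x.1).mp x.2).2 _ ⟨i, hi, rfl⟩
    · exact lt_of_le_of_lt (((hK x.1).mp x.2).2 _ ⟨i, hi, rfl⟩) hr'1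

end

end FPoly

namespace FPoly

open Topology TopologicalSpace

/-- Local parametrizability of a subset of a normed space by `C²` immersions. -/
def HasCharts {W : Type} [NormedAddCommGroup W] [NormedSpace ℝ W] (X : Set W) : Prop :=
  ∀ p ∈ X, ∃ (K : Type) (_ : NormedAddCommGroup K) (_ : NormedSpace ℝ K)
    (_ : FiniteDimensional ℝ K) (ψ : K → W), ψ 0 = p ∧ ContDiffAt ℝ 2 ψ 0 ∧
    Function.Injective (fderiv ℝ ψ 0) ∧ Filter.map ψ (𝓝 0) = 𝓝[X] p

theorem HasCharts.locSmooth {W W' : Type} [NormedAddCommGroup W] [NormedSpace ℝ W]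
    [NormedAddCommGroup W'] [InnerProductSpace ℝ W'] {X : Set W} (hX : HasCharts X)
    (e : W ≃L[ℝ] W') : LocSmooth (e '' X) := by
  rintro _ ⟨p, hp, rfl⟩
  obtain ⟨K, i1, i2, i3, ψ, h0, h1, h2, h3⟩ := hX p hp
  refine ⟨K, i1, i2, i3, e ∘ ψ, by simp [h0], ?_, ?_, ?_⟩
  · exact e.contDiff.contDiffAt.comp _ h1
  · rw [ContinuousLinearEquiv.comp_fderiv]
    exact e.injective.comp h2
  · rw [← Filter.map_map, h3]
    exact e.toHomeomorph.isEmbedding.map_nhdsWithin_eq X p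

theorem zeroSet_chart {E F : Type} [NormedAddCommGroup E] [NormedSpace ℝ E]
    [FiniteDimensional ℝ E] [NormedAddCommGroup F] [NormedSpace ℝ F] [FiniteDimensional ℝ F]
    {G : E → F} (hG : ContDiffAt ℝ 2 G 0) (h0 : G 0 = 0)
    (hs : Function.Surjective (fderiv ℝ G 0)) :
    ∃ (K : Type) (_ : NormedAddCommGroup K) (_ : NormedSpace ℝ K) (_ : FiniteDimensional ℝ K)
      (χ : K → E), χ 0 = 0 ∧ ContDiffAt ℝ 2 χ 0 ∧
      Function.Injective (fderiv ℝ χ 0) ∧ Filter.map χ (𝓝 0) = 𝓝[{x | G x = 0}] 0 := by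
  have : CompleteSpace E := FiniteDimensional.complete ℝ E
  set L := fderiv ℝ G 0 with hL
  set K := LinearMap.ker (L : E →ₗ[ℝ] F) with hK
  obtain ⟨π₀, hπ₀⟩ := K.subtype.exists_leftInverse_of_injective (by simp)
  set π : E →L[ℝ] K := π₀.toContinuousLinearMap with hπ
  have hπK : ∀ k : K, π (k : E) = k := fun k => LinearMap.congr_fun hπ₀ k
  have hinj : Function.Injective (L.prod π) := by
    rw [injective_iff_map_eq_zero]
    intro x hx
    have h1 : L x = 0 := congrArg Prod.fst hx
    have h2 : π x = 0 := congrArg Prod.snd hx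
    have := hπK ⟨x, h1⟩
    rw [h2] at this
    exact (congrArg Subtype.val this).symm
  have hsurj : Function.Surjective (L.prod π) := by
    rintro ⟨b, k⟩
    obtain ⟨x, rfl⟩ := hs b
    have hm : ((k - π x : K) : E) ∈ K := (k - π x).2
    refine ⟨x + (k - π x : K), Prod.ext ?_ ?_⟩
    · have : L ((k - π x : K) : E) = 0 := hm
      change L (x + ((k - π x : K) : E)) = L x
      rw [map_add, this, add_zero]
    · change π (x + ((k - π x : K) : E)) = k
      rw [map_add, hπK, add_sub_cancel]
  let D : E ≃L[ℝ] (F × K) :=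
    (LinearEquiv.ofBijective (L.prod π : E →ₗ[ℝ] F × K) ⟨hinj, hsurj⟩).toContinuousLinearEquiv
  have hDa : ∀ x, D x = (L x, π x) := fun x => rfl
  let H : E → F × K := fun x => (G x, π x)
  have hH : ContDiffAt ℝ 2 H 0 := hG.prodMk π.contDiff.contDiffAt
  have hH' : HasFDerivAt H (D : E →L[ℝ] F × K) 0 := by
    have : HasFDerivAt H (L.prod π) 0 :=
      (hG.differentiableAt (by norm_num)).hasFDerivAt.prodMk π.hasFDerivAt
    exact this.congr_fderiv (by ext x <;> rfl)
  have hH0 : H 0 = 0 := by simp [H, h0]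
  have hHs : HasStrictFDerivAt H (D : E →L[ℝ] F × K) 0 :=
    hH.hasStrictFDerivAt' hH' (by norm_num)
  let I : F × K → E := hHs.localInverse H D 0
  have hI : ContDiffAt ℝ 2 I 0 := by
    have := hH.to_localInverse hH' (by norm_num)
    rwa [hH0] at this
  have hI0 : I 0 = 0 := by
    have := hHs.localInverse_apply_image
    rwa [hH0] at this
  have hl : ∀ᶠ x in 𝓝 0, I (H x) = x := hHs.eventually_left_inverse
  have hr : ∀ᶠ y in 𝓝 (0 : F × K), H (I y) = y := by
    have := hHs.eventually_right_inverse
    rwa [hH0] at this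
  have hId : HasFDerivAt I (D.symm : F × K →L[ℝ] E) 0 := by
    have := hHs.to_localInverse.hasFDerivAt
    rwa [hH0] at this
  have hj : Filter.Tendsto (fun k : K => ((0 : F), k)) (𝓝 0) (𝓝 0) := by
    have : Continuous (fun k : K => ((0 : F), k)) := by fun_prop
    exact this.tendsto 0
  have hχt : Filter.Tendsto (fun k : K => I (0, k)) (𝓝 0) (𝓝 0) := by
    have := hI.continuousAt.tendsto
    rw [hI0] at this
    exact this.comp hj
  refine ⟨K, Submodule.normedAddCommGroup _, Submodule.normedSpace _, inferInstance,
    fun k => I (0, k), hI0, ?_, ?_, ?_⟩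
  · have h1 : ContDiffAt ℝ 2 I ((fun k : K => ((0 : F), k)) 0) := hI
    exact h1.comp (0 : K) (contDiffAt_const.prodMk contDiffAt_id)
  · have h1 : HasFDerivAt I (D.symm : F × K →L[ℝ] E) ((fun k : K => ((0 : F), k)) 0) := hId
    have h2 := h1.comp (0 : K) ((hasFDerivAt_const (0 : F) (0 : K)).prodMk (hasFDerivAt_id _))
    have h3 : fderiv ℝ (fun k : K => I (0, k)) 0 = _ := h2.fderiv
    rw [h3]
    refine D.symm.injective.comp ?_
    intro k k' h
    exact (Prod.ext_iff.1 h).2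
  · refine le_antisymm ?_ ?_
    · refine tendsto_nhdsWithin_iff.2 ⟨hχt, ?_⟩
      filter_upwards [hj.eventually hr] with k hk
      exact (Prod.ext_iff.1 hk).1
    · refine Filter.le_map_of_right_inverse (mba := fun x => π x) ?_ ?_
      · filter_upwards [self_mem_nhdsWithin, nhdsWithin_le_nhds hl] with x hx hx'
        have : H x = (0, π x) := by
          have hx : G x = 0 := hx
          simp [H, hx]
        simp only [Function.comp, id, ← this, hx']
      · have := π.continuous.tendsto 0
        rw [map_zero] at this
        exact this.mono_left nhdsWithin_le_nhds

end FPoly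

namespace FPoly

open Topology TopologicalSpace

section
variable {R : Type} [NormedRing R] [NormedAlgebra ℝ R] [FiniteDimensional ℝ R] [StarRing R]
  [ContinuousStar R] [StarModule ℝ R]

/-- The self-adjoint idempotents of a star ring. -/
def Proj (R : Type) [Ring R] [StarRing R] : Set R := {P | star P = P ∧ P * P = P}

/-- The tangent directions `(1 - P) R P` at a projection `P`. -/
def offDiag (P : R) : Submodule ℝ R where
  carrier := {φ | (1 - P) * φ * P = φ}
  add_mem' {a b} ha hb := by
    simp only [Set.mem_ofPred_eq] at *
    rw [mul_add, add_mul, ha, hb]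
  zero_mem' := by simp
  smul_mem' c x hx := by
    simp only [Set.mem_ofPred_eq] at *
    rw [mul_smul_comm, smul_mul_assoc, hx]

/-- The element `1 + φ - φ*` conjugating a projection to a nearby one. -/
def rot (φ : R) : R := 1 + φ - star φ

def projChart (P : R) (φ : offDiag P) : R := rot (φ : R) * P * Ring.inverse (rot (φ : R))

theorem offDiag_rels {P φ : R} (hP : P ∈ Proj R) (hφ : φ ∈ offDiag P) :
    P * φ = 0 ∧ φ * P = φ ∧ star φ * P = 0 ∧ P * star φ = star φ := by
  have h : (1 - P) * φ * P = φ := hφ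
  have h1 : P * φ = 0 := by
    rw [← h, ← mul_assoc, ← mul_assoc, mul_sub, mul_one, hP.2, sub_self, zero_mul, zero_mul]
  have h2 : φ * P = φ := by
    conv_lhs => rw [← h, mul_assoc, hP.2, h]
  refine ⟨h1, h2, ?_, ?_⟩
  · have := congrArg star h1
    rwa [star_mul, hP.1, star_zero] at this
  · have := congrArg star h2
    rwa [star_mul, hP.1] at this

theorem rot_mul {P φ : R} (hP : P ∈ Proj R) (hφ : φ ∈ offDiag P) : rot φ * P = P + φ := by
  obtain ⟨h1, h2, h3, h4⟩ := offDiag_rels hP hφ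
  rw [rot, sub_mul, add_mul, one_mul, h2, h3, sub_zero]

theorem conj_rot_mem {P φ : R} (hP : P ∈ Proj R) (hφ : φ ∈ offDiag P) (hu : IsUnit (rot φ)) :
    rot φ * P * Ring.inverse (rot φ) ∈ Proj R := by
  obtain ⟨h1, h2, h3, h4⟩ := offDiag_rels hP hφ
  have e1 := Ring.inverse_mul_cancel _ hu
  have e2 := Ring.mul_inverse_cancel _ hu
  set g := rot φ with hg
  set g' := Ring.inverse g
  have hs : P * (star g * g) = star g * g * P := by
    have a : star g = 1 + star φ - φ := by rw [hg, rot]; simp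
    have hx : φ * φ = 0 := by rw [← h2, mul_assoc, ← mul_assoc P, h1, zero_mul, mul_zero]
    have hy : star φ * star φ = 0 := by rw [← star_mul, hx, star_zero]
    have : star g * g = 1 + φ * star φ + star φ * φ := by
      rw [a, hg, rot]
      simp only [mul_add, add_mul, sub_mul, mul_sub, one_mul, mul_one, hx, hy]
      abel
    rw [this]
    simp only [mul_add, add_mul, mul_one, one_mul, ← mul_assoc, h1, h4, zero_mul]
    simp only [mul_assoc, h2, h3, mul_zero]
  have hu' : star g' * star g = 1 := by rw [← star_mul, e2, star_one]
  constructor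
  · rw [star_mul, star_mul, hP.1]
    calc star g' * (P * star g) = star g' * (P * (star g * g)) * g' := by
          simp only [mul_assoc, e2, mul_one]
      _ = (star g' * star g) * g * P * g' := by rw [hs]; simp only [mul_assoc]
      _ = _ := by rw [hu', one_mul]
  · calc g * P * g' * (g * P * g') = g * P * (g' * g) * P * g' := by simp only [mul_assoc]
      _ = g * (P * P) * g' := by rw [e1]; simp only [mul_assoc, one_mul]
      _ = _ := by rw [hP.2]

theorem idempotent_eq_zero_of_norm_lt {x : R} (hx : x * x = x) (h : ‖x‖ < 1) : x = 0 := by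
  have h1 : ‖x‖ ≤ ‖x‖ * ‖x‖ := by
    conv_lhs => rw [← hx]
    exact norm_mul_le x x
  rw [← norm_eq_zero]
  nlinarith [norm_nonneg x]

theorem continuous_rot : Continuous (rot : R → R) := by
  unfold rot
  fun_prop

theorem rot_zero : rot (0 : R) = 1 := by simp [rot]

theorem eventually_isUnit {X : Type} [TopologicalSpace X] {f : X → R} {x : X}
    (hf : ContinuousAt f x) (h : IsUnit (f x)) : ∀ᶠ y in 𝓝 x, IsUnit (f y) := by
  have : CompleteSpace R := FiniteDimensional.complete ℝ R
  exact hf.eventually (Units.isOpen.mem_nhds h)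

def starL (R : Type) [NormedRing R] [NormedAlgebra ℝ R] [StarRing R]
    [ContinuousStar R] [StarModule ℝ R] : R →L[ℝ] R :=
  { toFun := star
    map_add' := star_add
    map_smul' := fun c x => by simp
    cont := continuous_star }

theorem contDiff_rot : ContDiff ℝ 2 (rot : R → R) :=
  (contDiff_const.add contDiff_id).sub (starL R).contDiff

theorem contDiffAt_inverse_rot : ContDiffAt ℝ 2 (fun φ : R => Ring.inverse (rot φ)) 0 := by
  have : CompleteSpace R := FiniteDimensional.complete ℝ R
  have h : ContDiffAt ℝ 2 (Ring.inverse : R → R) (rot 0) := by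
    rw [rot_zero]
    exact contDiffAt_ringInverse ℝ (1 : Rˣ)
  exact h.comp (0 : R) contDiff_rot.contDiffAt

theorem hasFDerivAt_rot :
    HasFDerivAt (rot : R → R) (ContinuousLinearMap.id ℝ R - starL R) 0 := by
  have h := ((hasFDerivAt_const (1 : R) (0 : R)).add (hasFDerivAt_id (𝕜 := ℝ) (0 : R))).sub
    (starL R).hasFDerivAt
  have h' : HasFDerivAt (rot : R → R) _ 0 := h
  exact h'.congr_fderiv (by rw [zero_add])

theorem hasFDerivAt_inverse_rot : HasFDerivAt (fun φ : R => Ring.inverse (rot φ))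
    (-(ContinuousLinearMap.id ℝ R - starL R)) 0 := by
  have : CompleteSpace R := FiniteDimensional.complete ℝ R
  have h : HasFDerivAt (Ring.inverse : R → R) (-ContinuousLinearMap.mulLeftRight ℝ R 1 1)
      (rot 0) := by
    rw [rot_zero]
    simpa using hasFDerivAt_ringInverse (𝕜 := ℝ) (1 : Rˣ)
  refine (h.comp (0 : R) hasFDerivAt_rot).congr_fderiv ?_
  ext x
  simp
  abel

variable {P : R}

theorem projChart_zero : projChart P 0 = P := by simp [projChart, rot_zero]

theorem contDiffAt_projChart : ContDiffAt ℝ 2 (projChart P) 0 := by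
  have h0 : ContDiffAt ℝ 2 (fun φ : offDiag P => (φ : R)) 0 :=
    (offDiag P).subtypeL.contDiff.contDiffAt
  have h1 : ContDiffAt ℝ 2 (fun φ : offDiag P => Ring.inverse (rot (φ : R))) 0 :=
    ContDiffAt.comp (g := fun φ : R => Ring.inverse (rot φ)) (0 : offDiag P)
      (by simpa using contDiffAt_inverse_rot) h0
  exact (((contDiff_rot.contDiffAt).comp (0 : offDiag P) h0).mul contDiffAt_const).mul h1

theorem eventually_isUnit_rot : ∀ᶠ φ : offDiag P in 𝓝 0, IsUnit (rot (φ : R)) :=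
  eventually_isUnit (continuous_rot.comp continuous_subtype_val).continuousAt
    (by simp [rot_zero])

theorem injective_fderiv_projChart (hP : P ∈ Proj R) :
    Function.Injective (fderiv ℝ (projChart P) 0) := by
  rw [injective_iff_map_eq_zero]
  intro ψ hψ
  have d1 := (contDiffAt_projChart (P := P)).differentiableAt (by norm_num) |>.hasFDerivAt
  have d0 : HasFDerivAt (fun φ : offDiag P => (φ : R)) (offDiag P).subtypeL 0 :=
    (offDiag P).subtypeL.hasFDerivAt
  have d2 : HasFDerivAt (fun φ : offDiag P => rot (φ : R)) _ 0 :=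
    HasFDerivAt.comp (g := (rot : R → R)) (0 : offDiag P) hasFDerivAt_rot d0
  have d3 := d1.mul' d2
  have d4 : HasFDerivAt (fun φ : offDiag P => P + (φ : R)) (offDiag P).subtypeL 0 :=
    d0.const_add P
  have he : (projChart P * fun φ : offDiag P => rot (φ : R)) =ᶠ[𝓝 0]
      fun φ : offDiag P => P + (φ : R) := by
    filter_upwards [eventually_isUnit_rot (P := P)] with φ hφ
    rw [Pi.mul_apply, projChart, mul_assoc, Ring.inverse_mul_cancel _ hφ, mul_one,
      rot_mul hP φ.2]
  have d5 := (d4.congr_of_eventuallyEq he).unique d3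
  have d6 := DFunLike.congr_fun d5 ψ
  simp only [_root_.add_apply, _root_.smul_apply, hψ,
    projChart_zero] at d6
  have d7 : (ψ : R) = P * ((ψ : R) - star (ψ : R)) := by
    simpa [starL, hψ] using d6
  have hψ' : (1 - P) * (ψ : R) * P = ψ := ψ.2
  ext
  change (ψ : R) = 0
  rw [← hψ', d7, ← mul_assoc (1 - P), sub_mul, one_mul, hP.2, sub_self, zero_mul, zero_mul]

theorem map_projChart (hP : P ∈ Proj R) : Filter.map (projChart P) (𝓝 0) = 𝓝[Proj R] P := by
  have hc : ContinuousAt (projChart P) 0 := contDiffAt_projChart.continuousAt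
  have hc' : Filter.Tendsto (projChart P) (𝓝 0) (𝓝 P) := by
    have := hc.tendsto
    rwa [projChart_zero] at this
  have : CompleteSpace R := FiniteDimensional.complete ℝ R
  refine le_antisymm ?_ ?_
  · refine tendsto_nhdsWithin_iff.2 ⟨hc', ?_⟩
    filter_upwards [eventually_isUnit_rot (P := P)] with φ hφ
    exact conj_rot_mem hP φ.2 hφ
  let c : R → R := fun Q => P * Q * P + 1 - P
  have hcc : Continuous c := by fun_prop
  have hcP : c P = 1 := by simp [c, hP.2]
  let ρ : R → R := fun Q => (1 - P) * Q * P * Ring.inverse (c Q) * P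
  have hρm : ∀ Q, ρ Q ∈ offDiag P := fun Q => by
    change (1 - P) * ((1 - P) * Q * P * Ring.inverse (c Q) * P) * P = _
    have : (1 - P) * (1 - P) = 1 - P := by
      rw [sub_mul, one_mul, mul_sub, mul_one, hP.2, sub_self, sub_zero]
    simp only [← mul_assoc, this]
    rw [mul_assoc _ P P, hP.2]
  have hρ0 : ρ P = 0 := by simp [ρ, sub_mul, hP.2]
  have hρc : ContinuousAt ρ P := by
    have h1 : ContinuousAt (fun Q => Ring.inverse (c Q)) P := by
      have h : ContinuousAt (Ring.inverse : R → R) (c P) := by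
        rw [hcP]
        exact NormedRing.inverse_continuousAt (1 : Rˣ)
      exact h.comp hcc.continuousAt
    exact ((by fun_prop : ContinuousAt (fun Q => (1 - P) * Q * P) P).mul h1).mul
      continuousAt_const
  let σ : R → offDiag P := fun Q => ⟨ρ Q, hρm Q⟩
  have hσ : Filter.Tendsto σ (𝓝 P) (𝓝 0) := by
    refine tendsto_subtype_rng.2 ?_
    have := hρc.tendsto
    rwa [hρ0] at this
  refine Filter.le_map_of_right_inverse (mba := σ) ?_ (hσ.mono_left nhdsWithin_le_nhds)
  have hcu : ∀ᶠ Q in 𝓝 P, IsUnit (c Q) := eventually_isUnit hcc.continuousAt (by simp [hcP])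
  have hnear : ∀ᶠ Q in 𝓝 P, ‖Q - projChart P (σ Q)‖ < 1 := by
    have h : Filter.Tendsto (fun Q => ‖Q - projChart P (σ Q)‖) (𝓝 P) (𝓝 0) := by
      simpa using (Filter.tendsto_id.sub (hc'.comp hσ)).norm
    exact h.eventually_lt_const one_pos
  filter_upwards [self_mem_nhdsWithin, nhdsWithin_le_nhds hcu, nhdsWithin_le_nhds hnear,
    nhdsWithin_le_nhds (hσ.eventually (eventually_isUnit_rot (P := P)))] with Q hQ hu hn hg
  change projChart P (σ Q) = Q
  have hm : projChart P (σ Q) ∈ Proj R := conj_rot_mem hP (hρm Q) hg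
  have e0 : c Q * P = P * c Q := by
    simp only [c, add_mul, sub_mul, mul_add, mul_sub, one_mul, mul_one, hP.2, ← mul_assoc]
    rw [mul_assoc _ P P, hP.2]
  have e1 : P + ρ Q = Q * P * Ring.inverse (c Q) * P := by
    have h1 : P = c Q * P * Ring.inverse (c Q) * P := by
      rw [e0, mul_assoc P, Ring.mul_inverse_cancel _ hu, mul_one, hP.2]
    have h2 : c Q * P = P * Q * P := by
      simp only [c, add_mul, sub_mul, one_mul, hP.2, mul_assoc, add_sub_cancel_right]
    rw [h2] at h1
    calc P + ρ Q = P * Q * P * Ring.inverse (c Q) * P + ρ Q := by rw [← h1]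
      _ = _ := by simp only [ρ, sub_mul, one_mul]; abel
  have e2 : Q * projChart P (σ Q) = projChart P (σ Q) := by
    have : projChart P (σ Q) = (P + ρ Q) * Ring.inverse (rot (ρ Q)) := by
      rw [← rot_mul hP (hρm Q)]; rfl
    rw [this, e1, ← mul_assoc, ← mul_assoc, ← mul_assoc, ← mul_assoc, hQ.2]
  have e3 : projChart P (σ Q) * Q = projChart P (σ Q) := by
    have := congrArg star e2
    rwa [star_mul, hQ.1, hm.1] at this
  have := idempotent_eq_zero_of_norm_lt (x := Q - projChart P (σ Q)) (by
    rw [mul_sub, sub_mul, sub_mul, e2, e3, hQ.2, hm.2, sub_self, sub_zero]) hn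
  exact (sub_eq_zero.1 this).symm

theorem hasChart_at (hP : P ∈ Proj R) {N : Type} [NormedAddCommGroup N] [NormedSpace ℝ N]
    [FiniteDimensional ℝ N] (C : Set R) (Γ : R →L[ℝ] R →L[ℝ] N)
    (hC : ∀ g : R, IsUnit g → (g * P * Ring.inverse g ∈ C ↔ Γ (Ring.inverse g) g = 0))
    (hPC : P ∈ C)
    (hs : ∀ b : N, ∃ ψ ∈ offDiag P, Γ 1 (ψ - star ψ) - Γ (ψ - star ψ) 1 = b) :
    ∃ (K : Type) (_ : NormedAddCommGroup K) (_ : NormedSpace ℝ K)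
      (_ : FiniteDimensional ℝ K) (ψ : K → R), ψ 0 = P ∧ ContDiffAt ℝ 2 ψ 0 ∧
      Function.Injective (fderiv ℝ ψ 0) ∧ Filter.map ψ (𝓝 0) = 𝓝[Proj R ∩ C] P := by
  have h11 : Γ 1 1 = 0 := by
    have := (hC 1 isUnit_one).1 (by simpa using hPC)
    simpa using this
  let G : offDiag P → N := fun φ => Γ (Ring.inverse (rot (φ : R))) (rot (φ : R))
  have d0 : HasFDerivAt (fun φ : offDiag P => (φ : R)) (offDiag P).subtypeL 0 :=
    (offDiag P).subtypeL.hasFDerivAt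
  have d1 : HasFDerivAt (fun φ : offDiag P => rot (φ : R)) _ 0 :=
    HasFDerivAt.comp (g := (rot : R → R)) (0 : offDiag P) hasFDerivAt_rot d0
  have d2 : HasFDerivAt (fun φ : offDiag P => Ring.inverse (rot (φ : R))) _ 0 :=
    HasFDerivAt.comp (g := fun φ : R => Ring.inverse (rot φ)) (0 : offDiag P)
      hasFDerivAt_inverse_rot d0
  have c0 : ContDiffAt ℝ 2 (fun φ : offDiag P => (φ : R)) 0 :=
    (offDiag P).subtypeL.contDiff.contDiffAt
  have c1 : ContDiffAt ℝ 2 (fun φ : offDiag P => rot (φ : R)) 0 :=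
    contDiff_rot.contDiffAt.comp (0 : offDiag P) c0
  have c2 : ContDiffAt ℝ 2 (fun φ : offDiag P => Ring.inverse (rot (φ : R))) 0 :=
    ContDiffAt.comp (g := fun φ : R => Ring.inverse (rot φ)) (0 : offDiag P)
      (by simpa using contDiffAt_inverse_rot) c0
  have hG : ContDiffAt ℝ 2 G 0 :=
    (Γ.contDiff.contDiffAt.comp (0 : offDiag P) c2).clm_apply c1
  have hG0 : G 0 = 0 := by simp [G, rot_zero, h11]
  have hGd := (Γ.hasFDerivAt.comp (0 : offDiag P) d2).clm_apply d1
  have hGd' : HasFDerivAt G _ 0 := hGd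
  have hsurj : Function.Surjective (fderiv ℝ G 0) := by
    intro b
    obtain ⟨ψ, hψ, rfl⟩ := hs b
    refine ⟨⟨ψ, hψ⟩, ?_⟩
    rw [hGd'.fderiv]
    simp [rot_zero, starL]
    abel
  obtain ⟨K, i1, i2, i3, χ, x0, x1, x2, x3⟩ := zeroSet_chart hG hG0 hsurj
  refine ⟨K, i1, i2, i3, projChart P ∘ χ, ?_, ?_, ?_, ?_⟩
  · simp [x0, projChart_zero]
  · exact ContDiffAt.comp (g := projChart P) _ (by rw [x0]; exact contDiffAt_projChart) x1
  · have hd : DifferentiableAt ℝ (projChart P) (χ 0) := by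
      rw [x0]; exact contDiffAt_projChart.differentiableAt (by norm_num)
    rw [fderiv_comp _ hd (x1.differentiableAt (by norm_num)), x0]
    exact (injective_fderiv_projChart hP).comp x2
  · rw [← Filter.map_map, x3, nhdsWithin_inter']
    rw [← map_projChart hP, ← Filter.map_inf_principal_preimage]
    have he : {x | G x = 0} =ᶠ[𝓝 (0 : offDiag P)] projChart P ⁻¹' C := by
      filter_upwards [eventually_isUnit_rot (P := P)] with φ hφ
      exact propext (hC _ hφ).symm
    exact congrArg _ (nhdsWithin_eq_iff_eventuallyEq.2 he)

theorem hasChart_at' (hP : P ∈ Proj R) {N : Type} [AddCommGroup N] [Module ℝ N]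
    [FiniteDimensional ℝ N] (C : Set R) (Γ : R →ₗ[ℝ] R →ₗ[ℝ] N)
    (hC : ∀ g : R, IsUnit g → (g * P * Ring.inverse g ∈ C ↔ Γ (Ring.inverse g) g = 0))
    (hPC : P ∈ C)
    (hs : ∀ b : N, ∃ ψ ∈ offDiag P, Γ 1 (ψ - star ψ) - Γ (ψ - star ψ) 1 = b) :
    ∃ (K : Type) (_ : NormedAddCommGroup K) (_ : NormedSpace ℝ K)
      (_ : FiniteDimensional ℝ K) (ψ : K → R), ψ 0 = P ∧ ContDiffAt ℝ 2 ψ 0 ∧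
      Function.Injective (fderiv ℝ ψ 0) ∧ Filter.map ψ (𝓝 0) = 𝓝[Proj R ∩ C] P := by
  let e : N ≃ₗ[ℝ] (Fin (Module.finrank ℝ N) → ℝ) := (Module.finBasis ℝ N).equivFun
  let Γ' := (Γ.compr₂ e.toLinearMap).toContinuousBilinearMap
  have hΓ' : ∀ u v, Γ' u v = e (Γ u v) := fun u v => rfl
  refine hasChart_at hP C Γ' (fun g hg => ?_) hPC (fun b => ?_)
  · rw [hC g hg, hΓ', e.map_eq_zero_iff]
  · obtain ⟨ψ, h1, h2⟩ := hs (e.symm b)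
    refine ⟨ψ, h1, ?_⟩
    rw [hΓ', hΓ', ← map_sub, h2, e.apply_symm_apply]

end

end FPoly

namespace FPoly

open Topology TopologicalSpace

section
variable {V A : Type} {s t : A → V} {ι : V → Type} [∀ i, Fintype (ι i)] [∀ i, DecidableEq (ι i)]

/-- The quiver Grassmannian realised by orthogonal projections. -/
def PG (X : ∀ a : A, Matrix (ι (t a)) (ι (s a)) ℂ) (e : V → ℕ) :
    Set (∀ i, Matrix (ι i) (ι i) ℂ) :=
  {P | (∀ i, (P i)ᴴ = P i) ∧ (∀ i, P i * P i = P i) ∧ (∀ i, (P i).trace = e i) ∧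
    ∀ a, (1 - P (t a)) * X a * P (s a) = 0}

theorem norm_entry_le {n : Type} [Fintype n] {P : Matrix n n ℂ} (h1 : Pᴴ = P)
    (h2 : P * P = P) (i j : n) : ‖P i j‖ ≤ 1 := by
  have h : ∀ i, ((∑ j, ‖P i j‖ ^ 2 : ℝ) : ℂ) = P i i := fun i => by
    conv_rhs => rw [← h2, mul_apply]
    push_cast
    refine Finset.sum_congr rfl fun j _ => ?_
    have : P j i = star (P i j) := by
      conv_lhs => rw [← h1]
      rfl
    rw [this, ← Complex.mul_conj']
    rfl
  have h' : ∀ i, ∑ j, ‖P i j‖ ^ 2 = ‖P i i‖ := fun i => by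
    rw [← h i, Complex.norm_real, Real.norm_of_nonneg (Finset.sum_nonneg fun _ _ => sq_nonneg _)]
  have hle : ∀ i j, ‖P i j‖ ^ 2 ≤ ‖P i i‖ := fun i j => by
    rw [← h']
    exact Finset.single_le_sum (f := fun j => ‖P i j‖ ^ 2) (fun _ _ => sq_nonneg _)
      (Finset.mem_univ j)
  have hii : ‖P i i‖ ≤ 1 := by nlinarith [hle i i, norm_nonneg (P i i)]
  nlinarith [hle i j, norm_nonneg (P i j)]

theorem isClosed_PG (X : ∀ a : A, Matrix (ι (t a)) (ι (s a)) ℂ) (e : V → ℕ) :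
    IsClosed (PG X e) := by
  have h1 : ∀ i, Continuous fun P : ∀ i, Matrix (ι i) (ι i) ℂ => P i := fun i =>
    continuous_apply i
  have he : PG X e = (⋂ i, {P | (P i)ᴴ = P i}) ∩ ((⋂ i, {P | P i * P i = P i}) ∩
      ((⋂ i, {P | (P i).trace = (e i : ℂ)}) ∩ ⋂ a, {P | (1 - P (t a)) * X a * P (s a) = 0})) := by
    ext P
    simp only [PG, Set.mem_ofPred_eq, Set.mem_inter_iff, Set.mem_iInter]
  rw [he]
  refine IsClosed.inter ?_ (IsClosed.inter ?_ (IsClosed.inter ?_ ?_))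
  · exact isClosed_iInter fun i => isClosed_eq (h1 i).matrix_conjTranspose (h1 i)
  · exact isClosed_iInter fun i => isClosed_eq ((h1 i).matrix_mul (h1 i)) (h1 i)
  · exact isClosed_iInter fun i => isClosed_eq (h1 i).matrix_trace continuous_const
  · exact isClosed_iInter fun a => isClosed_eq
      (((continuous_const.sub (h1 _)).matrix_mul continuous_const).matrix_mul (h1 _))
      continuous_const

theorem isCompact_PG (X : ∀ a : A, Matrix (ι (t a)) (ι (s a)) ℂ) (e : V → ℕ) :
    IsCompact (PG X e) := by
  have hK : IsCompact (Set.univ.pi fun i : V => (Set.univ.pi fun p : ι i =>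
      Set.univ.pi fun q : ι i => Metric.closedBall (0 : ℂ) 1 : Set (Matrix (ι i) (ι i) ℂ))) :=
    isCompact_univ_pi fun i => isCompact_univ_pi fun p => isCompact_univ_pi fun q =>
      isCompact_closedBall _ _
  refine hK.of_isClosed_subset (isClosed_PG X e) ?_
  intro P hP i _ p _ q _
  simpa using norm_entry_le (hP.1 i) (hP.2.1 i) p q

attribute [local instance] Matrix.linftyOpNormedRing Matrix.linftyOpNormedAlgebra

theorem continuousStar_matrices [Fintype V] :
    @ContinuousStar (∀ i, Matrix (ι i) (ι i) ℂ)
      (NormedRing.toNonUnitalNormedRing.toNormedAddCommGroup.toMetricSpace.toPseudoMetricSpace.toUniformSpace.toTopologicalSpace)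
      _ :=
  (inferInstance : @ContinuousStar (∀ i, Matrix (ι i) (ι i) ℂ) Pi.topologicalSpace _)

attribute [local instance] continuousStar_matrices

/-- The values of `B ↦ (1 - P) B P` on tuples of matrices. -/
def corner (s t : A → V) (P : ∀ i, Matrix (ι i) (ι i) ℂ) :
    Submodule ℝ (∀ a : A, Matrix (ι (t a)) (ι (s a)) ℂ) where
  carrier := {B | ∀ a, (1 - P (t a)) * B a * P (s a) = B a}
  add_mem' {a b} ha hb := fun i => by
    have h1 := ha i
    have h2 := hb i
    rw [Pi.add_apply, Matrix.mul_add, Matrix.add_mul, h1, h2]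
  zero_mem' := fun i => by simp
  smul_mem' c x hx := fun i => by
    have h1 := hx i
    rw [Pi.smul_apply, Matrix.mul_smul, Matrix.smul_mul, h1]

theorem hasCharts_PG [Fintype V] [Fintype A] (X : ∀ a : A, Matrix (ι (t a)) (ι (s a)) ℂ)
    (e : V → ℕ)
    (hX : ∀ B : ∀ a : A, Matrix (ι (t a)) (ι (s a)) ℂ,
      ∃ ψ : ∀ i, Matrix (ι i) (ι i) ℂ, ∀ a, X a * ψ (s a) - ψ (t a) * X a = B a) :
    HasCharts (PG X e) := by
  intro P hP
  have hproj : P ∈ Proj (∀ i, Matrix (ι i) (ι i) ℂ) := ⟨funext hP.1, funext hP.2.1⟩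
  have hPP : ∀ i, P i * P i = P i := hP.2.1
  have hQQ : ∀ i, (1 - P i) * (1 - P i) = 1 - P i := fun i => by
    rw [sub_mul, one_mul, mul_sub, mul_one, hPP, sub_self, sub_zero]
  let C : Set (∀ i, Matrix (ι i) (ι i) ℂ) :=
    {Q | (∀ i, (Q i).trace = e i) ∧ ∀ a, (1 - Q (t a)) * X a * Q (s a) = 0}
  have hPG : PG X e = Proj (∀ i, Matrix (ι i) (ι i) ℂ) ∩ C := by
    ext Q
    constructor
    · rintro ⟨h1, h2, h3, h4⟩
      exact ⟨⟨funext h1, funext h2⟩, h3, h4⟩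
    · rintro ⟨⟨h1, h2⟩, h3, h4⟩
      exact ⟨congrFun h1, congrFun h2, h3, h4⟩
  let Γ : (∀ i, Matrix (ι i) (ι i) ℂ) →ₗ[ℝ] (∀ i, Matrix (ι i) (ι i) ℂ) →ₗ[ℝ] corner s t P :=
    LinearMap.mk₂ ℝ (fun u v => ⟨fun a => (1 - P (t a)) * (u (t a) * X a * v (s a)) * P (s a),
      fun a => by
        simp only [← Matrix.mul_assoc, hQQ]
        rw [Matrix.mul_assoc _ (P (s a)) (P (s a)), hPP]⟩)
      (fun u u' v => by ext1; funext a; simp [Matrix.add_mul, Matrix.mul_add])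
      (fun c u v => by ext1; funext a; simp)
      (fun u v v' => by ext1; funext a; simp [Matrix.add_mul, Matrix.mul_add])
      (fun c u v => by ext1; funext a; simp)
  have hΓ : ∀ u v a, (Γ u v : ∀ a : A, Matrix (ι (t a)) (ι (s a)) ℂ) a =
      (1 - P (t a)) * (u (t a) * X a * v (s a)) * P (s a) := fun u v a => rfl
  rw [hPG]
  refine hasChart_at' hproj C Γ ?_ ⟨hP.2.2.1, hP.2.2.2⟩ ?_
  · intro g hg
    set g' := Ring.inverse g with hg'
    have e1 : ∀ i, g' i * g i = 1 := congrFun (Ring.inverse_mul_cancel _ hg)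
    have e2 : ∀ i, g i * g' i = 1 := congrFun (Ring.mul_inverse_cancel _ hg)
    have htr : ∀ i, ((g * P * g') i).trace = e i := fun i => by
      change (g i * P i * g' i).trace = e i
      rw [Matrix.trace_mul_comm, ← Matrix.mul_assoc, e1, Matrix.one_mul, hP.2.2.1]
    have hcon : ∀ a, (1 - (g * P * g') (t a)) * X a * (g * P * g') (s a) =
        g (t a) * ((1 - P (t a)) * (g' (t a) * X a * g (s a)) * P (s a)) * g' (s a) := fun a => by
      change (1 - g (t a) * P (t a) * g' (t a)) * X a * (g (s a) * P (s a) * g' (s a)) = _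
      have : 1 - g (t a) * P (t a) * g' (t a) = g (t a) * (1 - P (t a)) * g' (t a) := by
        rw [mul_sub, mul_one, sub_mul, e2]
      rw [this]
      simp only [Matrix.mul_assoc]
    constructor
    · rintro ⟨-, h⟩
      ext1
      funext a
      rw [hΓ]
      have := h a
      rw [hcon] at this
      have h2 := congrArg (fun Y => g' (t a) * Y * g (s a)) this
      simp only [Matrix.mul_zero, Matrix.zero_mul] at h2
      rw [← Matrix.mul_assoc, ← Matrix.mul_assoc, e1, Matrix.one_mul, Matrix.mul_assoc, e1,
        Matrix.mul_one] at h2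
      exact h2
    · intro h
      refine ⟨htr, fun a => ?_⟩
      rw [hcon, ← hΓ, h]
      simp
  · rintro ⟨B, hB⟩
    obtain ⟨ψ, hψ⟩ := hX B
    have hm : (1 - P) * ψ * P ∈ offDiag P := by
      change (1 - P) * ((1 - P) * ψ * P) * P = (1 - P) * ψ * P
      have : (1 - P) * (1 - P) = 1 - P := funext hQQ
      simp only [← mul_assoc, this]
      rw [mul_assoc _ P P, hproj.2]
    obtain ⟨-, -, h3, h4⟩ := offDiag_rels hproj hm
    refine ⟨(1 - P) * ψ * P, hm, ?_⟩
    set φ := (1 - P) * ψ * P with hφ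
    have k1 : ∀ i, star φ i * P i = 0 := congrFun h3
    have k2 : ∀ i, (1 - P i) * star φ i = 0 := fun i => by
      have := congrFun h4 i
      rw [Pi.mul_apply] at this
      rw [sub_mul, one_mul, this, sub_self]
    have k3 : ∀ i, φ i * P i = ψ i * P i - P i * ψ i * P i := fun i => by
      change (1 - P i) * ψ i * P i * P i = _
      rw [mul_assoc _ (P i) (P i), hPP, sub_mul, sub_mul, one_mul]
    have k4 : ∀ i, (1 - P i) * φ i = (1 - P i) * ψ i * P i := fun i => by
      change (1 - P i) * ((1 - P i) * ψ i * P i) = _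
      simp only [← mul_assoc, hQQ]
    ext1
    funext a
    change (Γ 1 (φ - star φ)).1 a - (Γ (φ - star φ) 1).1 a = B a
    rw [hΓ, hΓ]
    have hPa := hP.2.2.2 a
    have hPa' : (1 - P (t a)) * X a = (1 - P (t a)) * X a * (1 - P (s a)) := by
      rw [Matrix.mul_sub, Matrix.mul_one, hPa, sub_zero]
    have hPa'' : X a * P (s a) = P (t a) * X a * P (s a) := by
      rw [Matrix.sub_mul, Matrix.sub_mul, Matrix.one_mul, sub_eq_zero] at hPa
      exact hPa
    have l1 : (1 - P (t a)) * ((1 : ∀ i, Matrix (ι i) (ι i) ℂ) (t a) * X a *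
        (φ - star φ) (s a)) * P (s a) = (1 - P (t a)) * (X a * ψ (s a)) * P (s a) := by
      have : (φ - star φ) (s a) * P (s a) = ψ (s a) * P (s a) - P (s a) * ψ (s a) * P (s a) := by
        rw [Pi.sub_apply, sub_mul, k1, sub_zero, k3]
      rw [Pi.one_apply, Matrix.one_mul, Matrix.mul_assoc, Matrix.mul_assoc, this,
        ← Matrix.mul_assoc, Matrix.mul_sub]
      simp only [← Matrix.mul_assoc]
      rw [hPa, Matrix.zero_mul, Matrix.zero_mul, sub_zero]
    have l2 : (1 - P (t a)) * ((φ - star φ) (t a) * X a *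
        (1 : ∀ i, Matrix (ι i) (ι i) ℂ) (s a)) * P (s a) =
        (1 - P (t a)) * (ψ (t a) * X a) * P (s a) := by
      have : (1 - P (t a)) * (φ - star φ) (t a) = (1 - P (t a)) * ψ (t a) * P (t a) := by
        rw [Pi.sub_apply, mul_sub, k2, sub_zero, k4]
      rw [Pi.one_apply, Matrix.mul_one, ← Matrix.mul_assoc, this]
      simp only [Matrix.mul_assoc]
      conv_rhs => rw [hPa'', Matrix.mul_assoc]
    rw [l1, l2, ← Matrix.sub_mul, ← Matrix.mul_sub, hψ]
    exact hB a

theorem good_PG [Fintype V] [Fintype A] (X : ∀ a : A, Matrix (ι (t a)) (ι (s a)) ℂ)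
    (e : V → ℕ)
    (hX : ∀ B : ∀ a : A, Matrix (ι (t a)) (ι (s a)) ℂ,
      ∃ ψ : ∀ i, Matrix (ι i) (ι i) ℂ, ∀ a, X a * ψ (s a) - ψ (t a) * X a = B a) :
    ∃ (Y : Type) (_ : MetricSpace Y) (_ : CompactSpace Y), Good Y ∧
      Nonempty (PG X e ≃ₜ Y) := by
  let n := Module.finrank ℝ (∀ i, Matrix (ι i) (ι i) ℂ)
  let L : (∀ i, Matrix (ι i) (ι i) ℂ) ≃L[ℝ] EuclideanSpace ℝ (Fin n) :=
    ContinuousLinearEquiv.ofFinrankEq (by simp [n])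
  let Φ : (∀ i, Matrix (ι i) (ι i) ℂ) ≃ₜ EuclideanSpace ℝ (Fin n) := L.toHomeomorph
  have hc : IsCompact (Φ '' PG X e) := (isCompact_PG X e).image Φ.continuous
  refine ⟨↥(Φ '' PG X e), inferInstance, isCompact_iff_compactSpace.1 hc, ?_,
    ⟨Φ.image (PG X e)⟩⟩
  exact ((hasCharts_PG X e hX).locSmooth L).good hc

end

end FPoly

namespace FPoly

open Topology TopologicalSpace
open scoped ComplexOrder

section
variable {m n k : Type} [Fintype m] [Fintype n] [Fintype k] [DecidableEq m] [DecidableEq n]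
  [DecidableEq k]

theorem range_le_iff {A : Matrix m n ℂ} {B : Matrix m k ℂ} :
    LinearMap.range B.mulVecLin ≤ LinearMap.range A.mulVecLin ↔ ∃ G : Matrix n k ℂ, B = A * G := by
  constructor
  · intro h
    have h1 : ∀ j, ∃ v, A *ᵥ v = B.col j := fun j => by
      have := h ⟨Pi.single j 1, rfl⟩
      obtain ⟨v, hv⟩ := this
      exact ⟨v, by simpa using hv⟩
    choose v hv using h1
    refine ⟨Matrix.of fun i j => v j i, ?_⟩
    ext i j
    have := congrFun (hv j) i
    simpa [Matrix.mul_apply, Matrix.mulVec, dotProduct] using this.symm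
  · rintro ⟨G, rfl⟩
    rw [Matrix.mulVecLin_mul]
    exact LinearMap.range_comp_le_range _ _

theorem isUnit_det_gram {A : Matrix m n ℂ} (hA : Function.Injective A.mulVecLin) :
    IsUnit (Aᴴ * A).det := by
  rw [← Matrix.isUnit_iff_isUnit_det, ← Matrix.mulVec_injective_iff_isUnit]
  have h1 : LinearMap.ker (Aᴴ * A).mulVecLin = ⊥ := by
    rw [Matrix.ker_mulVecLin_conjTranspose_mul_self]
    exact LinearMap.ker_eq_bot.2 hA
  exact LinearMap.ker_eq_bot.1 h1

/-- The orthogonal projection onto the column space of an injective matrix. -/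
def colProj (A : Matrix m n ℂ) : Matrix m m ℂ := A * (Aᴴ * A)⁻¹ * Aᴴ

theorem colProj_conjTranspose (A : Matrix m n ℂ) : (colProj A)ᴴ = colProj A := by
  simp [colProj, Matrix.conjTranspose_mul, Matrix.conjTranspose_nonsing_inv, Matrix.mul_assoc]

theorem colProj_mul {A : Matrix m n ℂ} (hA : Function.Injective A.mulVecLin) :
    colProj A * A = A := by
  rw [colProj, Matrix.mul_assoc, Matrix.mul_assoc, Matrix.nonsing_inv_mul _ (isUnit_det_gram hA),
    Matrix.mul_one]

theorem colProj_idem {A : Matrix m n ℂ} (hA : Function.Injective A.mulVecLin) :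
    colProj A * colProj A = colProj A := by
  have h : colProj A * (A * (Aᴴ * A)⁻¹ * Aᴴ) = A * (Aᴴ * A)⁻¹ * Aᴴ := by
    rw [← Matrix.mul_assoc, ← Matrix.mul_assoc, colProj_mul hA]
  exact h

theorem colProj_trace {A : Matrix m n ℂ} (hA : Function.Injective A.mulVecLin) :
    (colProj A).trace = Fintype.card n := by
  rw [colProj, Matrix.mul_assoc, Matrix.trace_mul_comm, Matrix.mul_assoc,
    Matrix.nonsing_inv_mul _ (isUnit_det_gram hA), Matrix.trace_one]

theorem colProj_range {A : Matrix m n ℂ} (hA : Function.Injective A.mulVecLin) :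
    LinearMap.range (colProj A).mulVecLin = LinearMap.range A.mulVecLin := by
  refine le_antisymm (range_le_iff.2 ⟨_, Matrix.mul_assoc _ _ _⟩) (range_le_iff.2 ⟨A, ?_⟩)
  exact (colProj_mul hA).symm

theorem continuous_inv_of_det {X : Type} [TopologicalSpace X] {f : X → Matrix n n ℂ}
    (hf : Continuous f) (h : ∀ x, IsUnit (f x).det) : Continuous fun x => (f x)⁻¹ := by
  simp only [Matrix.inv_def, Ring.inverse_eq_inv']
  exact (hf.matrix_det.inv₀ fun x => (h x).ne_zero).smul hf.matrix_adjugate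

theorem proj_ext {P Q : Matrix m m ℂ} (hP : Pᴴ = P) (hP' : P * P = P) (hQ : Qᴴ = Q)
    (hQ' : Q * Q = Q)
    (h : LinearMap.range P.mulVecLin = LinearMap.range Q.mulVecLin) : P = Q := by
  obtain ⟨G, hG⟩ := range_le_iff.1 h.le
  obtain ⟨G', hG'⟩ := range_le_iff.1 h.ge
  have h1 : Q * P = P := by rw [hG, ← Matrix.mul_assoc, hQ']
  have h2 : P * Q = Q := by rw [hG', ← Matrix.mul_assoc, hP']
  have := congrArg Matrix.conjTranspose h1
  rw [Matrix.conjTranspose_mul, hP, hQ, h2] at this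
  exact this.symm

theorem finrank_range_proj {P : Matrix m m ℂ} (hP : P * P = P) {r : ℕ}
    (ht : P.trace = r) : Module.finrank ℂ (LinearMap.range P.mulVecLin) = r := by
  have hi : IsIdempotentElem P.mulVecLin := by
    change P.mulVecLin ∘ₗ P.mulVecLin = _
    rw [← Matrix.mulVecLin_mul, hP]
  have h1 := ((LinearMap.isProj_range_iff_isIdempotentElem _).2 hi).trace
  have h2 : LinearMap.trace ℂ _ P.mulVecLin = P.trace := by
    rw [← Matrix.toLin'_apply', Matrix.trace_toLin'_eq]
  rw [h2, ht] at h1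
  exact_mod_cast h1.symm

end

section
variable {V A : Type} {s t : A → V} {ι : V → Type} [∀ i, Fintype (ι i)] [∀ i, DecidableEq (ι i)]
  {d e : V → ℕ} {X : QRep s t d} {X' : ∀ a : A, Matrix (ι (t a)) (ι (s a)) ℂ}
  {γ : ∀ i, Matrix (ι i) (Fin (d i)) ℂ} {δ : ∀ i, Matrix (Fin (d i)) (ι i) ℂ}

theorem matOf_continuous (i : V) : Continuous fun F : Coord d e => matOf F i :=
  continuous_pi fun p => continuous_pi fun q => continuous_apply _

theorem toSub_surjective : Function.Surjective (toSub s t X e) := by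
  rintro ⟨N, hN, hX⟩
  have h : ∀ i, ∃ F : Matrix (Fin (d i)) (Fin (e i)) ℂ, Function.Injective F.mulVecLin ∧
      LinearMap.range F.mulVecLin = N i := fun i => by
    let b := Module.finBasisOfFinrankEq ℂ (N i) (hN i)
    let L : (Fin (e i) → ℂ) →ₗ[ℂ] (Fin (d i) → ℂ) :=
      (N i).subtype ∘ₗ b.equivFun.symm.toLinearMap
    refine ⟨LinearMap.toMatrix' L, ?_, ?_⟩
    · rw [← Matrix.toLin'_apply', Matrix.toLin'_toMatrix']
      exact Subtype.val_injective.comp b.equivFun.symm.injective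
    · rw [← Matrix.toLin'_apply', Matrix.toLin'_toMatrix', LinearMap.range_comp,
        LinearEquiv.range, Submodule.map_top, Submodule.range_subtype]
  choose F hF hF' using h
  have hm : ∀ i, matOf (fun x : Σ i : V, Fin (d i) × Fin (e i) => F x.1 x.2.1 x.2.2) i = F i :=
    fun i => rfl
  refine ⟨⟨fun x => F x.1 x.2.1 x.2.2, fun i => by rw [hm]; exact hF i, fun a => ?_⟩, ?_⟩
  · rw [hm, hm, hF', hF']
    exact hX a
  · exact Subtype.ext (funext fun i => hF' i)

theorem subRep_homeo [Finite V] (h1 : ∀ i, γ i * δ i = 1) (h2 : ∀ i, δ i * γ i = 1)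
    (hγ : ∀ a, X' a * γ (s a) = γ (t a) * X a) :
    Nonempty (SubRep s t X e ≃ₜ PG X' e) := by
  have hδ : ∀ a, X a * δ (s a) = δ (t a) * X' a := fun a => by
    have := congrArg (fun Y => δ (t a) * Y * δ (s a)) (hγ a)
    rw [← Matrix.mul_assoc, ← Matrix.mul_assoc, h2, Matrix.one_mul, Matrix.mul_assoc,
      Matrix.mul_assoc, h1, Matrix.mul_one] at this
    exact this.symm
  have hγi : ∀ i, Function.Injective (γ i).mulVecLin := fun i =>
    Function.LeftInverse.injective (g := (δ i).mulVecLin) fun v => by simp [h2]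
  have hδi : ∀ i, Function.Injective (δ i).mulVecLin := fun i =>
    Function.LeftInverse.injective (g := (γ i).mulVecLin) fun v => by simp [h1]
  let ψ : PG X' e → SubRep s t X e := fun P =>
    ⟨fun i => (LinearMap.range (P.1 i).mulVecLin).map (δ i).mulVecLin, fun i => by
      rw [← (Submodule.equivMapOfInjective _ (hδi i) _).finrank_eq]
      exact finrank_range_proj (P.2.2.1 i) (P.2.2.2.1 i), fun a => by
      have h3 := P.2.2.2.2 a
      rw [Matrix.sub_mul, Matrix.sub_mul, Matrix.one_mul, sub_eq_zero] at h3
      rintro _ ⟨_, ⟨_, ⟨v, rfl⟩, rfl⟩, rfl⟩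
      refine ⟨(P.1 (t a)).mulVecLin ((X' a * P.1 (s a)) *ᵥ v), ⟨_, rfl⟩, ?_⟩
      simp only [Matrix.mulVecLin_apply, Matrix.mulVec_mulVec]
      rw [← Matrix.mul_assoc _ (X' a), ← h3, ← Matrix.mul_assoc, ← hδ, Matrix.mul_assoc]⟩
  have hψ : ∀ P i, (ψ P).1 i = (LinearMap.range (P.1 i).mulVecLin).map (δ i).mulVecLin :=
    fun P i => rfl
  have hinjF : ∀ (F : StQ s t X e) i, Function.Injective (γ i * matOf F.1 i).mulVecLin :=
    fun F i => by
      rw [Matrix.mulVecLin_mul]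
      exact (hγi i).comp (F.2.1 i)
  let pr : StQ s t X e → PG X' e := fun F =>
    ⟨fun i => colProj (γ i * matOf F.1 i), fun i => colProj_conjTranspose _,
      fun i => colProj_idem (hinjF F i), fun i => by rw [colProj_trace (hinjF F i)]; simp,
      fun a => by
        have h3 : LinearMap.range (X a * matOf F.1 (s a)).mulVecLin ≤
            LinearMap.range (matOf F.1 (t a)).mulVecLin := by
          rw [Matrix.mulVecLin_mul, LinearMap.range_comp]
          exact F.2.2 a
        obtain ⟨G, hG⟩ := range_le_iff.1 h3
        have h4 : (1 - colProj (γ (t a) * matOf F.1 (t a))) * X' a *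
            (γ (s a) * matOf F.1 (s a)) = 0 := by
          rw [Matrix.mul_assoc, ← Matrix.mul_assoc (X' a), hγ, Matrix.mul_assoc (γ (t a)), hG,
            ← Matrix.mul_assoc (γ (t a)), Matrix.sub_mul, Matrix.one_mul,
            ← Matrix.mul_assoc (colProj _), colProj_mul (hinjF F _), sub_self]
        change (1 - colProj (γ (t a) * matOf F.1 (t a))) * X' a *
            ((γ (s a) * matOf F.1 (s a)) * _ * _) = 0
        rw [← Matrix.mul_assoc, ← Matrix.mul_assoc, h4, Matrix.zero_mul, Matrix.zero_mul]⟩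
  have hprc : @Continuous _ _ (TopologicalSpace.induced Subtype.val inferInstance) _ pr := by
    let _ : TopologicalSpace (StQ s t X e) := TopologicalSpace.induced Subtype.val inferInstance
    refine Continuous.subtype_mk (continuous_pi fun i => ?_) _
    have c1 : Continuous fun F : StQ s t X e => γ i * matOf F.1 i :=
      continuous_const.matrix_mul ((matOf_continuous i).comp continuous_induced_dom)
    exact (c1.matrix_mul (continuous_inv_of_det (c1.matrix_conjTranspose.matrix_mul c1)
      fun F => isUnit_det_gram (hinjF F i))).matrix_mul c1.matrix_conjTranspose
  have hψpr : ∀ F, ψ (pr F) = toSub s t X e F := fun F => by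
    refine Subtype.ext (funext fun i => ?_)
    rw [hψ]
    change (LinearMap.range (colProj (γ i * matOf F.1 i)).mulVecLin).map (δ i).mulVecLin = _
    rw [colProj_range (hinjF F i), ← LinearMap.range_comp, ← Matrix.mulVecLin_mul,
      ← Matrix.mul_assoc, h2, Matrix.one_mul]
    rfl
  have hinj : Function.Injective ψ := fun P Q h => by
    refine Subtype.ext (funext fun i => ?_)
    refine proj_ext (P.2.1 i) (P.2.2.1 i) (Q.2.1 i) (Q.2.2.1 i) ?_
    have := congrFun (congrArg Subtype.val h) i
    rw [hψ, hψ] at this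
    exact Submodule.map_injective_of_injective (hδi i) this
  have hsurj : Function.Surjective ψ := fun N => by
    obtain ⟨F, rfl⟩ := toSub_surjective N
    exact ⟨pr F, hψpr F⟩
  let E : PG X' e ≃ SubRep s t X e := Equiv.ofBijective ψ ⟨hinj, hsurj⟩
  have hE1 : Continuous E.symm := by
    refine continuous_coinduced_dom.2 ?_
    have : E.symm ∘ toSub s t X e = pr := by
      funext F
      exact E.injective ((E.apply_symm_apply _).trans (hψpr F).symm)
    rw [this]
    exact hprc
  have hE2 : Continuous ψ := by
    rw [continuous_iff_continuousAt]
    intro P₀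
    obtain ⟨F₀, hF₀⟩ := toSub_surjective (ψ P₀)
    have hP₀ : pr F₀ = P₀ := hinj ((hψpr F₀).trans hF₀)
    set B : ∀ i, Matrix (ι i) (Fin (e i)) ℂ := fun i => γ i * matOf F₀.1 i with hB
    have hPB : ∀ i, P₀.1 i * B i = B i := fun i => by
      rw [← hP₀]
      exact colProj_mul (hinjF F₀ i)
    let O : Set (PG X' e) := {P | ∀ i, ((B i)ᴴ * P.1 i * B i).det ≠ 0}
    have hdc : ∀ i, Continuous fun P : PG X' e => ((B i)ᴴ * P.1 i * B i).det := fun i =>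
      ((continuous_const.matrix_mul ((continuous_apply i).comp continuous_subtype_val)).matrix_mul
        continuous_const).matrix_det
    have hO : IsOpen O := by
      have : O = ⋂ i, {P : PG X' e | ((B i)ᴴ * P.1 i * B i).det ≠ 0} := by
        ext P
        simp [O]
      rw [this]
      exact isOpen_iInter_of_finite fun i => isOpen_ne_fun (hdc i) continuous_const
    have hP₀O : P₀ ∈ O := fun i => by
      rw [Matrix.mul_assoc, hPB]
      exact (isUnit_det_gram (hinjF F₀ i)).ne_zero
    have hGi : ∀ P ∈ O, ∀ i, Function.Injective (δ i * P.1 i * B i).mulVecLin := fun P hP i => by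
      have h5 : Function.Injective (((B i)ᴴ * γ i) * (δ i * P.1 i * B i)).mulVec := by
        have h6 : ((B i)ᴴ * γ i) * (δ i * P.1 i * B i) = (B i)ᴴ * P.1 i * B i := by
          rw [Matrix.mul_assoc, Matrix.mul_assoc (δ i), ← Matrix.mul_assoc (γ i), h1,
            Matrix.one_mul, Matrix.mul_assoc]
        rw [h6, Matrix.mulVec_injective_iff_isUnit, Matrix.isUnit_iff_isUnit_det]
        exact (hP i).isUnit
      have h7 : Function.Injective
          ((((B i)ᴴ * γ i).mulVecLin : _ → _) ∘ ((δ i * P.1 i * B i).mulVecLin : _ → _)) := by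
        rw [← LinearMap.coe_comp, ← Matrix.mulVecLin_mul]
        exact h5
      exact h7.of_comp
    have hGr : ∀ P (_ : P ∈ O) i,
        LinearMap.range (δ i * P.1 i * B i).mulVecLin = (ψ P).1 i := fun P hP i => by
      refine Submodule.eq_of_le_of_finrank_eq ?_ ?_
      · rw [hψ, ← LinearMap.range_comp, ← Matrix.mulVecLin_mul]
        exact range_le_iff.2 ⟨_, rfl⟩
      · rw [LinearMap.finrank_range_of_inj (hGi P hP i), (ψ P).2.1 i]
        exact Module.finrank_fin_fun ℂ
    let G : O → StQ s t X e := fun P =>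
      ⟨fun x => (δ x.1 * P.1.1 x.1 * B x.1) x.2.1 x.2.2, fun i => hGi P.1 P.2 i, fun a => by
        have h5 := (ψ P.1).2.2 a
        rw [← hGr P.1 P.2, ← hGr P.1 P.2] at h5
        exact h5⟩
    have hGc : @Continuous _ _ _ (TopologicalSpace.induced Subtype.val inferInstance) G := by
      refine continuous_induced_rng.2 (continuous_pi fun x => ?_)
      have c1 : Continuous fun P : O => δ x.1 * P.1.1 x.1 * B x.1 :=
        (continuous_const.matrix_mul ((continuous_apply x.1).comp
          (continuous_subtype_val.comp continuous_subtype_val))).matrix_mul continuous_const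
      exact c1.matrix_elem _ _
    have hGψ : (toSub s t X e) ∘ G = O.domRestrict ψ := by
      funext P
      exact Subtype.ext (funext fun i => hGr P.1 P.2 i)
    have hc : ContinuousOn ψ O := by
      rw [continuousOn_iff_continuous_domRestrict, ← hGψ]
      let _ : TopologicalSpace (StQ s t X e) := TopologicalSpace.induced Subtype.val inferInstance
      exact continuous_coinduced_rng.comp hGc
    exact hc.continuousAt (hO.mem_nhds hP₀O)
  exact ⟨⟨E.symm, hE1, hE2⟩⟩

end

end FPoly

namespace FPoly

open Topology TopologicalSpace

section
variable {Z H H' : Type} [TopologicalSpace Z] [NormedAddCommGroup H] [NormedSpace ℂ H]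
  [FiniteDimensional ℂ H] [NormedAddCommGroup H'] [NormedSpace ℂ H'] [FiniteDimensional ℂ H']

/-- The solution set of a continuous family of consistent linear equations of constant corank is
locally trivial. -/
theorem linear_bundle {D : Z → H →L[ℂ] H'} {κ : Z → H'} (hD : Continuous D) (hκ : Continuous κ)
    (hr : ∀ z, κ z ∈ LinearMap.range (D z).toLinearMap)
    (z₀ : Z)
    (hk : ∀ᶠ z in 𝓝 z₀, Module.finrank ℂ (LinearMap.ker (D z).toLinearMap) =
      Module.finrank ℂ (LinearMap.ker (D z₀).toLinearMap)) :
    ∃ O ∈ 𝓝 z₀, ∃ K : Submodule ℂ H,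
      ∃ e : ↥{x : {x : Z × H // D x.1 x.2 = κ x.1} | x.1.1 ∈ O} ≃ₜ ↥O × K,
        ∀ x, ((e x).1 : Z) = x.1.1.1 := by
  set R := LinearMap.range (D z₀).toLinearMap with hR
  set K := LinearMap.ker (D z₀).toLinearMap with hK
  obtain ⟨pR, hpR⟩ := R.subtype.exists_leftInverse_of_injective (Submodule.ker_subtype _)
  obtain ⟨pK, hpK⟩ := K.subtype.exists_leftInverse_of_injective (Submodule.ker_subtype _)
  let pR' : H' →L[ℂ] R := LinearMap.toContinuousLinearMap pR
  let pK' : H →L[ℂ] K := LinearMap.toContinuousLinearMap pK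
  let Θ : Z → H →L[ℂ] R × K := fun z => (pR'.comp (D z)).prod pK'
  have hΘ : Continuous Θ := by
    rw [continuous_clm_apply] at hD ⊢
    exact fun h => (pR'.continuous.comp (hD h)).prodMk continuous_const
  have hΘ0 : Function.Injective (Θ z₀).toLinearMap := by
    rw [← LinearMap.ker_eq_bot, LinearMap.ker_eq_bot']
    intro h hh
    have h1 : pR (D z₀ h) = 0 := congrArg Prod.fst hh
    have h2 : pK h = 0 := congrArg Prod.snd hh
    have h3 : pR (D z₀ h) = ⟨D z₀ h, h, rfl⟩ := LinearMap.congr_fun hpR ⟨D z₀ h, h, rfl⟩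
    have h4 : h ∈ K := congrArg Subtype.val (h3.symm.trans h1)
    have h5 : pK h = ⟨h, h4⟩ := LinearMap.congr_fun hpK ⟨h, h4⟩
    exact congrArg Subtype.val (h5.symm.trans h2)
  have hdim : Module.finrank ℂ H = Module.finrank ℂ (R × K) := by
    rw [Module.finrank_prod]
    exact ((D z₀).toLinearMap.finrank_range_add_finrank_ker).symm
  let Θ₀ : H ≃L[ℂ] R × K :=
    (LinearEquiv.ofInjectiveOfFinrankEq (Θ z₀).toLinearMap hΘ0 hdim).toContinuousLinearEquiv
  have hΘ₀ : (Θ₀ : H →L[ℂ] R × K) = Θ z₀ := by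
    ext1 h
    rfl
  let O : Set Z := {z | Θ z ∈ Set.range ((↑) : (H ≃L[ℂ] R × K) → H →L[ℂ] R × K)} ∩
    {z | Module.finrank ℂ (LinearMap.ker (D z).toLinearMap) = Module.finrank ℂ K}
  have hO : O ∈ 𝓝 z₀ := by
    refine Filter.inter_mem ?_ hk
    exact hΘ.continuousAt.preimage_mem_nhds
      (ContinuousLinearEquiv.isOpen.mem_nhds ⟨Θ₀, hΘ₀⟩)
  have hinv : ∀ z ∈ O, (Θ z).inverse ∘L Θ z = ContinuousLinearMap.id ℂ H ∧
      Θ z ∘L (Θ z).inverse = ContinuousLinearMap.id ℂ (R × K) := by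
    rintro z ⟨⟨e, he⟩, -⟩
    rw [← he, ContinuousLinearMap.inverse_equiv]
    exact ⟨e.coe_symm_comp_coe, e.coe_comp_coe_symm⟩
  have hci : ∀ z ∈ O, ContinuousAt (fun z => (Θ z).inverse) z := by
    rintro z ⟨⟨e, he⟩, -⟩
    have := (contDiffAt_map_inverse (𝕜 := ℂ) (n := 0) e).continuousAt
    rw [he] at this
    exact ContinuousAt.comp this hΘ.continuousAt
  have hsol : ∀ z ∈ O, ∀ h, pR (D z h) = pR (κ z) → D z h = κ z := by
    intro z hz h hh
    have h1 : Function.Surjective (pR.domRestrict (LinearMap.range (D z).toLinearMap)) := by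
      intro r
      refine ⟨⟨D z ((Θ z).inverse (r, 0)), _, rfl⟩, ?_⟩
      exact congrArg Prod.fst (DFunLike.congr_fun (hinv z hz).2 (r, 0))
    have h2 : Module.finrank ℂ (LinearMap.range (D z).toLinearMap) = Module.finrank ℂ R := by
      have e1 := (D z).toLinearMap.finrank_range_add_finrank_ker
      have e2 := (D z₀).toLinearMap.finrank_range_add_finrank_ker
      have e3 := hz.2
      simp only [Set.mem_ofPred_eq] at e3
      rw [← hK, ← hR] at e2
      omega
    have h3 := (LinearMap.injective_iff_surjective_of_finrank_eq_finrank h2).2 h1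
    have h4 := @h3 ⟨D z h, h, rfl⟩ ⟨κ z, hr z⟩ hh
    exact congrArg Subtype.val h4
  refine ⟨O, hO, K, ⟨⟨fun x => (⟨x.1.1.1, x.2⟩, pK' x.1.1.2),
    fun y => ⟨⟨(y.1.1, (Θ y.1.1).inverse (pR' (κ y.1.1), y.2)), ?_⟩, y.1.2⟩, ?_, ?_⟩, ?_, ?_⟩,
    fun x => rfl⟩
  · refine hsol _ y.1.2 _ ?_
    exact congrArg Prod.fst (DFunLike.congr_fun (hinv _ y.1.2).2 (pR' (κ y.1.1), y.2))
  · rintro ⟨⟨⟨z, h⟩, hx⟩, hz⟩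
    refine Subtype.ext (Subtype.ext (Prod.ext rfl ?_))
    have h1 : (pR' (κ z), pK' h) = Θ z h := by
      rw [← show D z h = κ z from hx]
      rfl
    change (Θ z).inverse (pR' (κ z), pK' h) = h
    rw [h1]
    exact DFunLike.congr_fun (hinv z hz).1 h
  · rintro ⟨⟨z, hz⟩, k⟩
    refine Prod.ext rfl ?_
    change pK' ((Θ z).inverse (pR' (κ z), k)) = k
    exact congrArg Prod.snd (DFunLike.congr_fun (hinv _ hz).2 (pR' (κ z), k))
  · refine Continuous.prodMk ?_ ?_
    · exact (continuous_fst.comp (continuous_subtype_val.comp continuous_subtype_val)).subtype_mk _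
    · exact pK'.continuous.comp (continuous_snd.comp
        (continuous_subtype_val.comp continuous_subtype_val))
  · refine Continuous.subtype_mk (Continuous.subtype_mk (Continuous.prodMk ?_ ?_) _) _
    · exact continuous_subtype_val.comp continuous_fst
    · have c1 : Continuous fun z : O => (Θ z).inverse :=
        continuous_iff_continuousAt.2 fun z =>
          ContinuousAt.comp (f := Subtype.val) (hci z z.2) continuous_subtype_val.continuousAt
      exact (c1.comp continuous_fst).clm_apply
        ((pR'.continuous.comp (hκ.comp (continuous_subtype_val.comp continuous_fst))).prodMk
          continuous_snd)

/-- The rank of a continuous family of idempotents is locally constant. -/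
theorem eventually_finrank_range_idem {F : Z → H →L[ℂ] H} (hF : Continuous F)
    (hi : ∀ z, F z ∘L F z = F z) (z₀ : Z) :
    ∀ᶠ z in 𝓝 z₀, Module.finrank ℂ (LinearMap.range (F z).toLinearMap) =
      Module.finrank ℂ (LinearMap.range (F z₀).toLinearMap) := by
  have h1 : ∀ z, LinearMap.trace ℂ H (F z).toLinearMap =
      Module.finrank ℂ (LinearMap.range (F z).toLinearMap) := fun z =>
    ((LinearMap.isProj_range_iff_isIdempotentElem _).2
      (congrArg ContinuousLinearMap.toLinearMap (hi z))).trace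
  let tr : (H →L[ℂ] H) →ₗ[ℂ] ℂ := LinearMap.trace ℂ H ∘ₗ ContinuousLinearMap.coeLM ℂ
  have h2 : Continuous fun z => tr (F z) := tr.continuous_of_finiteDimensional.comp hF
  have h3 : ∀ᶠ z in 𝓝 z₀, dist (tr (F z)) (tr (F z₀)) < 1 :=
    h2.continuousAt.eventually (Metric.ball_mem_nhds _ one_pos)
  filter_upwards [h3] with z hz
  have h4 : ∀ z, tr (F z) = Module.finrank ℂ (LinearMap.range (F z).toLinearMap) := h1
  have h6 : ∀ m n : ℕ, (m : ℂ) - n = ((m - n : ℤ) : ℂ) := fun m n => by push_cast; rfl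
  rw [h4, h4, Complex.dist_eq, h6, Complex.norm_intCast] at hz
  have h5 : |((Module.finrank ℂ (LinearMap.range (F z).toLinearMap) : ℤ) -
      (Module.finrank ℂ (LinearMap.range (F z₀).toLinearMap) : ℤ))| < 1 := by exact_mod_cast hz
  have := Int.abs_lt_one_iff.1 h5
  omega

end

end FPoly

namespace FPoly

open Topology TopologicalSpace
open scoped ComplexOrder

section
variable {m n k l : Type} [Fintype m] [Fintype n] [DecidableEq m] [DecidableEq n]
  [Fintype k] [Fintype l] [DecidableEq k] [DecidableEq l]
  {P : Matrix m m ℂ} {Q : Matrix n n ℂ} {h : Matrix m n ℂ}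

theorem isUnit_gramOne (h : Matrix m n ℂ) : IsUnit (1 + hᴴ * h).det :=
  (Matrix.isUnit_iff_isUnit_det _).1
    (Matrix.PosDef.one.add_posSemidef (Matrix.posSemidef_conjTranspose_mul_self h)).isUnit

/-- The inverse of `1 + hᴴ h`. -/
def gramInv (h : Matrix m n ℂ) : Matrix n n ℂ := (1 + hᴴ * h)⁻¹

theorem gramInv_mul (h : Matrix m n ℂ) : gramInv h * (hᴴ * h) = 1 - gramInv h := by
  have := Matrix.nonsing_inv_mul _ (isUnit_gramOne h)
  rw [Matrix.mul_add, Matrix.mul_one] at this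
  exact eq_sub_of_add_eq' this

theorem mul_gramInv (h : Matrix m n ℂ) : hᴴ * h * gramInv h = 1 - gramInv h := by
  have := Matrix.mul_nonsing_inv _ (isUnit_gramOne h)
  rw [Matrix.add_mul, Matrix.one_mul] at this
  exact eq_sub_of_add_eq' this

theorem gramInv_conjTranspose (h : Matrix m n ℂ) : (gramInv h)ᴴ = gramInv h := by
  simp [gramInv, Matrix.conjTranspose_nonsing_inv]

theorem gramInv_eq {X : Matrix n l ℂ} {Y : Matrix n l ℂ} (hX : X + hᴴ * h * X = Y) :
    gramInv h * Y = X := by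
  rw [← hX, Matrix.mul_add, ← Matrix.mul_assoc, gramInv_mul, Matrix.sub_mul, Matrix.one_mul,
    add_sub_cancel]

theorem gramInv_comm (hQ : Qᴴ = Q) (hh : h * Q = h) : gramInv h * Q = Q * gramInv h := by
  have h1 : Q * hᴴ = hᴴ := by
    have := congrArg Matrix.conjTranspose hh
    rwa [Matrix.conjTranspose_mul, hQ] at this
  refine gramInv_eq ?_
  have h2 : hᴴ * h * Q = Q * (hᴴ * h) := by
    rw [Matrix.mul_assoc, hh, ← Matrix.mul_assoc, h1]
  rw [← Matrix.mul_assoc, h2, Matrix.mul_assoc, mul_gramInv, Matrix.mul_sub, Matrix.mul_one,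
    add_sub_cancel]

/-- The block triangular idempotent attached to `(P, Q, h)`. -/
def triIdem (P : Matrix m m ℂ) (Q : Matrix n n ℂ) (h : Matrix m n ℂ) :
    Matrix (m ⊕ n) (m ⊕ n) ℂ := fromBlocks P h 0 Q

/-- The orthogonal projection with the same range as `triIdem`. -/
def triProj (P : Matrix m m ℂ) (Q : Matrix n n ℂ) (h : Matrix m n ℂ) :
    Matrix (m ⊕ n) (m ⊕ n) ℂ :=
  fromBlocks (P + h * gramInv h * hᴴ) (h * gramInv h) (gramInv h * hᴴ) (gramInv h * Q)

/-- Data `(P, Q, h)` describing a subspace of a direct sum. -/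
structure TriData (P : Matrix m m ℂ) (Q : Matrix n n ℂ) (h : Matrix m n ℂ) : Prop where
  hP : Pᴴ = P
  hP' : P * P = P
  hQ : Qᴴ = Q
  hQ' : Q * Q = Q
  left : P * h = 0
  right : h * Q = h

namespace TriData

theorem conj_left (D : TriData P Q h) : hᴴ * P = 0 := by
  have := congrArg Matrix.conjTranspose D.left
  rwa [Matrix.conjTranspose_mul, D.hP, Matrix.conjTranspose_zero] at this

theorem conj_right (D : TriData P Q h) : Q * hᴴ = hᴴ := by
  have := congrArg Matrix.conjTranspose D.right
  rwa [Matrix.conjTranspose_mul, D.hQ] at this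

theorem comm (D : TriData P Q h) : gramInv h * Q = Q * gramInv h := gramInv_comm D.hQ D.right

theorem triIdem_mul_self (D : TriData P Q h) : triIdem P Q h * triIdem P Q h = triIdem P Q h := by
  simp [triIdem, fromBlocks_multiply, D.hP', D.hQ', D.left, D.right]

theorem triProj_eq (D : TriData P Q h) :
    triProj P Q h = triIdem P Q h * fromBlocks 1 0 (gramInv h * hᴴ) (gramInv h) := by
  simp only [triIdem, triProj, fromBlocks_multiply, Matrix.mul_one, Matrix.mul_zero,
    Matrix.zero_mul, zero_add, ← Matrix.mul_assoc, ← D.comm]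
  rw [Matrix.mul_assoc (gramInv h) Q, D.conj_right]

theorem lower_mul (D : TriData P Q h) :
    fromBlocks 1 0 (gramInv h * hᴴ) (gramInv h) * triIdem P Q h = triIdem P Q h := by
  have h1 : gramInv h * hᴴ * h + gramInv h * Q = Q := by
    have h2 : hᴴ * h = hᴴ * h * Q := by rw [Matrix.mul_assoc, D.right]
    rw [Matrix.mul_assoc, h2, ← Matrix.mul_assoc (gramInv h), gramInv_mul, Matrix.sub_mul,
      Matrix.one_mul, sub_add_cancel]
  simp only [triIdem, fromBlocks_multiply, Matrix.one_mul, Matrix.zero_mul, Matrix.mul_zero,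
    add_zero, h1]
  rw [Matrix.mul_assoc, D.conj_left, Matrix.mul_zero]

theorem triProj_mul_triIdem (D : TriData P Q h) :
    triProj P Q h * triIdem P Q h = triIdem P Q h := by
  rw [D.triProj_eq, Matrix.mul_assoc, D.lower_mul, D.triIdem_mul_self]

theorem triIdem_mul_triProj (D : TriData P Q h) :
    triIdem P Q h * triProj P Q h = triProj P Q h := by
  rw [D.triProj_eq, ← Matrix.mul_assoc, D.triIdem_mul_self]

theorem triProj_mul_self (D : TriData P Q h) : triProj P Q h * triProj P Q h = triProj P Q h := by
  nth_rw 2 [D.triProj_eq]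
  rw [← Matrix.mul_assoc, D.triProj_mul_triIdem, ← D.triProj_eq]

theorem triProj_conjTranspose (D : TriData P Q h) : (triProj P Q h)ᴴ = triProj P Q h := by
  simp only [triProj, fromBlocks_conjTranspose, Matrix.conjTranspose_add,
    Matrix.conjTranspose_mul, Matrix.conjTranspose_conjTranspose, gramInv_conjTranspose, D.hP,
    D.hQ, D.comm, Matrix.mul_assoc]

theorem triProj_trace (D : TriData P Q h) : (triProj P Q h).trace = P.trace + Q.trace := by
  rw [D.triProj_eq, Matrix.trace_mul_comm, D.lower_mul, triIdem]
  simp [Matrix.trace, Fintype.sum_sum_type]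

theorem rel_iff {P' : Matrix k k ℂ} {Q' : Matrix l l ℂ} {h' : Matrix k l ℂ}
    (D : TriData P Q h) (D' : TriData P' Q' h') (T : Matrix k m ℂ) (ξ : Matrix k n ℂ)
    (M : Matrix l n ℂ) :
    (1 - triProj P' Q' h') * fromBlocks T ξ 0 M * triProj P Q h = 0 ↔
      (1 - P') * T * P = 0 ∧ (1 - Q') * M * Q = 0 ∧
        (1 - P') * (T * h + ξ - h' * M) * Q = 0 := by
  have e1 : (1 - triProj P' Q' h') * fromBlocks T ξ 0 M * triProj P Q h = 0 ↔
      (1 - triIdem P' Q' h') * fromBlocks T ξ 0 M * triIdem P Q h = 0 := by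
    constructor
    · intro H
      have H1 := congrArg (triIdem P' Q' h' * · * triIdem P Q h) H
      have H2 := congrArg (fun X => X * triIdem P Q h) H
      simp only [Matrix.sub_mul, Matrix.one_mul, Matrix.mul_zero, Matrix.zero_mul,
        Matrix.mul_assoc, D.triProj_mul_triIdem] at H2 ⊢
      rw [sub_eq_zero] at H2 ⊢
      rw [H2, ← Matrix.mul_assoc (triIdem P' Q' h'), D'.triIdem_mul_triProj]
    · intro H
      have H2 := congrArg (fun X => X * triProj P Q h) H
      simp only [Matrix.sub_mul, Matrix.one_mul, Matrix.mul_zero, Matrix.zero_mul,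
        Matrix.mul_assoc, D.triIdem_mul_triProj] at H2 ⊢
      rw [sub_eq_zero] at H2 ⊢
      rw [H2, ← Matrix.mul_assoc (triProj P' Q' h'), D'.triProj_mul_triIdem]
  have e2 : (1 - triIdem P' Q' h') * fromBlocks T ξ 0 M * triIdem P Q h =
      fromBlocks ((1 - P') * T * P) ((1 - P') * (T * h + ξ - h' * M) * Q) 0
        ((1 - Q') * M * Q) := by
    have h1 : (1 : Matrix (k ⊕ l) (k ⊕ l) ℂ) - triIdem P' Q' h' =
        fromBlocks (1 - P') (-h') 0 (1 - Q') := by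
      rw [triIdem, ← fromBlocks_one, sub_eq_add_neg, fromBlocks_neg, fromBlocks_add]
      simp [sub_eq_add_neg]
    have h2 : (1 - P') * h' = h' := by rw [Matrix.sub_mul, Matrix.one_mul, D'.left, sub_zero]
    rw [h1, triIdem]
    simp only [fromBlocks_multiply, Matrix.mul_zero, Matrix.zero_mul, add_zero, zero_add]
    congr 1
    have h3 : (1 - P') * (T * h + ξ - h' * M) * Q =
        (1 - P') * T * (h * Q) + (1 - P') * ξ * Q - (1 - P') * h' * M * Q := by
      simp only [Matrix.mul_add, Matrix.add_mul, Matrix.mul_sub, Matrix.sub_mul, Matrix.mul_assoc]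
    rw [h3, h2, D.right, Matrix.add_mul, Matrix.neg_mul, Matrix.neg_mul]
    abel
  rw [e1, e2, ← fromBlocks_zero, fromBlocks_inj]
  tauto

theorem mul_aux (D : TriData P Q h) : (gramInv h * Q + 1 - Q) * (1 + hᴴ * h) = 1 := by
  have h1 : Q * (hᴴ * h) = hᴴ * h := by rw [← Matrix.mul_assoc, D.conj_right]
  have h2 : gramInv h * Q * (1 + hᴴ * h) = Q := by
    rw [D.comm, Matrix.mul_assoc, Matrix.mul_add, gramInv_mul, Matrix.mul_one, add_sub_cancel,
      Matrix.mul_one]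
  rw [Matrix.sub_mul, Matrix.add_mul, h2, Matrix.mul_add Q, h1, Matrix.one_mul, Matrix.mul_one]
  abel

theorem isUnit_aux (D : TriData P Q h) : (gramInv h * Q + 1 - Q)⁻¹ = 1 + hᴴ * h :=
  Matrix.inv_eq_right_inv D.mul_aux

theorem left_inv (D : TriData P Q h) :
    h * gramInv h * (gramInv h * Q + 1 - Q)⁻¹ = h := by
  rw [D.isUnit_aux, Matrix.mul_assoc, Matrix.mul_add, gramInv_mul, Matrix.mul_one, add_sub_cancel,
    Matrix.mul_one]

end TriData

theorem exists_colBasis (c : Matrix m n ℂ) : ∃ F : Matrix m (Fin c.rank) ℂ,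
    Function.Injective F.mulVecLin ∧ LinearMap.range F.mulVecLin = LinearMap.range c.mulVecLin := by
  let N := LinearMap.range c.mulVecLin
  let b := Module.finBasisOfFinrankEq ℂ N (n := c.rank) rfl
  let L : (Fin c.rank → ℂ) →ₗ[ℂ] (m → ℂ) := N.subtype ∘ₗ b.equivFun.symm.toLinearMap
  refine ⟨LinearMap.toMatrix' L, ?_, ?_⟩
  · rw [← Matrix.toLin'_apply', Matrix.toLin'_toMatrix']
    exact Subtype.val_injective.comp b.equivFun.symm.injective
  · rw [← Matrix.toLin'_apply', Matrix.toLin'_toMatrix', LinearMap.range_comp,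
      LinearEquiv.range, Submodule.map_top, Submodule.range_subtype]

theorem exists_rangeProj (c : Matrix m n ℂ) : ∃ Q : Matrix m m ℂ, Qᴴ = Q ∧ Q * Q = Q ∧
    Q.trace = c.rank ∧ LinearMap.range Q.mulVecLin = LinearMap.range c.mulVecLin := by
  obtain ⟨F, hF, hF'⟩ := exists_colBasis c
  refine ⟨colProj F, colProj_conjTranspose F, colProj_idem hF, ?_, (colProj_range hF).trans hF'⟩
  rw [colProj_trace hF, Fintype.card_fin]

theorem exists_triData {N : Matrix (m ⊕ n) (m ⊕ n) ℂ} (hN : Nᴴ = N) (hN' : N * N = N) :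
    ∃ (P : Matrix m m ℂ) (Q : Matrix n n ℂ) (h : Matrix m n ℂ), TriData P Q h ∧
      triProj P Q h = N := by
  obtain ⟨a, b, b', c, rfl⟩ : ∃ a b b' c, N = fromBlocks a b b' c :=
    ⟨_, _, _, _, (fromBlocks_toBlocks N).symm⟩
  rw [fromBlocks_conjTranspose, fromBlocks_inj] at hN
  obtain ⟨ha, rfl, -, hc⟩ := hN
  have hb : ∀ x : Matrix n m ℂ, xᴴᴴ = x := fun x => Matrix.conjTranspose_conjTranspose x
  rw [fromBlocks_multiply, fromBlocks_inj] at hN'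
  obtain ⟨b, rfl⟩ : ∃ b : Matrix m n ℂ, b' = bᴴ := ⟨b'ᴴ, (hb b').symm⟩
  simp only [Matrix.conjTranspose_conjTranspose] at hN' ⊢
  obtain ⟨e11, e12, -, e22⟩ := hN'
  have e21 : bᴴ * a + c * bᴴ = bᴴ := by
    have := congrArg Matrix.conjTranspose e12
    rwa [Matrix.conjTranspose_add, Matrix.conjTranspose_mul, Matrix.conjTranspose_mul, ha, hc]
      at this
  obtain ⟨Q, hQ, hQ', -, hQc⟩ := exists_rangeProj c
  obtain ⟨G, hG⟩ := range_le_iff.1 hQc.le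
  obtain ⟨G', hG'⟩ := range_le_iff.1 hQc.ge
  have q1 : Q * c = c := by rw [hG', ← Matrix.mul_assoc, hQ']
  have q2 : c * Q = c := by
    have := congrArg Matrix.conjTranspose q1
    rwa [Matrix.conjTranspose_mul, hQ, hc] at this
  have q3 : Q = Gᴴ * c := by
    have := congrArg Matrix.conjTranspose hG
    rwa [Matrix.conjTranspose_mul, hQ, hc] at this
  have hb1 : bᴴ * b = c - c * c := eq_sub_of_add_eq e22
  have hbQ : b * Q = b := by
    have h1 : (b * (1 - Q))ᴴ * (b * (1 - Q)) = 0 := by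
      rw [Matrix.conjTranspose_mul, Matrix.mul_assoc, ← Matrix.mul_assoc bᴴ, hb1,
        Matrix.mul_sub, Matrix.mul_one, Matrix.sub_mul c, q2, Matrix.mul_assoc, q2, sub_self,
        Matrix.mul_zero]
    rw [Matrix.conjTranspose_mul_self_eq_zero, Matrix.mul_sub, Matrix.mul_one, sub_eq_zero] at h1
    exact h1.symm
  have hu : IsUnit (c + 1 - Q).det := by
    rw [← Matrix.isUnit_iff_isUnit_det, ← Matrix.mulVec_injective_iff_isUnit]
    rw [← Matrix.coe_mulVecLin, ← LinearMap.ker_eq_bot, LinearMap.ker_eq_bot']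
    intro v hv
    rw [Matrix.mulVecLin_apply] at hv
    have h1 : (1 - Q) * (c + 1 - Q) = 1 - Q := by
      simp only [Matrix.sub_mul, Matrix.mul_sub, Matrix.mul_add, Matrix.mul_one, Matrix.one_mul,
        q1, hQ']
      abel
    have h2 : (1 - Q) *ᵥ v = 0 := by rw [← h1, ← Matrix.mulVec_mulVec, hv, Matrix.mulVec_zero]
    have h3 : c *ᵥ v = 0 := by
      rw [add_sub_assoc, Matrix.add_mulVec, h2, add_zero] at hv
      exact hv
    rw [Matrix.sub_mulVec, Matrix.one_mulVec, q3, ← Matrix.mulVec_mulVec, h3, Matrix.mulVec_zero,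
      sub_zero] at h2
    exact h2
  obtain ⟨u, hu0⟩ : ∃ u, u = (c + 1 - Q)⁻¹ := ⟨_, rfl⟩
  have u1 : u * (c + 1 - Q) = 1 := hu0 ▸ Matrix.nonsing_inv_mul _ hu
  have uH : uᴴ = u := by
    rw [hu0, Matrix.conjTranspose_nonsing_inv, Matrix.conjTranspose_sub, Matrix.conjTranspose_add,
      hc, hQ, Matrix.conjTranspose_one]
  have uc : u * c = Q := by
    have h1 : (c + 1 - Q) * Q = c := by
      rw [Matrix.sub_mul, Matrix.add_mul, q2, hQ', Matrix.one_mul, add_sub_cancel_right]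
    nth_rw 1 [← h1]
    rw [← Matrix.mul_assoc, u1, Matrix.one_mul]
  have cu : c * u = Q := by
    have := congrArg Matrix.conjTranspose uc
    rwa [Matrix.conjTranspose_mul, uH, hQ, hc] at this
  have uQ : u * Q = Q * u := by rw [← cu, ← Matrix.mul_assoc, uc, cu]
  have hh : (b * u)ᴴ * (b * u) = Q * u - Q := by
    rw [Matrix.conjTranspose_mul, uH, Matrix.mul_assoc, ← Matrix.mul_assoc bᴴ, hb1, Matrix.sub_mul,
      Matrix.mul_sub, ← Matrix.mul_assoc, uc, Matrix.mul_assoc c, cu, q2, uc]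
  have Ph : (a - b * (b * u)ᴴ) * (b * u) = 0 := by
    rw [Matrix.sub_mul, Matrix.mul_assoc b, hh, Matrix.mul_sub, ← Matrix.mul_assoc, hbQ,
      ← Matrix.mul_assoc, eq_sub_of_add_eq e12, Matrix.sub_mul, Matrix.mul_assoc b c, cu, hbQ]
    abel
  have PH : (a - b * (b * u)ᴴ)ᴴ = a - b * (b * u)ᴴ := by
    simp only [Matrix.conjTranspose_sub, Matrix.conjTranspose_mul, ha, uH,
      Matrix.conjTranspose_conjTranspose, Matrix.mul_assoc]
  have D : TriData (a - b * (b * u)ᴴ) Q (b * u) := by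
    refine ⟨PH, ?_, hQ, hQ', Ph, ?_⟩
    · have h2 : (a - b * (b * u)ᴴ) * b = 0 := by
        have h3 : b = b * u * c := by rw [Matrix.mul_assoc, uc, hbQ]
        have h4 := congrArg (fun X => X * c) Ph
        rwa [Matrix.mul_assoc, ← h3, Matrix.zero_mul] at h4
      have h5 : (b * u)ᴴ * a = u * bᴴ - Q * bᴴ := by
        rw [Matrix.conjTranspose_mul, uH, Matrix.mul_assoc, eq_sub_of_add_eq e21, Matrix.mul_sub,
          ← Matrix.mul_assoc u c, uc]
      have h6 : b * (Q * bᴴ) = b * bᴴ := by rw [← Matrix.mul_assoc, hbQ]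
      rw [Matrix.mul_sub, ← Matrix.mul_assoc _ b, h2, Matrix.zero_mul, sub_zero, Matrix.sub_mul,
        Matrix.mul_assoc b, h5, Matrix.mul_sub, h6, eq_sub_of_add_eq e11, Matrix.conjTranspose_mul,
        uH]
      abel
    · rw [Matrix.mul_assoc, uQ, ← Matrix.mul_assoc, hbQ]
  refine ⟨_, Q, b * u, D, ?_⟩
  have g1 : gramInv (b * u) * Q = c := by
    refine gramInv_eq ?_
    rw [hh, Matrix.sub_mul, Matrix.mul_assoc, uc, hQ', q1]
    abel
  have g2 : b * u * gramInv (b * u) = b := by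
    nth_rw 1 [← D.right]
    rw [Matrix.mul_assoc, ← D.comm, g1, Matrix.mul_assoc, uc, hbQ]
  have g3 : gramInv (b * u) * (b * u)ᴴ = bᴴ := by
    have := congrArg Matrix.conjTranspose g2
    rwa [Matrix.conjTranspose_mul, gramInv_conjTranspose] at this
  rw [triProj, g1, g2, g3, sub_add_cancel]

end

end FPoly

namespace FPoly

open Topology TopologicalSpace

theorem continuous_of_closed_graph {X Y : Type} [TopologicalSpace X] [TopologicalSpace Y]
    [CompactSpace Y] {f : X → Y} (hf : IsClosed {p : X × Y | f p.1 = p.2}) : Continuous f := by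
  refine continuous_iff_isClosed.2 fun C hC => ?_
  have h1 : f ⁻¹' C = Prod.fst '' ({p : X × Y | f p.1 = p.2} ∩ Prod.snd ⁻¹' C) := by
    ext x
    constructor
    · intro hx
      exact ⟨(x, f x), ⟨rfl, hx⟩, rfl⟩
    · rintro ⟨⟨x, y⟩, ⟨h, hy⟩, rfl⟩
      have h' : f x = y := h
      exact h' ▸ hy
  rw [h1]
  exact isClosedMap_fst_of_compactSpace _ (hf.inter (hC.preimage continuous_snd))

theorem isClosed_rank_le {m n : Type} [Fintype m] [Fintype n] [DecidableEq m] [DecidableEq n]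
    (r : ℕ) : IsClosed {A : Matrix m n ℂ | A.rank ≤ r} := by
  have h1 := isOpen_setOfPred_nat_le_rank (𝕜 := ℂ) (E := n → ℂ) (F := m → ℂ) (r + 1)
  have h2 : Continuous fun A : Matrix m n ℂ => LinearMap.toContinuousLinearMap A.mulVecLin := by
    rw [continuous_clm_apply]
    exact fun v => continuous_id.matrix_mulVec continuous_const
  convert (h1.preimage h2).isClosed_compl using 1
  ext A
  have h3 : (LinearMap.toContinuousLinearMap A.mulVecLin).toLinearMap.rank = (A.rank : Cardinal) :=
    (Module.finrank_eq_rank _ _).symm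
  rw [Set.mem_compl_iff, Set.mem_preimage, Set.mem_ofPred_eq, Set.mem_ofPred_eq]
  erw [h3]
  rw [Nat.cast_le]
  omega

section
variable {V A : Type} {s t : A → V} {ι κ : V → Type} [∀ i, Fintype (ι i)]
  [∀ i, DecidableEq (ι i)] [∀ i, Fintype (κ i)] [∀ i, DecidableEq (κ i)]
  {T : ∀ a : A, Matrix (ι (t a)) (ι (s a)) ℂ} {M : ∀ a : A, Matrix (κ (t a)) (κ (s a)) ℂ}
  {ξ : ∀ a : A, Matrix (ι (t a)) (κ (s a)) ℂ} {e f g : V → ℕ}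

/-- The extension of `M` by `T` with cocycle `ξ`. -/
def extRep (T : ∀ a : A, Matrix (ι (t a)) (ι (s a)) ℂ) (ξ : ∀ a : A, Matrix (ι (t a)) (κ (s a)) ℂ)
    (M : ∀ a : A, Matrix (κ (t a)) (κ (s a)) ℂ) :
    ∀ a : A, Matrix (ι (t a) ⊕ κ (t a)) (ι (s a) ⊕ κ (s a)) ℂ :=
  fun a => fromBlocks (T a) (ξ a) 0 (M a)

/-- The compatibility condition for a map from a subrepresentation to a quotient. -/
def GraphRel (ξ : ∀ a : A, Matrix (ι (t a)) (κ (s a)) ℂ) (x : (PG T f × PG M g) ×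
    (∀ i, Matrix (ι i) (κ i) ℂ)) : Prop :=
  (∀ i, (1 - x.1.1.1 i) * x.2 i * x.1.2.1 i = x.2 i) ∧
  ∀ a, (1 - x.1.1.1 (t a)) * (T a * x.2 (s a) + ξ a - x.2 (t a) * M a) * x.1.2.1 (s a) = 0

theorem GraphRel.triData {x : (PG T f × PG M g) × (∀ i, Matrix (ι i) (κ i) ℂ)}
    (hx : GraphRel ξ x) (i : V) : TriData (x.1.1.1 i) (x.1.2.1 i) (x.2 i) where
  hP := x.1.1.2.1 i
  hP' := x.1.1.2.2.1 i
  hQ := x.1.2.2.1 i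
  hQ' := x.1.2.2.2.1 i
  left := by
    rw [← hx.1 i, ← Matrix.mul_assoc, ← Matrix.mul_assoc, Matrix.mul_sub, x.1.1.2.2.1 i,
      Matrix.mul_one, sub_self, Matrix.zero_mul, Matrix.zero_mul]
  right := by
    nth_rw 1 [← hx.1 i]
    rw [Matrix.mul_assoc, x.1.2.2.2.1 i, hx.1 i]

/-- The stratum of subrepresentations of the extension whose image in `M` has dimension `g`. -/
def stratum (T : ∀ a : A, Matrix (ι (t a)) (ι (s a)) ℂ)
    (ξ : ∀ a : A, Matrix (ι (t a)) (κ (s a)) ℂ) (M : ∀ a : A, Matrix (κ (t a)) (κ (s a)) ℂ)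
    (e g : V → ℕ) : Set (PG (ι := fun i => ι i ⊕ κ i) (s := s) (t := t) (extRep T ξ M) e) :=
  {N | (fun i => (N.1 i).toBlocks₂₂.rank) = g}

theorem rank_of_range_eq {m n : Type} [Fintype m] [Fintype n] [DecidableEq m] [DecidableEq n]
    {Q : Matrix m m ℂ} {c : Matrix m n ℂ} (hQ : Q * Q = Q) {r : ℕ} (ht : Q.trace = r)
    (h : LinearMap.range c.mulVecLin = LinearMap.range Q.mulVecLin) : c.rank = r := by
  rw [Matrix.rank, h]
  exact finrank_range_proj hQ ht

theorem TriData.range_eq {m n : Type} [Fintype m] [Fintype n] [DecidableEq m] [DecidableEq n]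
    {P : Matrix m m ℂ} {Q : Matrix n n ℂ} {h : Matrix m n ℂ} (D : TriData P Q h) :
    LinearMap.range (gramInv h * Q).mulVecLin = LinearMap.range Q.mulVecLin := by
  refine le_antisymm (range_le_iff.2 ⟨gramInv h, D.comm⟩)
    (range_le_iff.2 ⟨1 + hᴴ * h, ?_⟩)
  rw [D.comm, Matrix.mul_assoc, Matrix.mul_add, gramInv_mul, Matrix.mul_one, add_sub_cancel,
    Matrix.mul_one]

/-- The orthogonal projection onto the subrepresentation attached to a graph datum. -/
def graphProj (hfg : ∀ i, f i + g i = e i)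
    (x : {x : (PG T f × PG M g) × (∀ i, Matrix (ι i) (κ i) ℂ) // GraphRel ξ x}) :
    ↥(stratum T ξ M e g) :=
  ⟨⟨fun i => triProj (x.1.1.1.1 i) (x.1.1.2.1 i) (x.1.2 i),
    fun i => (x.2.triData i).triProj_conjTranspose, fun i => (x.2.triData i).triProj_mul_self,
    fun i => by
      rw [(x.2.triData i).triProj_trace, x.1.1.1.2.2.2.1 i, x.1.1.2.2.2.2.1 i, ← hfg i,
        Nat.cast_add],
    fun a => ((x.2.triData _).rel_iff (x.2.triData _) _ _ _).2
      ⟨x.1.1.1.2.2.2.2 a, x.1.1.2.2.2.2.2 a, x.2.2 a⟩⟩,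
    funext fun i => rank_of_range_eq (x.2.triData i).hQ' (x.1.1.2.2.2.2.1 i)
      (x.2.triData i).range_eq⟩

theorem graphProj_surjective (hfg : ∀ i, f i + g i = e i) :
    Function.Surjective (graphProj (T := T) (M := M) (ξ := ξ) hfg) := by
  rintro ⟨⟨N, hN1, hN2, hN3, hN4⟩, hg⟩
  choose P Q h D hD using fun i => exists_triData (hN1 i) (hN2 i)
  have hQt : ∀ i, (Q i).trace = g i := fun i => by
    have h1 := (((LinearMap.isProj_range_iff_isIdempotentElem (Q i).mulVecLin).2 (by
      change (Q i).mulVecLin ∘ₗ (Q i).mulVecLin = _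
      rw [← Matrix.mulVecLin_mul, (D i).hQ'])).trace)
    rw [← Matrix.toLin'_apply', Matrix.trace_toLin'_eq, Matrix.toLin'_apply',
      ← (D i).range_eq] at h1
    rw [h1, ← congrFun hg i]
    change _ = (((N i).toBlocks₂₂.rank : ℕ) : ℂ)
    rw [← hD i]
    rfl
  have hPt : ∀ i, (P i).trace = f i := fun i => by
    have h1 := (D i).triProj_trace
    rw [hD i, hN3 i, hQt i, ← hfg i, Nat.cast_add] at h1
    exact (add_right_cancel h1).symm
  have hrel := fun a => ((D (s a)).rel_iff (D (t a)) (T a) (ξ a) (M a)).1 (by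
    rw [hD, hD]
    exact hN4 a)
  refine ⟨⟨((⟨P, fun i => (D i).hP, fun i => (D i).hP', hPt, fun a => (hrel a).1⟩,
    ⟨Q, fun i => (D i).hQ, fun i => (D i).hQ', hQt, fun a => (hrel a).2.1⟩), h), ?_, ?_⟩, ?_⟩
  · intro i
    change (1 - P i) * h i * Q i = h i
    rw [Matrix.mul_assoc, (D i).right, Matrix.sub_mul, (D i).left, Matrix.one_mul, sub_zero]
  · exact fun a => (hrel a).2.2
  · exact Subtype.ext (Subtype.ext (funext hD))

theorem TriData.proj_unique {m n : Type} [Fintype m] [Fintype n] [DecidableEq m] [DecidableEq n]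
    {P : Matrix m m ℂ} {Q Q' : Matrix n n ℂ} {h : Matrix m n ℂ} (D : TriData P Q h)
    (h1 : Q'ᴴ = Q') (h2 : Q' * Q' = Q') {r : ℕ} (h3 : Q.trace = r) (h3' : Q'.trace = r)
    (h4 : Q' * (gramInv h * Q) = gramInv h * Q) : Q = Q' := by
  refine proj_ext D.hQ D.hQ' h1 h2 (Submodule.eq_of_le_of_finrank_eq ?_ ?_)
  · rw [← D.range_eq]
    exact range_le_iff.2 ⟨_, h4.symm⟩
  · rw [finrank_range_proj D.hQ' h3, finrank_range_proj h2 h3']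

theorem graphProj_injective (hfg : ∀ i, f i + g i = e i) :
    Function.Injective (graphProj (T := T) (M := M) (ξ := ξ) hfg) := by
  rintro x y hxy
  have h0 : ∀ i, triProj (x.1.1.1.1 i) (x.1.1.2.1 i) (x.1.2 i) =
      triProj (y.1.1.1.1 i) (y.1.1.2.1 i) (y.1.2 i) := fun i =>
    congrFun (congrArg (fun z => z.1.1) hxy) i
  have h1 := fun i => (fromBlocks_inj.1 (h0 i))
  have hQ : ∀ i, x.1.1.2.1 i = y.1.1.2.1 i := fun i => by
    refine (x.2.triData i).proj_unique (y.2.triData i).hQ (y.2.triData i).hQ'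
      (x.1.1.2.2.2.2.1 i) (y.1.1.2.2.2.2.1 i) ?_
    rw [(h1 i).2.2.2, (y.2.triData i).comm, ← Matrix.mul_assoc, (y.2.triData i).hQ']
  have hh : ∀ i, x.1.2 i = y.1.2 i := fun i => by
    rw [← (x.2.triData i).left_inv, (h1 i).2.1, (h1 i).2.2.2, hQ i, (y.2.triData i).left_inv]
  have hP : ∀ i, x.1.1.1.1 i = y.1.1.1.1 i := fun i => by
    have := (h1 i).1
    rw [hh i] at this
    exact add_right_cancel this
  exact Subtype.ext (Prod.ext (Prod.ext (Subtype.ext (funext hP)) (Subtype.ext (funext hQ)))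
    (funext hh))

theorem continuous_gramInv {m n : Type} [Fintype m] [Fintype n] [DecidableEq m] [DecidableEq n] :
    Continuous fun h : Matrix m n ℂ => gramInv h :=
  continuous_inv_of_det (continuous_const.add (continuous_id.matrix_conjTranspose.matrix_mul
    continuous_id)) isUnit_gramOne

/-- Strata of the quiver Grassmannian of an extension as affine families. -/
def stratumHomeo (hfg : ∀ i, f i + g i = e i) :
    {x : (PG T f × PG M g) × (∀ i, Matrix (ι i) (κ i) ℂ) // GraphRel ξ x} ≃ₜ
      ↥(stratum T ξ M e g) := by
  let E := Equiv.ofBijective _ ⟨graphProj_injective (T := T) (M := M) (ξ := ξ) hfg,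
    graphProj_surjective hfg⟩
  refine ⟨E, ?_, ?_⟩
  · refine Continuous.subtype_mk (Continuous.subtype_mk (continuous_pi fun i => ?_) _) _
    have cP : Continuous fun x : {x : (PG T f × PG M g) × (∀ i, Matrix (ι i) (κ i) ℂ) //
        GraphRel ξ x} => x.1.1.1.1 i := (continuous_apply i).comp (continuous_subtype_val.comp
          (continuous_fst.comp (continuous_fst.comp continuous_subtype_val)))
    have cQ : Continuous fun x : {x : (PG T f × PG M g) × (∀ i, Matrix (ι i) (κ i) ℂ) //
        GraphRel ξ x} => x.1.1.2.1 i := (continuous_apply i).comp (continuous_subtype_val.comp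
          (continuous_snd.comp (continuous_fst.comp continuous_subtype_val)))
    have ch : Continuous fun x : {x : (PG T f × PG M g) × (∀ i, Matrix (ι i) (κ i) ℂ) //
        GraphRel ξ x} => x.1.2 i := (continuous_apply i).comp
          (continuous_snd.comp continuous_subtype_val)
    have cw := continuous_gramInv.comp ch
    exact (cP.add ((ch.matrix_mul cw).matrix_mul ch.matrix_conjTranspose)).matrix_fromBlocks
      (ch.matrix_mul cw) (cw.matrix_mul ch.matrix_conjTranspose) (cw.matrix_mul cQ)
  · have hE : ∀ N i, N.1.1 i = triProj ((E.symm N).1.1.1.1 i) ((E.symm N).1.1.2.1 i)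
        ((E.symm N).1.2 i) := fun N i => by
      conv_lhs => rw [← E.apply_symm_apply N]
      rfl
    have cN : ∀ i, Continuous fun N : ↥(stratum T ξ M e g) => N.1.1 i := fun i =>
      (continuous_apply i).comp (continuous_subtype_val.comp continuous_subtype_val)
    have cb : ∀ i, Continuous fun N : ↥(stratum T ξ M e g) => (N.1.1 i).toBlocks₁₂ := fun i =>
      (cN i).matrix_submatrix _ _
    have cc : ∀ i, Continuous fun N : ↥(stratum T ξ M e g) => (N.1.1 i).toBlocks₂₂ := fun i =>
      (cN i).matrix_submatrix _ _
    have ca : ∀ i, Continuous fun N : ↥(stratum T ξ M e g) => (N.1.1 i).toBlocks₁₁ := fun i =>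
      (cN i).matrix_submatrix _ _
    have hc : ∀ N i, (N.1.1 i).toBlocks₂₂ = gramInv ((E.symm N).1.2 i) * (E.symm N).1.1.2.1 i :=
      fun N i => by rw [hE]; rfl
    have hb : ∀ N i, (N.1.1 i).toBlocks₁₂ = (E.symm N).1.2 i * gramInv ((E.symm N).1.2 i) :=
      fun N i => by rw [hE]; rfl
    have ha : ∀ N i, (N.1.1 i).toBlocks₁₁ = (E.symm N).1.1.1.1 i +
        (E.symm N).1.2 i * gramInv ((E.symm N).1.2 i) * ((E.symm N).1.2 i)ᴴ :=
      fun N i => by rw [hE]; rfl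
    have : CompactSpace (PG M g) := isCompact_iff_compactSpace.1 (isCompact_PG M g)
    have cQ : Continuous fun N => (E.symm N).1.1.2 := by
      refine continuous_of_closed_graph ?_
      have : {p : ↥(stratum T ξ M e g) × PG M g | (E.symm p.1).1.1.2 = p.2} =
          ⋂ i, {p | p.2.1 i * (p.1.1.1 i).toBlocks₂₂ = (p.1.1.1 i).toBlocks₂₂} := by
        ext ⟨N, Q⟩
        simp only [Set.mem_ofPred_eq, Set.mem_iInter]
        constructor
        · rintro rfl i
          rw [hc, ((E.symm N).2.triData i).comm, ← Matrix.mul_assoc,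
            ((E.symm N).2.triData i).hQ']
        · intro h
          refine Subtype.ext (funext fun i => ?_)
          refine ((E.symm N).2.triData i).proj_unique (Q.2.1 i) (Q.2.2.1 i)
            ((E.symm N).1.1.2.2.2.2.1 i) (Q.2.2.2.1 i) ?_
          rw [← hc]
          exact h i
      rw [this]
      refine isClosed_iInter fun i => isClosed_eq ?_ ((cc i).comp continuous_fst)
      exact ((continuous_apply i).comp (continuous_subtype_val.comp continuous_snd)).matrix_mul
        ((cc i).comp continuous_fst)
    have cQi : ∀ i, Continuous fun N => (E.symm N).1.1.2.1 i := fun i =>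
      (continuous_apply i).comp (continuous_subtype_val.comp cQ)
    have ch : ∀ i, Continuous fun N => (E.symm N).1.2 i := fun i => by
      have h1 : (fun N => (E.symm N).1.2 i) = fun N : ↥(stratum T ξ M e g) =>
          (N.1.1 i).toBlocks₁₂ * ((N.1.1 i).toBlocks₂₂ + 1 - (E.symm N).1.1.2.1 i)⁻¹ := by
        funext N
        rw [hb, hc, ((E.symm N).2.triData i).left_inv]
      rw [h1]
      refine (cb i).matrix_mul (continuous_inv_of_det (((cc i).add continuous_const).sub (cQi i))
        fun N => ?_)
      rw [hc]
      exact Matrix.isUnit_det_of_right_inverse ((E.symm N).2.triData i).mul_aux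
    have cP : ∀ i, Continuous fun N => (E.symm N).1.1.1.1 i := fun i => by
      have h1 : (fun N => (E.symm N).1.1.1.1 i) = fun N : ↥(stratum T ξ M e g) =>
          (N.1.1 i).toBlocks₁₁ - (N.1.1 i).toBlocks₁₂ * ((E.symm N).1.2 i)ᴴ := by
        funext N
        rw [ha, hb, add_sub_cancel_right]
      rw [h1]
      exact (ca i).sub ((cb i).matrix_mul (ch i).matrix_conjTranspose)
    exact Continuous.subtype_mk (Continuous.prodMk (Continuous.prodMk
      (Continuous.subtype_mk (continuous_pi cP) _) cQ) (continuous_pi ch)) _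

end

end FPoly

namespace FPoly

open Topology TopologicalSpace

section
variable {V A : Type} {s t : A → V} {ι κ : V → Type} [∀ i, Fintype (ι i)]
  [∀ i, DecidableEq (ι i)] [∀ i, Fintype (κ i)] [∀ i, DecidableEq (κ i)]
  {T : ∀ a : A, Matrix (ι (t a)) (ι (s a)) ℂ} {M : ∀ a : A, Matrix (κ (t a)) (κ (s a)) ℂ}
  {ξ : ∀ a : A, Matrix (ι (t a)) (κ (s a)) ℂ} {e f g : V → ℕ}

/-- The linear map defining the graph fibration. -/
def graphMap (T : ∀ a : A, Matrix (ι (t a)) (ι (s a)) ℂ) (M : ∀ a : A, Matrix (κ (t a)) (κ (s a)) ℂ)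
    (P : ∀ i, Matrix (ι i) (ι i) ℂ) (Q : ∀ i, Matrix (κ i) (κ i) ℂ) :
    (∀ i, Matrix (ι i) (κ i) ℂ) →ₗ[ℂ]
      (∀ i, Matrix (ι i) (κ i) ℂ) × (∀ a : A, Matrix (ι (t a)) (κ (s a)) ℂ) where
  toFun h := (fun i => h i - (1 - P i) * h i * Q i,
    fun a => (1 - P (t a)) * (T a * h (s a) - h (t a) * M a) * Q (s a))
  map_add' h k := by
    ext <;> simp only [Pi.add_apply, Prod.fst_add, Prod.snd_add, Matrix.mul_add, Matrix.add_mul,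
      Matrix.mul_sub, Matrix.sub_mul, Matrix.add_apply, Matrix.sub_apply] <;> ring
  map_smul' c h := by
    ext <;> simp only [Pi.smul_apply, Prod.smul_fst, Prod.smul_snd, Matrix.mul_smul,
      Matrix.smul_mul, ← smul_sub, RingHom.id_apply]

/-- An idempotent with the same image as `graphMap`. -/
def graphIdem (s t : A → V) (P : ∀ i, Matrix (ι i) (ι i) ℂ) (Q : ∀ i, Matrix (κ i) (κ i) ℂ) :
    ((∀ i, Matrix (ι i) (κ i) ℂ) × (∀ a : A, Matrix (ι (t a)) (κ (s a)) ℂ)) →ₗ[ℂ]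
      (∀ i, Matrix (ι i) (κ i) ℂ) × (∀ a : A, Matrix (ι (t a)) (κ (s a)) ℂ) where
  toFun h := (fun i => h.1 i - (1 - P i) * h.1 i * Q i, fun a => (1 - P (t a)) * h.2 a * Q (s a))
  map_add' h k := by
    ext <;> simp only [Pi.add_apply, Prod.fst_add, Prod.snd_add, Matrix.mul_add, Matrix.add_mul,
      Matrix.add_apply, Matrix.sub_apply]
    ring
  map_smul' c h := by
    ext <;> simp only [Pi.smul_apply, Prod.smul_fst, Prod.smul_snd, Matrix.mul_smul,
      Matrix.smul_mul, ← smul_sub, RingHom.id_apply]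

theorem sandwich_sandwich {m n : Type} [Fintype m] [Fintype n] [DecidableEq m]
    {P : Matrix m m ℂ} {Q : Matrix n n ℂ} (hP : P * P = P) (hQ : Q * Q = Q) (h : Matrix m n ℂ) :
    (1 - P) * ((1 - P) * h * Q) * Q = (1 - P) * h * Q := by
  have h1 : (1 - P) * (1 - P) = 1 - P := by
    rw [Matrix.mul_sub, Matrix.mul_one, Matrix.sub_mul, Matrix.one_mul, hP, sub_self, sub_zero]
  rw [Matrix.mul_assoc, Matrix.mul_assoc _ Q Q, hQ, ← Matrix.mul_assoc, ← Matrix.mul_assoc, h1]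

theorem sandwich_cocycle (p : PG T f) (q : PG M g) (h : ∀ i, Matrix (ι i) (κ i) ℂ) (a : A) :
    (1 - p.1 (t a)) * (T a * ((1 - p.1 (s a)) * h (s a) * q.1 (s a)) -
      ((1 - p.1 (t a)) * h (t a) * q.1 (t a)) * M a) * q.1 (s a) =
    (1 - p.1 (t a)) * (T a * h (s a) - h (t a) * M a) * q.1 (s a) := by
  have hp := p.2.2.1 (t a)
  have hq := q.2.2.1 (s a)
  have h1 : (1 - p.1 (t a)) * (1 - p.1 (t a)) = 1 - p.1 (t a) := by
    rw [Matrix.mul_sub, Matrix.mul_one, Matrix.sub_mul, Matrix.one_mul, hp, sub_self, sub_zero]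
  have h2 : (1 - p.1 (t a)) * T a * (1 - p.1 (s a)) = (1 - p.1 (t a)) * T a := by
    rw [Matrix.mul_sub, Matrix.mul_one, p.2.2.2.2 a, sub_zero]
  have h3 : q.1 (t a) * M a * q.1 (s a) = M a * q.1 (s a) := by
    have := q.2.2.2.2 a
    rw [Matrix.sub_mul, Matrix.sub_mul, Matrix.one_mul, sub_eq_zero] at this
    exact this.symm
  rw [Matrix.mul_sub (1 - p.1 (t a)), Matrix.sub_mul _ _ (q.1 (s a)),
    Matrix.mul_sub (1 - p.1 (t a)) (T a * h (s a)), Matrix.sub_mul _ _ (q.1 (s a))]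
  congr 1
  · calc _ = (1 - p.1 (t a)) * T a * (1 - p.1 (s a)) * h (s a) * (q.1 (s a) * q.1 (s a)) := by
          simp only [Matrix.mul_assoc]
      _ = _ := by rw [h2, hq]; simp only [Matrix.mul_assoc]
  · calc _ = (1 - p.1 (t a)) * (1 - p.1 (t a)) * h (t a) * (q.1 (t a) * M a * q.1 (s a)) := by
          simp only [Matrix.mul_assoc]
      _ = _ := by rw [h1, h3]; simp only [Matrix.mul_assoc]

theorem range_graphMap (p : PG T f) (q : PG M g)
    (hs : ∀ η : ∀ a : A, Matrix (ι (t a)) (κ (s a)) ℂ, ∃ h : ∀ i, Matrix (ι i) (κ i) ℂ, ∀ a,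
      (1 - p.1 (t a)) * (T a * h (s a) - h (t a) * M a - η a) * q.1 (s a) = 0) :
    LinearMap.range (graphMap T M p.1 q.1) = LinearMap.range (graphIdem s t p.1 q.1) := by
  have hp := p.2.2.1
  have hq := q.2.2.1
  refine le_antisymm ?_ ?_
  · rintro _ ⟨h, rfl⟩
    exact ⟨(h, fun a => T a * h (s a) - h (t a) * M a), rfl⟩
  · rintro _ ⟨⟨h, η⟩, rfl⟩
    obtain ⟨k, hk⟩ := hs η
    refine ⟨(fun i => h i - (1 - p.1 i) * h i * q.1 i) +
      fun i => (1 - p.1 i) * k i * q.1 i, ?_⟩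
    rw [map_add]
    refine Prod.ext (funext fun i => ?_) (funext fun a => ?_)
    · change h i - (1 - p.1 i) * h i * q.1 i - (1 - p.1 i) * (h i - (1 - p.1 i) * h i * q.1 i) *
        q.1 i + ((1 - p.1 i) * k i * q.1 i - (1 - p.1 i) * ((1 - p.1 i) * k i * q.1 i) * q.1 i) =
        h i - (1 - p.1 i) * h i * q.1 i
      rw [sandwich_sandwich (hp i) (hq i), Matrix.mul_sub (1 - p.1 i) (h i),
        Matrix.sub_mul _ _ (q.1 i), sandwich_sandwich (hp i) (hq i), sub_self, sub_self,
        sub_zero, add_zero]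
    · have h1 : T a * (h (s a) - (1 - p.1 (s a)) * h (s a) * q.1 (s a)) -
          (h (t a) - (1 - p.1 (t a)) * h (t a) * q.1 (t a)) * M a =
          (T a * h (s a) - h (t a) * M a) - (T a * ((1 - p.1 (s a)) * h (s a) * q.1 (s a)) -
            ((1 - p.1 (t a)) * h (t a) * q.1 (t a)) * M a) := by
        rw [Matrix.mul_sub (T a), Matrix.sub_mul (h (t a))]
        abel
      change (1 - p.1 (t a)) * (T a * (h (s a) - (1 - p.1 (s a)) * h (s a) * q.1 (s a)) -
          (h (t a) - (1 - p.1 (t a)) * h (t a) * q.1 (t a)) * M a) * q.1 (s a) +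
        (1 - p.1 (t a)) * (T a * ((1 - p.1 (s a)) * k (s a) * q.1 (s a)) -
          ((1 - p.1 (t a)) * k (t a) * q.1 (t a)) * M a) * q.1 (s a) =
        (1 - p.1 (t a)) * η a * q.1 (s a)
      rw [h1, Matrix.mul_sub (1 - p.1 (t a)), Matrix.sub_mul _ _ (q.1 (s a)), sandwich_cocycle,
        sandwich_cocycle, sub_self, zero_add]
      have := hk a
      rwa [Matrix.mul_sub, Matrix.sub_mul, sub_eq_zero] at this

theorem graphIdem_idem (p : PG T f) (q : PG M g) :
    graphIdem s t p.1 q.1 ∘ₗ graphIdem s t p.1 q.1 = graphIdem s t p.1 q.1 := by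
  have hp := p.2.2.1
  have hq := q.2.2.1
  refine LinearMap.ext fun x => Prod.ext (funext fun i => ?_) (funext fun a => ?_)
  · change x.1 i - (1 - p.1 i) * x.1 i * q.1 i - (1 - p.1 i) * (x.1 i - (1 - p.1 i) * x.1 i * q.1 i)
      * q.1 i = x.1 i - (1 - p.1 i) * x.1 i * q.1 i
    rw [Matrix.mul_sub (1 - p.1 i) (x.1 i), Matrix.sub_mul _ _ (q.1 i),
      sandwich_sandwich (hp i) (hq i), sub_self, sub_zero]
  · exact sandwich_sandwich (hp _) (hq _) _

variable [Fintype V] [Fintype A]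

/-- The compactly supported Euler characteristic of a family of affine spaces over a product. -/
theorem EC_linear_family {X Y H H' : Type} [MetricSpace X] [MetricSpace Y] [CompactSpace X]
    [CompactSpace Y] (hX : Good X) (hY : Good Y) (cX : CE X) (cY : CE Y) [NormedAddCommGroup H]
    [NormedSpace ℂ H] [FiniteDimensional ℂ H] [NormedAddCommGroup H'] [NormedSpace ℂ H']
    [FiniteDimensional ℂ H'] {D : X × Y → H →ₗ[ℂ] H'} {F : X × Y → H' →ₗ[ℂ] H'} {k : X × Y → H'}
    (hD : ∀ h, Continuous fun z => D z h) (hF : ∀ h, Continuous fun z => F z h)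
    (hi : ∀ z, F z ∘ₗ F z = F z) (hDF : ∀ z, LinearMap.range (D z) = LinearMap.range (F z))
    (hk : Continuous k) (hr : ∀ z, k z ∈ LinearMap.range (F z)) :
    EC {x : (X × Y) × H // D x.1 x.2 = k x.1} (chiH X * chiH Y) := by
  have : NormedSpace ℝ H := NormedSpace.restrictScalars ℝ ℂ H
  have : FiniteDimensional ℝ H := Module.Finite.trans (R := ℝ) ℂ H
  let D' : X × Y → H →L[ℂ] H' := fun z => LinearMap.toContinuousLinearMap (D z)
  let F' : X × Y → H' →L[ℂ] H' := fun z => LinearMap.toContinuousLinearMap (F z)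
  have hD' : Continuous D' := continuous_clm_apply.2 hD
  have hF' : Continuous F' := continuous_clm_apply.2 hF
  have hloc := fun z₀ => linear_bundle hD' hk (fun z => (hDF z).symm ▸ hr z) z₀ (by
    filter_upwards [eventually_finrank_range_idem hF' (fun z =>
      ContinuousLinearMap.coe_injective (hi z)) z₀] with z hz
    have h1 := (D z).finrank_range_add_finrank_ker
    have h2 := (D z₀).finrank_range_add_finrank_ker
    rw [hDF] at h1 h2
    change Module.finrank ℂ (LinearMap.range (F z)) =
      Module.finrank ℂ (LinearMap.range (F z₀)) at hz
    change Module.finrank ℂ (LinearMap.ker (D z)) = Module.finrank ℂ (LinearMap.ker (D z₀))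
    omega)
  have cH : CE H := CE.of_closedEmbedding (Homeomorph.refl _).isClosedEmbedding
  have cS : CE {x : (X × Y) × H // D' x.1 x.2 = k x.1} :=
    CE.closed (C := {x : (X × Y) × H | D' x.1 x.2 = k x.1}) (isClosed_eq
      ((hD'.comp continuous_fst).clm_apply continuous_snd) (hk.comp continuous_fst))
      ((cX.prod cY).prod cH)
  exact Good.bundle hX hY cS (continuous_fst.comp continuous_subtype_val) hloc

/-- The compactly supported Euler characteristic of a stratum of the Grassmannian of an
extension. -/
theorem EC_stratum
    (hT : ∀ B : ∀ a : A, Matrix (ι (t a)) (ι (s a)) ℂ,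
      ∃ ψ : ∀ i, Matrix (ι i) (ι i) ℂ, ∀ a, T a * ψ (s a) - ψ (t a) * T a = B a)
    (hM : ∀ B : ∀ a : A, Matrix (κ (t a)) (κ (s a)) ℂ,
      ∃ ψ : ∀ i, Matrix (κ i) (κ i) ℂ, ∀ a, M a * ψ (s a) - ψ (t a) * M a = B a)
    (hfg : ∀ i, f i + g i = e i)
    (hs : ∀ (p : PG T f) (q : PG M g) (η : ∀ a : A, Matrix (ι (t a)) (κ (s a)) ℂ),
      ∃ h : ∀ i, Matrix (ι i) (κ i) ℂ, ∀ a,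
      (1 - p.1 (t a)) * (T a * h (s a) - h (t a) * M a - η a) * q.1 (s a) = 0) :
    EC ↥(stratum T ξ M e g) (chiH (PG T f) * chiH (PG M g)) := by
  obtain ⟨X, _, _, hX, ⟨eX⟩⟩ := good_PG T f hT
  obtain ⟨Y, _, _, hY, ⟨eY⟩⟩ := good_PG M g hM
  rw [chiH_homeo eX, chiH_homeo eY]
  let p : X × Y → PG T f := fun z => eX.symm z.1
  let q : X × Y → PG M g := fun z => eY.symm z.2
  have cp : ∀ i, Continuous fun z => (p z).1 i := fun i =>
    (continuous_apply i).comp (continuous_subtype_val.comp (eX.symm.continuous.comp continuous_fst))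
  have cq : ∀ i, Continuous fun z => (q z).1 i := fun i =>
    (continuous_apply i).comp (continuous_subtype_val.comp (eY.symm.continuous.comp continuous_snd))
  have cX : CE X := CE.homeo eX
    (CE.of_closedEmbedding (W := ∀ i, ι i → ι i → ℂ) (isClosed_PG T f).isClosedEmbedding_subtypeVal)
  have cY : CE Y := CE.homeo eY
    (CE.of_closedEmbedding (W := ∀ i, κ i → κ i → ℂ) (isClosed_PG M g).isClosedEmbedding_subtypeVal)
  have main := EC_linear_family hX hY cX cY (H := ∀ i, ι i → κ i → ℂ)
    (H' := (∀ i, ι i → κ i → ℂ) × (∀ a : A, ι (t a) → κ (s a) → ℂ))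
    (D := fun z => graphMap T M (p z).1 (q z).1) (F := fun z => graphIdem s t (p z).1 (q z).1)
    (k := fun z => (0, fun a => -((1 - (p z).1 (t a)) * ξ a * (q z).1 (s a))))
    (fun h => ?_) (fun h => ?_) (fun z => graphIdem_idem (p z) (q z))
    (fun z => range_graphMap (p z) (q z) (hs _ _)) ?_ (fun z => ?_)
  have hiff : ∀ x : (X × Y) × (∀ i, Matrix (ι i) (κ i) ℂ),
      graphMap T M (p x.1).1 (q x.1).1 x.2 =
      (0, fun a => -((1 - (p x.1).1 (t a)) * ξ a * (q x.1).1 (s a))) ↔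
        GraphRel ξ ((p x.1, q x.1), x.2) := by
    intro x
    rw [Prod.ext_iff, funext_iff, funext_iff]
    refine and_congr (forall_congr' fun i => ?_) (forall_congr' fun a => ?_)
    · change x.2 i - (1 - (p x.1).1 i) * x.2 i * (q x.1).1 i = 0 ↔ _
      rw [sub_eq_zero, eq_comm]
    · change (1 - (p x.1).1 (t a)) * (T a * x.2 (s a) - x.2 (t a) * M a) * (q x.1).1 (s a) =
        -((1 - (p x.1).1 (t a)) * ξ a * (q x.1).1 (s a)) ↔ (1 - (p x.1).1 (t a)) *
        (T a * x.2 (s a) + ξ a - x.2 (t a) * M a) * (q x.1).1 (s a) = 0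
      rw [eq_neg_iff_add_eq_zero, ← Matrix.add_mul, ← Matrix.mul_add, sub_add_eq_add_sub]
  let e1 : ((X × Y) × (∀ i, Matrix (ι i) (κ i) ℂ)) ≃ₜ
      (PG T f × PG M g) × (∀ i, Matrix (ι i) (κ i) ℂ) :=
    (eX.symm.prodCongr eY.symm).prodCongr (Homeomorph.refl _)
  exact main.homeo ((e1.subtype hiff).trans (stratumHomeo hfg))
  · refine Continuous.prodMk (continuous_pi fun i => ?_) (continuous_pi fun a => ?_)
    · exact Continuous.sub (G := ι i → κ i → ℂ) continuous_const (((continuous_const.sub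
        (cp i)).matrix_mul continuous_const).matrix_mul (cq i))
    · exact ((continuous_const.sub (cp _)).matrix_mul continuous_const).matrix_mul (cq _)
  · refine Continuous.prodMk (continuous_pi fun i => ?_) (continuous_pi fun a => ?_)
    · exact Continuous.sub (G := ι i → κ i → ℂ) continuous_const (((continuous_const.sub
        (cp i)).matrix_mul continuous_const).matrix_mul (cq i))
    · exact ((continuous_const.sub (cp _)).matrix_mul continuous_const).matrix_mul (cq _)
  · exact continuous_const.prodMk (continuous_pi fun a =>
      (((continuous_const.sub (cp _)).matrix_mul continuous_const).matrix_mul (cq _)).neg)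
  · refine ⟨(0, fun a => -ξ a), Prod.ext (funext fun i => ?_) (funext fun a => ?_)⟩
    · have h0 : (0 : Matrix (ι i) (κ i) ℂ) - (1 - (p z).1 i) * (0 : Matrix (ι i) (κ i) ℂ) *
          (q z).1 i = 0 := by
        rw [Matrix.mul_zero, Matrix.zero_mul, sub_zero]
      exact h0
    · have h0 : (1 - (p z).1 (t a)) * (-ξ a) * (q z).1 (s a) =
          -((1 - (p z).1 (t a)) * ξ a * (q z).1 (s a)) := by
        rw [Matrix.mul_neg, Matrix.neg_mul]
      exact h0

end

end FPoly

namespace FPoly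

open Topology TopologicalSpace

section
variable {V A : Type} {s t : A → V} {ι κ : V → Type} [∀ i, Fintype (ι i)]
  [∀ i, DecidableEq (ι i)] [∀ i, Fintype (κ i)] [∀ i, DecidableEq (κ i)]
  {T : ∀ a : A, Matrix (ι (t a)) (ι (s a)) ℂ} {M : ∀ a : A, Matrix (κ (t a)) (κ (s a)) ℂ}
  {ξ : ∀ a : A, Matrix (ι (t a)) (κ (s a)) ℂ} {e f g : V → ℕ}

theorem eq_zero_of_trace {m : Type} [Fintype m] [DecidableEq m] {P : Matrix m m ℂ}
    (hP : P * P = P) (ht : P.trace = 0) : P = 0 := by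
  have h1 := finrank_range_proj hP (r := 0) (by rw [ht, Nat.cast_zero])
  rw [Submodule.finrank_eq_zero, LinearMap.range_eq_bot] at h1
  exact Matrix.toLin'.injective (by rw [Matrix.toLin'_apply', h1, map_zero])

theorem eq_one_of_trace {m : Type} [Fintype m] [DecidableEq m] {P : Matrix m m ℂ}
    (hP : P * P = P) (ht : P.trace = Fintype.card m) : P = 1 := by
  have h1 := eq_zero_of_trace (P := 1 - P)
    (by rw [Matrix.mul_sub, Matrix.mul_one, Matrix.sub_mul, Matrix.one_mul, hP, sub_self, sub_zero])
    (by rw [Matrix.trace_sub, Matrix.trace_one, ht, sub_self])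
  exact (sub_eq_zero.1 h1).symm

theorem chiH_unique (X : Type) [TopologicalSpace X] [Unique X] : chiH X = 1 := by
  rw [chiH_homeo (Homeomorph.homeomorphOfUnique X Unit), chiH_unit]

theorem chiH_PG_zero (T : ∀ a : A, Matrix (ι (t a)) (ι (s a)) ℂ) : chiH (PG T 0) = 1 := by
  have : Unique (PG T 0) :=
    { default := ⟨0, fun i => Matrix.conjTranspose_zero, fun i => Matrix.mul_zero _,
        fun i => by simp, fun a => Matrix.mul_zero _⟩
      uniq := fun P => Subtype.ext (funext fun i => eq_zero_of_trace (P.2.2.1 i) (by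
        rw [P.2.2.2.1 i, Pi.zero_apply, Nat.cast_zero])) }
  exact chiH_unique _

theorem chiH_PG_card (T : ∀ a : A, Matrix (ι (t a)) (ι (s a)) ℂ) :
    chiH (PG T fun i => Fintype.card (ι i)) = 1 := by
  have : Unique (PG T fun i => Fintype.card (ι i)) :=
    { default := ⟨1, fun i => Matrix.conjTranspose_one, fun i => Matrix.mul_one _,
        fun i => Matrix.trace_one, fun a => by
          rw [Pi.one_apply, sub_self, Matrix.zero_mul, Matrix.zero_mul]⟩
      uniq := fun P => Subtype.ext (funext fun i => eq_one_of_trace (P.2.2.1 i) (P.2.2.2.1 i)) }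
  exact chiH_unique _

variable [Fintype V] [Fintype A] [DecidableEq V]

open Classical in
/-- The Euler characteristics of the Grassmannians of a nonsplit extension such that all proper
strata are affine fibrations. -/
theorem chiH_extension
    (hT : ∀ B : ∀ a : A, Matrix (ι (t a)) (ι (s a)) ℂ,
      ∃ ψ : ∀ i, Matrix (ι i) (ι i) ℂ, ∀ a, T a * ψ (s a) - ψ (t a) * T a = B a)
    (hM : ∀ B : ∀ a : A, Matrix (κ (t a)) (κ (s a)) ℂ,
      ∃ ψ : ∀ i, Matrix (κ i) (κ i) ℂ, ∀ a, M a * ψ (s a) - ψ (t a) * M a = B a)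
    (hE : ∀ B : ∀ a : A, Matrix (ι (t a) ⊕ κ (t a)) (ι (s a) ⊕ κ (s a)) ℂ,
      ∃ ψ : ∀ i, Matrix (ι i ⊕ κ i) (ι i ⊕ κ i) ℂ,
        ∀ a, extRep T ξ M a * ψ (s a) - ψ (t a) * extRep T ξ M a = B a)
    (hs : ∀ (f g : V → ℕ), ¬ (f = 0 ∧ g = fun i => Fintype.card (κ i)) →
      ∀ (p : PG T f) (q : PG M g) (η : ∀ a : A, Matrix (ι (t a)) (κ (s a)) ℂ),
      ∃ h : ∀ i, Matrix (ι i) (κ i) ℂ, ∀ a,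
      (1 - p.1 (t a)) * (T a * h (s a) - h (t a) * M a - η a) * q.1 (s a) = 0)
    (hne : ¬ ∃ h : ∀ i, Matrix (ι i) (κ i) ℂ, ∀ a, T a * h (s a) + ξ a - h (t a) * M a = 0)
    (e : V → ℕ) :
    chiH (PG (ι := fun i => ι i ⊕ κ i) (s := s) (t := t) (extRep T ξ M) e) =
      ∑ g ∈ Finset.Iic (fun i => Fintype.card (κ i)),
        if g ≤ e then chiH (PG T (e - g)) * chiH (PG M g) -
          (if e = fun i => Fintype.card (κ i) then if g = e then 1 else 0 else 0) else 0 := by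
  have hce : CE (PG (ι := fun i => ι i ⊕ κ i) (s := s) (t := t) (extRep T ξ M) e) :=
    CE.of_closedEmbedding (W := ∀ i, ι i ⊕ κ i → ι i ⊕ κ i → ℂ)
      (isClosed_PG (ι := fun i => ι i ⊕ κ i) (extRep T ξ M) e).isClosedEmbedding_subtypeVal
  have hec : EC (PG (ι := fun i => ι i ⊕ κ i) (s := s) (t := t) (extRep T ξ M) e)
      (chiH (PG (ι := fun i => ι i ⊕ κ i) (s := s) (t := t) (extRep T ξ M) e)) := by
    obtain ⟨Y, _, _, hY, ⟨eY⟩⟩ := good_PG (ι := fun i => ι i ⊕ κ i) (extRep T ξ M) e hE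
    rw [chiH_homeo eY]
    exact ((hY.ec (hce.homeo eY)).2).homeo eY.symm
  have hrank : ∀ g : V → ℕ, IsClosed {N : PG (ι := fun i => ι i ⊕ κ i) (s := s) (t := t)
      (extRep T ξ M) e | (fun i => (N.1 i).toBlocks₂₂.rank) ≤ g} := fun g => by
    have : {N : PG (ι := fun i => ι i ⊕ κ i) (s := s) (t := t)
      (extRep T ξ M) e | (fun i => (N.1 i).toBlocks₂₂.rank) ≤ g} =
      ⋂ i, (fun N => (N.1 i).toBlocks₂₂) ⁻¹' {B | B.rank ≤ g i} := by
      ext N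
      simp only [Set.mem_ofPred_eq, Set.mem_iInter, Set.mem_preimage]
      exact Iff.rfl
    rw [this]
    refine isClosed_iInter fun i => (isClosed_rank_le _).preimage ?_
    exact Continuous.matrix_submatrix ((continuous_apply i).comp continuous_subtype_val) _ _
  have hst := EC.stratify hce (fun N i => (N.1 i).toBlocks₂₂.rank) hrank
    (fun g => if g ≤ e then chiH (PG T (e - g)) * chiH (PG M g) -
      (if e = fun i => Fintype.card (κ i) then if g = e then 1 else 0 else 0) else 0)
    (Finset.Iic fun i => Fintype.card (κ i))
    (by rw [Finset.coe_Iic]; exact isLowerSet_Iic _) (fun g hg => ?_)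
  · refine hec.unique (EC.homeo ?_ hst)
    refine (Homeomorph.setCongr ?_).trans (Homeomorph.Set.univ _)
    refine Set.eq_univ_of_forall fun N => ?_
    rw [Set.mem_ofPred_eq, Finset.mem_Iic]
    exact fun i => Matrix.rank_le_card_height _
  · change EC ↥(stratum T ξ M e g) _
    by_cases hge : g ≤ e
    · rw [if_pos hge]
      have hfg : ∀ i, (e - g) i + g i = e i := fun i => Nat.sub_add_cancel (hge i)
      by_cases h0 : e - g = 0 ∧ g = fun i => Fintype.card (κ i)
      · have heg : g = e := le_antisymm hge fun i =>
          Nat.sub_eq_zero_iff_le.1 (congrFun h0.1 i)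
        rw [h0.1, if_pos (heg ▸ h0.2), if_pos heg, chiH_PG_zero, h0.2, chiH_PG_card, one_mul,
          sub_self, ← h0.2]
        have : IsEmpty ↥(stratum T ξ M e g) := by
          refine ⟨fun N => hne ?_⟩
          obtain ⟨x, hx⟩ := (stratumHomeo (T := T) (M := M) (ξ := ξ) hfg).symm N
          refine ⟨x.2, fun a => ?_⟩
          have h1 := hx.2 a
          have hp : x.1.1.1 (t a) = 0 := eq_zero_of_trace (x.1.1.2.2.1 _) (by
            rw [x.1.1.2.2.2.1, h0.1, Pi.zero_apply, Nat.cast_zero])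
          have hq : x.1.2.1 (s a) = 1 := eq_one_of_trace (x.1.2.2.2.1 _) (by
            rw [x.1.2.2.2.2.1, h0.2])
          rwa [hp, hq, sub_zero, Matrix.one_mul, Matrix.mul_one] at h1
        exact EC_empty _
      · have h1 : (if e = fun i => Fintype.card (κ i) then if g = e then (1 : ℤ) else 0 else 0) =
            0 := by
          split_ifs with h2 h3
          · exact absurd ⟨by rw [h3, tsub_self], h3.trans h2⟩ h0
          · rfl
          · rfl
        rw [h1, sub_zero]
        exact EC_stratum hT hM hfg (hs _ _ h0)
    · rw [if_neg hge]
      have : IsEmpty ↥(stratum T ξ M e g) := by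
        refine ⟨fun N => hge fun i => ?_⟩
        rw [← N.2, ← finrank_range_proj (N.1.2.2.1 i) (N.1.2.2.2.1 i)]
        exact Matrix.rank_submatrix_le _ _ _
      exact EC_empty _

end

end FPoly

namespace FPoly

open Module

/-- A finite dimensional representation, in coordinate free form. -/
structure Rep {V A : Type} (s t : A → V) where
  X : V → Type
  [acg : ∀ i, AddCommGroup (X i)]
  [mod : ∀ i, Module ℂ (X i)]
  [fd : ∀ i, FiniteDimensional ℂ (X i)]
  map : ∀ a, X (s a) →ₗ[ℂ] X (t a)

attribute [instance] Rep.acg Rep.mod Rep.fd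

section Factor

variable {X Y Z : Type} [AddCommGroup X] [AddCommGroup Y] [AddCommGroup Z]
  [Module ℂ X] [Module ℂ Y] [Module ℂ Z]

theorem exists_factor_of_ker_le (f : X →ₗ[ℂ] Z) (g : X →ₗ[ℂ] Y)
    (h : LinearMap.ker g ≤ LinearMap.ker f) : ∃ c : Y →ₗ[ℂ] Z, f = c ∘ₗ g := by
  obtain ⟨σ, hσ⟩ := g.rangeRestrict.exists_rightInverse_of_surjective
    (LinearMap.range_eq_top.2 g.surjective_rangeRestrict)
  obtain ⟨c, hc⟩ := LinearMap.exists_extend (f ∘ₗ σ)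
  refine ⟨c, LinearMap.ext fun x => ?_⟩
  have h1 : c (g x) = f (σ (g.rangeRestrict x)) := LinearMap.congr_fun hc (g.rangeRestrict x)
  have h2 : g (x - σ (g.rangeRestrict x)) = 0 := by
    have := congrArg Subtype.val (LinearMap.congr_fun hσ (g.rangeRestrict x))
    rw [map_sub, sub_eq_zero]
    exact this.symm
  have h3 : f (x - σ (g.rangeRestrict x)) = 0 := h h2
  rw [LinearMap.comp_apply, h1, ← sub_eq_zero, ← map_sub, h3]

theorem exists_factor_of_range_le (f : X →ₗ[ℂ] Z) (g : Y →ₗ[ℂ] Z)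
    (h : ∀ x, f x ∈ LinearMap.range g) : ∃ c : X →ₗ[ℂ] Y, f = g ∘ₗ c := by
  obtain ⟨σ, hσ⟩ := g.rangeRestrict.exists_rightInverse_of_surjective
    (LinearMap.range_eq_top.2 g.surjective_rangeRestrict)
  refine ⟨σ ∘ₗ f.codRestrict _ h, LinearMap.ext fun x => ?_⟩
  exact (congrArg Subtype.val (LinearMap.congr_fun hσ (f.codRestrict _ h x))).symm

end Factor

namespace Rep

variable {V A : Type} {s t : A → V}

/-- Families of linear maps between two representations. -/
abbrev C0 (X Y : Rep s t) : Type := ∀ i, X.X i →ₗ[ℂ] Y.X i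

/-- Families of linear maps indexed by the arrows. -/
abbrev C1 (X Y : Rep s t) : Type := ∀ a, X.X (s a) →ₗ[ℂ] Y.X (t a)

/-- The identity family. -/
def one (X : Rep s t) : C0 X X := fun _ => LinearMap.id

/-- Composition of families. -/
def cmp {X Y Z : Rep s t} (ψ : C0 Y Z) (φ : C0 X Y) : C0 X Z := fun i => ψ i ∘ₗ φ i

/-- Postcomposition of an arrow family. -/
def lm {X Y Z : Rep s t} (ψ : C0 Y Z) (η : C1 X Y) : C1 X Z := fun a => ψ (t a) ∘ₗ η a

/-- Precomposition of an arrow family. -/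
def rm {X Y Z : Rep s t} (η : C1 Y Z) (φ : C0 X Y) : C1 X Z := fun a => η a ∘ₗ φ (s a)

/-- The standard differential; its kernel is `Hom` and its cokernel is `Ext`. -/
def dd (X Y : Rep s t) : C0 X Y →ₗ[ℂ] C1 X Y where
  toFun φ a := Y.map a ∘ₗ φ (s a) - φ (t a) ∘ₗ X.map a
  map_add' φ ψ := by
    funext a; ext x
    simp only [Pi.add_apply, LinearMap.sub_apply, LinearMap.comp_apply, LinearMap.add_apply,
      map_add]
    abel
  map_smul' c φ := by
    funext a; ext x
    simp only [Pi.smul_apply, LinearMap.sub_apply, LinearMap.comp_apply, LinearMap.smul_apply,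
      map_smul, RingHom.id_apply, smul_sub]

variable {W X Y Z : Rep s t}

@[simp] theorem one_apply (i : V) (x : X.X i) : one X i x = x := rfl
@[simp] theorem cmp_apply (ψ : C0 Y Z) (φ : C0 X Y) (i : V) (x : X.X i) :
    cmp ψ φ i x = ψ i (φ i x) := rfl
@[simp] theorem lm_apply (ψ : C0 Y Z) (η : C1 X Y) (a : A) (x : X.X (s a)) :
    lm ψ η a x = ψ (t a) (η a x) := rfl
@[simp] theorem rm_apply (η : C1 Y Z) (φ : C0 X Y) (a : A) (x : X.X (s a)) :
    rm η φ a x = η a (φ (s a) x) := rfl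
@[simp] theorem dd_apply (φ : C0 X Y) (a : A) (x : X.X (s a)) :
    dd X Y φ a x = Y.map a (φ (s a) x) - φ (t a) (X.map a x) := rfl

theorem C0_ext {φ ψ : C0 X Y} (h : ∀ i x, φ i x = ψ i x) : φ = ψ :=
  funext fun i => LinearMap.ext (h i)

theorem C1_ext {φ ψ : C1 X Y} (h : ∀ a x, φ a x = ψ a x) : φ = ψ :=
  funext fun a => LinearMap.ext (h a)

/-- Homomorphisms of representations. -/
def IsHom (φ : C0 X Y) : Prop := dd X Y φ = 0

theorem isHom_iff {φ : C0 X Y} :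
    IsHom φ ↔ ∀ a x, Y.map a (φ (s a) x) = φ (t a) (X.map a x) := by
  constructor
  · intro h a x
    have : dd X Y φ a x = 0 := by rw [show dd X Y φ = 0 from h]; rfl
    exact sub_eq_zero.1 this
  · intro h
    exact C1_ext fun a x => sub_eq_zero.2 (h a x)

theorem dd_cmp (ψ : C0 Y Z) (φ : C0 X Y) :
    dd X Z (cmp ψ φ) = rm (dd Y Z ψ) φ + lm ψ (dd X Y φ) := by
  refine C1_ext fun a x => ?_
  simp only [dd_apply, cmp_apply, Pi.add_apply, LinearMap.add_apply, rm_apply, lm_apply, map_sub]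
  abel

theorem IsHom.cmp {ψ : C0 Y Z} {φ : C0 X Y} (hψ : IsHom ψ) (hφ : IsHom φ) :
    IsHom (cmp ψ φ) := by
  rw [isHom_iff] at *
  intro a x
  rw [cmp_apply, cmp_apply, hψ, hφ]

theorem IsHom.sub {ψ φ : C0 X Y} (hψ : IsHom ψ) (hφ : IsHom φ) : IsHom (ψ - φ) := by
  rw [IsHom, map_sub, show dd X Y ψ = 0 from hψ, show dd X Y φ = 0 from hφ, sub_zero]

theorem IsHom.smul (c : ℂ) {φ : C0 X Y} (hφ : IsHom φ) : IsHom (c • φ) := by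
  rw [IsHom, map_smul, show dd X Y φ = 0 from hφ, smul_zero]

theorem isHom_one : IsHom (one X) := isHom_iff.2 fun _ _ => rfl

theorem dd_cmp_left {ψ : C0 Y Z} (hψ : IsHom ψ) (φ : C0 X Y) :
    dd X Z (Rep.cmp ψ φ) = lm ψ (dd X Y φ) := by
  rw [dd_cmp, show dd Y Z ψ = 0 from hψ]
  exact zero_add _

theorem dd_cmp_right (ψ : C0 Y Z) {φ : C0 X Y} (hφ : IsHom φ) :
    dd X Z (Rep.cmp ψ φ) = rm (dd Y Z ψ) φ := by
  rw [dd_cmp, show dd X Y φ = 0 from hφ]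
  refine C1_ext fun a x => ?_
  simp

/-- A subrepresentation. -/
def Stable (X : Rep s t) (S : ∀ i, Submodule ℂ (X.X i)) : Prop :=
  ∀ a, ∀ x ∈ S (s a), X.map a x ∈ S (t a)

theorem exists_sub {S : ∀ i, Submodule ℂ (X.X i)} (hS : Stable X S) :
    ∃ (K : Rep s t) (j : C0 K X), IsHom j ∧ (∀ i, Function.Injective (j i)) ∧
      ∀ i, LinearMap.range (j i) = S i := by
  refine ⟨{ X := fun i => S i, map := fun a => (X.map a).restrict (hS a) },
    fun i => (S i).subtype, ?_, fun i => (S i).injective_subtype, fun i => (S i).range_subtype⟩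
  exact isHom_iff.2 fun a x => rfl

theorem exists_quot {S : ∀ i, Submodule ℂ (X.X i)} (hS : Stable X S) :
    ∃ (N : Rep s t) (π : C0 X N), IsHom π ∧ (∀ i, Function.Surjective (π i)) ∧
      ∀ i, LinearMap.ker (π i) = S i := by
  refine ⟨{ X := fun i => X.X i ⧸ S i, map := fun a => (S (s a)).mapQ (S (t a)) (X.map a) (hS a) },
    fun i => (S i).mkQ, ?_, fun i => (S i).mkQ_surjective, fun i => (S i).ker_mkQ⟩
  exact isHom_iff.2 fun a x => rfl

theorem exists_ext (N M : Rep s t) (ξ : C1 M N) :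
    ∃ (F : Rep s t) (ι : C0 N F) (pr : C0 F M) (σ : C0 M F) (κ : C0 F N), IsHom ι ∧ IsHom pr ∧
      (∀ i x, pr i (ι i x) = 0) ∧ (∀ i x, pr i (σ i x) = x) ∧ (∀ i x, κ i (ι i x) = x) ∧
      (∀ i x, κ i (σ i x) = 0) ∧ (∀ i x, ι i (κ i x) + σ i (pr i x) = x) ∧
      dd M F σ = lm ι ξ := by
  refine ⟨
    { X := fun i => N.X i × M.X i
      map := fun a => (N.map a ∘ₗ LinearMap.fst ℂ _ _ + ξ a ∘ₗ LinearMap.snd ℂ _ _).prod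
        (M.map a ∘ₗ LinearMap.snd ℂ _ _) },
    fun i => LinearMap.inl ℂ _ _, fun i => LinearMap.snd ℂ _ _, fun i => LinearMap.inr ℂ _ _,
    fun i => LinearMap.fst ℂ _ _, ?_, ?_, fun i x => rfl, fun i x => rfl, fun i x => rfl,
    fun i x => rfl, fun i x => ?_, ?_⟩
  · refine isHom_iff.2 fun a x => ?_
    simp
  · refine isHom_iff.2 fun a x => ?_
    simp
  · simp
  · refine C1_ext fun a x => ?_
    rw [dd_apply, lm_apply]
    refine Prod.ext ?_ ?_
    · change N.map a 0 + ξ a x - 0 = ξ a x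
      rw [map_zero, zero_add, sub_zero]
    · change M.map a x - M.map a x = 0
      rw [sub_self]

/-- The Euler form inequality packaged through the standard differential. -/
theorem euler_eq [Fintype V] [Fintype A] (X Y : Rep s t) :
    (finrank ℂ (LinearMap.ker (dd X Y)) : ℤ) + finrank ℂ (LinearMap.range (dd X Y))
      - finrank ℂ (C1 X Y) =
      eulerForm s t (fun i => (finrank ℂ (X.X i) : ℤ)) (fun i => (finrank ℂ (Y.X i) : ℤ)) := by
  have h1 := (dd X Y).finrank_range_add_finrank_ker
  have h2 : finrank ℂ (C0 X Y) = ∑ i, finrank ℂ (X.X i) * finrank ℂ (Y.X i) := by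
    rw [finrank_pi_fintype]
    exact Finset.sum_congr rfl fun i _ => finrank_linearMap ..
  have h3 : finrank ℂ (C1 X Y) = ∑ a, finrank ℂ (X.X (s a)) * finrank ℂ (Y.X (t a)) := by
    rw [finrank_pi_fintype]
    exact Finset.sum_congr rfl fun i _ => finrank_linearMap ..
  rw [eulerForm, h3]
  rw [h2] at h1
  have h4 := congrArg (Nat.cast : ℕ → ℤ) h1
  push_cast at h4 ⊢
  linarith

/-- Dimension vector. -/
def dimv (X : Rep s t) : V → ℤ := fun i => (finrank ℂ (X.X i) : ℤ)

theorem euler_neg [Fintype V] [Fintype A] {X Y : Rep s t} (h1 : Function.Injective (dd X Y))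
    (h2 : ¬ Function.Surjective (dd X Y)) : eulerForm s t (dimv X) (dimv Y) ≤ -1 := by
  have h := euler_eq X Y
  have h3 : finrank ℂ (LinearMap.range (dd X Y)) < finrank ℂ (C1 X Y) :=
    Submodule.finrank_lt (fun h => h2 (LinearMap.range_eq_top.1 h))
  rw [LinearMap.ker_eq_bot.2 h1, finrank_bot] at h
  unfold dimv
  push_cast at h
  omega

end Rep
end FPoly

namespace FPoly

open Module

namespace Rep

variable {V A : Type} {s t : A → V} {W X Y Z : Rep s t}

/-- Indecomposability through idempotent endomorphisms. -/
def Ind (X : Rep s t) : Prop :=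
  one X ≠ 0 ∧ ∀ φ : C0 X X, IsHom φ → cmp φ φ = φ → φ = 0 ∨ φ = one X

/-- Total rank. -/
def rk [Fintype V] (φ : C0 X Y) : ℕ := ∑ i, finrank ℂ (LinearMap.range (φ i))

/-- Total dimension. -/
def tdim [Fintype V] (X : Rep s t) : ℕ := ∑ i, finrank ℂ (X.X i)

theorem sum_eq_of_le [Fintype V] {f g : V → ℕ} (h : ∀ i, f i ≤ g i)
    (h2 : ∑ i, g i ≤ ∑ i, f i) (i : V) : f i = g i :=
  (Finset.sum_eq_sum_iff_of_le fun i _ => h i).1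
    (le_antisymm (Finset.sum_le_sum fun i _ => h i) h2) i (Finset.mem_univ i)

theorem tdim_le [Fintype V] {φ : C0 X Y} (h : ∀ i, Function.Injective (φ i)) :
    tdim X ≤ tdim Y :=
  Finset.sum_le_sum fun i _ => LinearMap.finrank_le_finrank_of_injective (h i)

theorem bijective_of_tdim_le [Fintype V] {φ : C0 X Y} (h : ∀ i, Function.Injective (φ i))
    (h2 : tdim Y ≤ tdim X) (i : V) : Function.Surjective (φ i) :=
  (LinearMap.injective_iff_surjective_of_finrank_eq_finrank
    (sum_eq_of_le (fun i => LinearMap.finrank_le_finrank_of_injective (h i)) h2 i)).1 (h i)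

theorem cmp_assoc (θ : C0 Y Z) (ψ : C0 X Y) (φ : C0 W X) :
    cmp (cmp θ ψ) φ = cmp θ (cmp ψ φ) := rfl

theorem one_cmp (φ : C0 X Y) : cmp (one Y) φ = φ := rfl

theorem cmp_one (φ : C0 X Y) : cmp φ (one X) = φ := rfl

theorem cmp_zero (φ : C0 X Y) : cmp φ (0 : C0 W X) = 0 := C0_ext fun i x => by simp

theorem zero_cmp (φ : C0 X Y) : cmp (0 : C0 Y W) φ = 0 := C0_ext fun i x => by simp

theorem injective_of_cmp_eq_one {π : C0 Y X} {j : C0 X Y} (h : cmp π j = one X) (i : V) :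
    Function.Injective (j i) := fun x y hxy => by
  have h1 : ∀ z, π i (j i z) = z := fun z => by
    rw [← cmp_apply, h, one_apply]
  rw [← h1 x, hxy, h1 y]

theorem stable_range {φ : C0 X Y} (h : IsHom φ) :
    Stable Y (fun i => LinearMap.range (φ i)) := by
  rintro a _ ⟨x, rfl⟩
  exact ⟨X.map a x, (isHom_iff.1 h a x).symm⟩

theorem stable_ker {φ : C0 X Y} (h : IsHom φ) :
    Stable X (fun i => LinearMap.ker (φ i)) := by
  intro a x hx
  rw [LinearMap.mem_ker] at hx ⊢
  rw [← isHom_iff.1 h a x, hx, map_zero]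

/-- Lifting a homomorphism through a monomorphism. -/
theorem exists_lift {j : C0 X Y} (hj : IsHom j) (hi : ∀ i, Function.Injective (j i))
    {φ : C0 W Y} (hφ : IsHom φ) (h : ∀ i x, φ i x ∈ LinearMap.range (j i)) :
    ∃ ψ : C0 W X, IsHom ψ ∧ cmp j ψ = φ := by
  choose ψ hψ using fun i => exists_factor_of_range_le (φ i) (j i) (h i)
  have h2 : cmp j ψ = φ := funext fun i => (hψ i).symm
  refine ⟨ψ, isHom_iff.2 fun a x => hi _ ?_, h2⟩
  have h3 : ∀ i x, j i (ψ i x) = φ i x := fun i x => by rw [← h2, cmp_apply]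
  rw [← isHom_iff.1 hj, h3, h3, isHom_iff.1 hφ]

theorem exists_indec_summand [Fintype V] (K : Rep s t) (p : C0 K K → Prop) (h1 : p (one K))
    (h0 : ¬ p 0) (hadd : ∀ φ ψ, p (φ + ψ) → p φ ∨ p ψ) :
    ∃ (Y : Rep s t) (j : C0 Y K) (π : C0 K Y), IsHom j ∧ IsHom π ∧ cmp π j = one Y ∧ Ind Y ∧
      p (cmp j π) := by
  classical
  have hex : ∃ n, ∃ φ : C0 K K, IsHom φ ∧ cmp φ φ = φ ∧ p φ ∧ rk φ = n :=
    ⟨_, one K, isHom_one, rfl, h1, rfl⟩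
  obtain ⟨φ, hφ, hid, hp, hn⟩ := Nat.find_spec hex
  have hmin : ∀ ψ : C0 K K, IsHom ψ → cmp ψ ψ = ψ → p ψ → rk φ ≤ rk ψ := fun ψ a b c => by
    rw [hn]; exact Nat.find_min' hex ⟨ψ, a, b, c, rfl⟩
  obtain ⟨Y, j, hj, hji, hjr⟩ := exists_sub (stable_range hφ)
  obtain ⟨π, hπ, hjπ⟩ := exists_lift hj hji hφ (fun i x => by rw [hjr]; exact ⟨x, rfl⟩)
  have hπj : cmp π j = one Y := by
    refine C0_ext fun i y => hji i ?_
    have h2 : j i y ∈ LinearMap.range (φ i) := by rw [← hjr]; exact ⟨y, rfl⟩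
    obtain ⟨x, hx⟩ := h2
    rw [cmp_apply, one_apply, ← cmp_apply (φ := π), hjπ, ← hx, ← cmp_apply, hid]
  have hπj' : ∀ i y, π i (j i y) = y := fun i y => by rw [← cmp_apply, hπj, one_apply]
  have key : ∀ e : C0 Y Y, IsHom e → cmp e e = e → p (cmp j (cmp e π)) → e = one Y := by
    intro e he hee hpe
    have hle := hmin _ (hj.cmp (he.cmp hπ)) (by
      refine C0_ext fun i x => ?_
      simp only [cmp_apply, hπj']
      rw [← cmp_apply (ψ := e), hee]) hpe
    have hr : ∀ i, LinearMap.range (cmp j (cmp e π) i) ≤ LinearMap.range (φ i) := by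
      rintro i _ ⟨x, rfl⟩
      rw [← hjr]; exact ⟨_, rfl⟩
    have heq := sum_eq_of_le (fun i => Submodule.finrank_mono (hr i)) hle
    refine C0_ext fun i y => ?_
    have h3 : j i y ∈ LinearMap.range (cmp j (cmp e π) i) := by
      rw [Submodule.eq_of_le_of_finrank_eq (hr i) (heq i), ← hjr]; exact ⟨y, rfl⟩
    obtain ⟨x, hx⟩ := h3
    have h4 : e i (π i x) = y := hji i hx
    rw [one_apply, ← h4, ← cmp_apply (ψ := e), hee]
  refine ⟨Y, j, π, hj, hπ, hπj, ⟨?_, ?_⟩, by rwa [hjπ]⟩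
  · intro h2
    refine h0 ?_
    have h3 : φ = 0 := by
      rw [← hjπ, ← one_cmp π, h2, zero_cmp, cmp_zero]
    rwa [h3] at hp
  · intro e he hee
    have h5 : φ = cmp j (cmp e π) + cmp j (cmp (one Y - e) π) := by
      rw [← hjπ]
      refine C0_ext fun i x => ?_
      simp
    rw [h5] at hp
    rcases hadd _ _ hp with h | h
    · exact Or.inr (key e he hee h)
    · left
      have h6 := key (one Y - e) (isHom_one.sub he) (by
        refine C0_ext fun i x => ?_
        have h7 : e i (e i x) = e i x := by rw [← cmp_apply, hee]
        simp [h7]) h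
      refine C0_ext fun i x => ?_
      have h8 : (one Y - e) i x = x := by rw [h6, one_apply]
      simpa using h8

theorem exists_idempotent_of_isCompl [Fintype V] {θ : C0 X X} (hθ : IsHom θ)
    (h : ∀ i, IsCompl (LinearMap.range (θ i)) (LinearMap.ker (θ i))) :
    ∃ e : C0 X X, IsHom e ∧ cmp e e = e ∧ (∀ i x, e i (θ i x) = θ i x) ∧
      (∀ i x, θ i x = 0 → e i x = 0) := by
  have hl : ∀ i x, x ∈ LinearMap.range (θ i) →
      (LinearMap.range (θ i)).projection _ (h i) x = x := fun i x hx =>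
    Submodule.projection_apply_of_mem_left (h i) hx
  have hm : ∀ i x, (LinearMap.range (θ i)).projection _ (h i) x ∈ LinearMap.range (θ i) :=
    fun i x => Submodule.projection_apply_mem (h i) x
  refine ⟨fun i => (LinearMap.range (θ i)).projection _ (h i), ?_, ?_, ?_, ?_⟩
  · refine isHom_iff.2 fun a x => ?_
    have h1 := Submodule.sub_projection_mem (h (s a)) x
    have h2 := stable_ker hθ a _ h1
    have h3 := (Submodule.projection_apply_eq_zero_iff (h (t a))).2 h2
    rw [map_sub, map_sub, sub_eq_zero] at h3
    rw [h3]
    exact (hl _ _ (stable_range hθ a _ (hm _ _))).symm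
  · exact C0_ext fun i x => hl _ _ (hm _ _)
  · exact fun i x => hl _ _ ⟨x, rfl⟩
  · exact fun i x hx => (Submodule.projection_apply_eq_zero_iff (h i)).2 hx

end Rep
end FPoly

namespace FPoly

open Module

theorem ker_eq_of_finrank_range_le {X Y Z : Type} [AddCommGroup X] [AddCommGroup Y]
    [AddCommGroup Z] [Module ℂ X] [Module ℂ Y] [Module ℂ Z] [FiniteDimensional ℂ X]
    {f : X →ₗ[ℂ] Y} {g : X →ₗ[ℂ] Z} (h : LinearMap.ker f ≤ LinearMap.ker g)
    (h2 : finrank ℂ (LinearMap.range f) ≤ finrank ℂ (LinearMap.range g)) :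
    LinearMap.ker f = LinearMap.ker g := by
  refine Submodule.eq_of_le_of_finrank_le h ?_
  have h3 := f.finrank_range_add_finrank_ker
  have h4 := g.finrank_range_add_finrank_ker
  omega

theorem finrank_range_le_of_ker_le {X Y Z : Type} [AddCommGroup X] [AddCommGroup Y]
    [AddCommGroup Z] [Module ℂ X] [Module ℂ Y] [Module ℂ Z] [FiniteDimensional ℂ X]
    {f : X →ₗ[ℂ] Y} {g : X →ₗ[ℂ] Z} (h : LinearMap.ker f ≤ LinearMap.ker g) :
    finrank ℂ (LinearMap.range g) ≤ finrank ℂ (LinearMap.range f) := by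
  have h2 := Submodule.finrank_mono h
  have h3 := f.finrank_range_add_finrank_ker
  have h4 := g.finrank_range_add_finrank_ker
  omega

namespace Rep

variable {V A : Type} {s t : A → V} {W X Y Z : Rep s t}

theorem injective_of_ind [Fintype V] (hX : Ind X)
    (IH : ∀ Y : Rep s t, Ind Y → tdim Y < tdim X → Function.Surjective (dd Y Y))
    (θ₀ : C0 X X) (hθ₀ : IsHom θ₀) (hne : θ₀ ≠ 0) (i : V) : Function.Injective (θ₀ i) := by
  classical
  by_contra hni
  have hex : ∃ n, ∃ θ : C0 X X, IsHom θ ∧ θ ≠ 0 ∧ (∃ i, ¬ Function.Injective (θ i)) ∧ rk θ = n :=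
    ⟨_, θ₀, hθ₀, hne, ⟨i, hni⟩, rfl⟩
  obtain ⟨θ, hθ, hθ0, ⟨l, hl⟩, hn⟩ := Nat.find_spec hex
  have hmin : ∀ ψ : C0 X X, IsHom ψ → ψ ≠ 0 → (∀ i, LinearMap.ker (θ i) ≤ LinearMap.ker (ψ i)) →
      ∀ i, LinearMap.ker (θ i) = LinearMap.ker (ψ i) := by
    intro ψ a b c i
    have h1 : rk θ ≤ rk ψ := by
      rw [hn]
      refine Nat.find_min' hex ⟨ψ, a, b, ⟨l, fun h => hl ?_⟩, rfl⟩
      rw [← LinearMap.ker_eq_bot] at h ⊢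
      exact le_bot_iff.1 (h ▸ c l)
    have h2 := sum_eq_of_le (fun i => finrank_range_le_of_ker_le (c i)) h1 i
    exact ker_eq_of_finrank_range_le (c i) h2.ge
  have hθl : ∃ x, x ≠ 0 ∧ θ l x = 0 := by
    rw [← LinearMap.ker_eq_bot, Submodule.eq_bot_iff] at hl
    push Not at hl
    obtain ⟨x, hx, hx0⟩ := hl
    exact ⟨x, hx0, hx⟩
  have hsq : cmp θ θ = 0 := by
    by_contra hsq
    have h1 := hmin _ (hθ.cmp hθ) hsq (fun i x hx => by
      rw [LinearMap.mem_ker] at hx ⊢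
      rw [cmp_apply, hx, map_zero])
    have h2 : ∀ i, IsCompl (LinearMap.range (θ i)) (LinearMap.ker (θ i)) := by
      intro i
      rw [Submodule.isCompl_iff_disjoint _ _ ((θ i).finrank_range_add_finrank_ker).ge,
        Submodule.disjoint_def]
      rintro _ ⟨y, rfl⟩ h3
      have h4 : y ∈ LinearMap.ker (cmp θ θ i) := h3
      rw [← h1 i] at h4
      exact h4
    obtain ⟨e, he, hee, he1, he2⟩ := exists_idempotent_of_isCompl hθ h2
    rcases hX.2 e he hee with h | h
    · refine hθ0 (C0_ext fun i x => ?_)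
      rw [← he1, h]; rfl
    · obtain ⟨x, hx, hx0⟩ := hθl
      have := he2 _ _ hx0
      rw [h] at this
      exact hx this
  obtain ⟨K, j, hj, hji, hjr⟩ := exists_sub (stable_ker hθ)
  have hsq' : ∀ i x, θ i (θ i x) = 0 := fun i x => by rw [← cmp_apply, hsq]; rfl
  have hθj : ∀ i x, θ i (j i x) = 0 := fun i x => by
    have : j i x ∈ LinearMap.ker (θ i) := by rw [← hjr]; exact ⟨x, rfl⟩
    exact this
  obtain ⟨θ', hθ', hjθ⟩ := exists_lift hj hji hθ (fun i x => by rw [hjr]; exact hsq' i x)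
  have hK : tdim K < tdim X := by
    by_contra h
    have h2 := bijective_of_tdim_le hji (not_lt.1 h)
    refine hθ0 (C0_ext fun i x => ?_)
    obtain ⟨y, rfl⟩ := h2 i x
    exact hθj i y
  obtain ⟨Y, jY, π, hjY, hπ, hπj, hY, hp⟩ := exists_indec_summand K (fun φ => cmp φ θ' ≠ 0)
    (fun h => hθ0 (by rw [← hjθ, ← one_cmp θ', h, cmp_zero]))
    (fun h => h (zero_cmp _))
    (fun φ ψ h => by
      by_contra h2
      push Not at h2
      refine h ?_
      have : cmp (φ + ψ) θ' = cmp φ θ' + cmp ψ θ' := rfl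
      rw [this, h2.1, h2.2, add_zero])
  have hπj' : ∀ i y, π i (jY i y) = y := fun i y => by rw [← cmp_apply, hπj, one_apply]
  set θ₂ : C0 X X := cmp j (cmp (cmp jY π) θ') with hθ₂
  have hθ'0 : ∀ i x, θ i x = 0 → θ' i x = 0 := fun i x h => hji i (by
    rw [← cmp_apply, hjθ, h, map_zero])
  have hker := hmin θ₂ (hj.cmp ((hjY.cmp hπ).cmp hθ')) (fun h => hp (C0_ext fun i x => hji i (by
    have : θ₂ i x = 0 := by rw [h]; rfl
    rw [hθ₂, cmp_apply] at this
    rw [this]; exact (map_zero _).symm))) (fun i x hx => by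
      rw [LinearMap.mem_ker] at hx ⊢
      rw [hθ₂, cmp_apply, cmp_apply, hθ'0 i x hx, map_zero, map_zero])
  have hg : IsHom (cmp π θ') := hπ.cmp hθ'
  choose r hr using fun i => exists_factor_of_ker_le (π i) (j i)
    (by rw [LinearMap.ker_eq_bot.2 (hji i)]; exact bot_le)
  have hrj : ∀ i x, r i (j i x) = π i x := fun i x => (LinearMap.congr_fun (hr i) x).symm
  choose c hc using fun a => exists_factor_of_ker_le (dd X Y r a) (cmp π θ' (s a)) (by
    intro x hx
    have h1 : x ∈ LinearMap.ker (θ (s a)) := by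
      rw [hker, LinearMap.mem_ker, hθ₂, cmp_apply, cmp_apply, cmp_apply]
      rw [LinearMap.mem_ker, cmp_apply] at hx
      rw [hx, map_zero, map_zero]
    rw [← hjr] at h1
    obtain ⟨y, rfl⟩ := h1
    rw [LinearMap.mem_ker, dd_apply, hrj, isHom_iff.1 hj, hrj, isHom_iff.1 hπ, sub_self])
  obtain ⟨c', hc'⟩ := IH Y hY
    ((tdim_le (injective_of_cmp_eq_one hπj)).trans_lt hK) c
  have hρ : IsHom (r - cmp c' (cmp π θ')) := by
    rw [IsHom, map_sub, dd_cmp_right _ hg, hc', sub_eq_zero]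
    exact funext hc
  set ρ := r - cmp c' (cmp π θ') with hρd
  have hρj : ∀ i x, ρ i (j i x) = π i x := fun i x => by
    have : ρ i (j i x) = r i (j i x) - c' i (π i (θ' i (j i x))) := rfl
    rw [this, hrj, hθ'0 _ _ (hθj i x), map_zero, map_zero, sub_zero]
  rcases hX.2 (cmp j (cmp jY ρ)) (hj.cmp (hjY.cmp hρ)) (C0_ext fun i x => by
    simp only [cmp_apply, hρj, hπj']) with h | h
  · refine hp (C0_ext fun i x => hji i ?_)
    have h1 : cmp j (cmp jY ρ) i (j i (θ' i x)) = 0 := by rw [h]; rfl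
    rw [cmp_apply, cmp_apply, hρj] at h1
    rw [cmp_apply, cmp_apply, h1]
    exact (map_zero _).symm
  · refine hθ0 (C0_ext fun i x => ?_)
    have h1 : cmp j (cmp jY ρ) i x = x := by rw [h, one_apply]
    rw [← h1, cmp_apply, hθj]; rfl

/-- A representation all of whose endomorphisms are scalar and without self extensions. -/
structure Brick (X : Rep s t) : Prop where
  ne : one X ≠ 0
  scalar : ∀ φ : C0 X X, IsHom φ → ∃ c : ℂ, φ = c • one X
  surj : Function.Surjective (dd X X)

theorem exists_nontrivial (h : one X ≠ 0) : ∃ i, ∃ x : X.X i, x ≠ 0 := by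
  by_contra h2
  push Not at h2
  exact h (C0_ext fun i x => h2 i x)

theorem dimv_ne_zero (h : one X ≠ 0) : dimv X ≠ 0 := by
  obtain ⟨i, x, hx⟩ := exists_nontrivial h
  intro h2
  have h3 : (finrank ℂ (X.X i) : ℤ) = 0 := congrFun h2 i
  have : Nontrivial (X.X i) := nontrivial_of_ne x 0 hx
  have := finrank_pos (R := ℂ) (M := X.X i)
  omega

theorem finrank_ker_of_scalar (hne : one X ≠ 0)
    (h : ∀ φ : C0 X X, IsHom φ → ∃ c : ℂ, φ = c • one X) :
    finrank ℂ (LinearMap.ker (dd X X)) = 1 := by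
  have h1 : LinearMap.ker (dd X X) = Submodule.span ℂ {one X} := by
    refine le_antisymm (fun φ hφ => ?_) ?_
    · obtain ⟨c, rfl⟩ := h φ hφ
      exact Submodule.smul_mem _ _ (Submodule.mem_span_singleton_self _)
    · rw [Submodule.span_singleton_le_iff_mem]
      exact isHom_one
  rw [h1, finrank_span_singleton hne]

theorem Brick.euler [Fintype V] [Fintype A] (hX : Brick X) :
    eulerForm s t (dimv X) (dimv X) = 1 := by
  have h := euler_eq X X
  rw [LinearMap.range_eq_top.2 hX.surj, finrank_top, finrank_ker_of_scalar hX.ne hX.scalar] at h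
  unfold dimv
  rw [← h]
  push_cast
  ring

theorem Ind.brick [Fintype V] [Fintype A] (hQ : IsDynkin s t) (hX : Ind X) : Brick X := by
  induction hn : tdim X using Nat.strong_induction_on generalizing X with
  | _ n ih =>
  subst hn
  have hinj := injective_of_ind hX (fun Y hY hlt => (ih _ hlt hY rfl).surj)
  have hsc : ∀ φ : C0 X X, IsHom φ → ∃ c : ℂ, φ = c • one X := by
    intro φ hφ
    obtain ⟨i, x, hx⟩ := exists_nontrivial hX.1
    have : Nontrivial (X.X i) := nontrivial_of_ne x 0 hx
    obtain ⟨c, hc⟩ := Module.End.exists_eigenvalue (φ i)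
    obtain ⟨v, hv⟩ := hc.exists_hasEigenvector
    refine ⟨c, sub_eq_zero.1 ?_⟩
    by_contra hne
    have h1 := hinj _ (hφ.sub (isHom_one.smul c)) hne i
    refine hv.2 (h1 ?_)
    rw [map_zero]
    have h2 : φ i v = c • v := hv.apply_eq_smul
    have h3 : (φ - c • one X) i v = φ i v - c • v := rfl
    rw [h3, h2, sub_self]
  refine ⟨hX.1, hsc, ?_⟩
  have h := euler_eq X X
  rw [finrank_ker_of_scalar hX.1 hsc] at h
  have h2 := hQ _ (dimv_ne_zero hX.1)
  unfold dimv at h2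
  rw [← h] at h2
  rw [← LinearMap.range_eq_top]
  refine Submodule.eq_top_of_finrank_eq (le_antisymm (Submodule.finrank_le _) ?_)
  push_cast at h2
  omega

end Rep
end FPoly

namespace FPoly

open Module

namespace Rep

variable {V A : Type} {s t : A → V} {W X Y Z T M : Rep s t}

/-- An almost split sequence given by its cocycle. -/
structure AlmostSplit (T M : Rep s t) (ξ : C1 M T) : Prop where
  left : Brick T
  right : Brick M
  ne : ∀ h : C0 M T, dd M T h ≠ ξ
  lift : ∀ (X : Rep s t) (h : C0 X M), IsHom h → (¬ ∃ r : C0 M X, IsHom r ∧ cmp h r = one M) →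
    ∃ k : C0 X T, dd X T k = rm ξ h

variable {ξ : C1 M T}

/-- Extensions by `N` along a morphism out of the left term. -/
theorem AlmostSplit.pushout (h : AlmostSplit T M ξ) {N : Rep s t} (η : C1 M N)
    (hη : ∀ k, dd M N k ≠ η) :
    ∃ (φ : C0 N T) (k : C0 M T), IsHom φ ∧ ξ = dd M T k + lm φ η := by
  obtain ⟨F, ι, pr, σ, κ, hι, hpr, h1, h2, h3, h4, h5, h6⟩ := exists_ext N M η
  have h6' : ∀ a x, F.map a (σ (s a) x) - σ (t a) (M.map a x) = ι (t a) (η a x) := fun a x => by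
    rw [← dd_apply, h6, lm_apply]
  obtain ⟨k', hk'⟩ := h.lift F pr hpr (by
    rintro ⟨r, hr, hr2⟩
    refine hη (- cmp κ r) (C1_ext fun a x => ?_)
    have h7 : ∀ i x, r i x = ι i (κ i (r i x)) + σ i x := fun i x => by
      conv_lhs => rw [← h5 i (r i x)]
      rw [← cmp_apply (ψ := pr), hr2, one_apply]
    have h8 := isHom_iff.1 hr a x
    rw [h7 _ x, h7 _ (M.map a x), map_add, isHom_iff.1 hι] at h8
    have h9 := congrArg (κ (t a)) h8
    rw [map_add, map_add, h3, h3, h4, add_zero] at h9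
    have h10 := congrArg (κ (t a)) (h6' a x)
    rw [map_sub, h4, h3, sub_zero] at h10
    rw [h10] at h9
    rw [dd_apply]
    change N.map a (-(κ (s a) (r (s a) x))) - (-(κ (t a) (r (t a) (M.map a x)))) = η a x
    rw [← h9, map_neg]
    abel)
  refine ⟨- cmp k' ι, cmp k' σ, ?_, ?_⟩
  · rw [IsHom, map_neg, dd_cmp_right _ hι, hk', neg_eq_zero]
    refine C1_ext fun a x => ?_
    rw [rm_apply, rm_apply, h1, map_zero]; rfl
  · rw [dd_cmp, hk', h6]
    refine C1_ext fun a x => ?_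
    change ξ a x = ξ a (pr (s a) (σ (s a) x)) + k' (t a) (ι (t a) (η a x)) +
      (-(k' (t a) (ι (t a) (η a x))))
    rw [h2, add_neg_cancel_right]

theorem AlmostSplit.ext_eq (h : AlmostSplit T M ξ) (η : C1 M T) :
    ∃ (c : ℂ) (k : C0 M T), η = dd M T k + c • ξ := by
  by_cases hη : ∃ k, dd M T k = η
  · obtain ⟨k, rfl⟩ := hη
    exact ⟨0, k, by rw [zero_smul, add_zero]⟩
  · push Not at hη
    obtain ⟨φ, k, hφ, hk⟩ := h.pushout η hη
    obtain ⟨c, rfl⟩ := h.left.scalar φ hφ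
    have h1 : lm (c • one T) η = c • η := rfl
    rw [h1] at hk
    have hc : c ≠ 0 := by
      rintro rfl
      rw [zero_smul, add_zero] at hk
      exact h.ne k hk.symm
    refine ⟨c⁻¹, - (c⁻¹ • k), ?_⟩
    rw [hk, smul_add, smul_smul, inv_mul_cancel₀ hc, one_smul, map_neg, map_smul,
      neg_add_cancel_left]

theorem AlmostSplit.restrict_right (h : AlmostSplit T M ξ) {B : ∀ i, Submodule ℂ (M.X i)}
    (hB : Stable M B) (hne : ∃ i, B i ≠ ⊤) (η : C1 M T) :
    ∃ k : C0 M T, ∀ a, ∀ x ∈ B (s a), dd M T k a x = η a x := by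
  obtain ⟨c, k₀, rfl⟩ := h.ext_eq η
  obtain ⟨K, j, hj, hji, hjr⟩ := exists_sub hB
  obtain ⟨k, hk⟩ := h.lift K j hj (by
    rintro ⟨r, hr, hr2⟩
    obtain ⟨i, hi⟩ := hne
    refine hi (Submodule.eq_top_iff'.2 fun x => ?_)
    rw [← hjr]
    exact ⟨r i x, by rw [← cmp_apply, hr2, one_apply]⟩)
  choose k' hk' using fun i => exists_factor_of_ker_le (k i) (j i)
    (by rw [LinearMap.ker_eq_bot.2 (hji i)]; exact bot_le)
  have hkj : cmp k' j = k := funext fun i => (hk' i).symm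
  refine ⟨k₀ + c • k', fun a x hx => ?_⟩
  rw [← hjr] at hx
  obtain ⟨y, rfl⟩ := hx
  rw [← hkj, dd_cmp_right _ hj] at hk
  have h1 : dd M T k' a (j (s a) y) = ξ a (j (s a) y) := LinearMap.congr_fun (congrFun hk a) y
  rw [map_add, map_smul]
  change _ + c • (dd M T k' a (j (s a) y)) = _ + c • ξ a (j (s a) y)
  rw [h1]

theorem AlmostSplit.reduce_left (h : AlmostSplit T M ξ) {S : ∀ i, Submodule ℂ (T.X i)}
    (hS : Stable T S) (hne : ∃ i, S i ≠ ⊥) (η : C1 M T) :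
    ∃ k : C0 M T, ∀ a x, dd M T k a x - η a x ∈ S (t a) := by
  obtain ⟨c, k₀, rfl⟩ := h.ext_eq η
  obtain ⟨N, π, hπ, hπs, hπk⟩ := exists_quot hS
  have key : ∃ k, dd M N k = lm π ξ := by
    by_contra hcon
    push Not at hcon
    obtain ⟨φ, k, hφ, hk⟩ := h.pushout _ hcon
    obtain ⟨c, hc⟩ := h.left.scalar _ (hφ.cmp hπ)
    have hc0 : c = 0 := by
      obtain ⟨i, hi⟩ := hne
      obtain ⟨x, hx, hx0⟩ := Submodule.exists_mem_ne_zero_of_ne_bot hi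
      rw [← hπk] at hx
      have h1 : cmp φ π i x = c • x := by rw [hc]; rfl
      rw [cmp_apply, show π i x = 0 from hx, map_zero] at h1
      exact (smul_eq_zero.1 h1.symm).resolve_right hx0
    have h2 : lm φ (lm π ξ) = lm (cmp φ π) ξ := rfl
    rw [h2, hc, hc0, zero_smul] at hk
    refine h.ne k (hk.trans ?_).symm
    exact add_zero _
  obtain ⟨k, hk⟩ := key
  choose k' hk' using fun i => exists_factor_of_range_le (k i) (π i)
    (fun x => hπs i (k i x))
  have hkk : cmp π k' = k := funext fun i => (hk' i).symm
  refine ⟨k₀ + c • k', fun a x => ?_⟩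
  rw [← hkk, dd_cmp_left hπ] at hk
  have h1 : π (t a) (dd M T k' a x) = π (t a) (ξ a x) := LinearMap.congr_fun (congrFun hk a) x
  rw [map_add, map_smul]
  change (dd M T k₀ a x + c • (dd M T k' a x)) - (dd M T k₀ a x + c • ξ a x) ∈ _
  rw [add_sub_add_left_eq_sub, ← smul_sub]
  refine Submodule.smul_mem _ _ ?_
  rw [← hπk, LinearMap.mem_ker, map_sub, h1, sub_self]

theorem AlmostSplit.transversal (h : AlmostSplit T M ξ) {S : ∀ i, Submodule ℂ (T.X i)}
    {B : ∀ i, Submodule ℂ (M.X i)} (hS : Stable T S) (hB : Stable M B)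
    (hne : ¬ ((∀ i, S i = ⊥) ∧ ∀ i, B i = ⊤)) (η : C1 M T) :
    ∃ k : C0 M T, ∀ a, ∀ x ∈ B (s a), dd M T k a x - η a x ∈ S (t a) := by
  by_cases h1 : ∃ i, B i ≠ ⊤
  · obtain ⟨k, hk⟩ := h.restrict_right hB h1 η
    exact ⟨k, fun a x hx => by rw [hk a x hx, sub_self]; exact Submodule.zero_mem _⟩
  · push Not at h1
    have h2 : ∃ i, S i ≠ ⊥ := by
      by_contra h2
      push Not at h2
      exact hne ⟨h2, h1⟩
    obtain ⟨k, hk⟩ := h.reduce_left hS h2 η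
    exact ⟨k, fun a x _ => hk a x⟩

theorem exists_range_ne_bot {φ : C0 X Y} (h : φ ≠ 0) : ∃ i, LinearMap.range (φ i) ≠ ⊥ := by
  by_contra h2
  push Not at h2
  exact h (funext fun i => LinearMap.range_eq_bot.1 (h2 i))

/-- A nonzero map from `K` into the left term forces `Ext(M,K)` to be nonzero. -/
theorem AlmostSplit.not_surjective (h : AlmostSplit T M ξ) {φ : C0 X T} (hφ : IsHom φ)
    (hne : φ ≠ 0) : ¬ Function.Surjective (dd M X) := by
  intro hs
  obtain ⟨k, hk⟩ := h.reduce_left (stable_range hφ) (exists_range_ne_bot hne) ξ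
  choose c hc using fun a => exists_factor_of_range_le (dd M T k a - ξ a) (φ (t a)) (hk a)
  obtain ⟨c', rfl⟩ := hs c
  refine h.ne (k - cmp φ c') ?_
  rw [map_sub, dd_cmp_left hφ]
  have h1 : lm φ (dd M X c') = dd M T k - ξ := funext fun a => (hc a).symm
  rw [h1, sub_sub_cancel]

theorem AlmostSplit.hom_eq_zero (h : AlmostSplit T M ξ) {φ : C0 M T} (hφ : IsHom φ) : φ = 0 := by
  by_contra hne
  exact h.not_surjective hφ hne h.right.surj

/-- `L` detects the extensions of `T` by `M`. -/
def Detects (T M : Rep s t) (L : ∀ i, Submodule ℂ (T.X i)) : Prop :=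
  ∀ η : C1 T M, (∃ h : C0 T M, ∀ a, ∀ x ∈ L (s a), dd T M h a x = η a x) →
    ∃ h : C0 T M, dd T M h = η

theorem exists_detecting_sub [Fintype V] (hM : Brick M) :
    ∃ (L : Rep s t) (j : C0 L T), IsHom j ∧ (∀ i, Function.Injective (j i)) ∧
      (∀ f : C0 L M, IsHom f → f = 0) ∧
      ∀ η : C1 T M, (∃ h, dd L M h = rm η j) → ∃ h, dd T M h = η := by
  classical
  have hex : ∃ n, ∃ L : ∀ i, Submodule ℂ (T.X i), Stable T L ∧ Detects T M L ∧
      ∑ i, finrank ℂ (L i) = n :=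
    ⟨_, fun _ => ⊤, fun _ _ _ => trivial,
      fun η ⟨h, hh⟩ => ⟨h, C1_ext fun a x => hh a x trivial⟩, rfl⟩
  obtain ⟨L, hL, hd, hn⟩ := Nat.find_spec hex
  obtain ⟨K, j, hj, hji, hjr⟩ := exists_sub hL
  have hmem : ∀ i y, j i y ∈ L i := fun i y => by rw [← hjr]; exact ⟨y, rfl⟩
  have hext : ∀ f : C0 K M, ∃ g : C0 T M, cmp g j = f := fun f => by
    choose g hg using fun i => exists_factor_of_ker_le (f i) (j i)
      (by rw [LinearMap.ker_eq_bot.2 (hji i)]; exact bot_le)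
    exact ⟨g, funext fun i => (hg i).symm⟩
  refine ⟨K, j, hj, hji, fun f hf => ?_, fun η ⟨h, hh⟩ => ?_⟩
  · by_contra hne
    obtain ⟨f', rfl⟩ := hext f
    have hmin := Nat.find_min' hex (m := ∑ i, finrank ℂ ↥(L i ⊓ LinearMap.ker (f' i)))
      ⟨fun i => L i ⊓ LinearMap.ker (f' i), ?_, ?_, rfl⟩
    · rw [← hn] at hmin
      have heq := sum_eq_of_le
        (fun i => Submodule.finrank_mono (inf_le_left : L i ⊓ LinearMap.ker (f' i) ≤ L i)) hmin
      refine hne (C0_ext fun i y => ?_)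
      have h1 : j i y ∈ L i ⊓ LinearMap.ker (f' i) := by
        rw [Submodule.eq_of_le_of_finrank_eq inf_le_left (heq i)]
        exact hmem i y
      exact h1.2
    · rintro a x ⟨hx, hx0⟩
      refine ⟨hL a x hx, ?_⟩
      rw [← hjr] at hx
      obtain ⟨y, rfl⟩ := hx
      have h1 := isHom_iff.1 hf a y
      rw [cmp_apply, cmp_apply, show f' (s a) (j (s a) y) = 0 from hx0, map_zero,
        ← isHom_iff.1 hj] at h1
      exact h1.symm
    · rintro η ⟨h, hh⟩
      choose ρ hρ using fun a => exists_factor_of_ker_le ((rm η j - rm (dd T M h) j) a)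
        (cmp f' j (s a)) (by
          intro y hy
          have h1 := hh a (j (s a) y) ⟨hmem _ _, hy⟩
          exact sub_eq_zero.2 h1.symm)
      obtain ⟨g, rfl⟩ := hM.surj ρ
      refine hd η ⟨h + cmp g f', fun a x hx => ?_⟩
      rw [← hjr] at hx
      obtain ⟨y, rfl⟩ := hx
      have h2 : η a (j (s a) y) - dd T M h a (j (s a) y) = dd M M g a (f' (s a) (j (s a) y)) :=
        LinearMap.congr_fun (hρ a) y
      have h3 : dd T M (cmp g f') a (j (s a) y) = dd M M g a (f' (s a) (j (s a) y)) := by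
        have h4 := dd_cmp_right g hf
        rw [← cmp_assoc, dd_cmp_right _ hj] at h4
        exact LinearMap.congr_fun (congrFun h4 a) y
      rw [map_add]
      change dd T M h a (j (s a) y) + dd T M (cmp g f') a (j (s a) y) = _
      rw [h3, ← h2, add_sub_cancel]
  · obtain ⟨g, rfl⟩ := hext h
    rw [dd_cmp_right _ hj] at hh
    refine hd η ⟨g, fun a x hx => ?_⟩
    rw [← hjr] at hx
    obtain ⟨y, rfl⟩ := hx
    exact LinearMap.congr_fun (congrFun hh a) y

theorem eulerForm_add [Fintype V] [Fintype A] (x y : V → ℤ) :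
    eulerForm s t (x + y) (x + y) = eulerForm s t x x + eulerForm s t x y + eulerForm s t y x
      + eulerForm s t y y := by
  simp only [eulerForm, Pi.add_apply, add_mul, mul_add, Finset.sum_add_distrib]
  ring

theorem dimv_add_ne_zero (h : one X ≠ 0) : dimv X + dimv Y ≠ 0 := by
  obtain ⟨i, x, hx⟩ := exists_nontrivial h
  intro h2
  have h3 : (finrank ℂ (X.X i) : ℤ) + finrank ℂ (Y.X i) = 0 := congrFun h2 i
  have : Nontrivial (X.X i) := nontrivial_of_ne x 0 hx
  have := finrank_pos (R := ℂ) (M := X.X i)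
  omega

theorem AlmostSplit.ext_surj [Fintype V] [Fintype A] (hQ : IsDynkin s t)
    (h : AlmostSplit T M ξ) : Function.Surjective (dd T M) := by
  intro η
  by_contra hη
  obtain ⟨L, j, hj, hji, hhom, hdet⟩ := exists_detecting_sub (T := T) h.right
  have hη' : ¬ ∃ h, dd L M h = rm η j := fun h => hη (hdet η h)
  obtain ⟨Y, jY, π, hjY, hπ, hπj, hY, hp⟩ := exists_indec_summand L
    (fun φ => ¬ ∃ h, dd L M h = rm (rm η j) φ) hη'
    (fun h => h ⟨0, by
      refine C1_ext fun a x => ?_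
      rw [map_zero, rm_apply]
      exact (map_zero _).symm⟩)
    (fun φ ψ h => by
      by_contra h2
      push Not at h2
      obtain ⟨⟨h1, e1⟩, ⟨h2, e2⟩⟩ := h2
      refine h ⟨h1 + h2, ?_⟩
      rw [map_add, e1, e2]
      refine C1_ext fun a x => ?_
      exact (map_add (η a ∘ₗ j (s a)) (φ (s a) x) (ψ (s a) x)).symm)
  have hb := hY.brick hQ
  have h1 : Function.Injective (dd Y M) := by
    rw [injective_iff_map_eq_zero]
    intro f hf
    have h2 := hhom _ (IsHom.cmp hf hπ)
    rw [← cmp_one f, ← hπj, ← cmp_assoc, h2, zero_cmp]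
  have h2 : ¬ Function.Surjective (dd Y M) := fun hs => by
    obtain ⟨k, hk⟩ := hs (rm (rm η j) jY)
    refine hp ⟨cmp k π, ?_⟩
    rw [dd_cmp_right _ hπ, hk]
    rfl
  have hjj : ∀ i, Function.Injective (cmp j jY i) :=
    fun i => (hji i).comp (injective_of_cmp_eq_one hπj i)
  have h3 : Function.Injective (dd M Y) := by
    rw [injective_iff_map_eq_zero]
    intro f hf
    have h4 := h.hom_eq_zero ((hj.cmp hjY).cmp hf)
    refine C0_ext fun i x => hjj i ?_
    rw [← cmp_apply, h4]
    exact (map_zero _).symm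
  have h4 : ¬ Function.Surjective (dd M Y) := by
    refine h.not_surjective (hj.cmp hjY) fun h0 => hb.ne (C0_ext fun i x => hjj i ?_)
    rw [h0]; rfl
  have h5 := euler_neg h1 h2
  have h6 := euler_neg h3 h4
  have h7 := hQ _ (dimv_add_ne_zero (Y := M) hb.ne)
  rw [eulerForm_add, hb.euler, h.right.euler] at h7
  omega

end Rep
end FPoly

namespace FPoly

open Module

namespace Rep

variable {V A : Type} {s t : A → V} {dX dY dT dE dM : V → ℕ}

/-- The coordinate free representation attached to a family of matrices. -/
abbrev ofMat (X : QRep s t dX) : Rep s t where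
  X i := Fin (dX i) → ℂ
  map a := toLin' (X a)

theorem exists_matrix (X : QRep s t dX) (Y : QRep s t dY) (φ : C0 (ofMat X) (ofMat Y)) :
    ∃ h : ∀ i, Matrix (Fin (dY i)) (Fin (dX i)) ℂ, φ = fun i => toLin' (h i) :=
  ⟨fun i => LinearMap.toMatrix' (φ i), funext fun i => (toLin'_toMatrix' (φ i)).symm⟩

theorem dd_toLin (X : QRep s t dX) (Y : QRep s t dY)
    (h : ∀ i, Matrix (Fin (dY i)) (Fin (dX i)) ℂ) :
    dd (ofMat X) (ofMat Y) (fun i => toLin' (h i)) =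
      fun a => toLin' (Y a * h (s a) - h (t a) * X a) := by
  refine C1_ext fun a x => ?_
  rw [map_sub, toLin'_mul, toLin'_mul]
  rfl

theorem isHom_toLin {X : QRep s t dX} {Y : QRep s t dY}
    {h : ∀ i, Matrix (Fin (dY i)) (Fin (dX i)) ℂ} :
    IsHom (X := ofMat X) (Y := ofMat Y) (fun i => toLin' (h i)) ↔
      ∀ a, Y a * h (s a) = h (t a) * X a := by
  rw [IsHom, dd_toLin]
  constructor
  · intro h1 a
    exact sub_eq_zero.1 (toLin'.injective ((congrFun h1 a).trans (map_zero _).symm))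
  · intro h1
    funext a
    rw [h1 a, sub_self, map_zero]
    rfl

theorem exists_of_surj {X : QRep s t dX} {Y : QRep s t dY}
    (h : Function.Surjective (dd (ofMat X) (ofMat Y)))
    (B : ∀ a, Matrix (Fin (dY (t a))) (Fin (dX (s a))) ℂ) :
    ∃ ψ : ∀ i, Matrix (Fin (dY i)) (Fin (dX i)) ℂ, ∀ a, Y a * ψ (s a) - ψ (t a) * X a = B a := by
  obtain ⟨φ, hφ⟩ := h (fun a => toLin' (B a))
  obtain ⟨ψ, rfl⟩ := exists_matrix X Y φ
  rw [dd_toLin] at hφ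
  exact ⟨ψ, fun a => toLin'.injective (congrFun hφ a)⟩

theorem ind_ofMat {X : QRep s t dX} (h : Indec s t X) : Ind (ofMat X) := by
  refine ⟨?_, fun φ hφ hid => ?_⟩
  · intro h0
    obtain ⟨i, hi⟩ := h.1
    have h1 := LinearMap.congr_fun (congrFun h0 i) (fun _ => (1 : ℂ))
    exact one_ne_zero (congrFun h1 ⟨0, hi⟩)
  · obtain ⟨m, rfl⟩ := exists_matrix X X φ
    have h1 : ∀ i, m i * m i = m i := fun i => toLin'.injective (by
      rw [toLin'_mul]; exact congrFun hid i)
    rcases h.2 ⟨m, isHom_toLin.1 hφ⟩ h1 with h2 | h2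
    · left
      funext i
      exact (congrArg toLin' (h2 i)).trans (map_zero _)
    · right
      funext i
      exact (congrArg toLin' (h2 i)).trans toLin'_one

/-- Vertexwise splittings of a short exact sequence. -/
theorem exists_splitting {T : QRep s t dT} {E : QRep s t dE} {M : QRep s t dM}
    {f : RHom s t T E} {g : RHom s t E M} (h : IsSES s t f g) :
    ∃ (σ : ∀ i, Matrix (Fin (dE i)) (Fin (dM i)) ℂ) (κ : ∀ i, Matrix (Fin (dT i)) (Fin (dE i)) ℂ)
      (ξ : ∀ a, Matrix (Fin (dT (t a))) (Fin (dM (s a))) ℂ),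
      (∀ i, g.1 i * σ i = 1) ∧ (∀ i, κ i * f.1 i = 1) ∧ (∀ i, κ i * σ i = 0) ∧
      (∀ i, g.1 i * f.1 i = 0) ∧ (∀ i, f.1 i * κ i + σ i * g.1 i = 1) ∧
      (∀ a, T a * κ (s a) + ξ a * g.1 (s a) = κ (t a) * E a) ∧
      ∀ a, f.1 (t a) * ξ a = E a * σ (s a) - σ (t a) * M a := by
  obtain ⟨hf, hg, hfg⟩ := h
  have hgf : ∀ i, g.1 i * f.1 i = 0 := fun i => by
    refine toLin'.injective (LinearMap.ext fun x => ?_)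
    rw [toLin'_mul, map_zero]
    have h1 : (f.1 i).mulVecLin x ∈ LinearMap.ker (g.1 i).mulVecLin := by
      rw [← hfg]; exact ⟨x, rfl⟩
    exact h1
  have h1 : ∀ i, ∃ σ : Matrix (Fin (dE i)) (Fin (dM i)) ℂ, 1 = g.1 i * σ := fun i =>
    range_le_iff.1 (by rw [LinearMap.range_eq_top.2 (hg i)]; exact le_top)
  choose σ hσ using h1
  have h2 : ∀ i, ∃ κ : Matrix (Fin (dT i)) (Fin (dE i)) ℂ, 1 - σ i * g.1 i = f.1 i * κ := fun i =>
    range_le_iff.1 (by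
      rw [hfg]
      rintro _ ⟨x, rfl⟩
      rw [LinearMap.mem_ker, mulVecLin_apply, mulVecLin_apply, mulVec_mulVec, Matrix.mul_sub,
        ← Matrix.mul_assoc, ← hσ, Matrix.mul_one, Matrix.one_mul, sub_self, zero_mulVec])
  choose κ hκ using h2
  have hc : ∀ i (n : ℕ) (P Q : Matrix (Fin (dT i)) (Fin n) ℂ), f.1 i * P = f.1 i * Q → P = Q := by
    intro i n P Q hPQ
    refine toLin'.injective (LinearMap.ext fun x => hf i ?_)
    have := congrArg (fun Z => Z *ᵥ x) hPQ
    simp only [← mulVec_mulVec] at this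
    exact this
  have hκσ : ∀ i, κ i * σ i = 0 := fun i => hc i _ _ _ (by
    rw [← Matrix.mul_assoc, ← hκ, Matrix.sub_mul, Matrix.mul_assoc, ← hσ, Matrix.mul_one,
      Matrix.one_mul, sub_self, Matrix.mul_zero])
  have hξ : ∀ a, f.1 (t a) * (κ (t a) * E a * σ (s a)) = E a * σ (s a) - σ (t a) * M a := by
    intro a
    rw [← Matrix.mul_assoc, ← Matrix.mul_assoc, ← hκ, Matrix.sub_mul, Matrix.sub_mul,
      Matrix.one_mul, Matrix.mul_assoc (σ (t a)), ← g.2 a, Matrix.mul_assoc (σ (t a)),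
      Matrix.mul_assoc (M a), ← hσ, Matrix.mul_one]
  refine ⟨σ, κ, fun a => κ (t a) * E a * σ (s a), fun i => (hσ i).symm, fun i => hc i _ _ _ ?_,
    hκσ, hgf, fun i => ?_, fun a => hc _ _ _ _ ?_, hξ⟩
  · rw [← Matrix.mul_assoc, ← hκ, Matrix.sub_mul, Matrix.mul_assoc, hgf, Matrix.mul_zero,
      Matrix.one_mul, Matrix.mul_one, sub_zero]
  · rw [← hκ, sub_add_cancel]
  · rw [Matrix.mul_add, ← Matrix.mul_assoc, ← f.2 a, ← Matrix.mul_assoc, hξ, Matrix.mul_assoc,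
      ← hκ, Matrix.sub_mul, Matrix.mul_assoc (σ (t a)), g.2 a, Matrix.mul_sub, Matrix.mul_one,
      ← Matrix.mul_assoc (f.1 (t a)), ← hκ, Matrix.sub_mul, Matrix.one_mul,
      ← Matrix.mul_assoc (E a), ← Matrix.mul_assoc (σ (t a))]
    abel

theorem almostSplit_ofMat [Fintype V] [Fintype A] (hQ : IsDynkin s t)
    {T : QRep s t dT} {E : QRep s t dE} {M : QRep s t dM}
    {f : RHom s t T E} {g : RHom s t E M} (has : IsAlmostSplit s t f g)
    {σ : ∀ i, Matrix (Fin (dE i)) (Fin (dM i)) ℂ} {κ : ∀ i, Matrix (Fin (dT i)) (Fin (dE i)) ℂ}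
    {ξ : ∀ a, Matrix (Fin (dT (t a))) (Fin (dM (s a))) ℂ} (hσ : ∀ i, g.1 i * σ i = 1)
    (hgf : ∀ i, g.1 i * f.1 i = 0)
    (h1 : ∀ a, T a * κ (s a) + ξ a * g.1 (s a) = κ (t a) * E a)
    (h2 : ∀ a, f.1 (t a) * ξ a = E a * σ (s a) - σ (t a) * M a) :
    AlmostSplit (ofMat T) (ofMat M) (fun a => toLin' (ξ a)) := by
  obtain ⟨-, hns, hT, hM, hl⟩ := has
  refine ⟨(ind_ofMat hT).brick hQ, (ind_ofMat hM).brick hQ, fun h hh => ?_, fun X h hh hnr => ?_⟩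
  · obtain ⟨m, rfl⟩ := exists_matrix M T h
    rw [dd_toLin] at hh
    have h3 : ∀ a, T a * m (s a) - m (t a) * M a = ξ a := fun a =>
      toLin'.injective (congrFun hh a)
    refine hns ⟨⟨fun i => σ i - f.1 i * m i, fun a => ?_⟩, fun i => ?_⟩
    · have h4 := h2 a
      rw [← h3, Matrix.mul_sub, ← Matrix.mul_assoc, ← f.2 a] at h4
      rw [Matrix.mul_sub, Matrix.sub_mul, ← Matrix.mul_assoc, Matrix.mul_assoc (f.1 (t a))]
      rw [sub_eq_sub_iff_add_eq_add] at h4 ⊢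
      exact h4.symm.trans (add_comm _ _)
    · change g.1 i * (σ i - f.1 i * m i) = 1
      rw [Matrix.mul_sub, hσ, ← Matrix.mul_assoc, hgf, Matrix.zero_mul, sub_zero]
  · let e : ∀ i, X.X i ≃ₗ[ℂ] (Fin (finrank ℂ (X.X i)) → ℂ) :=
      fun i => (finBasis ℂ (X.X i)).equivFun
    let X' : QRep s t (fun i => finrank ℂ (X.X i)) := fun a =>
      LinearMap.toMatrix' ((e (t a)).toLinearMap ∘ₗ X.map a ∘ₗ (e (s a)).symm.toLinearMap)
    have hX' : ∀ a x, toLin' (X' a) x = e (t a) (X.map a ((e (s a)).symm x)) := fun a x =>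
      LinearMap.congr_fun (toLin'_toMatrix' _) x
    let h' : ∀ i, Matrix (Fin (dM i)) (Fin (finrank ℂ (X.X i))) ℂ := fun i =>
      LinearMap.toMatrix' (h i ∘ₗ (e i).symm.toLinearMap)
    have hh' : ∀ i x, toLin' (h' i) x = h i ((e i).symm x) := fun i x =>
      LinearMap.congr_fun (toLin'_toMatrix' _) x
    have hhom : ∀ a, M a * h' (s a) = h' (t a) * X' a := by
      refine isHom_toLin.1 (isHom_iff.2 fun a x => ?_)
      change toLin' (M a) (toLin' (h' (s a)) x) = toLin' (h' (t a)) (toLin' (X' a) x)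
      rw [hX', hh', hh', LinearEquiv.symm_apply_apply]
      exact isHom_iff.1 hh a _
    obtain ⟨u, hu⟩ := hl _ X' ⟨h', hhom⟩ (by
      rintro ⟨r, hr⟩
      refine hnr ⟨fun i => (e i).symm.toLinearMap ∘ₗ toLin' (r.1 i), isHom_iff.2 fun a x => ?_,
        C0_ext fun i x => ?_⟩
      · have h3 := isHom_iff.1 (isHom_toLin.2 r.2) a x
        have h4 : toLin' (X' a) (toLin' (r.1 (s a)) x) = toLin' (r.1 (t a)) (toLin' (M a) x) := h3
        rw [hX'] at h4
        change X.map a ((e (s a)).symm (toLin' (r.1 (s a)) x)) =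
          (e (t a)).symm (toLin' (r.1 (t a)) (toLin' (M a) x))
        rw [← h4, LinearEquiv.symm_apply_apply]
      · change h i ((e i).symm (toLin' (r.1 i) x)) = x
        rw [← hh', ← LinearMap.comp_apply, ← toLin'_mul, hr i, toLin'_one]
        rfl)
    refine ⟨fun i => - (toLin' (κ i) ∘ₗ toLin' (u.1 i) ∘ₗ (e i).toLinearMap),
      C1_ext fun a x => ?_⟩
    have h3 : toLin' (E a) (toLin' (u.1 (s a)) (e (s a) x)) =
        toLin' (u.1 (t a)) (toLin' (X' a) (e (s a) x)) :=
      isHom_iff.1 (isHom_toLin.2 u.2) a (e (s a) x)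
    rw [hX', LinearEquiv.symm_apply_apply] at h3
    have h4 : ∀ i y, toLin' (g.1 i) (toLin' (u.1 i) y) = h i ((e i).symm y) := fun i y => by
      rw [← hh', ← LinearMap.comp_apply, ← toLin'_mul, hu i]
    have h5 : ∀ y, toLin' (T a) (toLin' (κ (s a)) y) + toLin' (ξ a) (toLin' (g.1 (s a)) y) =
        toLin' (κ (t a)) (toLin' (E a) y) := fun y => by
      simp only [← LinearMap.comp_apply, ← toLin'_mul]
      rw [← h1, map_add, LinearMap.add_apply]
    have h6 := h5 (toLin' (u.1 (s a)) (e (s a) x))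
    rw [h3, h4, LinearEquiv.symm_apply_apply] at h6
    change toLin' (T a) (-(toLin' (κ (s a)) (toLin' (u.1 (s a)) (e (s a) x)))) -
      (-(toLin' (κ (t a)) (toLin' (u.1 (t a)) (e (t a) (X.map a x))))) = toLin' (ξ a) (h (s a) x)
    rw [← h6, map_neg]
    abel

end Rep
end FPoly

namespace FPoly

open Module FPoly.Rep

variable {V A : Type} {s t : A → V} {dT dM : V → ℕ} {T : QRep s t dT} {M : QRep s t dM}
  {ξ : ∀ a, Matrix (Fin (dT (t a))) (Fin (dM (s a))) ℂ}

/-- The quiver Grassmannian of a representation, as a variety of projections. -/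
abbrev QPG {d : V → ℕ} (X : QRep s t d) (e : V → ℕ) :
    Set (∀ i, Matrix (Fin (d i)) (Fin (d i)) ℂ) :=
  PG (ι := fun i => Fin (d i)) (s := s) (t := t) X e

/-- The middle term of an extension of two representations. -/
abbrev qext (T : QRep s t dT) (ξ : ∀ a, Matrix (Fin (dT (t a))) (Fin (dM (s a))) ℂ)
    (M : QRep s t dM) :
    ∀ a : A, Matrix (Fin (dT (t a)) ⊕ Fin (dM (t a))) (Fin (dT (s a)) ⊕ Fin (dM (s a))) ℂ :=
  extRep (ι := fun i => Fin (dT i)) (κ := fun i => Fin (dM i)) T ξ M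

theorem Rep.AlmostSplit.extRep_surj
    (h : AlmostSplit (ofMat T) (ofMat M) (fun a => toLin' (ξ a)))
    (hTM : Function.Surjective (dd (ofMat T) (ofMat M)))
    (B : ∀ a : A, Matrix (Fin (dT (t a)) ⊕ Fin (dM (t a))) (Fin (dT (s a)) ⊕ Fin (dM (s a))) ℂ) :
    ∃ ψ : ∀ i, Matrix (Fin (dT i) ⊕ Fin (dM i)) (Fin (dT i) ⊕ Fin (dM i)) ℂ,
      ∀ a, qext T ξ M a * ψ (s a) - ψ (t a) * qext T ξ M a = B a := by
  obtain ⟨c, hc⟩ := exists_of_surj hTM (fun a => (B a).toBlocks₂₁)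
  obtain ⟨a₀, ha⟩ := exists_of_surj h.left.surj (fun a => (B a).toBlocks₁₁ - ξ a * c (s a))
  obtain ⟨d, hd⟩ := exists_of_surj h.right.surj (fun a => (B a).toBlocks₂₂ + c (t a) * ξ a)
  obtain ⟨l, k, hk⟩ := h.ext_eq
    (fun a => toLin' ((B a).toBlocks₁₂ - ξ a * d (s a) + a₀ (t a) * ξ a))
  obtain ⟨b, rfl⟩ := exists_matrix M T k
  rw [dd_toLin] at hk
  have hb : ∀ a, (B a).toBlocks₁₂ - ξ a * d (s a) + a₀ (t a) * ξ a =
      T a * b (s a) - b (t a) * M a + l • ξ a := fun a => toLin'.injective (by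
    rw [map_add _ _ (l • ξ a), map_smul]; exact congrFun hk a)
  refine ⟨fun i => fromBlocks (a₀ i - l • (1 : Matrix (Fin (dT i)) (Fin (dT i)) ℂ)) (b i) (c i)
    (d i), fun a => ?_⟩
  rw [qext, extRep, fromBlocks_multiply, fromBlocks_multiply, sub_eq_add_neg, fromBlocks_neg,
    fromBlocks_add]
  conv_rhs => rw [← fromBlocks_toBlocks (B a)]
  have h11 := ha a
  have h12 := hb a
  have h21 := hc a
  have h22 := hd a
  simp only [← sub_eq_add_neg, Matrix.mul_zero, Matrix.zero_mul, add_zero, zero_add,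
    Matrix.mul_sub, Matrix.sub_mul,
    Matrix.mul_smul, Matrix.smul_mul, Matrix.mul_one, Matrix.one_mul]
  rw [fromBlocks_inj]
  refine ⟨?_, ?_, by rwa [smul_zero, sub_zero, zero_add], ?_⟩
  · rw [← sub_eq_zero] at h11 ⊢
    rw [← h11]; abel
  · rw [← sub_eq_zero] at h12 ⊢
    rw [← neg_eq_zero, ← h12]; abel
  · rw [← sub_eq_zero] at h22 ⊢
    rw [← h22]; abel

theorem stable_range_proj {X : QRep s t dT} {e : V → ℕ} (p : QPG X e) :
    Stable (ofMat X) (fun i => LinearMap.range (toLin' (p.1 i))) := by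
  rintro a _ ⟨x, rfl⟩
  refine ⟨X a *ᵥ (p.1 (s a) *ᵥ x), ?_⟩
  have h1 := p.2.2.2.2 a
  rw [Matrix.sub_mul, Matrix.one_mul, Matrix.sub_mul, sub_eq_zero] at h1
  change p.1 (t a) *ᵥ (X a *ᵥ (p.1 (s a) *ᵥ x)) = X a *ᵥ (p.1 (s a) *ᵥ x)
  rw [mulVec_mulVec, mulVec_mulVec, mulVec_mulVec, ← h1]

theorem Rep.AlmostSplit.transversal_proj
    (h : AlmostSplit (ofMat T) (ofMat M) (fun a => toLin' (ξ a))) {f g : V → ℕ}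
    (hne : ¬ (f = 0 ∧ g = dM)) (p : QPG T f) (q : QPG M g)
    (η : ∀ a, Matrix (Fin (dT (t a))) (Fin (dM (s a))) ℂ) :
    ∃ k : ∀ i, Matrix (Fin (dT i)) (Fin (dM i)) ℂ, ∀ a,
      (1 - p.1 (t a)) * (T a * k (s a) - k (t a) * M a - η a) * q.1 (s a) = 0 := by
  obtain ⟨k, hk⟩ := h.transversal (stable_range_proj p) (stable_range_proj q) (by
    rintro ⟨h1, h2⟩
    refine hne ⟨funext fun i => ?_, funext fun i => ?_⟩
    · have h3 := h1 i
      rw [LinearMap.range_eq_bot] at h3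
      have h4 : p.1 i = 0 := toLin'.injective (h3.trans (map_zero _).symm)
      have h5 := p.2.2.2.1 i
      rw [h4, Matrix.trace_zero] at h5
      exact_mod_cast h5.symm
    · have h3 := LinearMap.range_eq_top.1 (h2 i)
      have h4 : q.1 i = 1 := toLin'.injective (LinearMap.ext fun x => by
        obtain ⟨y, rfl⟩ := h3 x
        rw [← LinearMap.comp_apply, ← toLin'_mul, q.2.2.1 i, toLin'_one]; rfl)
      have h5 := q.2.2.2.1 i
      rw [h4, Matrix.trace_one, Fintype.card_fin] at h5
      exact_mod_cast h5.symm) (fun a => toLin' (η a))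
  obtain ⟨k, rfl⟩ := exists_matrix M T k
  rw [dd_toLin] at hk
  refine ⟨k, fun a => toLin'.injective (LinearMap.ext fun x => ?_)⟩
  obtain ⟨y, hy⟩ := hk a (toLin' (q.1 (s a)) x) ⟨x, rfl⟩
  rw [← LinearMap.sub_apply, ← map_sub] at hy
  have hp : toLin' (p.1 (t a)) (toLin' (p.1 (t a)) y) = toLin' (p.1 (t a)) y := by
    rw [← LinearMap.comp_apply, ← toLin'_mul, p.2.2.1]
  rw [toLin'_mul, toLin'_mul, LinearMap.comp_apply, LinearMap.comp_apply, ← hy, map_sub,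
    LinearMap.sub_apply, hp, toLin'_one, LinearMap.id_apply, sub_self, map_zero,
    LinearMap.zero_apply]

theorem chiH_PG_of_not_le {e : V → ℕ} (h : ¬ e ≤ dT) : chiH (QPG T e) = 0 := by
  have : IsEmpty (QPG T e) := by
    refine ⟨fun p => h fun i => ?_⟩
    have h1 := finrank_range_proj (p.2.2.1 i) (p.2.2.2.1 i)
    rw [← h1]
    exact (Submodule.finrank_le _).trans_eq (Module.finrank_fin_fun ℂ)
  exact chiH_empty _

section

variable [Fintype V] [Fintype A] [DecidableEq V]

theorem eulerChar_subRep_eq {ι : V → Type} [∀ i, Fintype (ι i)] [∀ i, DecidableEq (ι i)]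
    {X' : ∀ a : A, Matrix (ι (t a)) (ι (s a)) ℂ}
    {γ : ∀ i, Matrix (ι i) (Fin (dT i)) ℂ} {δ : ∀ i, Matrix (Fin (dT i)) (ι i) ℂ}
    (h1 : ∀ i, γ i * δ i = 1) (h2 : ∀ i, δ i * γ i = 1)
    (hγ : ∀ a, X' a * γ (s a) = γ (t a) * T a) (e : V → ℕ) :
    eulerChar (SubRep s t T e) = chiH (PG (ι := ι) (s := s) (t := t) X' e) := by
  obtain ⟨φ⟩ := subRep_homeo (e := e) (X' := X') h1 h2 hγ
  rw [eulerChar_eq, chiH_homeo φ]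

theorem eulerChar_subRep (T : QRep s t dT) (e : V → ℕ) :
    eulerChar (SubRep s t T e) = chiH (QPG T e) :=
  eulerChar_subRep_eq (ι := fun i => Fin (dT i)) (γ := fun _ => 1) (δ := fun _ => 1)
    (fun _ => Matrix.one_mul _)
    (fun _ => Matrix.one_mul _) (fun a => by rw [Matrix.mul_one, Matrix.one_mul]) e

theorem coeff_Fpoly (T : QRep s t dT) (m : V →₀ ℕ) :
    (Fpoly s t T).coeff m = chiH (QPG T m) := by
  classical
  rw [Fpoly, MvPolynomial.coeff_sum]
  simp only [MvPolynomial.coeff_monomial, eulerChar_subRep]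
  by_cases hm : (m : V → ℕ) ≤ dT
  · rw [Finset.sum_eq_single (fun i => ⟨m i, Nat.lt_succ_of_le (hm i)⟩ : ∀ i, Fin (dT i + 1))]
    · have h : (Finsupp.equivFunOnFinite.symm fun i => m i) = m := Finsupp.ext fun i => rfl
      exact if_pos h
    · intro f _ hf
      refine if_neg fun h => hf (funext fun i => Fin.ext ?_)
      exact DFunLike.congr_fun h i
    · exact fun h => absurd (Finset.mem_univ _) h
  · rw [chiH_PG_of_not_le hm]
    refine Finset.sum_eq_zero fun f _ => if_neg fun h => hm fun i => ?_
    exact (DFunLike.congr_fun h i).symm.trans_le (Nat.lt_succ_iff.1 (f i).2)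

theorem sum_antidiagonal_eq (F G : (V → ℕ) → ℤ) (m : V →₀ ℕ) :
    ∑ p ∈ Finset.HasAntidiagonal.antidiagonal m, F p.1 * G p.2 =
      ∑ g ∈ Finset.Iic (m : V → ℕ), G (m - g) * F g := by
  classical
  refine Finset.sum_bij' (fun p _ => (p.1 : V → ℕ))
    (fun g _ => (Finsupp.equivFunOnFinite.symm g, m - Finsupp.equivFunOnFinite.symm g))
    ?_ ?_ ?_ ?_ ?_
  · intro p hp
    rw [Finset.HasAntidiagonal.mem_antidiagonal] at hp
    rw [Finset.mem_Iic, ← hp]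
    exact fun i => Nat.le_add_right _ _
  · intro g hg
    rw [Finset.mem_Iic] at hg
    rw [Finset.HasAntidiagonal.mem_antidiagonal]
    exact add_tsub_cancel_of_le (show Finsupp.equivFunOnFinite.symm g ≤ m from hg)
  · intro p hp
    rw [Finset.HasAntidiagonal.mem_antidiagonal] at hp
    refine Prod.ext (Finsupp.ext fun i => rfl) (Finsupp.ext fun i => ?_)
    rw [← hp]
    exact Nat.add_sub_cancel_left _ _
  · intro g hg
    rfl
  · intro p hp
    rw [Finset.HasAntidiagonal.mem_antidiagonal] at hp
    have : (m : V → ℕ) - p.1 = p.2 := by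
      rw [← hp]
      exact funext fun i => Nat.add_sub_cancel_left _ _
    rw [this, mul_comm]

end

end FPoly

namespace FPoly

open Module FPoly.Rep

variable {V A : Type} {s t : A → V} {dT dE dM : V → ℕ} {T : QRep s t dT} {E : QRep s t dE}
  {M : QRep s t dM} {f : RHom s t T E} {g : RHom s t E M}

variable [Fintype V] [Fintype A] [DecidableEq V]

open Classical in
theorem chiH_middle (hQ : IsDynkin s t) (has : IsAlmostSplit s t f g) (e : V → ℕ) :
    chiH (QPG E e) = ∑ c ∈ Finset.Iic dM, if c ≤ e then chiH (QPG T (e - c)) * chiH (QPG M c) -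
      (if e = dM then if c = e then 1 else 0 else 0) else 0 := by
  obtain ⟨σ, κ, ξ, h1, h2, h3, h4, h5, h6, h7⟩ := exists_splitting has.1
  have AS := almostSplit_ofMat hQ has h1 h4 h6 h7
  have hγ : chiH (QPG E e) = chiH (PG (ι := fun i => Fin (dT i) ⊕ Fin (dM i)) (s := s) (t := t)
      (qext T ξ M) e) := by
    rw [← eulerChar_subRep]
    refine eulerChar_subRep_eq (γ := fun i => fromRows (κ i) (g.1 i))
      (δ := fun i => fromCols (f.1 i) (σ i)) (fun i => ?_) (fun i => ?_) (fun a => ?_) e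
    · rw [fromRows_mul_fromCols, h1, h2, h3, h4, fromBlocks_one]
    · rw [fromCols_mul_fromRows, h5]
    · have h8 := g.2 a
      rw [qext, extRep, fromBlocks_mul_fromRows, fromRows_mul, h6, Matrix.zero_mul, zero_add]
      exact congrArg _ h8
  have hcard : (fun i => Fintype.card (Fin (dM i))) = dM := funext fun i => Fintype.card_fin _
  have key := chiH_extension (ι := fun i => Fin (dT i)) (κ := fun i => Fin (dM i))
    (T := T) (M := M) (ξ := ξ) (exists_of_surj AS.left.surj) (exists_of_surj AS.right.surj)
    (AS.extRep_surj (AS.ext_surj hQ))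
    (fun p q hpq => AS.transversal_proj (by rwa [hcard] at hpq)) (by
      rintro ⟨h, hh⟩
      obtain hne := AS.ne (fun i => toLin' (-h i))
      refine hne ?_
      rw [dd_toLin]
      refine funext fun a => congrArg _ ?_
      have h8 := hh a
      rw [Matrix.mul_neg, Matrix.neg_mul, ← sub_eq_zero, ← neg_eq_zero, ← h8]
      abel) e
  rw [hcard] at key
  exact hγ.trans key

open Classical in
theorem sum_middle (F G : (V → ℕ) → ℤ) (hF : ∀ c, ¬ c ≤ dM → F c = 0) (m : V → ℕ) :
    ∑ c ∈ Finset.Iic m, G (m - c) * F c = (∑ c ∈ Finset.Iic dM, if c ≤ m then G (m - c) * F c -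
      (if m = dM then if c = m then 1 else 0 else 0) else 0) + if m = dM then 1 else 0 := by
  have h1 : ∑ c ∈ Finset.Iic dM, (if c ≤ m then G (m - c) * F c else 0) =
      ∑ c ∈ Finset.Iic m, G (m - c) * F c := by
    rw [← Finset.sum_filter]
    refine Finset.sum_subset (fun c hc => Finset.mem_Iic.2 (Finset.mem_filter.1 hc).2)
      fun c hc hn => ?_
    rw [hF c fun h => hn (Finset.mem_filter.2 ⟨Finset.mem_Iic.2 h, Finset.mem_Iic.1 hc⟩), mul_zero]
  have h2 : ∑ c ∈ Finset.Iic dM, (if c ≤ m then (if m = dM then if c = m then 1 else 0 else 0)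
      else 0 : ℤ) = if m = dM then 1 else 0 := by
    by_cases hm : m = dM
    · subst hm
      rw [Finset.sum_eq_single m]
      · simp
      · intro c _ hc
        simp [hc]
      · exact fun h => absurd (Finset.mem_Iic.2 le_rfl) h
    · simp [hm]
  rw [← h1, ← h2, ← Finset.sum_add_distrib]
  refine Finset.sum_congr rfl fun c _ => ?_
  by_cases hc : c ≤ m
  · rw [if_pos hc, if_pos hc, if_pos hc]; ring
  · rw [if_neg hc, if_neg hc, if_neg hc, add_zero]

end FPoly

/-- For an almost split sequence `0 → τM → E → M → 0`,
`F_M · F_{τM} = F_E + y^{dim M}`. -/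
theorem fpoly_almost_split [Fintype V] [Fintype A] [DecidableEq V] (s t : A → V)
    (hQ : IsDynkin s t) (dT dE dM : V → ℕ)
    (T : QRep s t dT) (E : QRep s t dE) (M : QRep s t dM)
    (f : RHom s t T E) (g : RHom s t E M) (has : IsAlmostSplit s t f g) :
    Fpoly s t M * Fpoly s t T =
      Fpoly s t E +
        MvPolynomial.monomial (Finsupp.equivFunOnFinite.symm dM) (1 : ℤ) := by
  classical
  refine MvPolynomial.ext _ _ fun m => ?_
  rw [MvPolynomial.coeff_mul, MvPolynomial.coeff_add, MvPolynomial.coeff_monomial]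
  simp only [FPoly.coeff_Fpoly]
  refine (FPoly.sum_antidiagonal_eq (fun c => FPoly.chiH (FPoly.QPG M c))
    (fun c => FPoly.chiH (FPoly.QPG T c)) m).trans ?_
  refine (FPoly.sum_middle (dM := dM) (fun c => FPoly.chiH (FPoly.QPG M c))
    (fun c => FPoly.chiH (FPoly.QPG T c)) (fun c => FPoly.chiH_PG_of_not_le) m).trans ?_
  rw [FPoly.chiH_middle hQ has]
  have hm : (Finsupp.equivFunOnFinite.symm dM = m) ↔ (m : V → ℕ) = dM :=
    ⟨fun h => h ▸ rfl, fun h => Finsupp.ext fun i => (congrFun h i).symm⟩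
  simp only [hm]

end
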